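/- Every weak solution u of problem (P) is locally symmetric. -/

import Mathlib

open Set Metric MeasureTheory Bornology
open scoped RealInnerProductSpace Classical

noncomputable section

/-- The vector field `y ↦ (g(|y|)/|y|)·y`, with the convention that it vanishes at `y = 0`. -/
def gvec {N : ℕ} (g : ℝ → ℝ) (y : EuclideanSpace ℝ (Fin N)) : EuclideanSpace ℝ (Fin N) :=
  if y = 0 then 0 else (g ‖y‖ / ‖y‖) • y

/-- `φ` is a smooth test function compactly supported in `Ω`. -/
def IsTestFun {N : ℕ} (Ω : Set (EuclideanSpace ℝ (Fin N)))
    (φ : EuclideanSpace ℝ (Fin N) → ℝ) : Prop :=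
  ContDiff ℝ (⊤ : ℕ∞) φ ∧ HasCompactSupport φ ∧ tsupport φ ⊆ Ω

/-- Conditions (2.1)-(2.2): `g ∈ C[0,∞) ∩ C¹(0,∞)`, `g(0) = 0`, `g'(t) > 0` for `t > 0`. -/
def GCond (g : ℝ → ℝ) : Prop :=
  ContinuousOn g (Ici 0) ∧ ContDiffOn ℝ 1 g (Ioi 0) ∧ g 0 = 0 ∧
    ∀ t : ℝ, 0 < t → 0 < deriv g t

/-- Conditions (2.3)-(2.4): `f ∈ C([0,R] × [0,∞))`, `r ↦ f(r,t)` non-increasing. -/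
def FCond (R : ℝ) (f : ℝ → ℝ → ℝ) : Prop :=
  ContinuousOn (fun q : ℝ × ℝ => f q.1 q.2) (Icc 0 R ×ˢ Ici 0) ∧
    ∀ t : ℝ, 0 ≤ t → ∀ r₁ ∈ Icc (0:ℝ) R, ∀ r₂ ∈ Icc (0:ℝ) R, r₁ ≤ r₂ → f r₂ t ≤ f r₁ t

/-- `u` solves `-div((g(|∇u|)/|∇u|)∇u) = f(|x|,u)` distributionally in the ball `B_R`. -/
def IsDistribSolBall {N : ℕ} (R : ℝ) (g : ℝ → ℝ) (f : ℝ → ℝ → ℝ)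
    (u : EuclideanSpace ℝ (Fin N) → ℝ) : Prop :=
  ∀ φ : EuclideanSpace ℝ (Fin N) → ℝ, IsTestFun (ball 0 R) φ →
    (∫ x in ball (0:EuclideanSpace ℝ (Fin N)) R, ⟪gvec g (gradient u x), gradient φ x⟫) =
      ∫ x in ball (0:EuclideanSpace ℝ (Fin N)) R, f ‖x‖ (u x) * φ x

/-- `u` is a weak solution of problem (P): `u ∈ C¹(clos B_R)`, `u ≥ 0`, `u ≢ 0`,
`u = 0` on `∂B_R`, and the equation holds distributionally. -/
def IsWeakSolP {N : ℕ} (R : ℝ) (g : ℝ → ℝ) (f : ℝ → ℝ → ℝ)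
    (u : EuclideanSpace ℝ (Fin N) → ℝ) : Prop :=
  ContDiffOn ℝ 1 u (closedBall 0 R) ∧
  (∀ x ∈ closedBall (0:EuclideanSpace ℝ (Fin N)) R, 0 ≤ u x) ∧
  (∃ x ∈ closedBall (0:EuclideanSpace ℝ (Fin N)) R, u x ≠ 0) ∧
  (∀ x ∈ sphere (0:EuclideanSpace ℝ (Fin N)) R, u x = 0) ∧
  IsDistribSolBall R g f u

/-- `U` is `C¹` on `[a,b]` with (continuous) derivative `U'`. -/
def C1On (U U' : ℝ → ℝ) (a b : ℝ) : Prop :=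
  ContinuousOn U' (Icc a b) ∧ ∀ r ∈ Icc a b, HasDerivWithinAt U (U' r) (Icc a b) r

/-- Definition 2.1: `u` is locally symmetric in `B_R`. -/
def LocallySymmetric {N : ℕ} (R : ℝ) (u : EuclideanSpace ℝ (Fin N) → ℝ) : Prop :=
  ∃ (K : Set ℕ) (z : ℕ → EuclideanSpace ℝ (Fin N)) (ri ro : ℕ → ℝ) (U U' : ℕ → ℝ → ℝ),
    (∀ k ∈ K, z k ∈ ball (0:EuclideanSpace ℝ (Fin N)) R ∧ 0 ≤ ri k ∧ ri k < ro k) ∧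
    K.PairwiseDisjoint (fun k => ball (z k) (ro k) \ closedBall (z k) (ri k)) ∧
    ball (0:EuclideanSpace ℝ (Fin N)) R =
      (⋃ k ∈ K, ball (z k) (ro k) \ closedBall (z k) (ri k)) ∪
        {x ∈ ball (0:EuclideanSpace ℝ (Fin N)) R | gradient u x = 0} ∧
    ∀ k ∈ K,
      C1On (U k) (U' k) (ri k) (ro k) ∧
      (∀ x ∈ ball (z k) (ro k) \ closedBall (z k) (ri k), u x = U k ‖x - z k‖) ∧
      (∀ r ∈ Ioo (ri k) (ro k), U' k r < 0) ∧
      (∀ x ∈ ball (z k) (ri k), U k (ri k) ≤ u x)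

/-- `H(t) = t·g(t) - ∫₀ᵗ g(s) ds`. -/
def Hfun (g : ℝ → ℝ) (t : ℝ) : ℝ := t * g t - ∫ s in (0:ℝ)..t, g s

/-- The inverse of `H` on `[0,∞)`. -/
def Hinv (g : ℝ → ℝ) : ℝ → ℝ := Function.invFunOn (Hfun g) (Ici 0)

/-- The class `A_g` of Definition 3.1. -/
def MemAg (g φ : ℝ → ℝ) : Prop :=
  ContinuousOn φ (Ici 0) ∧ (∀ t : ℝ, 0 ≤ t → 0 ≤ φ t) ∧ φ 0 = 0 ∧
  ((∃ d > (0:ℝ), ∀ t ∈ Icc (0:ℝ) d, φ t = 0) ∨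
    ∃ δ > (0:ℝ), (∀ t ∈ Ioo (0:ℝ) δ, 0 < φ t) ∧
      ∫⁻ t in Ioc (0:ℝ) δ, ENNReal.ofReal (1 / Hinv g (∫ s in (0:ℝ)..t, φ s)) = ⊤)

/-- `u` satisfies `div((g(|∇u|)/|∇u|)∇u) ≤ φ(u)` distributionally in `Ω`. -/
def DistribSupIneq {N : ℕ} (Ω : Set (EuclideanSpace ℝ (Fin N))) (g φ : ℝ → ℝ)
    (u : EuclideanSpace ℝ (Fin N) → ℝ) : Prop :=
  ∀ ψ : EuclideanSpace ℝ (Fin N) → ℝ, IsTestFun Ω ψ → (∀ x, 0 ≤ ψ x) →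
    -(∫ x in Ω, ⟪gvec g (gradient u x), gradient ψ x⟫) ≤ ∫ x in Ω, φ (u x) * ψ x

/-- Condition (a) of Lemma 3.7. -/
def CondA (R : ℝ) (g : ℝ → ℝ) (f : ℝ → ℝ → ℝ) : Prop :=
  ∀ ρ ∈ Ico (0:ℝ) R, ∀ τ : ℝ, 0 < τ → f ρ τ = 0 →
    ∃ δ ∈ Ioo (0:ℝ) τ, ∃ φ : ℝ → ℝ, MemAg g φ ∧
      ∀ t ∈ Icc (τ - δ) τ, ∀ r ∈ Icc (ρ - δ) (ρ + δ) ∩ Icc (0:ℝ) R, f r t ≤ φ (τ - t)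

/-- Condition (b) of Lemma 3.8. -/
def CondB (R : ℝ) (g : ℝ → ℝ) (f : ℝ → ℝ → ℝ) : Prop :=
  ∀ ρ ∈ Ico (0:ℝ) R, f ρ 0 = 0 →
    ∃ δ > (0:ℝ), ∃ φ : ℝ → ℝ, MemAg g φ ∧
      ∀ r ∈ Ico (0:ℝ) R, ∀ t ∈ Icc (0:ℝ) δ, -f r t ≤ φ t

/-- Condition (c) of Theorem 3.9. -/
def CondC (R : ℝ) (g : ℝ → ℝ) (f : ℝ → ℝ → ℝ) : Prop :=
  ∀ ρ ∈ Ico (0:ℝ) R, ∀ τ : ℝ, 0 ≤ τ → f ρ τ = 0 →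
    ∃ δ > (0:ℝ), ∃ φ : ℝ → ℝ, MemAg g φ ∧
      ∀ t ∈ Icc τ (τ + δ), ∀ r ∈ Icc (ρ - δ) (ρ + δ) ∩ Icc (0:ℝ) R, -f r t ≤ φ (t - τ)

/-- `u` solves `-div((g(|∇u|)/|∇u|)∇u) = f(u)` distributionally in `Ω` (autonomous case). -/
def IsDistribSolAut {N : ℕ} (Ω : Set (EuclideanSpace ℝ (Fin N))) (g f : ℝ → ℝ)
    (u : EuclideanSpace ℝ (Fin N) → ℝ) : Prop :=
  ∀ φ : EuclideanSpace ℝ (Fin N) → ℝ, IsTestFun Ω φ →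
    (∫ x in Ω, ⟪gvec g (gradient u x), gradient φ x⟫) = ∫ x in Ω, f (u x) * φ x

/-- `u` is a weak solution of problem (P) with autonomous right-hand side `f = f(u)`. -/
def IsWeakSolPAut {N : ℕ} (R : ℝ) (g f : ℝ → ℝ) (u : EuclideanSpace ℝ (Fin N) → ℝ) : Prop :=
  ContDiffOn ℝ 1 u (closedBall 0 R) ∧
  (∀ x ∈ closedBall (0:EuclideanSpace ℝ (Fin N)) R, 0 ≤ u x) ∧
  (∃ x ∈ closedBall (0:EuclideanSpace ℝ (Fin N)) R, u x ≠ 0) ∧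
  (∀ x ∈ sphere (0:EuclideanSpace ℝ (Fin N)) R, u x = 0) ∧
  IsDistribSolAut (ball 0 R) g f u

/-- `G(t) = ∫₀ᵗ g(s) ds`. -/
def Gfun (g : ℝ → ℝ) (t : ℝ) : ℝ := ∫ s in (0:ℝ)..t, g s

/-- The variational functional `J(v) = ∫_Ω (G(|∇v|) - F(v)) dx`. -/
def Jfun {N : ℕ} (g f : ℝ → ℝ) (Ω : Set (EuclideanSpace ℝ (Fin N)))
    (v : EuclideanSpace ℝ (Fin N) → ℝ) : ℝ :=
  ∫ x in Ω, (Gfun g ‖gradient v x‖ - Gfun f (v x))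

/-- `v ∈ X`, i.e. `v ∈ C¹(clos Ω)` with `v = 0` on `∂Ω`. -/
def MemX {N : ℕ} (Ω : Set (EuclideanSpace ℝ (Fin N)))
    (v : EuclideanSpace ℝ (Fin N) → ℝ) : Prop :=
  ContDiffOn ℝ 1 v (closure Ω) ∧ ∀ x ∈ frontier Ω, v x = 0

/-- `u` is a global minimizer of `J` in `X`. -/
def IsGlobalMinJ {N : ℕ} (g f : ℝ → ℝ) (Ω : Set (EuclideanSpace ℝ (Fin N)))
    (u : EuclideanSpace ℝ (Fin N) → ℝ) : Prop :=
  MemX Ω u ∧ ∀ v, MemX Ω v → Jfun g f Ω u ≤ Jfun g f Ω v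

/-- `u` is a local minimizer of `J` in `X` (w.r.t. the `C¹` distance). -/
def IsLocalMinJ {N : ℕ} (g f : ℝ → ℝ) (Ω : Set (EuclideanSpace ℝ (Fin N)))
    (u : EuclideanSpace ℝ (Fin N) → ℝ) : Prop :=
  MemX Ω u ∧ ∃ ε > (0:ℝ), ∀ v, MemX Ω v →
    (∀ x ∈ Ω, |v x - u x| + ‖gradient v x - gradient u x‖ < ε) →
    Jfun g f Ω u ≤ Jfun g f Ω v

/-- `Ω` has `C¹` boundary: near every boundary point, `Ω` is the sublevel set of a `C¹`
defining function with nonvanishing gradient. -/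
def HasC1Boundary {N : ℕ} (Ω : Set (EuclideanSpace ℝ (Fin N))) : Prop :=
  ∀ y ∈ frontier Ω, ∃ (V : Set (EuclideanSpace ℝ (Fin N))) (ρ : EuclideanSpace ℝ (Fin N) → ℝ),
    IsOpen V ∧ y ∈ V ∧ ContDiffOn ℝ 1 ρ V ∧ (∀ x ∈ V, (x ∈ Ω ↔ ρ x < 0)) ∧ gradient ρ y ≠ 0

/-- The Neumann condition `∂u/∂ν = 0` on `∂Ω`; for `u ∈ X` (so that `u` vanishes on the
boundary and all tangential derivatives vanish) this is equivalent to the vanishing of the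
full derivative of `u` (within `clos Ω`) at every boundary point. -/
def NeumannZero {N : ℕ} (Ω : Set (EuclideanSpace ℝ (Fin N)))
    (u : EuclideanSpace ℝ (Fin N) → ℝ) : Prop :=
  ∀ y ∈ frontier Ω, HasFDerivWithinAt u (0 : EuclideanSpace ℝ (Fin N) →L[ℝ] ℝ) (closure Ω) y

/-- `u` is radially symmetric and radially non-increasing on `clos B_R`, with `C¹`
profile `U` (with derivative `U'`). -/
def RadialNonincreasing {N : ℕ} (R : ℝ) (u : EuclideanSpace ℝ (Fin N) → ℝ)
    (U U' : ℝ → ℝ) : Prop :=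
  C1On U U' 0 R ∧ AntitoneOn U (Icc 0 R) ∧
    ∀ x ∈ closedBall (0:EuclideanSpace ℝ (Fin N)) R, u x = U ‖x‖

end

noncomputable section
namespace LS

/-! ### Part 1: one-dimensional balayage -/

/-- indicator function of a set of reals -/
def ind (V : Set ℝ) : ℝ → ℝ := V.indicator (fun _ => (1:ℝ))

/-- signed mass of `V` between `x` and `z` -/
def mass (V : Set ℝ) (x z : ℝ) : ℝ := ∫ τ in x..z, ind V τ

/-- second order increment of the potential -/
def Ain (V : Set ℝ) (x z : ℝ) : ℝ := ∫ τ in x..z, ind V τ * (z - τ)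

/-- swept set -/
def Bal (k : ℝ) (V : Set ℝ) : Set ℝ := {x | ∃ z, k * (z - x) ^ 2 / 2 < Ain V x z}

lemma ind_nonneg (V : Set ℝ) (x : ℝ) : 0 ≤ ind V x := by
  unfold ind; exact Set.indicator_nonneg (fun _ _ => zero_le_one) x

lemma ind_le_one (V : Set ℝ) (x : ℝ) : ind V x ≤ 1 := by
  unfold ind; by_cases h : x ∈ V <;> simp [h]

lemma ind_mono {V W : Set ℝ} (h : V ⊆ W) (x : ℝ) : ind V x ≤ ind W x := by
  unfold ind; exact Set.indicator_le_indicator_of_subset h (fun _ => zero_le_one) x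

lemma ind_mem {V : Set ℝ} {x : ℝ} (h : x ∈ V) : ind V x = 1 := by simp [ind, h]
lemma ind_notMem {V : Set ℝ} {x : ℝ} (h : x ∉ V) : ind V x = 0 := by simp [ind, h]

lemma ind_measurable {V : Set ℝ} (hV : MeasurableSet V) : Measurable (ind V) :=
  measurable_const.indicator hV

lemma ind_ii {V : Set ℝ} (hV : MeasurableSet V) (a b : ℝ) :
    IntervalIntegrable (ind V) volume a b := by
  refine (intervalIntegrable_const (c := (1:ℝ))).mono_fun (ind_measurable hV).aestronglyMeasurable ?_
  refine Filter.Eventually.of_forall fun x => ?_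
  show ‖ind V x‖ ≤ ‖(1:ℝ)‖
  rw [Real.norm_of_nonneg (ind_nonneg V x)]; simpa using ind_le_one V x

lemma ind_mul_ii {V : Set ℝ} (hV : MeasurableSet V) {h : ℝ → ℝ} (hh : Continuous h) (a b : ℝ) :
    IntervalIntegrable (fun τ => ind V τ * h τ) volume a b :=
  (ind_ii hV a b).mul_continuousOn hh.continuousOn

lemma mass_add {V : Set ℝ} (hV : MeasurableSet V) (x y z : ℝ) :
    mass V x y + mass V y z = mass V x z :=
  intervalIntegral.integral_add_adjacent_intervals (ind_ii hV _ _) (ind_ii hV _ _)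

lemma mass_self (V : Set ℝ) (x : ℝ) : mass V x x = 0 := by simp [mass]
lemma Ain_self (V : Set ℝ) (x : ℝ) : Ain V x x = 0 := by simp [Ain]

lemma mass_symm (V : Set ℝ) (x z : ℝ) : mass V z x = - mass V x z :=
  intervalIntegral.integral_symm _ _

lemma mass_nonneg (V : Set ℝ) {x z : ℝ} (h : x ≤ z) : 0 ≤ mass V x z :=
  intervalIntegral.integral_nonneg h (fun _ _ => ind_nonneg V _)

lemma mass_le {V : Set ℝ} (hV : MeasurableSet V) {x z : ℝ} (h : x ≤ z) : mass V x z ≤ z - x := by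
  have := intervalIntegral.integral_mono_on h (ind_ii hV x z)
    (intervalIntegrable_const (c := (1:ℝ))) (fun t _ => ind_le_one V t)
  simpa [mass] using this

lemma mass_abs_le {V : Set ℝ} (hV : MeasurableSet V) (x z : ℝ) : |mass V x z| ≤ |z - x| := by
  rcases le_total x z with h | h
  · rw [abs_of_nonneg (mass_nonneg V h), abs_of_nonneg (by linarith)]; exact mass_le hV h
  · rw [mass_symm, abs_neg, abs_of_nonneg (mass_nonneg V h), abs_of_nonpos (by linarith)]
    linarith [mass_le hV h]

lemma Ain_chain {V : Set ℝ} (hV : MeasurableSet V) (x y z : ℝ) :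
    Ain V x z = Ain V x y + Ain V y z + mass V x y * (z - y) := by
  unfold Ain mass
  rw [← intervalIntegral.integral_add_adjacent_intervals
    (ind_mul_ii hV (by fun_prop : Continuous fun τ : ℝ => z - τ) x y)
    (ind_mul_ii hV (by fun_prop : Continuous fun τ : ℝ => z - τ) y z)]
  have : ∫ τ in x..y, ind V τ * (z - τ) =
      (∫ τ in x..y, ind V τ * (y - τ)) + (∫ τ in x..y, ind V τ * (z - y)) := by
    rw [← intervalIntegral.integral_add
      (ind_mul_ii hV (by fun_prop : Continuous fun τ : ℝ => y - τ) x y)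
      (ind_mul_ii hV (by fun_prop : Continuous fun τ : ℝ => z - y) x y)]
    congr 1; ext τ; ring
  rw [this, intervalIntegral.integral_mul_const]; ring

/-- absolute kernel representation -/
lemma Ain_eq_abs (V : Set ℝ) (x z : ℝ) :
    Ain V x z = ∫ τ in uIoc x z, ind V τ * |z - τ| := by
  unfold Ain
  rcases le_total x z with h | h
  · rw [intervalIntegral.integral_of_le h, uIoc_of_le h]
    refine setIntegral_congr_fun measurableSet_Ioc fun τ hτ => ?_
    simp only [abs_of_nonneg (by linarith [hτ.2] : 0 ≤ z - τ)]
  · rw [intervalIntegral.integral_of_ge h, uIoc_of_ge h, ← integral_neg]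
    refine setIntegral_congr_fun measurableSet_Ioc fun τ hτ => ?_
    simp only [abs_of_nonpos (by linarith [hτ.1] : z - τ ≤ 0)]; ring

lemma abs_ii (z a b : ℝ) : IntervalIntegrable (fun τ => |z - τ|) volume a b :=
  (by fun_prop : Continuous fun τ : ℝ => |z - τ|).intervalIntegrable _ _

lemma indabs_on {V : Set ℝ} (hV : MeasurableSet V) (z a b : ℝ) :
    IntegrableOn (fun τ => ind V τ * |z - τ|) (uIoc a b) :=
  (intervalIntegrable_iff.1 (ind_mul_ii hV (by fun_prop : Continuous fun τ : ℝ => |z - τ|) a b))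

lemma Ain_nonneg (V : Set ℝ) (x z : ℝ) : 0 ≤ Ain V x z := by
  rw [Ain_eq_abs]
  exact setIntegral_nonneg measurableSet_uIoc fun τ _ => mul_nonneg (ind_nonneg _ _) (abs_nonneg _)

lemma Ain_mono {V W : Set ℝ} (hV : MeasurableSet V) (hW : MeasurableSet W) (h : V ⊆ W) (x z : ℝ) :
    Ain V x z ≤ Ain W x z := by
  rw [Ain_eq_abs, Ain_eq_abs]
  refine setIntegral_mono (indabs_on hV _ _ _) (indabs_on hW _ _ _) fun τ => ?_
  exact mul_le_mul_of_nonneg_right (ind_mono h τ) (abs_nonneg _)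

lemma Ain_univ (x z : ℝ) : Ain univ x z = (z - x) ^ 2 / 2 := by
  simp only [Ain, ind, Set.indicator_univ, one_mul]
  rw [intervalIntegral.integral_sub (by simp) (by simp)]
  simp; ring

lemma Ain_le {V : Set ℝ} (hV : MeasurableSet V) (x z : ℝ) : Ain V x z ≤ (z - x) ^ 2 / 2 := by
  rw [← Ain_univ]; exact Ain_mono hV MeasurableSet.univ (subset_univ _) x z

/-- `Ph k V x z = k (z-x)²/2 - Ain V x z`. -/
def Ph (k : ℝ) (V : Set ℝ) (x z : ℝ) : ℝ := k * (z - x) ^ 2 / 2 - Ain V x z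
def Qf (k : ℝ) (V : Set ℝ) (x z : ℝ) : ℝ := k * (z - x) - mass V x z

lemma Ph_chain {k : ℝ} {V : Set ℝ} (hV : MeasurableSet V) (x y z : ℝ) :
    Ph k V x z = Ph k V x y + Ph k V y z + Qf k V x y * (z - y) := by
  unfold Ph Qf; rw [Ain_chain hV x y z]; ring

lemma notMem_Bal {k : ℝ} {V : Set ℝ} {x : ℝ} : x ∉ Bal k V ↔ ∀ z, 0 ≤ Ph k V x z := by
  simp only [Bal, mem_ofPred_eq, not_exists, not_lt, Ph, sub_nonneg]

lemma mem_Bal {k : ℝ} {V : Set ℝ} {x : ℝ} : x ∈ Bal k V ↔ ∃ z, Ph k V x z < 0 := by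
  simp only [Bal, mem_ofPred_eq, Ph, sub_neg]

lemma Ph_le {k : ℝ} {V : Set ℝ} (x z : ℝ) : Ph k V x z ≤ k * (z - x) ^ 2 / 2 := by
  unfold Ph; linarith [Ain_nonneg V x z]

lemma Qf_add {k : ℝ} {V : Set ℝ} (hV : MeasurableSet V) (x y z : ℝ) :
    Qf k V x y + Qf k V y z = Qf k V x z := by
  unfold Qf; rw [← mass_add hV x y z]; ring

/-- a minimiser of a tilted potential is a contact point -/
lemma contact_of_min {k : ℝ} (hk : 0 < k) {V : Set ℝ} (hV : MeasurableSet V) {x y a : ℝ}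
    (h : ∀ z, Ph k V x y - a * y ≤ Ph k V x z - a * z) : Qf k V x y = a ∧ y ∉ Bal k V := by
  have h1 : ∀ z, 0 ≤ Ph k V y z + (Qf k V x y - a) * (z - y) := by
    intro z; have := h z; rw [Ph_chain hV x y z] at this; linarith
  have h2 : Qf k V x y = a := by
    by_contra hne
    set d := Qf k V x y - a with hd
    have hd0 : d ≠ 0 := sub_ne_zero.2 hne
    have := h1 (y - d / k)
    have h3 := Ph_le (k := k) (V := V) y (y - d / k)
    have e1 : k * (y - d / k - y) ^ 2 / 2 = d ^ 2 / k / 2 := by field_simp; ring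
    have e2 : d * (y - d / k - y) = - (d ^ 2 / k) := by field_simp; ring
    have : 0 < d ^ 2 / k := by positivity
    linarith
  refine ⟨h2, notMem_Bal.2 fun z => ?_⟩
  have := h1 z; rw [h2] at this; simpa using this

lemma Qf_mono {k : ℝ} {V : Set ℝ} (hV : MeasurableSet V) {x y : ℝ} (hxy : x < y)
    (hx : x ∉ Bal k V) (hy : y ∉ Bal k V) : 0 ≤ Qf k V x y := by
  have h1 := notMem_Bal.1 hx y
  have h2 := notMem_Bal.1 hy x
  have h3 := Ph_chain (k := k) hV x y x
  have h4 : Ph k V x x = 0 := by simp [Ph, Ain_self]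
  nlinarith

lemma Bal_mono {k : ℝ} {V W : Set ℝ} (hV : MeasurableSet V) (hW : MeasurableSet W) (h : V ⊆ W) :
    Bal k V ⊆ Bal k W := by
  rintro x ⟨z, hz⟩; exact ⟨z, hz.trans_le (Ain_mono hV hW h x z)⟩

lemma continuous_mass {V : Set ℝ} (hV : MeasurableSet V) : Continuous fun x => mass V 0 x :=
  intervalIntegral.continuous_primitive (fun a b => ind_ii hV a b) 0

lemma Ain_formula {V : Set ℝ} (hV : MeasurableSet V) (x z : ℝ) :
    Ain V x z = Ain V 0 z - Ain V 0 x - mass V 0 x * (z - x) := by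
  rw [Ain_chain hV 0 x z]; ring

lemma Ain_hasDerivAt {V : Set ℝ} (hV : MeasurableSet V) (z : ℝ) :
    HasDerivAt (fun z => Ain V 0 z) (mass V 0 z) z := by
  rw [hasDerivAt_iff_isLittleO]
  refine Asymptotics.IsBigO.trans_isLittleO (g := fun y => (y - z) ^ 2) ?_ ?_
  · refine Asymptotics.IsBigO.of_bound 1 (Filter.Eventually.of_forall fun y => ?_)
    have : Ain V 0 y - Ain V 0 z - (y - z) • mass V 0 z = Ain V z y := by
      rw [Ain_formula hV z y]; simp [mul_comm]
    rw [this, Real.norm_of_nonneg (Ain_nonneg _ _ _), Real.norm_of_nonneg (sq_nonneg _)]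
    have := Ain_le hV z y; nlinarith [sq_nonneg (y - z)]
  · have : (fun y : ℝ => (y - z) ^ 2) = fun y => (y - z) * (y - z) := by ext; ring
    rw [this]
    have h1 : (fun y : ℝ => y - z) =o[nhds z] fun _ => (1:ℝ) := by
      rw [Asymptotics.isLittleO_one_iff]
      have : Continuous fun y : ℝ => y - z := by fun_prop
      simpa using this.tendsto z
    simpa using h1.mul_isBigO (Asymptotics.isBigO_refl (fun y : ℝ => y - z) (nhds z))

lemma continuous_Ain0 {V : Set ℝ} (hV : MeasurableSet V) : Continuous fun x => Ain V 0 x :=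
  continuous_iff_continuousAt.2 fun z => (Ain_hasDerivAt hV z).continuousAt

lemma continuous_Ain {V : Set ℝ} (hV : MeasurableSet V) :
    Continuous fun p : ℝ × ℝ => Ain V p.1 p.2 := by
  have h1 := continuous_Ain0 hV
  have h2 := continuous_mass hV
  have h3 : (fun p : ℝ × ℝ => Ain V p.1 p.2) =
      fun p => Ain V 0 p.2 - Ain V 0 p.1 - mass V 0 p.1 * (p.2 - p.1) :=
    funext fun p => Ain_formula hV _ _
  rw [h3]
  fun_prop

lemma continuous_Ph {k : ℝ} {V : Set ℝ} (hV : MeasurableSet V) :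
    Continuous fun p : ℝ × ℝ => Ph k V p.1 p.2 := by
  have := continuous_Ain hV
  unfold Ph; fun_prop

lemma isOpen_Bal (k : ℝ) {V : Set ℝ} (hV : MeasurableSet V) : IsOpen (Bal k V) := by
  have : Bal k V = ⋃ z, {x | Ph k V x z < 0} := by ext x; simp [mem_Bal]
  rw [this]
  refine isOpen_iUnion fun z => isOpen_lt ?_ continuous_const
  exact (continuous_Ph hV).comp (by fun_prop : Continuous fun x : ℝ => (x, z))

/-- right-adjacent intervals are swept -/
lemma mem_Bal_of_Ioo {k : ℝ} (hk : k < 1) {V : Set ℝ} {x y : ℝ}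
    (hxy : x ≠ y) (h : uIoo x y ⊆ V) : x ∈ Bal k V := by
  refine ⟨y, ?_⟩
  have h1 : Ain V x y = Ain univ x y := by
    rw [Ain_eq_abs, Ain_eq_abs]
    refine setIntegral_congr_ae measurableSet_uIoc ?_
    have : ∀ᵐ τ : ℝ, τ ≠ max x y := by simp [ae_iff]
    filter_upwards [this] with τ hτ hm
    rw [ind_mem (mem_univ _), ind_mem]
    refine h ⟨hm.1, lt_of_le_of_ne hm.2 hτ⟩
  rw [h1, Ain_univ]
  have : 0 < (y - x) ^ 2 := by have := sub_ne_zero.2 hxy.symm; positivity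
  nlinarith

lemma subset_Bal {k : ℝ} (hk : k < 1) {V : Set ℝ} (hV : IsOpen V) : V ⊆ Bal k V := by
  intro x hx
  obtain ⟨ε, hε, h⟩ := Metric.isOpen_iff.1 hV x hx
  refine mem_Bal_of_Ioo hk (y := x + ε) (by linarith) fun τ hτ => h ?_
  rw [uIoo_of_lt (by linarith)] at hτ
  rw [Real.ball_eq_Ioo]; exact ⟨by linarith [hτ.1], hτ.2⟩

/-! translation and reflection -/
lemma Ain_trans (V : Set ℝ) (s x z : ℝ) :
    Ain ((fun t => t + s) ⁻¹' V) x z = Ain V (x + s) (z + s) := by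
  unfold Ain
  rw [← intervalIntegral.integral_comp_add_right (fun τ => ind V τ * (z + s - τ)) s]
  refine intervalIntegral.integral_congr fun τ _ => ?_
  simp only [ind, Set.indicator_apply, mem_preimage]; ring_nf

lemma Bal_trans (k : ℝ) (V : Set ℝ) (s x : ℝ) :
    x ∈ Bal k ((fun t => t + s) ⁻¹' V) ↔ x + s ∈ Bal k V := by
  constructor
  · rintro ⟨z, hz⟩; refine ⟨z + s, ?_⟩; rw [← Ain_trans]; simpa using hz
  · rintro ⟨z, hz⟩; refine ⟨z - s, ?_⟩; rw [Ain_trans]; convert hz using 2 <;> ring_nf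

lemma Ain_neg (V : Set ℝ) (x z : ℝ) :
    Ain (Neg.neg ⁻¹' V) x z = Ain V (-x) (-z) := by
  unfold Ain
  have := intervalIntegral.integral_comp_neg (a := x) (b := z) (fun τ => ind V τ * (- z - τ))
  rw [intervalIntegral.integral_symm (-z) (-x), ← this, ← intervalIntegral.integral_neg]
  refine intervalIntegral.integral_congr fun τ _ => ?_
  simp only [ind, Set.indicator_apply, mem_preimage]; ring_nf

lemma mass_neg (V : Set ℝ) (x z : ℝ) :
    mass (Neg.neg ⁻¹' V) x z = - mass V (-x) (-z) := by
  unfold mass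
  have := intervalIntegral.integral_comp_neg (a := x) (b := z) (fun τ => ind V τ)
  rw [intervalIntegral.integral_symm (-z) (-x), ← this, neg_neg]
  refine intervalIntegral.integral_congr fun τ _ => ?_
  simp only [ind, Set.indicator_apply, mem_preimage]

lemma Bal_neg (k : ℝ) (V : Set ℝ) (x : ℝ) :
    x ∈ Bal k (Neg.neg ⁻¹' V) ↔ -x ∈ Bal k V := by
  constructor
  · rintro ⟨z, hz⟩; refine ⟨-z, ?_⟩; rw [← Ain_neg]; convert hz using 2; ring
  · rintro ⟨z, hz⟩; refine ⟨-z, ?_⟩; rw [Ain_neg]; convert hz using 2 <;> ring_nf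

end LS
end

noncomputable section
namespace LS

/-! ### components -/
def IsComp (O : Set ℝ) (p : ℝ × ℝ) : Prop :=
  p.1 < p.2 ∧ Ioo p.1 p.2 ⊆ O ∧ p.1 ∉ O ∧ p.2 ∉ O

lemma exists_comp {O : Set ℝ} (hO : IsOpen O) {l r : ℝ} (hb : O ⊆ Icc l r) {x : ℝ} (hx : x ∈ O) :
    ∃ p, IsComp O p ∧ x ∈ Ioo p.1 p.2 := by
  have hxlr := hb hx
  have hne1 : (Oᶜ ∩ Iic x).Nonempty :=
    ⟨l - 1, fun h => by have := (hb h).1; linarith, by simp; linarith [hxlr.1]⟩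
  have hne2 : (Oᶜ ∩ Ici x).Nonempty :=
    ⟨r + 1, fun h => by have := (hb h).2; linarith, by simp; linarith [hxlr.2]⟩
  have hbd1 : BddAbove (Oᶜ ∩ Iic x) := ⟨x, fun y hy => hy.2⟩
  have hbd2 : BddBelow (Oᶜ ∩ Ici x) := ⟨x, fun y hy => hy.2⟩
  have m1 := (hO.isClosed_compl.inter isClosed_Iic).csSup_mem hne1 hbd1
  have m2 := (hO.isClosed_compl.inter isClosed_Ici).csInf_mem hne2 hbd2
  set a := sSup (Oᶜ ∩ Iic x)
  set b := sInf (Oᶜ ∩ Ici x)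
  have ha : a < x := lt_of_le_of_ne m1.2 fun h => m1.1 (h ▸ hx)
  have hb' : x < b := lt_of_le_of_ne m2.2 fun h => m2.1 (h ▸ hx)
  refine ⟨(a, b), ⟨ha.trans hb', fun t ht => ?_, m1.1, m2.1⟩, ha, hb'⟩
  by_contra hn
  rcases le_total t x with h | h
  · have := le_csSup hbd1 ⟨hn, h⟩; exact absurd ht.1 (not_lt.2 this)
  · have := csInf_le hbd2 ⟨hn, h⟩; exact absurd ht.2 (not_lt.2 this)

lemma IsComp.eq_of_mem {O : Set ℝ} {p q : ℝ × ℝ} (hp : IsComp O p) (hq : IsComp O q) {t : ℝ}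
    (h1 : t ∈ Ioo p.1 p.2) (h2 : t ∈ Ioo q.1 q.2) : p = q := by
  obtain ⟨_, p2, p3, p4⟩ := hp
  obtain ⟨_, q2, q3, q4⟩ := hq
  ext
  · rcases lt_trichotomy p.1 q.1 with h | h | h
    · exact absurd (p2 ⟨h, h2.1.trans h1.2⟩) q3
    · exact h
    · exact absurd (q2 ⟨h, h1.1.trans h2.2⟩) p3
  · rcases lt_trichotomy p.2 q.2 with h | h | h
    · exact absurd (q2 ⟨h2.1.trans h1.2, h⟩) p4
    · exact h
    · exact absurd (p2 ⟨h1.1.trans h2.2, h⟩) q4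

lemma hasSum_comp {O : Set ℝ} (hO : IsOpen O) {l r : ℝ} (hb : O ⊆ Icc l r) {f : ℝ → ℝ}
    (hf : IntegrableOn f O) :
    HasSum (fun p : {p // IsComp O p} => ∫ τ in Ioo p.1.1 p.1.2, f τ) (∫ τ in O, f τ) := by
  have hd : Pairwise (Function.onFun Disjoint
      (fun p : {p // IsComp O p} => Ioo p.1.1 p.1.2)) := by
    intro p q hpq
    refine Set.disjoint_left.2 fun t h1 h2 => hpq (Subtype.ext (p.2.eq_of_mem q.2 h1 h2))
  have hc : Countable {p // IsComp O p} :=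
    hd.countable_of_isOpen_disjoint (fun p => isOpen_Ioo) (fun p => nonempty_Ioo.2 p.2.1)
  have hU : (⋃ p : {p // IsComp O p}, Ioo p.1.1 p.1.2) = O := by
    ext t; simp only [mem_iUnion]
    constructor
    · rintro ⟨p, hp⟩; exact p.2.2.1 hp
    · intro ht; obtain ⟨p, hp, h⟩ := exists_comp hO hb ht; exact ⟨⟨p, hp⟩, h⟩
  have := hasSum_integral_iUnion (f := f) (μ := volume) (fun p : {p // IsComp O p} =>
    (measurableSet_Ioo : MeasurableSet (Ioo p.1.1 p.1.2))) hd (by rw [hU]; exact hf)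
  rwa [hU] at this

lemma comp_zero {O : Set ℝ} (hO : IsOpen O) {l r : ℝ} (hb : O ⊆ Icc l r) {f : ℝ → ℝ}
    (hf : IntegrableOn f O) (h : ∀ p, IsComp O p → ∫ τ in Ioo p.1 p.2, f τ = 0) :
    ∫ τ in O, f τ = 0 := by
  have := hasSum_comp hO hb hf
  simp_rw [fun p : {p // IsComp O p} => h p.1 p.2] at this
  exact this.unique hasSum_zero

lemma comp_exists_nonpos {O : Set ℝ} (hO : IsOpen O) {l r : ℝ} (hb : O ⊆ Icc l r) {f : ℝ → ℝ}
    (hf : IntegrableOn f O) (hne : O.Nonempty) (h : ∫ τ in O, f τ ≤ 0) :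
    ∃ p, IsComp O p ∧ ∫ τ in Ioo p.1 p.2, f τ ≤ 0 := by
  by_contra! hcon
  obtain ⟨x, hx⟩ := hne
  obtain ⟨p, hp, -⟩ := exists_comp hO hb hx
  have := le_hasSum (hasSum_comp hO hb hf) ⟨p, hp⟩ (fun q _ => (hcon q.1 q.2).le)
  exact absurd (hcon p hp) (not_lt.2 (this.trans h))

/-! ### mass identities -/
lemma comp_Qf {k : ℝ} (hk : 0 < k) {V : Set ℝ} (hV : MeasurableSet V) {a b : ℝ} (hab : a < b)
    (ha : a ∉ Bal k V) (hb : b ∉ Bal k V) (h : Ioo a b ⊆ Bal k V) : Qf k V a b = 0 := by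
  have h0 := Qf_mono hV hab ha hb
  by_contra hne
  have hpos : 0 < Qf k V a b := lt_of_le_of_ne h0 (Ne.symm hne)
  set α := Qf k V a b / 2 with hα
  have hα0 : 0 < α := by positivity
  have hcont : Continuous fun z => Ph k V a z - α * z := by
    have := (continuous_Ph (k := k) hV).comp (by fun_prop : Continuous fun z : ℝ => (a, z))
    simp only [Function.comp_def] at this
    fun_prop
  obtain ⟨y, hy, hmin⟩ := isCompact_Icc.exists_isMinOn (nonempty_Icc.2 hab.le) hcont.continuousOn
  have hPaa : Ph k V a a = 0 := by simp [Ph, Ain_self]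
  have hall : ∀ z, Ph k V a y - α * y ≤ Ph k V a z - α * z := by
    intro z
    rcases lt_or_ge z a with hz | hz
    · have h1 := hmin (left_mem_Icc.2 hab.le)
      simp only [mem_ofPred_eq] at h1
      have h2 := notMem_Bal.1 ha z
      nlinarith
    · rcases le_or_gt z b with hz' | hz'
      · exact hmin ⟨hz, hz'⟩
      · have h1 := hmin (right_mem_Icc.2 hab.le)
        simp only [mem_ofPred_eq] at h1
        have h2 := notMem_Bal.1 hb z
        have h3 := Ph_chain (k := k) hV a b z
        nlinarith
  obtain ⟨e1, e2⟩ := contact_of_min hk hV hall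
  have hya : y ≠ a := by
    rintro rfl; simp [Qf, mass_self] at e1; linarith
  have hyb : y ≠ b := by
    rintro rfl; linarith
  exact e2 (h ⟨lt_of_le_of_ne hy.1 (Ne.symm hya), lt_of_le_of_ne hy.2 hyb⟩)

lemma mass_eq_Ioo (V : Set ℝ) {a b : ℝ} (h : a ≤ b) : mass V a b = ∫ τ in Ioo a b, ind V τ := by
  rw [mass, intervalIntegral.integral_of_le h, integral_Ioc_eq_integral_Ioo]

lemma Bal_mass_eq {k : ℝ} (hk : 0 < k) (hk1 : k < 1) {V : Set ℝ} (hV : IsOpen V) {x y : ℝ}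
    (hxy : x ≤ y) (hx : x ∉ Bal k V) (hy : y ∉ Bal k V) :
    k * mass (Bal k V) x y = mass V x y := by
  have hVm := hV.measurableSet
  have hBo := isOpen_Bal k hVm
  have hsub := subset_Bal hk1 hV
  have hIntg : ∀ a b, IntegrableOn (fun τ => k - ind V τ) (Ioo a b) := by
    intro a b
    refine (intervalIntegrable_iff_integrableOn_Ioo_of_le (le_max_left a b)).1
      (intervalIntegrable_const.sub (ind_ii hVm a (max a b))) |>.mono_set ?_
    exact Ioo_subset_Ioo_right (le_max_right _ _)
  have key : ∫ τ in Bal k V ∩ Ioo x y, (k - ind V τ) = 0 := by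
    refine comp_zero (hBo.inter isOpen_Ioo) (l := x) (r := y)
      (inter_subset_right.trans Ioo_subset_Icc_self) ((hIntg x y).mono_set inter_subset_right) ?_
    rintro ⟨a, b⟩ ⟨hab, hs, ha, hb⟩
    simp only at *
    have hclos : Icc a b ⊆ Icc x y := by
      rw [← closure_Ioo hab.ne]
      refine closure_minimal ((hs.trans inter_subset_right).trans Ioo_subset_Icc_self) isClosed_Icc
    have hxa := hclos (left_mem_Icc.2 hab.le)
    have hyb := hclos (right_mem_Icc.2 hab.le)
    have haB : a ∉ Bal k V := fun hB => by
      by_cases h : x = a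
      · exact hx (h ▸ hB)
      · exact ha ⟨hB, lt_of_le_of_ne hxa.1 h, hab.trans_le hyb.2⟩
    have hbB : b ∉ Bal k V := fun hB => by
      by_cases h : b = y
      · exact hy (h ▸ hB)
      · exact hb ⟨hB, hxa.1.trans_lt hab, lt_of_le_of_ne hyb.2 h⟩
    have := comp_Qf hk hVm hab haB hbB (hs.trans inter_subset_left)
    rw [Qf, mass_eq_Ioo V hab.le] at this
    rw [integral_sub (by simp) ((intervalIntegrable_iff_integrableOn_Ioo_of_le hab.le).1 (ind_ii hVm a b))]
    simp [hab.le]; linarith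
  have e : ∫ τ in Bal k V ∩ Ioo x y, (k - ind V τ) =
      ∫ τ in Ioo x y, (k * ind (Bal k V) τ - ind V τ) := by
    rw [inter_comm, ← setIntegral_indicator hBo.measurableSet]
    refine setIntegral_congr_fun measurableSet_Ioo fun τ _ => ?_
    by_cases h : τ ∈ Bal k V
    · simp [h, ind]
    · have : τ ∉ V := fun h' => h (hsub h')
      simp [h, ind, this]
  rw [e, integral_sub, integral_const_mul, ← mass_eq_Ioo _ hxy, ← mass_eq_Ioo _ hxy] at key
  · linarith
  · exact ((intervalIntegrable_iff_integrableOn_Ioo_of_le hxy).1 (ind_ii hBo.measurableSet x y)).const_mul k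
  · exact (intervalIntegrable_iff_integrableOn_Ioo_of_le hxy).1 (ind_ii hVm x y)

/-! ### bathtub estimates -/
lemma Ain_le_mass {V : Set ℝ} (hV : MeasurableSet V) {x z : ℝ} (h : x ≤ z) :
    Ain V x z ≤ mass V x z * (z - x) := by
  unfold Ain mass
  rw [← intervalIntegral.integral_mul_const]
  refine intervalIntegral.integral_mono_on h
    (ind_mul_ii hV (by fun_prop : Continuous fun τ : ℝ => z - τ) x z)
    ((ind_ii hV x z).mul_const _) fun τ hτ => ?_
  exact mul_le_mul_of_nonneg_left (by linarith [hτ.1]) (ind_nonneg _ _)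

lemma bath {V : Set ℝ} (hV : MeasurableSet V) {x z : ℝ} (h : x ≤ z) :
    Ain V x z ≤ mass V x z * (z - x) - mass V x z ^ 2 / 2 := by
  set L := mass V x z with hL
  have hL0 : 0 ≤ L := mass_nonneg V h
  have hL1 : L ≤ z - x := mass_le hV h
  have h1 := Ain_chain hV x (x + L) z
  have h2 := Ain_le hV x (x + L)
  have h3 := Ain_le_mass hV (by linarith : x + L ≤ z)
  have h4 := mass_add hV x (x + L) z
  nlinarith

lemma Ain_zero_of_disj {V : Set ℝ} {x z : ℝ} (h : x ≤ z) (hd : V ∩ Ioo x z = ∅) :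
    Ain V x z = 0 ∧ mass V x z = 0 := by
  have hae : ∀ τ ∈ Ioo x z, ind V τ = 0 := fun τ hτ =>
    ind_notMem fun hv => (Set.eq_empty_iff_forall_notMem.1 hd τ) ⟨hv, hτ⟩
  constructor
  · rw [Ain, intervalIntegral.integral_of_le h, integral_Ioc_eq_integral_Ioo]
    refine setIntegral_eq_zero_of_forall_eq_zero fun τ hτ => by rw [hae τ hτ, zero_mul]
  · rw [mass_eq_Ioo V h]
    exact setIntegral_eq_zero_of_forall_eq_zero hae

lemma mass_le_of_subset {V : Set ℝ} (hV : MeasurableSet V) {r : ℝ} (hr : 0 ≤ r) (hb : V ⊆ Icc (-r) r)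
    (x z : ℝ) : mass V x z ≤ 2 * r := by
  rcases le_total x z with h | h
  · rw [mass, intervalIntegral.integral_of_le h]
    have h1 : ∫ τ in Ioc x z, ind V τ ≤ ∫ τ in Ioc x z, ind (Icc (-r) r) τ := by
      refine setIntegral_mono ((intervalIntegrable_iff_integrableOn_Ioc_of_le h).1 (ind_ii hV x z))
        ((intervalIntegrable_iff_integrableOn_Ioc_of_le h).1 (ind_ii measurableSet_Icc x z))
        (fun τ => ind_mono hb τ)
    have h2 : ∫ τ in Ioc x z, ind (Icc (-r) r) τ ≤ ∫ τ, ind (Icc (-r) r) τ := by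
      refine setIntegral_le_integral ?_ (Filter.Eventually.of_forall fun τ => ind_nonneg _ _)
      unfold ind
      exact (integrable_indicator_iff measurableSet_Icc).2 (by simp)
    have h3 : ∫ τ, ind (Icc (-r) r) τ = 2 * r := by
      unfold ind
      rw [integral_indicator measurableSet_Icc]; simp [hr]; ring
    linarith
  · rw [mass_symm]; linarith [mass_nonneg V h]

lemma Ph_pos_right {k : ℝ} (hk : 0 < k) {V : Set ℝ} (hV : MeasurableSet V) {r d x z : ℝ}
    (hr : 0 ≤ r) (hb : V ⊆ Icc (-r) r) (hd : 0 < d) (hkd : r * (1 - k) < k * d) (hk1 : k ≤ 1)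
    (hdis : V ∩ Ioo x (x + d) = ∅) (hz : x < z) : 0 < Ph k V x z := by
  have hy : 0 < (z - x) := by linarith
  rcases le_or_gt z (x + d) with h | h
  · have : V ∩ Ioo x z = ∅ := by
      refine subset_empty_iff.1 (hdis ▸ inter_subset_inter_right V (Ioo_subset_Ioo_right h))
    rw [Ph, (Ain_zero_of_disj hz.le this).1]; simp; positivity
  · have e := Ain_zero_of_disj (by linarith : x ≤ x + d) hdis
    have h1 := Ain_chain hV x (x + d) z
    rw [e.1, e.2] at h1
    have h2 := bath hV h.le
    set L := mass V (x + d) z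
    have hL0 : 0 ≤ L := mass_nonneg V h.le
    have hLr : L ≤ 2 * r := mass_le_of_subset hV hr hb _ _
    have hLk : L * (1 - k) < 2 * k * d := by nlinarith
    rw [Ph, h1]
    rcases hL0.eq_or_lt with h0 | h0
    · rw [← h0] at h2
      have : 0 < k * (z - x) ^ 2 / 2 := by positivity
      linarith
    · have h5 : 0 ≤ (k * (z - x) - L) ^ 2 := sq_nonneg _
      have h6 : 0 < L * (2 * k * d - L * (1 - k)) := mul_pos h0 (by linarith)
      have h7 : 0 < 2 * k * (k * (z - x) ^ 2 / 2 - (L * (z - (x + d)) - L ^ 2 / 2)) := by nlinarith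
      have h8 := pos_of_mul_pos_right h7 (by positivity)
      linarith

lemma Ph_neg (k : ℝ) (V : Set ℝ) (x z : ℝ) : Ph k (Neg.neg ⁻¹' V) x z = Ph k V (-x) (-z) := by
  unfold Ph; rw [Ain_neg]; ring

lemma Ph_pos_left {k : ℝ} (hk : 0 < k) {V : Set ℝ} (hV : MeasurableSet V) {r d x z : ℝ}
    (hr : 0 ≤ r) (hb : V ⊆ Icc (-r) r) (hd : 0 < d) (hkd : r * (1 - k) < k * d) (hk1 : k ≤ 1)
    (hdis : V ∩ Ioo (x - d) x = ∅) (hz : z < x) : 0 < Ph k V x z := by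
  have := Ph_pos_right (V := Neg.neg ⁻¹' V) (x := -x) (z := -z) hk (measurable_neg hV) hr
    (fun t ht => by have := hb ht; constructor <;> linarith [this.1, this.2]) hd hkd hk1
    (by
      refine eq_empty_iff_forall_notMem.2 fun t ht => eq_empty_iff_forall_notMem.1 hdis (-t) ⟨ht.1, ?_⟩
      constructor <;> linarith [ht.2.1, ht.2.2]) (by linarith)
  rw [Ph_neg] at this; simpa using this

lemma notMem_Bal_of_far {k : ℝ} (hk : 0 < k) (hk1 : k ≤ 1) {V : Set ℝ} (hV : MeasurableSet V)
    {r d x : ℝ} (hr : 0 ≤ r) (hb : V ⊆ Icc (-r) r) (hd : 0 < d) (hkd : r * (1 - k) < k * d)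
    (hdis : V ∩ Ioo (x - d) (x + d) = ∅) : x ∉ Bal k V := by
  refine notMem_Bal.2 fun z => ?_
  rcases lt_trichotomy x z with h | h | h
  · refine (Ph_pos_right hk hV hr hb hd hkd hk1 (subset_empty_iff.1
      (hdis ▸ inter_subset_inter_right V (Ioo_subset_Ioo_left (by linarith)))) h).le
  · subst h; simp [Ph, Ain_self]
  · refine (Ph_pos_left hk hV hr hb hd hkd hk1 (subset_empty_iff.1
      (hdis ▸ inter_subset_inter_right V (Ioo_subset_Ioo_right (by linarith)))) h).le

/-! ### the radial mass inequality -/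
lemma contact_mass_left {k : ℝ} (hk : 0 < k) (hk1 : k < 1) {V : Set ℝ} (hV : MeasurableSet V)
    {ρ x : ℝ} (hρ : 0 ≤ ρ) (hx : x ∉ Bal k V) (hx1 : -ρ ≤ x) (hx2 : x ≤ ρ) :
    mass V (-(k * ρ)) x ≤ k * (ρ + x) := by
  rcases le_or_gt x (-(k * ρ)) with h | h
  · rw [mass_symm]
    have := mass_nonneg V h
    nlinarith
  by_contra! hcon
  set y := -(k * ρ) with hy
  set L := mass V y x with hL
  have hL0 : 0 < L := lt_of_le_of_lt (by nlinarith) hcon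
  set z := x - L / k with hz
  have hLk : L / k > ρ + x := by rw [gt_iff_lt, lt_div_iff₀ hk]; linarith
  have c := notMem_Bal.1 hx z
  have h1 := Ain_chain hV x y z
  have h2 := Ain_nonneg V y z
  have h3 := bath hV h.le
  have h4 := Ain_chain hV x y x
  rw [Ain_self] at h4
  have h5 : mass V x y = - L := mass_symm V y x
  rw [h5] at h1 h4
  rw [Ph] at c
  -- Ain x y = L (x-y) - Ain y x ≥ L^2/2
  have h6 : L ^ 2 / 2 ≤ Ain V x y := by nlinarith
  have h7 : L ^ 2 / 2 + L * (y - z) ≤ Ain V x z := by nlinarith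
  have e1 : k * (z - x) ^ 2 / 2 = L * (L / k) / 2 := by rw [hz]; field_simp; ring
  have h8 : L * (L / 2 + (y - z) - (L / k) / 2) ≤ 0 := by nlinarith
  have h9 : L / 2 + (y - z) - (L / k) / 2 ≤ 0 := by
    by_contra! h'; nlinarith [mul_pos hL0 h']
  have h10 : L = k * (L / k) := by field_simp
  rw [hz, hy] at h9
  nlinarith

lemma contact_mass_right {k : ℝ} (hk : 0 < k) (hk1 : k < 1) {V : Set ℝ} (hV : MeasurableSet V)
    {ρ x : ℝ} (hρ : 0 ≤ ρ) (hx : x ∉ Bal k V) (hx1 : -ρ ≤ x) (hx2 : x ≤ ρ) :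
    mass V x (k * ρ) ≤ k * (ρ - x) := by
  have := contact_mass_left (V := Neg.neg ⁻¹' V) (x := -x) hk hk1 (measurable_neg hV) hρ
    (by rw [Bal_neg]; simpa using hx) (by linarith) (by linarith)
  rw [mass_neg] at this
  simp only [neg_neg] at this
  rw [← mass_symm] at this
  linarith

lemma mass_of_subset {V : Set ℝ} {a b : ℝ} (hab : a ≤ b) (h : Ioo a b ⊆ V) : mass V a b = b - a := by
  rw [mass_eq_Ioo V hab, setIntegral_congr_fun (g := fun _ => (1:ℝ)) measurableSet_Ioo
    (fun τ hτ => ind_mem (h hτ))]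
  simp [hab]

lemma Bal_radial {k : ℝ} (hk : 0 < k) (hk1 : k < 1) {V : Set ℝ} (hV : IsOpen V)
    {ρ : ℝ} (hρ : 0 ≤ ρ) : mass V (-(k * ρ)) (k * ρ) ≤ k * mass (Bal k V) (-ρ) ρ := by
  have hVm := hV.measurableSet
  have hBo := isOpen_Bal k hVm
  have hBm := hBo.measurableSet
  have hkr : 0 ≤ k * ρ := by positivity
  set S := (Bal k V)ᶜ ∩ Icc (-ρ) ρ with hS
  rcases S.eq_empty_or_nonempty with hemp | hne
  · have hsub : Ioo (-ρ) ρ ⊆ Bal k V := fun t ht => by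
      by_contra hn; exact eq_empty_iff_forall_notMem.1 hemp t ⟨hn, Ioo_subset_Icc_self ht⟩
    rw [mass_of_subset (by linarith) hsub]
    have := mass_le hVm (by linarith : -(k * ρ) ≤ k * ρ)
    linarith
  · have hcomp : IsCompact S := isCompact_Icc.inter_left hBo.isClosed_compl
    have m1 := hcomp.sInf_mem hne
    have m2 := hcomp.sSup_mem hne
    have hle : sInf S ≤ sSup S := csInf_le_csSup hne hcomp.bddBelow hcomp.bddAbove
    have l1 : ∀ t ∈ S, sInf S ≤ t := fun t ht => csInf_le hcomp.bddBelow ht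
    have l2 : ∀ t ∈ S, t ≤ sSup S := fun t ht => le_csSup hcomp.bddAbove ht
    set a := sInf S
    set b := sSup S
    have s1 : Ioo (-ρ) a ⊆ Bal k V := fun t ht => by
      by_contra hn
      exact absurd (l1 t ⟨hn, ht.1.le, (ht.2.trans_le m1.2.2).le⟩) (not_le.2 ht.2)
    have s2 : Ioo b ρ ⊆ Bal k V := fun t ht => by
      by_contra hn
      exact absurd (l2 t ⟨hn, (m2.2.1.trans_lt ht.1).le, ht.2.le⟩) (not_le.2 ht.1)
    have e1 := mass_of_subset m1.2.1 s1
    have e2 := mass_of_subset m2.2.2 s2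
    have e3 := Bal_mass_eq hk hk1 hV hle m1.1 m2.1
    have c1 := contact_mass_left hk hk1 hVm hρ m1.1 m1.2.1 m1.2.2
    have c2 := contact_mass_right hk hk1 hVm hρ m2.1 m2.2.1 m2.2.2
    have t1 := mass_add hBm (-ρ) a b
    have t2 := mass_add hBm (-ρ) b ρ
    have t3 := mass_add hVm (-(k * ρ)) a b
    have t4 := mass_add hVm (-(k * ρ)) b (k * ρ)
    rw [← t4, ← t3, ← t2, ← t1, e1, e2]
    linarith

end LS
end

noncomputable section
namespace LS

/-! ### volume forms -/
lemma mass_vol {V : Set ℝ} (hV : MeasurableSet V) {a b : ℝ} (h : a ≤ b) :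
    ENNReal.ofReal (mass V a b) = volume (V ∩ Ioo a b) := by
  rw [mass_eq_Ioo V h, ind, integral_indicator hV, Measure.restrict_restrict hV]
  simp only [integral_const, MeasurableSet.univ, measureReal_restrict_apply, univ_inter, smul_eq_mul,
    mul_one]
  rw [Measure.real, ENNReal.ofReal_toReal]
  exact ((measure_mono inter_subset_right).trans_lt (by simp)).ne

lemma Bal_bdd {k : ℝ} (hk : 0 < k) (hk1 : k < 1) {V : Set ℝ} (hV : MeasurableSet V) {r : ℝ}
    (hr : 0 ≤ r) (hb : V ⊆ Icc (-r) r) :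
    ∃ M, r ≤ M ∧ Bal k V ⊆ Ioo (-M) M ∧ M ∉ Bal k V ∧ -M ∉ Bal k V := by
  set d := r * (1 - k) / k + 1 with hd
  have hd0 : 0 < d := by have : 0 ≤ r * (1 - k) / k := div_nonneg (mul_nonneg hr (by linarith)) hk.le
                         linarith
  have hkd : r * (1 - k) < k * d := by rw [hd, mul_add, mul_div_cancel₀ _ hk.ne']; linarith
  have far : ∀ x, r + d ≤ |x| → x ∉ Bal k V := by
    intro x hx
    refine notMem_Bal_of_far hk hk1.le hV hr hb hd0 hkd ?_
    refine eq_empty_iff_forall_notMem.2 fun t ht => ?_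
    have h1 := hb ht.1
    rcases abs_cases x with ⟨e, _⟩ | ⟨e, _⟩ <;> rw [e] at hx <;>
      linarith [ht.2.1, ht.2.2, h1.1, h1.2]
  refine ⟨r + d, by linarith, fun x hx => ?_, far _ (le_abs_self _), far _ (by rw [abs_neg]; exact le_abs_self _)⟩
  have := mt (far x) (not_not.2 hx)
  exact abs_lt.1 (not_le.1 this)

lemma Bal_vol {k : ℝ} (hk : 0 < k) (hk1 : k < 1) {V : Set ℝ} (hV : IsOpen V) {r : ℝ}
    (hr : 0 ≤ r) (hb : V ⊆ Icc (-r) r) : ENNReal.ofReal k * volume (Bal k V) = volume V := by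
  obtain ⟨M, hM, h1, h2, h3⟩ := Bal_bdd hk hk1 hV.measurableSet hr hb
  have hBm := (isOpen_Bal k hV.measurableSet).measurableSet
  have h4 : -M ≤ M := by linarith
  have e := Bal_mass_eq hk hk1 hV h4 h3 h2
  have e1 := mass_vol hBm h4
  have e2 := mass_vol hV.measurableSet h4
  rw [inter_eq_left.2 h1] at e1
  rw [inter_eq_left.2 ((subset_Bal hk1 hV).trans h1)] at e2
  rw [← e1, ← e2, ← e, ENNReal.ofReal_mul hk.le]

lemma Bal_vol_radial {k : ℝ} (hk : 0 < k) (hk1 : k < 1) {V : Set ℝ} (hV : IsOpen V)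
    {ρ : ℝ} (hρ : 0 ≤ ρ) :
    volume (V ∩ Ioo (-(k * ρ)) (k * ρ)) ≤ ENNReal.ofReal k * volume (Bal k V ∩ Ioo (-ρ) ρ) := by
  have hkr : 0 ≤ k * ρ := by positivity
  rw [← mass_vol hV.measurableSet (by linarith), ← mass_vol
    (isOpen_Bal k hV.measurableSet).measurableSet (by linarith), ← ENNReal.ofReal_mul hk.le]
  exact ENNReal.ofReal_le_ofReal (Bal_radial hk hk1 hV hρ)

lemma Bal_subset_Ioo {k : ℝ} (hk : 0 < k) (hk1 : k < 1) {V : Set ℝ} (hV : IsOpen V)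
    {ρ : ℝ} (hρ : 0 ≤ ρ) (hb : V ⊆ Ioo (-(k * ρ)) (k * ρ)) : Bal k V ⊆ Ioo (-ρ) ρ := by
  have hr : 0 ≤ k * ρ := by positivity
  have hBo := isOpen_Bal k hV.measurableSet
  have h1 := Bal_vol hk hk1 hV hr (hb.trans Ioo_subset_Icc_self)
  have h2 := Bal_vol_radial hk hk1 hV hρ
  rw [inter_eq_left.2 hb, ← h1] at h2
  have hk0 : ENNReal.ofReal k ≠ 0 := by simpa using hk
  have h3 : volume (Bal k V) ≤ volume (Bal k V ∩ Ioo (-ρ) ρ) :=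
    (ENNReal.mul_le_mul_iff_right hk0 ENNReal.ofReal_ne_top).1 h2
  have hfin : volume (Bal k V ∩ Ioo (-ρ) ρ) ≠ ⊤ :=
    ((measure_mono inter_subset_right).trans_lt (by simp)).ne
  have h4 : volume (Bal k V \ Icc (-ρ) ρ) = 0 := by
    have h5 : volume (Bal k V \ (Bal k V ∩ Ioo (-ρ) ρ)) = 0 := by
      rw [measure_sdiff inter_subset_left (hBo.inter isOpen_Ioo).nullMeasurableSet hfin]
      exact tsub_eq_zero_of_le h3
    have h6 : Bal k V \ Icc (-ρ) ρ ⊆ Bal k V \ (Bal k V ∩ Ioo (-ρ) ρ) :=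
      fun x hx => ⟨hx.1, fun h => hx.2 (Ioo_subset_Icc_self h.2)⟩
    exact measure_mono_null h6 h5
  have h5 : Bal k V \ Icc (-ρ) ρ = ∅ := (hBo.sdiff isClosed_Icc).eq_empty_of_measure_zero h4
  have h6 : Bal k V ⊆ Icc (-ρ) ρ := sdiff_eq_empty.1 h5
  rw [← interior_Icc]
  exact hBo.subset_interior_iff.2 h6

/-! ### convergence -/
lemma tendsto_Ain {ι : Type*} {l : Filter ι} [l.IsCountablyGenerated] {V : ι → Set ℝ} {V0 : Set ℝ}
    (hV : ∀ i, MeasurableSet (V i)) (x z : ℝ)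
    (h : ∀ᵐ τ, Filter.Tendsto (fun i => ind (V i) τ) l (nhds (ind V0 τ))) :
    Filter.Tendsto (fun i => Ain (V i) x z) l (nhds (Ain V0 x z)) := by
  refine intervalIntegral.tendsto_integral_filter_of_dominated_convergence (fun τ => |z - τ|)
    (Filter.Eventually.of_forall fun i => ?_) (Filter.Eventually.of_forall fun i => ?_)
    (abs_ii z x z) ?_
  · exact ((ind_measurable (hV i)).mul (by fun_prop)).aestronglyMeasurable
  · refine Filter.Eventually.of_forall fun τ _ => ?_
    rw [norm_mul, Real.norm_of_nonneg (ind_nonneg _ _), Real.norm_eq_abs]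
    exact mul_le_of_le_one_left (abs_nonneg _) (ind_le_one _ _)
  · filter_upwards [h] with τ hτ _ using hτ.mul_const _

lemma Ain_lip {V : Set ℝ} (hV : MeasurableSet V) (x z z' : ℝ) :
    |Ain V x z' - Ain V x z| ≤ (z' - z) ^ 2 / 2 + |z - x| * |z' - z| := by
  have h1 := Ain_chain hV x z z'
  have e : Ain V x z' - Ain V x z = Ain V z z' + mass V x z * (z' - z) := by linarith
  rw [e]
  refine (abs_add_le _ _).trans (add_le_add ?_ ?_)
  · rw [abs_of_nonneg (Ain_nonneg _ _ _)]; exact Ain_le hV _ _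
  · rw [abs_mul]; exact mul_le_mul_of_nonneg_right (mass_abs_le hV _ _) (abs_nonneg _)

/-! ### Part 2: rearrangement of functions -/
/-- superlevel set -/
def sup (ψ : ℝ → ℝ) (c : ℝ) : Set ℝ := {t | c < ψ t}

/-- swept function -/
def BalF (k : ℝ) (ψ : ℝ → ℝ) (x : ℝ) : ℝ := sSup {c | c = 0 ∨ (0 < c ∧ x ∈ Bal k (sup ψ c))}

structure Adm (r : ℝ) (ψ : ℝ → ℝ) : Prop where
  cont : Continuous ψ
  nonneg : ∀ t, 0 ≤ ψ t
  supp : ∀ t, t ∉ Icc (-r) r → ψ t = 0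

lemma Adm.isOpen {r : ℝ} {ψ : ℝ → ℝ} (h : Adm r ψ) (c : ℝ) : IsOpen (sup ψ c) :=
  isOpen_lt continuous_const h.cont

lemma Adm.subset {r : ℝ} {ψ : ℝ → ℝ} (h : Adm r ψ) {c : ℝ} (hc : 0 ≤ c) : sup ψ c ⊆ Icc (-r) r := by
  intro t ht
  by_contra hn
  have := h.supp t hn
  simp only [sup, mem_ofPred_eq] at ht
  linarith

lemma Adm.bdd {r : ℝ} {ψ : ℝ → ℝ} (h : Adm r ψ) : ∃ M, 0 ≤ M ∧ ∀ t, ψ t ≤ M := by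
  obtain ⟨M, hM⟩ := (isCompact_Icc (a := -r) (b := r)).bddAbove_image h.cont.continuousOn
  refine ⟨max M 0, le_max_right _ _, fun t => ?_⟩
  by_cases ht : t ∈ Icc (-r) r
  · exact (hM (mem_image_of_mem _ ht)).trans (le_max_left _ _)
  · rw [h.supp t ht]; exact le_max_right _ _

lemma Bal_empty {k : ℝ} (hk : 0 < k) : Bal k ∅ = ∅ := by
  refine eq_empty_iff_forall_notMem.2 fun x => notMem_Bal.2 fun z => ?_
  simp [Ph, Ain, ind]; positivity

lemma sup_anti (ψ : ℝ → ℝ) {c c' : ℝ} (h : c ≤ c') : sup ψ c' ⊆ sup ψ c := fun _ ht => h.trans_lt ht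

lemma BalF_bdd {k : ℝ} (hk : 0 < k) {r : ℝ} {ψ : ℝ → ℝ} (h : Adm r ψ) (x : ℝ) :
    BddAbove {c | c = 0 ∨ (0 < c ∧ x ∈ Bal k (sup ψ c))} := by
  obtain ⟨M, hM0, hM⟩ := h.bdd
  refine ⟨M, ?_⟩
  rintro c (rfl | ⟨hc, hx⟩)
  · exact hM0
  · by_contra! hlt
    have : sup ψ c = ∅ := eq_empty_iff_forall_notMem.2 fun t ht => by
      have := hM t; simp only [sup, mem_ofPred_eq] at ht; linarith
    rw [this, Bal_empty hk] at hx; exact hx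

lemma BalF_nonneg {k : ℝ} (hk : 0 < k) {r : ℝ} {ψ : ℝ → ℝ} (h : Adm r ψ) (x : ℝ) :
    0 ≤ BalF k ψ x := le_csSup (BalF_bdd hk h x) (Or.inl rfl)

lemma lt_BalF {k : ℝ} (hk : 0 < k) {r : ℝ} {ψ : ℝ → ℝ} (h : Adm r ψ) (x : ℝ) {c : ℝ} (hc : 0 ≤ c) :
    c < BalF k ψ x ↔ x ∈ Bal k (sup ψ c) := by
  have hm : ∀ c, MeasurableSet (sup ψ c) := fun c => (h.isOpen c).measurableSet
  constructor
  · intro hlt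
    obtain ⟨c', hc', hl⟩ := exists_lt_of_lt_csSup (s := {c | c = 0 ∨ (0 < c ∧ x ∈ Bal k (sup ψ c))})
      ⟨0, Or.inl rfl⟩ hlt
    rcases hc' with rfl | ⟨h1, h2⟩
    · exact absurd hc (not_le.2 hl)
    · exact Bal_mono (hm _) (hm _) (sup_anti ψ hl.le) h2
  · rintro ⟨z, hz⟩
    have ht : Filter.Tendsto (fun n : ℕ => Ain (sup ψ (c + 1 / ((n:ℝ) + 1))) x z) Filter.atTop
        (nhds (Ain (sup ψ c) x z)) := by
      refine tendsto_Ain (fun _ => hm _) x z (Filter.Eventually.of_forall fun τ => ?_)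
      have hlim : Filter.Tendsto (fun n : ℕ => c + 1 / ((n:ℝ) + 1)) Filter.atTop (nhds c) := by
        simpa using (tendsto_const_nhds (x := c)).add tendsto_one_div_add_atTop_nhds_zero_nat
      by_cases hτ : c < ψ τ
      · rw [ind_mem (by exact hτ : τ ∈ sup ψ c)]
        refine tendsto_const_nhds.congr' ?_
        filter_upwards [hlim.eventually_lt_const hτ] with n hn
        rw [ind_mem (by exact hn)]
      · rw [ind_notMem (by exact hτ : τ ∉ sup ψ c)]
        refine tendsto_const_nhds.congr fun n => ?_
        rw [ind_notMem]
        intro h'; simp only [sup, mem_ofPred_eq] at h'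
        have : 0 < 1 / ((n:ℝ) + 1) := by positivity
        linarith
    obtain ⟨n, hn⟩ := (ht.eventually_const_lt hz).exists
    have hp : 0 < 1 / ((n:ℝ) + 1) := by positivity
    refine lt_of_lt_of_le (by linarith : c < c + 1 / ((n:ℝ) + 1)) (le_csSup (BalF_bdd hk h x) (Or.inr ⟨by linarith, z, hn⟩))

lemma le_BalF {k : ℝ} (hk : 0 < k) (hk1 : k < 1) {r : ℝ} {ψ : ℝ → ℝ} (h : Adm r ψ) (x : ℝ) :
    ψ x ≤ BalF k ψ x := by
  by_contra! hlt
  have h0 := BalF_nonneg hk h x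
  have := (lt_BalF hk h x h0).2 (subset_Bal hk1 (h.isOpen _) hlt)
  exact lt_irrefl _ this

lemma BalF_contr {k : ℝ} (hk : 0 < k) {r r' : ℝ} {ψ ψ' : ℝ → ℝ} (h : Adm r ψ) (h' : Adm r' ψ')
    {d : ℝ} (hd : 0 ≤ d) (hle : ∀ t, ψ t ≤ ψ' t + d) (x : ℝ) : BalF k ψ x ≤ BalF k ψ' x + d := by
  by_contra! hlt
  have h0 := BalF_nonneg hk h' x
  have h1 := (lt_BalF hk h x (by linarith)).1 hlt
  have h2 : x ∈ Bal k (sup ψ' (BalF k ψ' x)) := by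
    refine Bal_mono (h.isOpen _).measurableSet (h'.isOpen _).measurableSet (fun t ht => ?_) h1
    have := hle t
    simp only [sup, mem_ofPred_eq] at ht ⊢; linarith
  exact lt_irrefl _ ((lt_BalF hk h' x h0).2 h2)

lemma BalF_trans (k : ℝ) (ψ : ℝ → ℝ) (s x : ℝ) : BalF k (fun t => ψ (t + s)) x = BalF k ψ (x + s) := by
  unfold BalF
  congr 1; ext c
  have : sup (fun t => ψ (t + s)) c = (fun t => t + s) ⁻¹' (sup ψ c) := rfl
  simp only [mem_ofPred_eq, this, Bal_trans]

lemma BalF_le_of_near {k : ℝ} (hk : 0 < k) (hk1 : k < 1) {r : ℝ} (hr : 0 ≤ r) {ψ : ℝ → ℝ} (h : Adm r ψ)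
    {x d M : ℝ} (hd : 0 < d) (hkd : r * (1 - k) < k * d) (hM : 0 ≤ M)
    (hle : ∀ t ∈ Ioo (x - d) (x + d), ψ t ≤ M) : BalF k ψ x ≤ M := by
  by_contra! hlt
  refine notMem_Bal_of_far hk hk1.le (h.isOpen M).measurableSet hr (h.subset hM) hd hkd ?_
    ((lt_BalF hk h x hM).1 hlt)
  refine eq_empty_iff_forall_notMem.2 fun t ht => absurd ht.1 (not_lt.2 (hle t ht.2))

lemma BalF_pos_mem {k : ℝ} (hk : 0 < k) (hk1 : k < 1) {r : ℝ} {ψ : ℝ → ℝ} (h : Adm r ψ) {ρ : ℝ}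
    (hρ : 0 ≤ ρ) (hs : ∀ t, 0 < ψ t → t ∈ Ioo (-(k * ρ)) (k * ρ)) {x : ℝ} (hx : 0 < BalF k ψ x) :
    x ∈ Ioo (-ρ) ρ :=
  Bal_subset_Ioo hk hk1 (h.isOpen 0) hρ (fun t ht => hs t ht) ((lt_BalF hk h x le_rfl).1 hx)

lemma BalF_vol {k : ℝ} (hk : 0 < k) (hk1 : k < 1) {r : ℝ} (hr : 0 ≤ r) {ψ : ℝ → ℝ} (h : Adm r ψ)
    {c : ℝ} (hc : 0 ≤ c) :
    ENNReal.ofReal k * volume {x | c < BalF k ψ x} = volume (sup ψ c) := by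
  have : {x | c < BalF k ψ x} = Bal k (sup ψ c) := by ext x; exact lt_BalF hk h x hc
  rw [this]; exact Bal_vol hk hk1 (h.isOpen c) hr (h.subset hc)

lemma BalF_vol_radial {k : ℝ} (hk : 0 < k) (hk1 : k < 1) {r : ℝ} {ψ : ℝ → ℝ} (h : Adm r ψ)
    {c : ℝ} (hc : 0 ≤ c) {ρ : ℝ} (hρ : 0 ≤ ρ) :
    volume (sup ψ c ∩ Ioo (-(k * ρ)) (k * ρ)) ≤
      ENNReal.ofReal k * volume ({x | c < BalF k ψ x} ∩ Ioo (-ρ) ρ) := by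
  have : {x | c < BalF k ψ x} = Bal k (sup ψ c) := by ext x; exact lt_BalF hk h x hc
  rw [this]; exact Bal_vol_radial hk hk1 (h.isOpen c) hρ

end LS
end

noncomputable section
namespace LS

open Filter Topology

/-! ### Part 4: Danskin data -/
def RegLevel (ψ dψ : ℝ → ℝ) (c : ℝ) : Prop := ∀ τ, ψ τ = c → HasDerivAt ψ (dψ τ) τ ∧ dψ τ ≠ 0

lemma right_of_deriv_pos {ψ : ℝ → ℝ} {a e : ℝ} (h : HasDerivAt ψ a e) (ha : 0 < a) :
    ∃ d > 0, ∀ τ, (τ ∈ Ioo e (e + d) → ψ e < ψ τ) ∧ (τ ∈ Ioo (e - d) e → ψ τ < ψ e) := by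
  have h1 := (hasDerivAt_iff_isLittleO.1 h).bound (by positivity : 0 < a / 2)
  obtain ⟨d, hd, h2⟩ := Metric.eventually_nhds_iff.1 h1
  refine ⟨d, hd, fun τ => ⟨fun hτ => ?_, fun hτ => ?_⟩⟩
  · have := h2 (y := τ) (by rw [Real.dist_eq, abs_lt]; constructor <;> linarith [hτ.1, hτ.2])
    rw [Real.norm_eq_abs, Real.norm_eq_abs, abs_of_pos (by linarith [hτ.1] : 0 < τ - e)] at this
    have := (abs_le.1 this).1
    simp only [smul_eq_mul] at this
    nlinarith [hτ.1]
  · have := h2 (y := τ) (by rw [Real.dist_eq, abs_lt]; constructor <;> linarith [hτ.1, hτ.2])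
    rw [Real.norm_eq_abs, Real.norm_eq_abs, abs_of_neg (by linarith [hτ.2] : τ - e < 0)] at this
    have := (abs_le.1 this).2
    simp only [smul_eq_mul] at this
    nlinarith [hτ.2]

lemma contact_lt {k : ℝ} (hk1 : k < 1) {r : ℝ} {ψ dψ : ℝ → ℝ} (h : Adm r ψ) {c x : ℝ}
    (hreg : RegLevel ψ dψ c) (hx : x ∉ Bal k (sup ψ c)) : ψ x < c := by
  rcases lt_trichotomy (ψ x) c with h1 | h1 | h1
  · exact h1
  · exfalso
    obtain ⟨hd, hne⟩ := hreg x h1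
    rcases lt_or_gt_of_ne hne with hneg | hpos
    · have hd' : HasDerivAt (fun t => - ψ t) (-dψ x) x := hd.neg
      obtain ⟨d, hd0, H⟩ := right_of_deriv_pos hd' (by linarith)
      refine hx (mem_Bal_of_Ioo hk1 (y := x - d) (by linarith) fun τ hτ => ?_)
      rw [uIoo_of_gt (by linarith)] at hτ
      have := (H τ).2 hτ
      simp only [sup, mem_ofPred_eq]; linarith
    · obtain ⟨d, hd0, H⟩ := right_of_deriv_pos hd hpos
      refine hx (mem_Bal_of_Ioo hk1 (y := x + d) (by linarith) fun τ hτ => ?_)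
      rw [uIoo_of_lt (by linarith)] at hτ
      have := (H τ).1 hτ
      simp only [sup, mem_ofPred_eq]; linarith
  · exact absurd (subset_Bal hk1 (h.isOpen c) h1) hx

lemma level_finite {r : ℝ} {ψ dψ : ℝ → ℝ} (h : Adm r ψ) {c : ℝ} (hc : 0 < c)
    (hreg : RegLevel ψ dψ c) : {τ | ψ τ = c}.Finite := by
  have h1 : (Icc (-r) r ∩ {τ | ψ τ = c}).Finite := by
    refine IsCompact.induction_on (p := fun s => (s ∩ {τ | ψ τ = c}).Finite) isCompact_Icc
      (by simp) (fun s t hst ht => ht.subset (inter_subset_inter_left _ hst))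
      (fun s t hs ht => by rw [union_inter_distrib_right]; exact hs.union ht) fun x _ => ?_
    by_cases hx : ψ x = c
    · obtain ⟨hd, hne⟩ := hreg x hx
      have h2 := hd.eventually_ne hne (c := c)
      refine ⟨{τ | τ ≠ x → ψ τ ≠ c}, mem_nhdsWithin_of_mem_nhds (eventually_nhdsWithin_iff.1 h2), ?_⟩
      refine (finite_singleton x).subset fun τ hτ => ?_
      by_contra hn; exact hτ.1 hn hτ.2
    · refine ⟨{τ | ψ τ ≠ c}, mem_nhdsWithin_of_mem_nhds (h.cont.continuousAt.eventually_ne hx), ?_⟩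
      convert finite_empty
      ext τ; simp
  refine h1.subset fun τ hτ => ⟨?_, hτ⟩
  by_contra hn
  have := h.supp τ hn
  simp only [mem_ofPred_eq] at hτ; linarith

lemma Ain_le_mass' {V : Set ℝ} (hV : MeasurableSet V) {r : ℝ} (hr : 0 ≤ r) (hb : V ⊆ Icc (-r) r)
    (x z : ℝ) : Ain V x z ≤ 2 * r * |z - x| := by
  rcases le_total x z with h | h
  · rw [abs_of_nonneg (by linarith)]
    exact (Ain_le_mass hV h).trans (mul_le_mul_of_nonneg_right (mass_le_of_subset hV hr hb _ _) (by linarith))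
  · have := (Ain_le_mass (V := Neg.neg ⁻¹' V) (measurable_neg hV) (neg_le_neg h)).trans
      (mul_le_mul_of_nonneg_right (mass_le_of_subset (measurable_neg hV) hr
      (fun t ht => by have := hb ht; constructor <;> linarith [this.1, this.2]) _ _) (by linarith))
    rw [Ain_neg, neg_neg, neg_neg] at this
    rw [abs_of_nonpos (by linarith)]; linarith

structure Dan (k : ℝ) (ψ : ℝ → ℝ) (t c z : ℝ) (Z : Finset ℝ) : Prop where
  ne : z ≠ t
  ain : Ain (sup ψ c) t z = k * (z - t) ^ 2 / 2
  mass_eq : mass (sup ψ c) t z = k * (z - t)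
  contact : z ∉ Bal k (sup ψ c)
  lt_t : ψ t < c
  lt_z : ψ z < c
  memZ : ∀ e, e ∈ Z ↔ e ∈ uIoo t z ∧ ψ e = c
  sum_le : |z - t| ≤ ∑ e ∈ Z, |z - e|

lemma exists_touch {k : ℝ} (hk : 0 < k) (hk1 : k < 1) {r : ℝ} (hr : 0 ≤ r) {ψ dψ : ℝ → ℝ}
    (h : Adm r ψ) {c t : ℝ} (hc : 0 < c) (hreg : RegLevel ψ dψ c) (ht : BalF k ψ t = c) :
    ∃ z, z ≠ t ∧ Ph k (sup ψ c) t z = 0 := by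
  have hm : ∀ c, MeasurableSet (sup ψ c) := fun c => (h.isOpen c).measurableSet
  have hK : t ∉ Bal k (sup ψ c) := fun hB => by
    have := (lt_BalF hk h t hc.le).2 hB; linarith
  have htc := contact_lt hk1 h hreg hK
  let cn : ℕ → ℝ := fun n => c - c * (1 / ((n:ℝ) + 1))
  have hcn : Tendsto cn atTop (𝓝 c) := by
    have := (tendsto_const_nhds (x := c)).sub
      ((tendsto_one_div_add_atTop_nhds_zero_nat (𝕜 := ℝ)).const_mul c)
    rw [mul_zero, sub_zero] at this
    exact this
  have hcn1 : ∀ n, cn n < c := fun n => by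
    have : 0 < c * (1 / ((n:ℝ) + 1)) := by positivity
    simp only [cn]; linarith
  have hcn0 : ∀ n, 0 ≤ cn n := fun n => by
    have : 1 / ((n:ℝ) + 1) ≤ 1 := by rw [div_le_one (by positivity)]; linarith [n.cast_nonneg (α := ℝ)]
    simp only [cn]; nlinarith
  have hz : ∀ n, ∃ z, k * (z - t) ^ 2 / 2 < Ain (sup ψ (cn n)) t z := fun n =>
    (lt_BalF hk h t (hcn0 n)).1 (by rw [ht]; exact hcn1 n)
  choose zn hzn using hz
  have hbd : ∀ n, zn n ∈ Icc (t - 4 * r / k) (t + 4 * r / k) := by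
    intro n
    have h1 := Ain_le_mass' (hm (cn n)) hr (h.subset (hcn0 n)) t (zn n)
    have h2 := hzn n
    have h3 : |zn n - t| ≤ 4 * r / k := by
      rw [le_div_iff₀ hk]
      by_contra! h4
      have h5 : 0 ≤ |zn n - t| := abs_nonneg _
      have h6 : 0 < |zn n - t| := by
        rcases h5.eq_or_lt with h7 | h7
        · rw [← h7] at h4; linarith
        · exact h7
      rw [← sq_abs] at h2
      nlinarith
    have := abs_le.1 h3
    constructor <;> linarith [this.1, this.2]
  obtain ⟨z, -, φ, hφ, hlim⟩ := isCompact_Icc.tendsto_subseq hbd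
  have hae : ∀ᵐ τ, Tendsto (fun n => ind (sup ψ (cn n)) τ) atTop (𝓝 (ind (sup ψ c) τ)) := by
    have : ∀ᵐ τ, τ ∉ {τ | ψ τ = c} :=
      measure_eq_zero_iff_ae_notMem.1 ((level_finite h hc hreg).measure_zero volume)
    filter_upwards [this] with τ hτ
    rcases lt_or_gt_of_ne hτ with h1 | h1
    · rw [ind_notMem (by exact not_lt.2 h1.le : τ ∉ sup ψ c)]
      refine tendsto_const_nhds.congr' ?_
      filter_upwards [hcn.eventually_const_lt h1] with n hn
      rw [ind_notMem (by exact not_lt.2 hn.le)]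
    · rw [ind_mem (by exact h1 : τ ∈ sup ψ c)]
      refine tendsto_const_nhds.congr' ?_
      filter_upwards [hcn.eventually_lt_const h1] with n hn
      rw [ind_mem (by exact hn)]
  have hA := (tendsto_Ain (fun n => hm (cn n)) t z hae).comp hφ.tendsto_atTop
  have hA2 : Tendsto (fun n => Ain (sup ψ (cn (φ n))) t (zn (φ n))) atTop (𝓝 (Ain (sup ψ c) t z)) := by
    have hd : Tendsto (fun n => Ain (sup ψ (cn (φ n))) t (zn (φ n)) - Ain (sup ψ (cn (φ n))) t z)
        atTop (𝓝 0) := by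
      refine squeeze_zero_norm (a := fun n => (zn (φ n) - z) ^ 2 / 2 + |z - t| * |zn (φ n) - z|)
        (fun n => Ain_lip (hm (cn (φ n))) t z (zn (φ n))) ?_
      have h1 : Tendsto (fun n => zn (φ n) - z) atTop (𝓝 0) := by
        simpa using hlim.sub_const z
      have := ((h1.pow 2).div_const 2).add (h1.abs.const_mul |z - t|)
      simpa using this
    have := hd.add hA
    simpa using this
  have hge : k * (z - t) ^ 2 / 2 ≤ Ain (sup ψ c) t z := by
    refine le_of_tendsto_of_tendsto ?_ hA2 (Eventually.of_forall fun n => (hzn (φ n)).le)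
    exact (((hlim.sub_const t).pow 2).const_mul k).div_const 2
  have hle := notMem_Bal.1 hK z
  refine ⟨z, ?_, ?_⟩
  · rintro rfl
    obtain ⟨c', hc1, hc2⟩ := exists_between htc
    obtain ⟨d, hd, hball⟩ := Metric.eventually_nhds_iff.1 (h.cont.continuousAt.eventually_lt_const hc1)
    have e1 := (hcn.comp hφ.tendsto_atTop).eventually_const_lt hc2
    have e2 := Metric.tendsto_nhds.1 hlim d hd
    obtain ⟨n, hn1, hn2⟩ := (e1.and e2).exists
    have hA0 : Ain (sup ψ (cn (φ n))) z (zn (φ n)) = 0 := by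
      rw [Ain_eq_abs]
      refine setIntegral_eq_zero_of_forall_eq_zero fun τ hτ => ?_
      rw [ind_notMem, zero_mul]
      have hτd : dist τ z < d := by
        rw [Function.comp_apply, Real.dist_eq] at hn2
        rw [Real.dist_eq]
        refine lt_of_le_of_lt ?_ hn2
        have := uIoc_subset_uIcc hτ
        exact abs_sub_left_of_mem_uIcc this
      have := hball hτd
      simp only [Function.comp_apply] at hn1
      exact not_lt.2 (this.trans hn1).le
    have := hzn (φ n)
    rw [hA0] at this
    nlinarith [sq_nonneg (zn (φ n) - z)]
  · unfold Ph at hle ⊢; linarith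

lemma exists_Dan {k : ℝ} (hk : 0 < k) (hk1 : k < 1) {r : ℝ} (hr : 0 ≤ r) {ψ dψ : ℝ → ℝ}
    (h : Adm r ψ) {c t : ℝ} (hc : 0 < c) (hreg : RegLevel ψ dψ c) (ht : BalF k ψ t = c) :
    ∃ z Z, Dan k ψ t c z Z := by
  obtain ⟨z, hzt, hP⟩ := exists_touch hk hk1 hr h hc hreg ht
  have hVo := h.isOpen c
  have hm := hVo.measurableSet
  have hK : t ∉ Bal k (sup ψ c) := fun hB => by
    have := (lt_BalF hk h t hc.le).2 hB; linarith
  have htc := contact_lt hk1 h hreg hK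
  have hall : ∀ z', Ph k (sup ψ c) t z - 0 * z ≤ Ph k (sup ψ c) t z' - 0 * z' := fun z' => by
    rw [hP]; simpa using notMem_Bal.1 hK z'
  obtain ⟨hQ, hzK⟩ := contact_of_min hk hm hall
  have hzc := contact_lt hk1 h hreg hzK
  have hfin : ({τ | ψ τ = c} ∩ uIoo t z).Finite := (level_finite h hc hreg).inter_of_left _
  have hain : Ain (sup ψ c) t z = k * (z - t) ^ 2 / 2 := by unfold Ph at hP; linarith
  have hmass : mass (sup ψ c) t z = k * (z - t) := by unfold Qf at hQ; linarith
  have hmemZ : ∀ e, e ∈ hfin.toFinset ↔ e ∈ uIoo t z ∧ ψ e = c := fun e => by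
    simp only [Finite.mem_toFinset, mem_inter_iff, mem_ofPred_eq]; tauto
  refine ⟨z, hfin.toFinset, hzt, hain, hmass, hzK, htc, hzc, hmemZ, ?_⟩
  set O := sup ψ c ∩ uIoo t z with hO
  have hOo : IsOpen O := hVo.inter isOpen_Ioo
  have hOb : O ⊆ Icc (min t z) (max t z) := inter_subset_right.trans Ioo_subset_Icc_self
  have hy : 0 < |z - t| := abs_pos.2 (sub_ne_zero.2 hzt)
  have hIntg : ∀ {g : ℝ → ℝ}, Continuous g → IntegrableOn g O := fun hg =>
    (hg.integrableOn_Icc).mono_set hOb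
  have e1 : ∫ τ in O, |z - τ| = k * |z - t| ^ 2 / 2 := by
    rw [sq_abs, ← hain, Ain_eq_abs, hO, inter_comm, ← setIntegral_indicator hm, uIoc,
      integral_Ioc_eq_integral_Ioo]
    refine setIntegral_congr_fun measurableSet_Ioo fun τ _ => ?_
    by_cases hτ : τ ∈ sup ψ c <;> simp [hτ, ind]
  have e2 : ∫ τ in O, (1:ℝ) = k * |z - t| := by
    have h1 : ∫ τ in O, (1:ℝ) = ∫ τ in Ioo (min t z) (max t z), ind (sup ψ c) τ := by
      rw [hO, inter_comm, ← setIntegral_indicator hm]; rfl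
    rw [h1, ← mass_eq_Ioo _ min_le_max]
    rcases le_total t z with h2 | h2
    · rw [min_eq_left h2, max_eq_right h2, hmass, abs_of_nonneg (by linarith)]
    · rw [min_eq_right h2, max_eq_left h2, mass_symm, hmass, abs_of_nonpos (by linarith)]; ring
  have hne : O.Nonempty := by
    by_contra hn
    rw [not_nonempty_iff_eq_empty] at hn
    rw [hn] at e2; simp at e2
    rcases e2 with e2 | e2
    · linarith
    · exact hzt (sub_eq_zero.1 e2)
  have e3 : ∫ τ in O, (|z - t| / 2 - |z - τ|) ≤ 0 := by
    rw [integral_sub (hIntg continuous_const) (hIntg (by fun_prop)), e1]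
    have : ∫ τ in O, |z - t| / 2 = (k * |z - t|) * (|z - t| / 2) := by
      rw [← e2, ← integral_mul_const]; simp
    rw [this]; nlinarith
  obtain ⟨⟨a, b⟩, ⟨hab, hs, haO, hbO⟩, hle⟩ := comp_exists_nonpos hOo hOb (hIntg (by fun_prop)) hne e3
  simp only at hab hs haO hbO hle
  have hclos1 : Icc a b ⊆ Icc (min t z) (max t z) := by
    rw [← closure_Ioo hab.ne]; exact closure_minimal (hs.trans hOb) isClosed_Icc
  have hclos2 : Icc a b ⊆ {τ | c ≤ ψ τ} := by
    rw [← closure_Ioo hab.ne]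
    refine closure_minimal (fun τ hτ => ?_) (isClosed_le continuous_const h.cont)
    have := (hs hτ).1
    simp only [sup, mem_ofPred_eq] at this ⊢; linarith
  have hZ : ∀ e ∈ Icc a b, e ∉ O → e ∈ hfin.toFinset := by
    intro e he heO
    have h1 := hclos1 he
    have h2 : c ≤ ψ e := hclos2 he
    have h3 : e ≠ t := by rintro rfl; linarith
    have h4 : e ≠ z := by rintro rfl; linarith
    have h5 : e ∈ uIoo t z := by
      refine ⟨lt_of_le_of_ne h1.1 fun h' => ?_, lt_of_le_of_ne h1.2 fun h' => ?_⟩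
      · rcases min_choice t z with h'' | h'' <;> rw [h''] at h' <;> [exact h3 h'.symm; exact h4 h'.symm]
      · rcases max_choice t z with h'' | h'' <;> rw [h''] at h' <;> [exact h3 h'; exact h4 h']
    refine (hmemZ e).2 ⟨h5, le_antisymm ?_ h2⟩
    by_contra! h6; exact heO ⟨h6, h5⟩
  have hsum : |z - a| + |z - b| ≤ ∑ e ∈ hfin.toFinset, |z - e| := by
    rw [← Finset.sum_pair hab.ne (f := fun e => |z - e|)]
    refine Finset.sum_le_sum_of_subset_of_nonneg (fun e he => ?_) (fun _ _ _ => abs_nonneg _)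
    simp only [Finset.mem_insert, Finset.mem_singleton] at he
    rcases he with rfl | rfl
    · exact hZ _ (left_mem_Icc.2 hab.le) haO
    · exact hZ _ (right_mem_Icc.2 hab.le) hbO
  refine le_trans ?_ hsum
  have e4 : ∫ τ in Ioo a b, (|z - t| / 2 - |z - τ|) = (b - a) / 2 * (|z - t| - (|z - a| + |z - b|)) := by
    rw [← integral_Ioc_eq_integral_Ioo, ← intervalIntegral.integral_of_le hab.le]
    have hmem : ∀ τ ∈ uIcc a b, τ ∈ Icc (min t z) (max t z) := fun τ hτ => by
      rw [uIcc_of_le hab.le] at hτ; exact hclos1 hτ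
    have ma := hmem a left_mem_uIcc
    have mb := hmem b right_mem_uIcc
    rcases le_total t z with h2 | h2
    · rw [max_eq_right h2] at ma mb
      rw [intervalIntegral.integral_congr (g := fun τ => |z - t| / 2 - (z - τ)) fun τ hτ => by
        have := (hmem τ hτ).2; rw [max_eq_right h2] at this
        simp only [abs_of_nonneg (by linarith : 0 ≤ z - τ)]]
      rw [abs_of_nonneg (by linarith [ma.2] : 0 ≤ z - a), abs_of_nonneg (by linarith [mb.2] : 0 ≤ z - b),
        intervalIntegral.integral_sub (by simp) ((by fun_prop : Continuous fun τ : ℝ => z - τ).intervalIntegrable _ _),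
        intervalIntegral.integral_sub (by simp) (by simp)]
      simp; ring
    · rw [min_eq_right h2] at ma mb
      rw [intervalIntegral.integral_congr (g := fun τ => |z - t| / 2 + (z - τ)) fun τ hτ => by
        have := (hmem τ hτ).1; rw [min_eq_right h2] at this
        simp only [abs_of_nonpos (by linarith : z - τ ≤ 0)]; ring]
      rw [abs_of_nonpos (by linarith [ma.1] : z - a ≤ 0), abs_of_nonpos (by linarith [mb.1] : z - b ≤ 0),
        intervalIntegral.integral_add (by simp) ((by fun_prop : Continuous fun τ : ℝ => z - τ).intervalIntegrable _ _),
        intervalIntegral.integral_sub (by simp) (by simp)]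
      simp; ring
  rw [e4] at hle
  by_contra! hcon
  have : 0 < (b - a) / 2 * (|z - t| - (|z - a| + |z - b|)) := mul_pos (by linarith) (by linarith)
  linarith

end LS
end

noncomputable section
namespace LS

open Filter Topology

/-! ### Part 4b: perturbation lemma -/
def edgeF (s e b τ : ℝ) : ℝ := (if 0 < s * (τ - e) + b then 1 else 0) - (if 0 < s * (τ - e) then 1 else 0)

lemma step_int {A B q : ℝ} (hA : A ≤ q) (hB : q ≤ B) {h : ℝ → ℝ} :
    ∫ τ in Ioc A B, (if q < τ then (1:ℝ) else 0) * h τ = ∫ τ in q..B, h τ := by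
  rw [intervalIntegral.integral_of_le hB]
  have : (fun τ => (if q < τ then (1:ℝ) else 0) * h τ) = (Ioi q).indicator h := by
    funext τ; by_cases hq : q < τ <;> simp [hq]
  rw [this, setIntegral_indicator measurableSet_Ioi]
  congr 2
  ext τ; simp only [mem_inter_iff, mem_Ioc, mem_Ioi]
  constructor
  · rintro ⟨⟨-, h2⟩, h3⟩; exact ⟨h3, h2⟩
  · rintro ⟨h1, h2⟩; exact ⟨⟨by linarith, h2⟩, h1⟩

lemma step_int' {A B q : ℝ} (hA : A ≤ q) (hB : q ≤ B) {h : ℝ → ℝ} :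
    ∫ τ in Ioc A B, (if τ < q then (1:ℝ) else 0) * h τ = ∫ τ in A..q, h τ := by
  rw [intervalIntegral.integral_of_le hA, integral_Ioc_eq_integral_Ioo (x := A) (y := q)]
  have : (fun τ => (if τ < q then (1:ℝ) else 0) * h τ) = (Iio q).indicator h := by
    funext τ; by_cases hq : τ < q <;> simp [hq]
  rw [this, setIntegral_indicator measurableSet_Iio]
  congr 2
  ext τ; simp only [mem_inter_iff, mem_Ioc, mem_Iio, mem_Ioo]
  constructor
  · rintro ⟨⟨h1, h2⟩, h3⟩; exact ⟨h1, h3⟩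
  · rintro ⟨h1, h2⟩; exact ⟨⟨h1, by linarith⟩, h2⟩

lemma step_meas (s e b : ℝ) : Measurable fun τ : ℝ => (if 0 < s * (τ - e) + b then (1:ℝ) else 0) :=
  Measurable.ite (measurableSet_lt measurable_const (by fun_prop)) measurable_const measurable_const

lemma step_on (s e b z A B : ℝ) :
    IntegrableOn (fun τ : ℝ => (if 0 < s * (τ - e) + b then (1:ℝ) else 0) * |z - τ|) (Ioc A B) := by
  have h1 : IntegrableOn (fun τ : ℝ => |z - τ|) (Ioc A B) :=
    ((by fun_prop : Continuous fun τ : ℝ => |z - τ|).integrableOn_Icc).mono_set Ioc_subset_Icc_self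
  refine h1.mono' (((step_meas s e b).mul (by fun_prop)).aestronglyMeasurable) (ae_of_all _ fun τ => ?_)
  rw [norm_mul, Real.norm_eq_abs |z - τ|, abs_abs]
  split_ifs <;> simp

lemma edge_on (s e b z A B : ℝ) : IntegrableOn (fun τ : ℝ => edgeF s e b τ * |z - τ|) (Ioc A B) := by
  have := (step_on s e b z A B).sub (step_on s e 0 z A B)
  refine this.congr (ae_of_all _ fun τ => ?_)
  simp [edgeF, sub_mul]

lemma edge_int {A B s e b z : ℝ} (hs : s = 1 ∨ s = -1) (h1 : A ≤ e - |b|) (h2 : e + |b| ≤ B) :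
    b * |z - e| - b ^ 2 ≤ ∫ τ in Ioc A B, edgeF s e b τ * |z - τ| := by
  have hb := abs_nonneg b
  have hb1 := le_abs_self b
  have hb2 := neg_abs_le b
  have e0 : ∫ τ in Ioc A B, edgeF s e b τ * |z - τ| =
      (∫ τ in Ioc A B, (if 0 < s * (τ - e) + b then (1:ℝ) else 0) * |z - τ|) -
      ∫ τ in Ioc A B, (if 0 < s * (τ - e) + 0 then (1:ℝ) else 0) * |z - τ| := by
    rw [← integral_sub (step_on s e b z A B) (step_on s e 0 z A B)]
    refine integral_congr_ae (ae_of_all _ fun τ => ?_)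
    simp [edgeF, sub_mul]
  have hii : ∀ p q : ℝ, IntervalIntegrable (fun τ => |z - τ|) volume p q := fun p q =>
    (by fun_prop : Continuous fun τ : ℝ => |z - τ|).intervalIntegrable _ _
  have key : ∀ p q : ℝ, (q - p) * |z - e| - (q - p) ^ 2 ≤ ∫ τ in p..q, |z - τ| ∨ (p ≠ e ∧ q ≠ e) := by
    intro p q
    by_cases hp : p ≠ e ∧ q ≠ e
    · exact Or.inr hp
    left
    have h3 : ‖∫ τ in p..q, (|z - τ| - |z - e|)‖ ≤ |q - p| * |q - p| := by
      refine intervalIntegral.norm_integral_le_of_norm_le_const fun τ hτ => ?_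
      have hτ' := uIoc_subset_uIcc hτ
      rw [Real.norm_eq_abs]
      refine (abs_abs_sub_abs_le _ _).trans ?_
      rw [show z - τ - (z - e) = -(τ - e) by ring, abs_neg]
      have : p = e ∨ q = e := by tauto
      rcases this with rfl | rfl
      · exact abs_sub_left_of_mem_uIcc hτ'
      · rw [abs_sub_comm τ]; exact abs_sub_right_of_mem_uIcc hτ'
    rw [intervalIntegral.integral_sub (hii _ _) (by simp), intervalIntegral.integral_const,
      Real.norm_eq_abs, abs_mul_abs_self, smul_eq_mul] at h3
    have := (abs_le.1 h3).1
    nlinarith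
  rw [e0]
  rcases hs with rfl | rfl
  · have c1 : ∀ b τ : ℝ, (0 < 1 * (τ - e) + b) ↔ (e - b < τ) := fun b τ => by
      constructor <;> intro h <;> linarith
    simp only [c1]
    rw [step_int (by linarith) (by linarith), step_int (by linarith) (by linarith), sub_zero]
    rw [← intervalIntegral.integral_add_adjacent_intervals (hii (e - b) e) (hii e B), add_sub_cancel_right]
    rcases key (e - b) e with h | h
    · convert h using 2 <;> ring
    · exact absurd rfl h.2
  · have c1 : ∀ b τ : ℝ, (0 < (-1) * (τ - e) + b) ↔ (τ < e + b) := fun b τ => by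
      constructor <;> intro h <;> linarith
    simp only [c1]
    rw [step_int' (by linarith) (by linarith), step_int' (by linarith) (by linarith), add_zero]
    rw [← intervalIntegral.integral_add_adjacent_intervals (hii A e) (hii e (e + b)), add_sub_cancel_left]
    rcases key e (e + b) with h | h
    · convert h using 2 <;> ring
    · exact absurd rfl h.1

lemma edge_zero {s e b τ : ℝ} (hs : s = 1 ∨ s = -1) (h : |b| < |τ - e|) : edgeF s e b τ = 0 := by
  have hb1 := le_abs_self b
  have hb2 := neg_abs_le b
  unfold edgeF
  rcases hs with rfl | rfl <;> rcases abs_cases (τ - e) with ⟨h1, h2⟩ | ⟨h1, h2⟩ <;>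
    split_ifs <;> first | (exfalso; linarith) | simp

/-- local estimate at an edge -/
lemma edge_local {ψ : ℝ → ℝ} {ψε : ℝ → ℝ → ℝ} {a e c α η δ s : ℝ} (hd : HasDerivAt ψ a e) (ha : a ≠ 0)
    (hs : s = SignType.sign a) (he : ψ e = c) (hδ : 0 < δ)
    (hloc : ∀ δ > 0, ∀ᶠ q : ℝ × ℝ in 𝓝 ((0:ℝ), e), 0 < q.1 → ψ q.2 + q.1 * (η - δ) ≤ ψε q.1 q.2) :
    ∀ᶠ q : ℝ × ℝ in 𝓝 ((0:ℝ), e), 0 < q.1 → q.2 ≠ e →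
      ind (sup ψ c) q.2 + edgeF s e (q.1 * ((η - α) / |a| - δ)) q.2 ≤ ind (sup (ψε q.1) (c + q.1 * α)) q.2 := by
  set β := (η - α) / |a| - δ with hβ
  have ha0 : 0 < |a| := abs_pos.2 ha
  have hs1 : s * a = |a| := by rw [hs]; exact sign_mul_self a
  have hss : s * s = 1 := by
    rcases lt_or_gt_of_ne ha with h | h
    · rw [hs, sign_neg h]; simp
    · rw [hs, sign_pos h]; simp
  have hsabs : |s| = 1 := by
    have := abs_mul_abs_self s; rw [hss] at this
    nlinarith [abs_nonneg s]
  set δ1 := min (|a| / 2) (|a| * δ / (4 * (|β| + 1))) with hδ1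
  have hδ1p : 0 < δ1 := lt_min (by positivity) (by positivity)
  have hδ1a : δ1 ≤ |a| / 2 := min_le_left _ _
  have hδ1b : δ1 * (|β| + 1) ≤ |a| * δ / 4 := by
    have : δ1 ≤ |a| * δ / (4 * (|β| + 1)) := min_le_right _ _
    rw [le_div_iff₀ (by positivity)] at this
    linarith
  have h1 := (hasDerivAt_iff_isLittleO.1 hd).bound hδ1p
  have h1' : ∀ᶠ q : ℝ × ℝ in 𝓝 ((0:ℝ), e), _ := (continuousAt_snd (p := ((0:ℝ), e))).eventually h1
  filter_upwards [h1', hloc (|a| * δ / 2) (by positivity)] with q hq1 hq2 hq0 hqe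
  obtain ⟨ε, τ⟩ := q
  simp only at hq1 hq2 hq0 hqe ⊢
  have hq2 := hq2 hq0
  set x := s * (τ - e) with hx
  have hx0 : x ≠ 0 := by
    intro h; rw [hx] at h
    rcases mul_eq_zero.1 h with h' | h'
    · rw [h'] at hss; simp at hss
    · exact hqe (by linarith)
  have hax : (τ - e) * a = |a| * x := by
    rw [hx, ← hs1]; linear_combination (-(τ - e) * a) * hss
  have hxabs : |τ - e| = |x| := by rw [hx, abs_mul, hsabs, one_mul]
  rw [Real.norm_eq_abs, Real.norm_eq_abs, smul_eq_mul, hax, he, hxabs] at hq1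
  have hq1' := abs_le.1 hq1
  have hV : ind (sup ψ c) τ = if 0 < x then 1 else 0 := by
    split_ifs with h
    · rw [ind_mem]; simp only [sup, mem_ofPred_eq]
      rw [abs_of_pos h] at hq1'; nlinarith [hq1'.1]
    · rw [ind_notMem]; simp only [sup, mem_ofPred_eq]
      rw [abs_of_nonpos (not_lt.1 h)] at hq1'; nlinarith [hq1'.2, not_lt.1 h]
  rw [hV, edgeF, ← hx, add_sub_cancel]
  split_ifs with h
  · rw [ind_mem]; simp only [sup, mem_ofPred_eq]
    have hβa : |a| * β = η - α - |a| * δ := by rw [hβ]; field_simp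
    have hηα : η - α = |a| * β + |a| * δ := by linarith
    have hβ1 := le_abs_self β
    have hβ2 := neg_abs_le β
    suffices hh : 0 < |a| * x - δ1 * |x| + ε * (|a| * β + |a| * δ / 2) by
      have hz : ε * (|a| * β + |a| * δ / 2) = ε * (η - |a| * δ / 2) - ε * α := by rw [← sub_eq_zero]; linear_combination (-ε) * hηα
      rw [hz] at hh
      linarith [hq1'.1]
    have hεd : 0 < ε * (|a| * δ) := by positivity
    have hk1 : ε * (δ1 * (|β| + 1)) ≤ ε * (|a| * δ / 4) := mul_le_mul_of_nonneg_left hδ1b hq0.le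
    have hk2 : 0 ≤ ε * δ1 := by positivity
    have hk3 : ε * δ1 * β ≤ ε * δ1 * |β| := mul_le_mul_of_nonneg_left hβ1 hk2
    have hk4 : ε * δ1 * (-|β|) ≤ ε * δ1 * β := mul_le_mul_of_nonneg_left hβ2 hk2
    rcases abs_cases x with ⟨h5, h6⟩ | ⟨h5, h6⟩
    · rw [h5]
      have : 0 ≤ (|a| - δ1) * (x + ε * β) := mul_nonneg (by linarith) h.le
      nlinarith
    · rw [h5]
      have : 0 ≤ (|a| + δ1) * (x + ε * β) := mul_nonneg (by linarith) h.le
      nlinarith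
  · exact ind_nonneg _ _

lemma Ain_ext {V : Set ℝ} (hV : MeasurableSet V) {t t' z : ℝ} (h : uIoc t' z ⊆ uIoc t z) :
    Ain V t' z ≤ Ain V t z := by
  rw [Ain_eq_abs, Ain_eq_abs]
  refine setIntegral_mono_set (indabs_on hV z _ _) (ae_of_all _ fun τ => ?_) (ae_of_all _ h)
  exact mul_nonneg (ind_nonneg _ _) (abs_nonneg _)

lemma exists_near {t z : ℝ} (hne : z ≠ t) {ψ : ℝ → ℝ} (hψ : Continuous ψ) {c : ℝ} (ht : ψ t < c) :
    ∃ t', (∀ τ ∈ uIcc t t', ψ τ < c) ∧ (∀ᶠ s in 𝓝 t, uIoc t' z ⊆ uIoc s z) ∧ t' ∈ uIcc t z ∧ t' ≠ t ∧ t' ≠ z := by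
  obtain ⟨d, hd, hball⟩ := Metric.eventually_nhds_iff.1 (hψ.continuousAt.eventually_lt_const ht)
  rcases lt_or_gt_of_ne hne with h | h
  · set d' := min (d / 2) ((t - z) / 2) with hd'
    have h0 : 0 < d' := lt_min (by linarith) (by linarith)
    have h1 : d' ≤ d / 2 := min_le_left _ _
    have h2 : d' ≤ (t - z) / 2 := min_le_right _ _
    refine ⟨t - d', fun τ hτ => hball ?_, ?_, ?_, by linarith, by linarith⟩
    · rw [uIcc_of_ge (by linarith)] at hτ
      rw [Real.dist_eq, abs_lt]; constructor <;> linarith [hτ.1, hτ.2]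
    · filter_upwards [lt_mem_nhds (show t - d' < t by linarith)] with s hs
      rw [uIoc_of_ge (by linarith), uIoc_of_ge (by linarith)]
      exact Ioc_subset_Ioc le_rfl hs.le
    · rw [uIcc_of_ge h.le]; constructor <;> linarith
  · set d' := min (d / 2) ((z - t) / 2) with hd'
    have h0 : 0 < d' := lt_min (by linarith) (by linarith)
    have h1 : d' ≤ d / 2 := min_le_left _ _
    have h2 : d' ≤ (z - t) / 2 := min_le_right _ _
    refine ⟨t + d', fun τ hτ => hball ?_, ?_, ?_, by linarith, by linarith⟩
    · rw [uIcc_of_le (by linarith)] at hτ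
      rw [Real.dist_eq, abs_lt]; constructor <;> linarith [hτ.1, hτ.2]
    · filter_upwards [gt_mem_nhds (show t < t + d' by linarith)] with s hs
      rw [uIoc_of_le (by linarith), uIoc_of_le (by linarith)]
      exact Ioc_subset_Ioc hs.le le_rfl
    · rw [uIcc_of_le h.le]; constructor <;> linarith

lemma perturb {k : ℝ} {r : ℝ} {ψ dψ : ℝ → ℝ}
    (h : Adm r ψ) {c t z : ℝ} {Z : Finset ℝ} (hreg : RegLevel ψ dψ c) (hD : Dan k ψ t c z Z)
    {ψε : ℝ → ℝ → ℝ} (hcont : ∀ ε, Continuous (ψε ε)) {C : ℝ}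
    (hglob : ∀ᶠ ε in 𝓝 (0:ℝ), 0 < ε → ∀ τ, ψ τ - C * ε ≤ ψε ε τ) {η : ℝ → ℝ} {ν α : ℝ}
    (hloc : ∀ e ∈ Z, ∀ δ > 0, ∀ᶠ q : ℝ × ℝ in 𝓝 ((0:ℝ), e), 0 < q.1 → ψ q.2 + q.1 * (η e - δ) ≤ ψε q.1 q.2)
    (hα : 0 < k * (z - t) * ν + ∑ e ∈ Z, |z - e| * ((η e - α) / |dψ e|)) :
    ∀ᶠ ε in 𝓝[>] (0:ℝ), t + ε * ν ∈ Bal k (sup (ψε ε) (c + ε * α)) := by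
  obtain ⟨t', ht1, ht2, ht3, ht4, ht5⟩ := exists_near hD.ne h.cont hD.lt_t
  set m := k * (z - t) * ν + ∑ e ∈ Z, |z - e| * ((η e - α) / |dψ e|) with hm
  set S := ∑ e ∈ Z, |z - e| with hS
  have hS0 : 0 ≤ S := Finset.sum_nonneg fun _ _ => abs_nonneg _
  set δ := m / (2 * (S + 1)) with hδ
  have hδ0 : 0 < δ := by positivity
  have hδS : δ * S ≤ m / 2 := by
    rw [hδ, div_mul_eq_mul_div, div_le_div_iff₀ (by positivity) (by positivity)]; nlinarith
  set β : ℝ → ℝ := fun e => (η e - α) / |dψ e| - δ with hβ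
  set s : ℝ → ℝ := fun e => (SignType.sign (dψ e) : ℝ) with hs
  have hV : ∀ c, MeasurableSet (sup ψ c) := fun c => (h.isOpen c).measurableSet
  have hVε : ∀ ε c, MeasurableSet (sup (ψε ε) c) := fun ε c =>
    (isOpen_lt continuous_const (hcont ε)).measurableSet
  have hs1 : ∀ e ∈ Z, s e = 1 ∨ s e = -1 := fun e he => by
    obtain ⟨-, hne⟩ := hreg e ((hD.memZ e).1 he).2
    rcases lt_or_gt_of_ne hne with h | h
    · right; simp only [hs]; rw [sign_neg h]; simp
    · left; simp only [hs]; rw [sign_pos h]; simp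
  -- edges lie strictly between t' and z
  have hZin : ∀ e ∈ Z, e ∈ uIoo t' z := fun e he => by
    obtain ⟨he1, he2⟩ := (hD.memZ e).1 he
    have hne : e ∉ uIcc t t' := fun hh => by have := ht1 e hh; linarith
    rcases lt_or_gt_of_ne hD.ne with h1 | h1
    · rw [uIcc_of_ge h1.le] at ht3
      have ht3' : z < t' := lt_of_le_of_ne ht3.1 (Ne.symm ht5)
      rw [uIoo_of_gt h1] at he1; rw [uIoo_of_gt ht3']
      rw [uIcc_of_ge ht3.2] at hne
      refine ⟨he1.1, ?_⟩
      by_contra! hh; exact hne ⟨hh, he1.2.le⟩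
    · rw [uIcc_of_le h1.le] at ht3
      have ht3' : t' < z := lt_of_le_of_ne ht3.2 ht5
      rw [uIoo_of_lt h1] at he1; rw [uIoo_of_lt ht3']
      rw [uIcc_of_le ht3.1] at hne
      refine ⟨?_, he1.2⟩
      by_contra! hh; exact hne ⟨he1.1.le, hh⟩
  have hAin : Ain (sup ψ c) t' z = Ain (sup ψ c) t z := by
    have h0 : ∀ x y, (∀ τ ∈ uIoc x y, ψ τ < c) → mass (sup ψ c) x y = 0 ∧ Ain (sup ψ c) x y = 0 := by
      intro x y hxy
      have h1 : ∀ τ ∈ uIoc x y, ind (sup ψ c) τ = 0 := fun τ hτ => ind_notMem (by exact not_lt.2 (hxy τ hτ).le)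
      constructor
      · unfold mass
        rw [intervalIntegral.integral_congr_ae (g := fun _ => 0) (ae_of_all _ fun τ hτ => h1 τ hτ)]; simp
      · unfold Ain
        rw [intervalIntegral.integral_congr_ae (g := fun _ => 0) (ae_of_all _ fun τ hτ => by simp [h1 τ hτ])]; simp
    obtain ⟨h2, h3⟩ := h0 t t' fun τ hτ => ht1 τ (uIoc_subset_uIcc hτ)
    have := Ain_chain (hV c) t t' z
    rw [h2, h3] at this; linarith
  have hloc2 : ∀ᶠ ε in 𝓝 (0:ℝ), ∀ τ ∈ uIcc t' z, 0 < ε → τ ∉ Z →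
      ind (sup ψ c) τ + ∑ e ∈ Z, edgeF (s e) e (ε * β e) τ ≤ ind (sup (ψε ε) (c + ε * α)) τ := by
    refine isCompact_uIcc.eventually_forall_of_forall_eventually fun τ0 hτ0 => ?_
    -- other edges vanish
    have hoth : ∀ᶠ q : ℝ × ℝ in 𝓝 ((0:ℝ), τ0), ∀ e ∈ Z, e ≠ τ0 → edgeF (s e) e (q.1 * β e) q.2 = 0 := by
      rw [Finset.eventually_all]
      intro e he
      by_cases hne : e = τ0
      · exact Eventually.of_forall fun _ h => absurd hne h
      have hc1 : ContinuousAt (fun q : ℝ × ℝ => |q.1 * β e| - |q.2 - e|) ((0:ℝ), τ0) := by fun_prop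
      have hneg : |(0:ℝ) * β e| - |τ0 - e| < 0 := by
        rw [zero_mul, abs_zero, zero_sub, neg_neg_iff_pos]
        exact abs_pos.2 (sub_ne_zero.2 (Ne.symm hne))
      filter_upwards [hc1.eventually_lt_const hneg] with q hq _
      exact edge_zero (hs1 e he) (by linarith)
    by_cases hmem : τ0 ∈ Z
    · obtain ⟨hd, hne⟩ := hreg τ0 ((hD.memZ τ0).1 hmem).2
      filter_upwards [hoth, edge_local (α := α) (δ := δ) (s := s τ0) hd hne rfl ((hD.memZ τ0).1 hmem).2 hδ0
        (hloc τ0 hmem)] with q hq1 hq2 hq0 hqZ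
      rw [Finset.sum_eq_single τ0 (fun e he hne => hq1 e he hne) (fun h => absurd hmem h)]
      exact hq2 hq0 (fun h => hqZ (h ▸ hmem))
    · have hne : ψ τ0 ≠ c := fun hh => by
        by_cases hz : τ0 = z
        · rw [hz] at hh; linarith [hD.lt_z]
        by_cases ht : τ0 = t'
        · have := ht1 t' right_mem_uIcc; rw [ht] at hh; linarith
        refine hmem ((hD.memZ τ0).2 ⟨?_, hh⟩)
        have h5 : τ0 ∈ uIcc t z := uIcc_subset_uIcc ht3 right_mem_uIcc hτ0
        have ht' : τ0 ≠ t := by rintro rfl; linarith [hD.lt_t]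
        refine ⟨lt_of_le_of_ne h5.1 fun h' => ?_, lt_of_le_of_ne h5.2 fun h' => ?_⟩
        · rcases min_choice t z with h'' | h'' <;> rw [h''] at h' <;> [exact ht' h'.symm; exact hz h'.symm]
        · rcases max_choice t z with h'' | h'' <;> rw [h''] at h' <;> [exact ht' h'; exact hz h']
      have hsum : ∀ᶠ q : ℝ × ℝ in 𝓝 ((0:ℝ), τ0), ∑ e ∈ Z, edgeF (s e) e (q.1 * β e) q.2 = 0 := by
        filter_upwards [hoth] with q hq
        exact Finset.sum_eq_zero fun e he => hq e he (by rintro rfl; exact hmem he)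
      have hψc := h.cont
      rcases lt_or_gt_of_ne hne with h1 | h1
      · have hc1 : ContinuousAt (fun q : ℝ × ℝ => ψ q.2) ((0:ℝ), τ0) := by fun_prop
        filter_upwards [hsum, hc1.eventually_lt_const h1] with q hq1 hq2 hq0 _
        rw [hq1, ind_notMem (by exact not_lt.2 hq2.le), zero_add]
        exact ind_nonneg _ _
      · have hc1 : ContinuousAt (fun q : ℝ × ℝ => ψ q.2 - C * q.1 - q.1 * α) ((0:ℝ), τ0) := by fun_prop
        have hg' := (continuousAt_fst (p := ((0:ℝ), τ0))).eventually hglob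
        filter_upwards [hsum, hg', hc1.eventually_const_lt (show c < ψ τ0 - C * 0 - 0 * α by simpa using h1)]
          with q hq1 hq2 hq3 hq0 _
        rw [hq1, add_zero, ind_mem (V := sup (ψε q.1) _)]
        · exact ind_le_one _ _
        · have := hq2 hq0 q.2
          simp only [sup, mem_ofPred_eq]; linarith
  have hsmall : ∀ᶠ ε in 𝓝 (0:ℝ), ∀ e ∈ Z, min t' z ≤ e - |ε * β e| ∧ e + |ε * β e| ≤ max t' z := by
    rw [Finset.eventually_all]
    intro e he
    have h1 := hZin e he
    have hc1 : ContinuousAt (fun ε : ℝ => e - |ε * β e|) 0 := by fun_prop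
    have hc2 : ContinuousAt (fun ε : ℝ => e + |ε * β e|) 0 := by fun_prop
    filter_upwards [hc1.eventually_const_lt (show min t' z < _ by simpa using h1.1),
      hc2.eventually_lt_const (show _ < max t' z by simpa using h1.2)] with ε h2 h3
    exact ⟨h2.le, h3.le⟩
  have htε : ∀ᶠ ε in 𝓝 (0:ℝ), uIoc t' z ⊆ uIoc (t + ε * ν) z := by
    have hc1 : Tendsto (fun ε : ℝ => t + ε * ν) (𝓝 0) (𝓝 t) := by
      have : Continuous (fun ε : ℝ => t + ε * ν) := by fun_prop
      simpa using this.tendsto 0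
    exact hc1.eventually ht2
  set T := ∑ e ∈ Z, β e ^ 2 with hT
  have hquad : ∀ᶠ ε in 𝓝 (0:ℝ), ε * (T + k * ν ^ 2 / 2) < m / 2 := by
    have hc1 : ContinuousAt (fun ε : ℝ => ε * (T + k * ν ^ 2 / 2)) 0 := by fun_prop
    exact hc1.eventually_lt_const (by simpa using hα)
  rw [eventually_nhdsWithin_iff]
  filter_upwards [hloc2, hsmall, htε, hquad] with ε e1 e2 e3 e4 hε
  have hε : 0 < ε := hε
  refine ⟨z, ?_⟩
  have hI : Ain (sup ψ c) t z + ∑ e ∈ Z, (ε * β e * |z - e| - (ε * β e) ^ 2)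
      ≤ Ain (sup (ψε ε) (c + ε * α)) t' z := by
    rw [← hAin, Ain_eq_abs, Ain_eq_abs]
    have hsub : ∑ e ∈ Z, (ε * β e * |z - e| - (ε * β e) ^ 2) ≤
        ∑ e ∈ Z, ∫ τ in uIoc t' z, edgeF (s e) e (ε * β e) τ * |z - τ| :=
      Finset.sum_le_sum fun e he => edge_int (hs1 e he) (e2 e he).1 (e2 e he).2
    have hIntg : ∀ e ∈ Z, IntegrableOn (fun τ => edgeF (s e) e (ε * β e) τ * |z - τ|) (uIoc t' z) :=
      fun e _ => edge_on _ _ _ _ _ _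
    rw [← integral_finsetSum _ hIntg] at hsub
    refine (add_le_add le_rfl hsub).trans ?_
    rw [← integral_add (indabs_on (hV c) z _ _) (integrable_finsetSum _ hIntg)]
    refine setIntegral_mono_ae_restrict ((indabs_on (hV c) z _ _).add (integrable_finsetSum _ hIntg))
      (indabs_on (hVε _ _) z _ _) ?_
    have hnull : ∀ᵐ τ ∂(volume.restrict (uIoc t' z)), τ ∉ (Z : Set ℝ) :=
      ae_restrict_of_ae (measure_eq_zero_iff_ae_notMem.1 (Z.finite_toSet.measure_zero volume))
    filter_upwards [hnull, ae_restrict_mem measurableSet_uIoc] with τ h1 h2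
    have := e1 τ (uIoc_subset_uIcc h2) hε (by simpa using h1)
    simp only [Pi.add_apply, ← Finset.sum_mul, ← add_mul]
    exact mul_le_mul_of_nonneg_right this (abs_nonneg _)
  refine lt_of_lt_of_le ?_ (Ain_ext (hVε _ _) e3)
  refine lt_of_lt_of_le ?_ hI
  rw [hD.ain]
  have e5 : ∑ e ∈ Z, (ε * β e * |z - e| - (ε * β e) ^ 2) =
      ε * (∑ e ∈ Z, |z - e| * ((η e - α) / |dψ e|)) - ε * (δ * S) - ε ^ 2 * T := by
    rw [hS, hT, Finset.mul_sum, Finset.mul_sum, Finset.mul_sum, Finset.mul_sum, ← Finset.sum_sub_distrib,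
      ← Finset.sum_sub_distrib]
    refine Finset.sum_congr rfl fun e _ => ?_
    simp only [hβ]; ring
  rw [e5]
  have e6 : ∑ e ∈ Z, |z - e| * ((η e - α) / |dψ e|) = m - k * (z - t) * ν := by rw [hm]; ring
  rw [e6]
  have e7 : ε * (ε * (T + k * ν ^ 2 / 2)) < ε * (m / 2) := mul_lt_mul_of_pos_left e4 hε
  have e8 : ε * (δ * S) ≤ ε * (m / 2) := mul_le_mul_of_nonneg_left hδS hε.le
  nlinarith

end LS
end

noncomputable section
namespace LS

open Filter Topology

/-! ### Part 3: rearrangement on the Euclidean space -/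
abbrev Eu (N : ℕ) := EuclideanSpace ℝ (Fin N)

variable {N : ℕ}

def lin (e x : Eu N) (t : ℝ) : Eu N := x + (t - ⟪e, x⟫) • e

def psi (k : ℝ) (e : Eu N) (W : Eu N → ℝ) (x : Eu N) (τ : ℝ) : ℝ := W (lin e x (τ / k))

def RR (k : ℝ) (e : Eu N) (W : Eu N → ℝ) (x : Eu N) : ℝ := BalF k (psi k e W x) ⟪e, x⟫

structure WC (ρ : ℝ) (W : Eu N → ℝ) : Prop where
  cont : Continuous W
  nonneg : ∀ x, 0 ≤ W x
  supp : ∀ x, 0 < W x → ‖x‖ < ρ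

lemma inner_ee {e : Eu N} (he : ‖e‖ = 1) : ⟪e, e⟫ = 1 := by
  rw [real_inner_self_eq_norm_sq, he]; norm_num

lemma inner_lin {e : Eu N} (he : ‖e‖ = 1) (x : Eu N) (t : ℝ) : ⟪e, lin e x t⟫ = t := by
  simp only [lin, inner_add_right, inner_smul_right, inner_ee he]; ring

lemma lin_lin {e : Eu N} (he : ‖e‖ = 1) (x : Eu N) (t s : ℝ) : lin e (lin e x t) s = lin e x s := by
  simp only [lin, inner_add_right, inner_smul_right, inner_ee he]
  module

lemma lin_self (e x : Eu N) : lin e x ⟪e, x⟫ = x := by simp [lin]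

lemma lin_norm {e : Eu N} (he : ‖e‖ = 1) (x : Eu N) (t : ℝ) :
    ‖lin e x t‖ ^ 2 = ‖x‖ ^ 2 - ⟪e, x⟫ ^ 2 + t ^ 2 := by
  rw [← real_inner_self_eq_norm_sq, ← real_inner_self_eq_norm_sq]
  simp only [lin, inner_add_right, inner_add_left, inner_smul_right, inner_smul_left, inner_ee he,
    real_inner_comm e x, conj_trivial]
  ring

lemma abs_inner_le {e : Eu N} (he : ‖e‖ = 1) (x : Eu N) : |⟪e, x⟫| ≤ ‖x‖ := by
  have := abs_real_inner_le_norm e x; rwa [he, one_mul] at this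

lemma abs_le_lin {e : Eu N} (he : ‖e‖ = 1) (x : Eu N) (t : ℝ) : |t| ≤ ‖lin e x t‖ := by
  have := abs_inner_le he (lin e x t); rwa [inner_lin he] at this

lemma continuous_lin (e : Eu N) : Continuous fun p : Eu N × ℝ => lin e p.1 p.2 := by
  unfold lin; fun_prop

lemma psi_adm {k : ℝ} (hk : 0 < k) (hk1 : k < 1) {e : Eu N} (he : ‖e‖ = 1) {ρ : ℝ} (hρ : 0 < ρ)
    {W : Eu N → ℝ} (h : WC ρ W) (x : Eu N) : Adm ρ (psi k e W x) where
  cont := by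
    have := (continuous_lin e).comp (by fun_prop : Continuous fun τ : ℝ => (x, τ / k))
    exact h.cont.comp this
  nonneg t := h.nonneg _
  supp t ht := by
    by_contra hne
    have h1 := h.supp _ (lt_of_le_of_ne (h.nonneg _) (Ne.symm hne))
    have h2 := abs_le_lin he x (t / k)
    have h3 : |t| < k * ρ := by
      rw [abs_div, abs_of_pos hk] at h2
      have := h2.trans_lt h1
      rwa [div_lt_iff₀ hk, mul_comm] at this
    have h4 : |t| ≤ ρ := by nlinarith
    exact ht (abs_le.1 h4)

lemma RR_nonneg {k : ℝ} (hk : 0 < k) (hk1 : k < 1) {e : Eu N} (he : ‖e‖ = 1) {ρ : ℝ} (hρ : 0 < ρ)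
    {W : Eu N → ℝ} (h : WC ρ W) (x : Eu N) : 0 ≤ RR k e W x := BalF_nonneg hk (psi_adm hk hk1 he hρ h x) _

lemma psi_lin {k : ℝ} {e : Eu N} (he : ‖e‖ = 1) (W : Eu N → ℝ) (x : Eu N) (t : ℝ) :
    psi k e W (lin e x t) = psi k e W x := by
  funext τ; simp only [psi, lin_lin he]

lemma RR_lin {k : ℝ} {e : Eu N} (he : ‖e‖ = 1) (W : Eu N → ℝ) (x : Eu N) (t : ℝ) :
    RR k e W (lin e x t) = BalF k (psi k e W x) t := by
  rw [RR, psi_lin he, inner_lin he]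

lemma lt_RR {k : ℝ} (hk : 0 < k) (hk1 : k < 1) {e : Eu N} (he : ‖e‖ = 1) {ρ : ℝ} (hρ : 0 < ρ)
    {W : Eu N → ℝ} (h : WC ρ W) (x : Eu N) {c : ℝ} (hc : 0 ≤ c) :
    c < RR k e W x ↔ ⟪e, x⟫ ∈ Bal k (sup (psi k e W x) c) := lt_BalF hk (psi_adm hk hk1 he hρ h x) _ hc

lemma RR_contr {k : ℝ} (hk : 0 < k) (hk1 : k < 1) {e : Eu N} (he : ‖e‖ = 1) {ρ ρ' : ℝ} (hρ : 0 < ρ)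
    (hρ' : 0 < ρ') {W W' : Eu N → ℝ} (h : WC ρ W) (h' : WC ρ' W') {d : ℝ} (hd : 0 ≤ d)
    (hle : ∀ x, W x ≤ W' x + d) (x : Eu N) : RR k e W x ≤ RR k e W' x + d :=
  BalF_contr hk (psi_adm hk hk1 he hρ h x) (psi_adm hk hk1 he hρ' h' x) hd (fun _ => hle _) _

lemma RR_mod {k : ℝ} (hk : 0 < k) (hk1 : k < 1) {e : Eu N} (he : ‖e‖ = 1) {ρ : ℝ} (hρ : 0 < ρ)
    {W : Eu N → ℝ} (h : WC ρ W) {D : ℝ} (hD : 0 ≤ D) (x y : Eu N)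
    (hmod : ∀ p q, ‖p - q‖ ≤ ‖x - y‖ / k → W p ≤ W q + D) : RR k e W x ≤ RR k e W y + D := by
  set a := ⟪e, x⟫ - ⟪e, y⟫ with ha
  have e1 : RR k e W x = BalF k (fun t => psi k e W x (t + a)) ⟪e, y⟫ := by
    rw [BalF_trans, RR]; congr 1; rw [ha]; ring
  have hadm : Adm (ρ + |a|) (fun t => psi k e W x (t + a)) := by
    have h1 := psi_adm hk hk1 he hρ h x
    refine ⟨h1.cont.comp (by fun_prop), fun t => h1.nonneg _, fun t ht => h1.supp _ fun h2 => ht ?_⟩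
    constructor <;> linarith [h2.1, h2.2, le_abs_self a, neg_abs_le a]
  rw [e1, RR]
  refine BalF_contr hk hadm (psi_adm hk hk1 he hρ h y) hD (fun t => hmod _ _ ?_) _
  have e2 : lin e x ((t + a) / k) - lin e y (t / k) = (x - y) + (a / k - a) • e := by
    simp only [lin, ha, add_div]; module
  rw [e2]
  refine (norm_add_le _ _).trans ?_
  rw [norm_smul, he, mul_one, Real.norm_eq_abs]
  have h4 : |a| ≤ ‖x - y‖ := by
    have := abs_inner_le he (x - y); rwa [inner_sub_right] at this
  have h5 : a / k - a = a * ((1 - k) / k) := by field_simp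
  rw [h5, abs_mul, abs_of_nonneg (div_nonneg (by linarith) hk.le : 0 ≤ (1 - k) / k)]
  have h6 : |a| * ((1 - k) / k) ≤ ‖x - y‖ * ((1 - k) / k) :=
    mul_le_mul_of_nonneg_right h4 (div_nonneg (by linarith) hk.le)
  have h7 : ‖x - y‖ / k = ‖x - y‖ + ‖x - y‖ * ((1 - k) / k) := by field_simp; ring
  linarith

lemma RR_lip {k : ℝ} (hk : 0 < k) (hk1 : k < 1) {e : Eu N} (he : ‖e‖ = 1) {ρ : ℝ} (hρ : 0 < ρ)
    {W : Eu N → ℝ} (h : WC ρ W) {L : ℝ} (hL : 0 ≤ L) (hlip : ∀ x y, |W x - W y| ≤ L * ‖x - y‖)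
    (x y : Eu N) : |RR k e W x - RR k e W y| ≤ L / k * ‖x - y‖ := by
  have key : ∀ x y, RR k e W x ≤ RR k e W y + L / k * ‖x - y‖ := by
    intro x y
    refine RR_mod hk hk1 he hρ h (by positivity) x y fun p q hpq => ?_
    have h2 := (abs_le.1 (hlip p q)).2
    have h4 : L * ‖p - q‖ ≤ L / k * ‖x - y‖ := by
      rw [div_mul_eq_mul_div, mul_div_assoc]; exact mul_le_mul_of_nonneg_left hpq hL
    linarith
  rw [abs_le]; constructor
  · have := key y x; rw [norm_sub_rev] at this; linarith
  · have := key x y; linarith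

lemma WC.compact {ρ : ℝ} {W : Eu N → ℝ} (h : WC ρ W) : HasCompactSupport W := by
  refine HasCompactSupport.intro (isCompact_closedBall (0 : Eu N) ρ) fun x hx => ?_
  by_contra hne
  have := h.supp x (lt_of_le_of_ne (h.nonneg x) (Ne.symm hne))
  exact hx (by simpa using this.le)

lemma RR_cont {k : ℝ} (hk : 0 < k) (hk1 : k < 1) {e : Eu N} (he : ‖e‖ = 1) {ρ : ℝ} (hρ : 0 < ρ)
    {W : Eu N → ℝ} (h : WC ρ W) : Continuous (RR k e W) := by
  have hu := h.compact.uniformContinuous_of_continuous h.cont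
  rw [Metric.uniformContinuous_iff] at hu
  refine (Metric.uniformContinuous_iff.2 fun ε hε => ?_).continuous
  obtain ⟨δ, hδ, H⟩ := hu (ε / 2) (by positivity)
  refine ⟨k * δ / 2, by positivity, fun {x y} hxy => ?_⟩
  have key : ∀ x y, dist x y < k * δ / 2 → RR k e W x ≤ RR k e W y + ε / 2 := by
    intro x y hxy
    refine RR_mod hk hk1 he hρ h (by positivity) x y fun p q hpq => ?_
    have h1 : dist p q < δ := by
      rw [dist_eq_norm] at hxy ⊢
      refine hpq.trans_lt ?_
      rw [div_lt_iff₀ hk]; nlinarith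
    have := H h1
    rw [Real.dist_eq] at this
    linarith [(abs_lt.1 this).2]
  have h1 := key x y hxy
  have h2 := key y x (by rwa [dist_comm])
  rw [Real.dist_eq, abs_lt]; constructor <;> linarith

lemma RR_WC {k : ℝ} (hk : 0 < k) (hk1 : k < 1) {e : Eu N} (he : ‖e‖ = 1) {ρ : ℝ} (hρ : 0 < ρ)
    {W : Eu N → ℝ} (h : WC ρ W) (hsupp : ∀ x, 0 < RR k e W x → ‖x‖ < ρ) : WC ρ (RR k e W) :=
  ⟨RR_cont hk hk1 he hρ h, RR_nonneg hk hk1 he hρ h, hsupp⟩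

lemma RR_supp {k : ℝ} (hk : 0 < k) (hk1 : k < 1) {e : Eu N} (he : ‖e‖ = 1) {ρ : ℝ} (hρ : 0 < ρ)
    {W : Eu N → ℝ} (h : WC ρ W) (x : Eu N) (hx : 0 < RR k e W x) : ‖x‖ < ρ := by
  set q := ‖x‖ ^ 2 - ⟪e, x⟫ ^ 2 with hq
  have h1 : ∀ t, 0 < psi k e W x t → t ∈ Ioo (-(k * √(ρ ^ 2 - q))) (k * √(ρ ^ 2 - q)) := by
    intro t ht
    have h2 := h.supp _ ht
    have h3 := lin_norm he x (t / k)
    have h4 : (t / k) ^ 2 < ρ ^ 2 - q := by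
      have : ‖lin e x (t / k)‖ ^ 2 < ρ ^ 2 := by gcongr
      rw [hq]; linarith
    have h5 : |t / k| < √(ρ ^ 2 - q) := by rw [Real.lt_sqrt (abs_nonneg _), sq_abs]; exact h4
    rw [abs_div, abs_of_pos hk, div_lt_iff₀ hk, mul_comm] at h5
    exact abs_lt.1 h5
  have h2 := BalF_pos_mem hk hk1 (psi_adm hk hk1 he hρ h x) (Real.sqrt_nonneg _) h1 hx
  have h3 := abs_lt.2 h2
  rw [Real.lt_sqrt (abs_nonneg _), sq_abs] at h3
  have : ‖x‖ ^ 2 < ρ ^ 2 := by rw [hq] at h3; linarith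
  exact lt_of_pow_lt_pow_left₀ 2 hρ.le this

lemma RR_near {k : ℝ} (hk : 1 / 2 ≤ k) (hk1 : k < 1) {e : Eu N} (he : ‖e‖ = 1) {ρ : ℝ} (hρ : 0 < ρ)
    {W : Eu N → ℝ} (h : WC ρ W) {L : ℝ} (hL : 0 ≤ L) (hlip : ∀ x y, |W x - W y| ≤ L * ‖x - y‖)
    (x : Eu N) : |RR k e W x - W x| ≤ 10 * L * ρ * (1 - k) := by
  have hk0 : 0 < k := by linarith
  have hadm := psi_adm hk0 hk1 he hρ h x
  have hB : 0 ≤ 10 * L * ρ * (1 - k) := by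
    have : 0 ≤ 1 - k := by linarith
    positivity
  have hR0 := RR_nonneg hk0 hk1 he hρ h x
  by_cases hx : ‖x‖ < ρ
  · set t := ⟪e, x⟫ with ht
    have htρ : |t| ≤ ρ := (abs_inner_le he x).trans hx.le
    have hpsi : ∀ τ, |psi k e W x τ - W x| ≤ L * |τ / k - t| := fun τ => by
      have := hlip (lin e x (τ / k)) x
      simp only [psi]
      refine this.trans_eq ?_
      rw [lin, add_sub_cancel_left, norm_smul, he, mul_one, Real.norm_eq_abs]
    have hinv : 1 / k - 1 ≤ 2 * (1 - k) := by
      rw [div_sub_one hk0.ne', div_le_iff₀ hk0]; nlinarith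
    have hinv0 : 0 ≤ 1 / k - 1 := by rw [div_sub_one hk0.ne']; exact div_nonneg (by linarith) hk0.le
    have ht2 : |t / k - t| ≤ 2 * ρ * (1 - k) := by
      have : t / k - t = t * (1 / k - 1) := by ring
      rw [this, abs_mul, abs_of_nonneg hinv0]
      calc |t| * (1 / k - 1) ≤ ρ * (2 * (1 - k)) := by gcongr
        _ = _ := by ring
    rw [abs_le]; constructor
    · have h1 := le_BalF hk0 hk1 hadm t
      have h2 := (abs_le.1 (hpsi t)).1
      have h3 : L * |t / k - t| ≤ L * (2 * ρ * (1 - k)) := mul_le_mul_of_nonneg_left ht2 hL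
      have h4 : RR k e W x = BalF k (psi k e W x) t := rfl
      have h5 : 0 ≤ L * ρ * (1 - k) := by
        have : 0 ≤ 1 - k := by linarith
        positivity
      rw [h4]; nlinarith
    · set d := 4 * ρ * (1 - k) with hd
      have hd0 : 0 < d := by have : 0 < 1 - k := by linarith
                             positivity
      have hM : ∀ τ ∈ Ioo (t - d) (t + d), psi k e W x τ ≤ W x + 10 * L * ρ * (1 - k) := by
        intro τ hτ
        have h2 := (abs_le.1 (hpsi τ)).2
        have h3 : |τ / k - t| ≤ 10 * ρ * (1 - k) := by
          have e1 : τ / k - t = (τ - t) / k + (t / k - t) := by ring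
          have h4 : |(τ - t) / k| ≤ 8 * ρ * (1 - k) := by
            rw [abs_div, abs_of_pos hk0, div_le_iff₀ hk0]
            have : |τ - t| ≤ d := abs_le.2 ⟨by linarith [hτ.1], by linarith [hτ.2]⟩
            have h5 : 0 ≤ ρ * (1 - k) := by
              have : 0 ≤ 1 - k := by linarith
              positivity
            nlinarith
          rw [e1]; exact (abs_add_le _ _).trans (by linarith)
        have h4 : L * |τ / k - t| ≤ L * (10 * ρ * (1 - k)) := mul_le_mul_of_nonneg_left h3 hL
        linarith
      have hkd : ρ * (1 - k) < k * d := by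
        have : 0 < ρ * (1 - k) := mul_pos hρ (by linarith)
        rw [hd]; nlinarith
      have := BalF_le_of_near hk0 hk1 hρ.le hadm hd0 hkd (add_nonneg (h.nonneg x) hB) hM
      have h4 : RR k e W x = BalF k (psi k e W x) t := rfl
      linarith
  · have h1 : RR k e W x = 0 := by
      by_contra hne
      exact hx (RR_supp hk0 hk1 he hρ h x (lt_of_le_of_ne hR0 (Ne.symm hne)))
    have h2 : W x = 0 := by
      by_contra hne
      exact hx (h.supp x (lt_of_le_of_ne (h.nonneg x) (Ne.symm hne)))
    rw [h1, h2]; simpa using hB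

lemma fubini_lin {e : Eu N} (he : ‖e‖ = 1) {F : Eu N → ENNReal} (hF : Measurable F) :
    ∫⁻ x, F x = ∫⁻ x in {x : Eu N | ⟪e, x⟫ ∈ Ioo (0:ℝ) 1}, ∫⁻ t : ℝ, F (lin e x t) := by
  have hin : Continuous fun x : Eu N => ⟪e, x⟫ := by fun_prop
  have hS : MeasurableSet {x : Eu N | ⟪e, x⟫ ∈ Ioo (0:ℝ) 1} := hin.measurable measurableSet_Ioo
  set S := {x : Eu N | ⟪e, x⟫ ∈ Ioo (0:ℝ) 1}
  have hind : Measurable (S.indicator (1 : Eu N → ENNReal)) := measurable_one.indicator hS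
  symm
  calc ∫⁻ x in S, ∫⁻ t : ℝ, F (lin e x t)
      = ∫⁻ x, S.indicator 1 x * ∫⁻ t : ℝ, F (x + t • e) := by
        rw [← lintegral_indicator hS]
        refine lintegral_congr fun x => ?_
        by_cases hx : x ∈ S
        · simp only [indicator_of_mem hx, Pi.one_apply, one_mul, lin]
          exact lintegral_sub_right_eq_self (fun t => F (x + t • e)) _
        · simp [indicator_of_notMem hx]
    _ = ∫⁻ x, ∫⁻ t : ℝ, S.indicator 1 x * F (x + t • e) := by
        refine lintegral_congr fun x => ?_
        rw [lintegral_const_mul]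
        exact hF.comp (by fun_prop)
    _ = ∫⁻ t : ℝ, ∫⁻ x, S.indicator 1 x * F (x + t • e) := by
        refine lintegral_lintegral_swap (Measurable.aemeasurable ?_)
        exact (hind.comp measurable_fst).mul (hF.comp (by fun_prop))
    _ = ∫⁻ t : ℝ, ∫⁻ x, S.indicator 1 (x - t • e) * F x := by
        refine lintegral_congr fun t => ?_
        rw [← lintegral_add_right_eq_self (fun x => S.indicator 1 (x - t • e) * F x) (t • e)]
        simp
    _ = ∫⁻ x, ∫⁻ t : ℝ, S.indicator 1 (x - t • e) * F x := by
        refine lintegral_lintegral_swap (Measurable.aemeasurable ?_)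
        exact (hind.comp (by fun_prop)).mul (hF.comp measurable_snd)
    _ = ∫⁻ x, F x := by
        refine lintegral_congr fun x => ?_
        rw [lintegral_mul_const _ (show Measurable fun t : ℝ => S.indicator (1 : Eu N → ENNReal) (x - t • e) from hind.comp (by fun_prop))]
        have : ∀ t : ℝ, S.indicator (1 : Eu N → ENNReal) (x - t • e) = (Ioo (⟪e, x⟫ - 1) ⟪e, x⟫).indicator 1 t := by
          intro t
          have : x - t • e ∈ S ↔ t ∈ Ioo (⟪e, x⟫ - 1) ⟪e, x⟫ := by
            simp only [S, mem_ofPred_eq, inner_sub_right, inner_smul_right, inner_ee he, mem_Ioo]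
            constructor <;> rintro ⟨h1, h2⟩ <;> constructor <;> linarith
          by_cases ht : t ∈ Ioo (⟪e, x⟫ - 1) ⟪e, x⟫
          · rw [indicator_of_mem ht, indicator_of_mem (this.2 ht)]; rfl
          · rw [indicator_of_notMem ht, indicator_of_notMem (fun h => ht (this.1 h))]
        simp only [this]
        rw [lintegral_indicator_one measurableSet_Ioo]
        simp

lemma vol_lin {e : Eu N} (he : ‖e‖ = 1) {A : Set (Eu N)} (hA : MeasurableSet A) :
    volume A = ∫⁻ x in {x : Eu N | ⟪e, x⟫ ∈ Ioo (0:ℝ) 1}, volume {t : ℝ | lin e x t ∈ A} := by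
  rw [← lintegral_indicator_one hA, fubini_lin he (measurable_one.indicator hA)]
  refine lintegral_congr fun x => ?_
  have hm : MeasurableSet {t : ℝ | lin e x t ∈ A} :=
    ((continuous_lin e).comp (by fun_prop : Continuous fun t : ℝ => (x, t))).measurable hA
  rw [← lintegral_indicator_one hm]
  rfl

end LS
end

noncomputable section
namespace LS

open Filter Topology

variable {N : ℕ}

lemma isOpen_sup {ρ : ℝ} {W : Eu N → ℝ} (h : WC ρ W) (c : ℝ) : IsOpen {x | c < W x} :=
  isOpen_lt continuous_const h.cont

lemma vol_scale {k : ℝ} (hk : 0 < k) (A : Set ℝ) :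
    ENNReal.ofReal k * volume {t : ℝ | k * t ∈ A} = volume A := by
  have := Real.volume_preimage_mul_left hk.ne' A
  have e1 : (fun x => k * x) ⁻¹' A = {t : ℝ | k * t ∈ A} := rfl
  rw [e1] at this
  rw [this, ← mul_assoc, ← ENNReal.ofReal_mul hk.le, abs_of_pos (inv_pos.2 hk), mul_inv_cancel₀ hk.ne']
  simp

lemma RR_vol_line {k : ℝ} (hk : 0 < k) (hk1 : k < 1) {e : Eu N} (he : ‖e‖ = 1) {ρ : ℝ} (hρ : 0 < ρ)
    {W : Eu N → ℝ} (h : WC ρ W) {c : ℝ} (hc : 0 ≤ c) (x : Eu N) :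
    volume {t : ℝ | c < RR k e W (lin e x t)} = volume {t : ℝ | c < W (lin e x t)} := by
  have h1 := BalF_vol hk hk1 hρ.le (psi_adm hk hk1 he hρ h x) hc
  have h2 := vol_scale hk (sup (psi k e W x) c)
  have e1 : {t : ℝ | k * t ∈ sup (psi k e W x) c} = {t : ℝ | c < W (lin e x t)} := by
    ext t; simp only [sup, psi, mem_ofPred_eq, mul_div_cancel_left₀ t hk.ne']
  rw [e1, ← h1] at h2
  have e2 : {t : ℝ | c < RR k e W (lin e x t)} = {t | c < BalF k (psi k e W x) t} := by
    ext t; simp only [mem_ofPred_eq, RR_lin he]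
  rw [e2]
  exact ((ENNReal.mul_right_inj (by simpa using hk) ENNReal.ofReal_ne_top).1 h2).symm

lemma RR_vol {k : ℝ} (hk : 0 < k) (hk1 : k < 1) {e : Eu N} (he : ‖e‖ = 1) {ρ : ℝ} (hρ : 0 < ρ)
    {W : Eu N → ℝ} (h : WC ρ W) {c : ℝ} (hc : 0 ≤ c) :
    volume {x | c < RR k e W x} = volume {x | c < W x} := by
  have hR := RR_WC hk hk1 he hρ h (RR_supp hk hk1 he hρ h)
  rw [vol_lin he (isOpen_sup hR c).measurableSet, vol_lin he (isOpen_sup h c).measurableSet]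
  refine lintegral_congr fun x => ?_
  exact RR_vol_line hk hk1 he hρ h hc x

lemma RR_vol_radial {k : ℝ} (hk : 0 < k) (hk1 : k < 1) {e : Eu N} (he : ‖e‖ = 1) {ρ : ℝ} (hρ : 0 < ρ)
    {W : Eu N → ℝ} (h : WC ρ W) {c : ℝ} (hc : 0 ≤ c) (r : ℝ) :
    volume ({x | c < W x} ∩ ball 0 r) ≤ volume ({x | c < RR k e W x} ∩ ball 0 r) := by
  have hR := RR_WC hk hk1 he hρ h (RR_supp hk hk1 he hρ h)
  rcases le_or_gt r 0 with hr | hr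
  · rw [ball_eq_empty.2 hr]; simp
  rw [vol_lin he ((isOpen_sup hR c).inter isOpen_ball).measurableSet,
    vol_lin he ((isOpen_sup h c).inter isOpen_ball).measurableSet]
  refine lintegral_mono fun x => ?_
  set q := ‖x‖ ^ 2 - ⟪e, x⟫ ^ 2 with hq
  have hball : ∀ t, lin e x t ∈ ball (0 : Eu N) r ↔ t ∈ Ioo (-√(r ^ 2 - q)) (√(r ^ 2 - q)) := by
    intro t
    rw [mem_ball_zero_iff, mem_Ioo, ← abs_lt, Real.lt_sqrt (abs_nonneg _), sq_abs]
    have := lin_norm he x t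
    rw [← pow_lt_pow_iff_left₀ (norm_nonneg _) hr.le two_ne_zero, this, hq]
    constructor <;> intro h <;> linarith
  have h1 := BalF_vol_radial hk hk1 (psi_adm hk hk1 he hρ h x) hc (Real.sqrt_nonneg (r ^ 2 - q))
  rw [← vol_scale hk (sup (psi k e W x) c ∩ _)] at h1
  have h2 := (ENNReal.mul_le_mul_iff_right (by simpa using hk) ENNReal.ofReal_ne_top).1 h1
  convert h2 using 2
  · ext t
    simp only [mem_ofPred_eq, mem_inter_iff, sup, psi, mul_div_cancel_left₀ t hk.ne', hball, mem_Ioo]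
    refine and_congr_right fun _ => ?_
    rw [← mul_neg, mul_lt_mul_iff_right₀ hk, mul_lt_mul_iff_right₀ hk]
  · ext t
    simp only [mem_ofPred_eq, mem_inter_iff, hball, RR_lin he]

lemma WC.integrable {ρ : ℝ} {W : Eu N → ℝ} (h : WC ρ W) : Integrable W :=
  h.cont.integrable_of_hasCompactSupport h.compact

lemma lint_eq {V W : Eu N → ℝ} (hV : Continuous V) (hW : Continuous W) (hV0 : ∀ x, 0 ≤ V x)
    (hW0 : ∀ x, 0 ≤ W x) (h : ∀ c, 0 ≤ c → volume {x | c < V x} = volume {x | c < W x}) :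
    ∫ x, V x = ∫ x, W x := by
  rw [integral_eq_lintegral_of_nonneg_ae (ae_of_all _ hV0) hV.aestronglyMeasurable,
    integral_eq_lintegral_of_nonneg_ae (ae_of_all _ hW0) hW.aestronglyMeasurable,
    lintegral_eq_lintegral_meas_lt _ (ae_of_all _ hV0) hV.aemeasurable,
    lintegral_eq_lintegral_meas_lt _ (ae_of_all _ hW0) hW.aemeasurable]
  congr 1
  refine setLIntegral_congr_fun measurableSet_Ioi fun t ht => ?_
  exact h t (le_of_lt ht)

lemma RR_int {k : ℝ} (hk : 0 < k) (hk1 : k < 1) {e : Eu N} (he : ‖e‖ = 1) {ρ : ℝ} (hρ : 0 < ρ)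
    {W : Eu N → ℝ} (h : WC ρ W) : ∫ x, RR k e W x = ∫ x, W x :=
  lint_eq (RR_cont hk hk1 he hρ h) h.cont (RR_nonneg hk hk1 he hρ h) h.nonneg
    fun _ hc => RR_vol hk hk1 he hρ h hc

/-- superlevel sets of radial antitone continuous functions are balls -/
lemma radial_ball {F : ℝ → ℝ} (hF : Continuous F) (ha : Antitone F) {R : ℝ} (s : ℝ)
    (hs : F R ≤ s) : ∃ r, {x : Eu N | s < F ‖x‖} = ball 0 r := by
  set A := {r : ℝ | s < F r} with hA
  have hAo : IsOpen A := isOpen_lt continuous_const hF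
  have hup : ∀ r ∈ A, r < R := fun r hr => by
    by_contra! h
    have := ha h
    simp only [hA, mem_ofPred_eq] at hr; linarith
  by_cases hne : A.Nonempty
  · have hbdd : BddAbove A := ⟨R, fun r hr => (hup r hr).le⟩
    have hlub := isLUB_csSup hne hbdd
    refine ⟨sSup A, ?_⟩
    ext x
    simp only [mem_ofPred_eq, mem_ball_zero_iff]
    constructor
    · intro hx
      obtain ⟨ε, hε, hb⟩ := Metric.isOpen_iff.1 hAo ‖x‖ hx
      have : ‖x‖ + ε / 2 ∈ A := hb (by rw [mem_ball, Real.dist_eq, add_sub_cancel_left, abs_of_pos] <;> linarith)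
      linarith [hlub.1 this]
    · intro hx
      obtain ⟨r, hr, hxr⟩ := exists_lt_of_lt_csSup hne hx
      exact lt_of_lt_of_le hr (ha hxr.le)
  · refine ⟨0, ?_⟩
    rw [ball_zero]
    refine eq_empty_iff_forall_notMem.2 fun x hx => hne ⟨‖x‖, hx⟩

lemma radial_int {F : ℝ → ℝ} (hF : Continuous F) (ha : Antitone F) {R : ℝ}
    {A B : Set (Eu N)} (hA : MeasurableSet A) (hB : MeasurableSet B) (hAR : A ⊆ ball 0 R) (hBR : B ⊆ ball 0 R)
    (hvol : volume A = volume B) (hrad : ∀ r, volume (A ∩ ball 0 r) ≤ volume (B ∩ ball 0 r)) :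
    ∫ x in A, F ‖x‖ ≤ ∫ x in B, F ‖x‖ := by
  have hFc : Continuous fun x : Eu N => F ‖x‖ := by fun_prop
  have hIntg : ∀ {A : Set (Eu N)}, A ⊆ ball 0 R → IntegrableOn (fun x : Eu N => F ‖x‖) A := fun h =>
    (hFc.continuousOn.integrableOn_compact (isCompact_closedBall (0:Eu N) R)).mono_set (h.trans ball_subset_closedBall)
  have hfin : ∀ {A : Set (Eu N)}, A ⊆ ball 0 R → volume A ≠ ⊤ := fun h =>
    ((measure_mono h).trans_lt measure_ball_lt_top).ne
  have hintc : ∀ {A : Set (Eu N)}, A ⊆ ball 0 R → IntegrableOn (fun _ : Eu N => F R) A := fun h =>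
    integrableOn_const (hfin h)
  suffices h : ∫ x in A, (F ‖x‖ - F R) ≤ ∫ x in B, (F ‖x‖ - F R) by
    rw [integral_sub (hIntg hAR) (hintc hAR), integral_sub (hIntg hBR) (hintc hBR)] at h
    simp only [integral_const, smul_eq_mul, measureReal_def, Measure.restrict_apply_univ, hvol] at h
    linarith
  have hnn : ∀ {A : Set (Eu N)}, MeasurableSet A → A ⊆ ball 0 R → ∀ᵐ x ∂(volume.restrict A), 0 ≤ F ‖x‖ - F R :=
    fun hA h => (ae_restrict_iff' hA).2 (ae_of_all _ fun x hx => by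
      have := ha (mem_ball_zero_iff.1 (h hx)).le; linarith)
  have hc : Continuous fun x : Eu N => F ‖x‖ - F R := by fun_prop
  have hle : ∫⁻ x in A, ENNReal.ofReal (F ‖x‖ - F R) ≤ ∫⁻ x in B, ENNReal.ofReal (F ‖x‖ - F R) := by
    rw [lintegral_eq_lintegral_meas_lt _ (hnn hA hAR) hc.aemeasurable,
      lintegral_eq_lintegral_meas_lt _ (hnn hB hBR) hc.aemeasurable]
    refine setLIntegral_mono' measurableSet_Ioi fun s hs => ?_
    have hs : 0 < s := hs
    obtain ⟨r, hr⟩ := radial_ball (N := N) (F := fun r => F r - F R) (by fun_prop)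
      (fun a b hab => by have := ha hab; simp only; linarith) (R := R) s (by simpa using hs.le)
    rw [hr, Measure.restrict_apply measurableSet_ball, Measure.restrict_apply measurableSet_ball,
      inter_comm _ A, inter_comm _ B]
    exact hrad r
  rw [integral_eq_lintegral_of_nonneg_ae (hnn hA hAR) hc.aestronglyMeasurable,
    integral_eq_lintegral_of_nonneg_ae (hnn hB hBR) hc.aestronglyMeasurable]
  refine ENNReal.toReal_mono ?_ hle
  exact ((hIntg hBR).sub (hintc hBR)).lintegral_lt_top.ne

lemma radial_double {k : ℝ} (hk : 0 < k) (hk1 : k < 1) {e : Eu N} (he : ‖e‖ = 1) {ρ : ℝ} (hρ : 0 < ρ)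
    {W : Eu N → ℝ} (h : WC ρ W) {F : ℝ → ℝ → ℝ} (hF : Continuous fun q : ℝ × ℝ => F q.1 q.2)
    (ha : ∀ c, Antitone fun r => F r c) :
    0 ≤ ∫ x, ∫ c in (W x)..(RR k e W x), F ‖x‖ c := by
  have hR := RR_WC hk hk1 he hρ h (RR_supp hk hk1 he hρ h)
  set V := RR k e W with hVdef
  have hMW : ∃ M, 0 ≤ M ∧ ∀ x, W x ≤ M ∧ V x ≤ M := by
    obtain ⟨M1, h1⟩ := h.cont.bounded_above_of_compact_support h.compact
    obtain ⟨M2, h2⟩ := hR.cont.bounded_above_of_compact_support hR.compact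
    refine ⟨max M1 M2, ?_, fun x => ⟨?_, ?_⟩⟩
    · exact (norm_nonneg _).trans ((h1 0).trans (le_max_left _ _))
    · exact (le_abs_self _).trans ((h1 x).trans (le_max_left _ _))
    · exact (le_abs_self _).trans ((h2 x).trans (le_max_right _ _))
  obtain ⟨M, hM0, hM⟩ := hMW
  have hFx : ∀ r, Continuous (F r) := fun r => hF.comp (by fun_prop : Continuous fun c : ℝ => (r, c))
  have hFc : ∀ c, Continuous fun r => F r c := fun c => hF.comp (by fun_prop : Continuous fun r : ℝ => (r, c))
  let i : ℝ → ℝ → ℝ := fun c q => if c < q then (1:ℝ) else 0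
  have hi0 : ∀ c q, |i c q| ≤ 1 := fun c q => by simp only [i]; split_ifs <;> simp
  have hint1 : ∀ r q, IntegrableOn (fun c => i c q * F r c) (Ioc 0 M) := fun r q => by
    have h1 : IntegrableOn (fun c => F r c) (Ioc 0 M) := ((hFx r).integrableOn_Icc).mono_set Ioc_subset_Icc_self
    refine h1.norm.mono' ?_ (ae_of_all _ fun c => ?_)
    · exact ((Measurable.ite (measurableSet_Iio) measurable_const measurable_const).mul
        (hFx r).measurable).aestronglyMeasurable
    · rw [norm_mul, Real.norm_eq_abs]; exact mul_le_of_le_one_left (norm_nonneg _) (hi0 _ _)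
  have e1 : ∀ x, ∫ c in (W x)..(V x), F ‖x‖ c = ∫ c in Ioc 0 M, (i c (V x) - i c (W x)) * F ‖x‖ c := by
    intro x
    simp only [sub_mul]
    rw [integral_sub (hint1 _ _) (hint1 _ _), step_int' (hR.nonneg x) (hM x).2, step_int' (h.nonneg x) (hM x).1]
    rw [intervalIntegral.integral_interval_sub_left] <;> exact (hFx _).intervalIntegrable _ _
  simp only [e1]
  have hbase : ∀ x ∉ ball (0 : Eu N) ρ, ∫ c in Ioc 0 M, (i c (V x) - i c (W x)) * F ‖x‖ c = 0 := by
    intro x hx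
    have h1 : W x = 0 := by
      by_contra hne
      exact hx (mem_ball_zero_iff.2 (h.supp x (lt_of_le_of_ne (h.nonneg x) (Ne.symm hne))))
    have h2 : V x = 0 := by
      by_contra hne
      exact hx (mem_ball_zero_iff.2 (hR.supp x (lt_of_le_of_ne (hR.nonneg x) (Ne.symm hne))))
    rw [h1, h2]; simp
  rw [← setIntegral_eq_integral_of_forall_compl_eq_zero hbase]
  have hFm : Continuous fun p : Eu N × ℝ => F ‖p.1‖ p.2 := hF.comp (by fun_prop : Continuous fun p : Eu N × ℝ => (‖p.1‖, p.2))
  have him : ∀ {G : Eu N → ℝ}, Continuous G → Measurable fun p : Eu N × ℝ => i p.2 (G p.1) := fun hG =>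
    Measurable.ite (measurableSet_lt measurable_snd (hG.measurable.comp measurable_fst)) measurable_const measurable_const
  have hsw : Integrable (Function.uncurry fun (x : Eu N) (c : ℝ) => (i c (V x) - i c (W x)) * F ‖x‖ c)
      ((volume.restrict (ball 0 ρ)).prod (volume.restrict (Ioc 0 M))) := by
    rw [Measure.prod_restrict]
    have h1 : IntegrableOn (fun p : Eu N × ℝ => F ‖p.1‖ p.2) (ball 0 ρ ×ˢ Ioc 0 M) (volume.prod volume) :=
      (hFm.continuousOn.integrableOn_compact ((isCompact_closedBall (0:Eu N) ρ).prod (isCompact_Icc (a := (0:ℝ)) (b := M)))).mono_set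
        (prod_mono ball_subset_closedBall Ioc_subset_Icc_self)
    refine (h1.norm.const_mul 2).mono' ?_ (ae_of_all _ fun p => ?_)
    · exact (((him hR.cont).sub (him h.cont)).mul hFm.measurable).aestronglyMeasurable
    · rw [Function.uncurry, norm_mul, Real.norm_eq_abs]
      refine mul_le_mul_of_nonneg_right ?_ (norm_nonneg _)
      have := hi0 p.2 (V p.1)
      have := hi0 p.2 (W p.1)
      exact (abs_sub _ _).trans (by linarith)
  rw [integral_integral_swap hsw]
  refine setIntegral_nonneg measurableSet_Ioc fun c hc => ?_
  have hint2 : ∀ {G : Eu N → ℝ}, Continuous G → IntegrableOn (fun x : Eu N => i c (G x) * F ‖x‖ c) (ball 0 ρ) := fun {G} hG => by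
    have hc1 : Continuous fun x : Eu N => F ‖x‖ c := (hFc c).comp continuous_norm
    have h1 : IntegrableOn (fun x : Eu N => F ‖x‖ c) (ball 0 ρ) := 
      (hc1.continuousOn.integrableOn_compact (isCompact_closedBall (0:Eu N) ρ)).mono_set ball_subset_closedBall
    refine h1.norm.mono' ?_ (ae_of_all _ fun x => ?_)
    · exact (((him hG).comp (by fun_prop : Measurable fun x : Eu N => (x, c))).mul hc1.measurable).aestronglyMeasurable
    · rw [norm_mul, Real.norm_eq_abs]; exact mul_le_of_le_one_left (norm_nonneg _) (hi0 _ _)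
  have hset : ∀ {G : Eu N → ℝ}, WC ρ G → ∫ x in ball (0:Eu N) ρ, i c (G x) * F ‖x‖ c = ∫ x in {x | c < G x}, F ‖x‖ c := by
    intro G hG
    have e2 : (fun x : Eu N => i c (G x) * F ‖x‖ c) = ({x | c < G x}).indicator (fun x => F ‖x‖ c) := by
      funext x; by_cases hx : c < G x <;> simp [i, hx]
    rw [e2, setIntegral_indicator (isOpen_sup hG c).measurableSet]
    congr 2
    refine inter_eq_right.2 fun x hx => mem_ball_zero_iff.2 (hG.supp x ?_)
    exact hc.1.trans hx
  simp only [sub_mul]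
  rw [integral_sub (hint2 hR.cont) (hint2 h.cont), hset hR, hset h, sub_nonneg]
  refine radial_int (hFc c) (ha c) (R := ρ) (isOpen_sup h c).measurableSet (isOpen_sup hR c).measurableSet ?_ ?_
    (RR_vol hk hk1 he hρ h hc.1.le).symm (RR_vol_radial hk hk1 he hρ h hc.1.le)
  · exact fun x hx => mem_ball_zero_iff.2 (h.supp x (hc.1.trans hx))
  · exact fun x hx => mem_ball_zero_iff.2 (hR.supp x (hc.1.trans hx))

end LS
end

noncomputable section
namespace LS

open Filter Topology

lemma null_preimage {w dw : ℝ → ℝ} {T A : Set ℝ}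
    (hw : ∀ t ∈ T, HasStrictDerivAt w (dw t) t) (hd : ∀ t ∈ T, dw t ≠ 0) (hA : volume A = 0) :
    volume (T ∩ w ⁻¹' A) = 0 := by
  refine measure_null_of_locally_null _ fun t ht => ?_
  have h1 := (hw t ht.1).isLittleO.def (c := |dw t| / 2) (by have := abs_pos.2 (hd t ht.1); positivity)
  rw [nhds_prod_eq] at h1
  obtain ⟨U, hU, hUs⟩ := Filter.eventually_prod_self_iff'.1 h1
  refine ⟨U ∩ (T ∩ w ⁻¹' A), inter_mem (mem_nhdsWithin_of_mem_nhds hU) self_mem_nhdsWithin, ?_⟩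
  have hdp := abs_pos.2 (hd t ht.1)
  have hanti : ∀ a ∈ U, ∀ b ∈ U, |a - b| ≤ 2 / |dw t| * |w a - w b| := by
    intro a ha b hb
    have h2 := hUs a ha b hb
    simp only [Real.norm_eq_abs, ContinuousLinearMap.toSpanSingleton_apply, smul_eq_mul] at h2
    have h3 : |dw t| * |a - b| ≤ |w a - w b| + |dw t| / 2 * |a - b| := by
      rw [← abs_mul]
      calc |dw t * (a - b)| = |(w a - w b) - (w a - w b - (a - b) * dw t)| := by congr 1; ring
        _ ≤ |w a - w b| + |w a - w b - (a - b) * dw t| := abs_sub _ _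
        _ ≤ _ := by linarith
    rw [div_mul_eq_mul_div, le_div_iff₀ hdp]; nlinarith
  set q := Function.invFunOn w U
  have hq : ∀ a ∈ U, q (w a) = a := by
    intro a ha
    have hm : q (w a) ∈ U := Function.invFunOn_mem ⟨a, ha, rfl⟩
    have he : w (q (w a)) = w a := Function.invFunOn_eq ⟨a, ha, rfl⟩
    have := hanti _ hm _ ha
    rw [he] at this; simp at this; linarith [sub_eq_zero.1 this]
  have hl : LipschitzOnWith (Real.toNNReal (2 / |dw t|)) q (w '' U) := by
    refine LipschitzOnWith.of_dist_le_mul ?_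
    rintro _ ⟨a, ha, rfl⟩ _ ⟨b, hb, rfl⟩
    rw [hq a ha, hq b hb, Real.coe_toNNReal _ (by positivity)]
    exact hanti a ha b hb
  have hsub : U ∩ (T ∩ w ⁻¹' A) ⊆ q '' (w '' U ∩ A) := by
    rintro a ⟨ha, -, haA⟩
    exact ⟨w a, ⟨⟨a, ha, rfl⟩, haA⟩, hq a ha⟩
  refine measure_mono_null hsub ?_
  have := (hl.mono (inter_subset_left (t := A))).hausdorffMeasure_image_le (d := 1) zero_le_one
  rw [hausdorffMeasure_real, measure_mono_null inter_subset_right hA, mul_zero] at this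
  exact le_antisymm this bot_le

lemma line_null {w v dw : ℝ → ℝ} (hwc : Continuous w) (hvc : Continuous v)
    (hw : ∀ t, 0 < w t → HasStrictDerivAt w (dw t) t)
    (heq : ∀ c, 0 ≤ c → volume {t | c < v t} = volume {t | c < w t})
    (hfin : volume {t | 0 < w t} ≠ ⊤) (hnd : volume {t | 0 < w t ∧ dw t = 0} = 0) :
    volume {t | 0 < v t ∧ ∃ s, w s = v t ∧ dw s = 0} = 0 := by
  set T := {t | 0 < w t ∧ dw t = 0}
  have hA : volume (w '' T) = 0 := by
    refine addHaar_image_eq_zero_of_det_fderivWithin_eq_zero volume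
      (f' := fun t => ContinuousLinearMap.toSpanSingleton ℝ (dw t))
      (fun t ht => (hw t ht.1).hasDerivAt.hasFDerivAt.hasFDerivWithinAt) fun t ht => ?_
    rw [ht.2]; simp
  set A := toMeasurable volume (w '' T)
  have hAm : MeasurableSet A := measurableSet_toMeasurable _ _
  have hA0 : volume A = 0 := by rw [measure_toMeasurable]; exact hA
  have hpos : MeasurableSet {t | 0 < w t} := (isOpen_lt continuous_const hwc).measurableSet
  have hposv : MeasurableSet {t | 0 < v t} := (isOpen_lt continuous_const hvc).measurableSet
  have hmeas : (volume.restrict {t | 0 < v t}).map v = (volume.restrict {t | 0 < w t}).map w := by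
    have : IsFiniteMeasure (volume.restrict {t | 0 < v t}) :=
      ⟨by rw [Measure.restrict_apply_univ, heq 0 le_rfl]; exact hfin.lt_top⟩
    have : IsFiniteMeasure ((volume.restrict {t | 0 < v t}).map v) :=
      Measure.isFiniteMeasure_map _ _
    refine ext_of_generate_finite _ ((BorelSpace.measurable_eq (α := ℝ)).trans (borel_eq_generateFrom_Ioi ℝ)) ?_ ?_ ?_
    · rintro _ ⟨a, rfl⟩ _ ⟨b, rfl⟩ -
      exact ⟨max a b, by rw [Ioi_inter_Ioi]⟩
    · rintro _ ⟨a, rfl⟩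
      rw [Measure.map_apply hvc.measurable measurableSet_Ioi,
        Measure.map_apply hwc.measurable measurableSet_Ioi,
        Measure.restrict_apply (hvc.measurable measurableSet_Ioi),
        Measure.restrict_apply (hwc.measurable measurableSet_Ioi)]
      have := heq (max a 0) (le_max_right _ _)
      simp only [max_lt_iff] at this
      exact this
    · rw [Measure.map_apply hvc.measurable .univ, Measure.map_apply hwc.measurable .univ]
      simpa using heq 0 le_rfl
  have h1 := congrArg (fun m => m A) hmeas
  simp only [Measure.map_apply hvc.measurable hAm, Measure.map_apply hwc.measurable hAm,
    Measure.restrict_apply (hvc.measurable hAm), Measure.restrict_apply (hwc.measurable hAm)] at h1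
  have h2 : volume (w ⁻¹' A ∩ {t | 0 < w t}) = 0 := by
    have h3 := null_preimage (T := {t | 0 < w t ∧ dw t ≠ 0}) (fun t ht => hw t ht.1)
      (fun t ht => ht.2) hA0
    refine measure_mono_null ?_ (measure_union_null hnd h3)
    rintro t ⟨ht, ht'⟩
    by_cases h : dw t = 0
    · exact Or.inl ⟨ht', h⟩
    · exact Or.inr ⟨⟨ht', h⟩, ht⟩
  rw [h2] at h1
  refine measure_mono_null ?_ h1
  rintro t ⟨ht, s, hs, hs'⟩
  refine ⟨?_, ht⟩
  show v t ∈ A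
  rw [← hs]
  exact subset_toMeasurable _ _ ⟨s, ⟨hs ▸ ht, hs'⟩, rfl⟩

structure WD {N : ℕ} (ρ L : ℝ) (e : Eu N) (W : Eu N → ℝ) (p : Eu N → Eu N) : Prop where
  wc : WC ρ W
  lip : ∀ x y, |W x - W y| ≤ L * ‖x - y‖
  strict : ∀ x, 0 < W x → HasStrictFDerivAt W (innerSL ℝ (p x)) x
  pcont : ContinuousOn p {x | 0 < W x}
  nd : volume {x | 0 < W x ∧ ⟪p x, e⟫ = 0} = 0

variable {N : ℕ}

lemma WD.strict_line {ρ L : ℝ} {e : Eu N} {W : Eu N → ℝ} {p : Eu N → Eu N} (h : WD ρ L e W p)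
    (x : Eu N) (t : ℝ) (ht : 0 < W (lin e x t)) :
    HasStrictDerivAt (fun t => W (lin e x t)) ⟪p (lin e x t), e⟫ t := by
  have h1 : HasStrictDerivAt (fun t => lin e x t) e t := by
    have h2 : HasStrictDerivAt (fun t : ℝ => t - ⟪e, x⟫) 1 t := (hasStrictDerivAt_id t).sub_const _
    have := (HasStrictDerivAt.smul_const h2 e).const_add x
    simpa [lin] using this
  have := (h.strict _ ht).comp_hasStrictDerivAt t h1
  rw [innerSL_apply_apply] at this
  exact this

def Bad (k : ℝ) (e : Eu N) (W : Eu N → ℝ) (p : Eu N → Eu N) : Set (Eu N) :=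
  {x | 0 < RR k e W x ∧ ∃ t, W (lin e x t) = RR k e W x ∧ ⟪p (lin e x t), e⟫ = 0}

lemma Bad_meas {k : ℝ} (hk : 0 < k) (hk1 : k < 1) {ρ L : ℝ} (hρ : 0 < ρ) {e : Eu N} (he : ‖e‖ = 1)
    {W : Eu N → ℝ} {p : Eu N → Eu N} (h : WD ρ L e W p) : MeasurableSet (Bad k e W p) := by
  have hv := RR_cont hk hk1 he hρ h.wc
  have hWl : Continuous fun q : Eu N × ℝ => W (lin e q.1 q.2) := h.wc.cont.comp (continuous_lin e)
  set K : ℕ → Set (Eu N × ℝ) := fun j => {q | 1 / ((j:ℝ) + 1) ≤ RR k e W q.1} ∩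
    ({q | W (lin e q.1 q.2) = RR k e W q.1} ∩ ({q | 1 / ((j:ℝ) + 1) ≤ W (lin e q.1 q.2)} ∩
      (fun q => ⟪p (lin e q.1 q.2), e⟫) ⁻¹' {0})) with hK
  have hpos : ∀ j : ℕ, (0:ℝ) < 1 / ((j:ℝ) + 1) := fun j => by positivity
  have hcl : ∀ j, IsClosed (K j) := by
    intro j
    refine (isClosed_le continuous_const (hv.comp continuous_fst)).inter
      ((isClosed_eq hWl (hv.comp continuous_fst)).inter ?_)
    refine ContinuousOn.preimage_isClosed_of_isClosed ?_ (isClosed_le continuous_const hWl)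
      isClosed_singleton
    refine ContinuousOn.inner (h.pcont.comp (continuous_lin e).continuousOn fun q hq => ?_)
      continuousOn_const
    exact lt_of_lt_of_le (hpos j) hq
  have hcp : ∀ j, IsCompact (K j) := by
    intro j
    refine ((isCompact_closedBall (0 : Eu N) ρ).prod (isCompact_Icc (a := -ρ) (b := ρ))).of_isClosed_subset
      (hcl j) fun q hq => ⟨?_, ?_⟩
    · have := RR_supp hk hk1 he hρ h.wc q.1 (lt_of_lt_of_le (hpos j) hq.1)
      simpa using this.le
    · have h1 := h.wc.supp _ (lt_of_lt_of_le (hpos j) hq.2.2.1)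
      have h2 := abs_le_lin he q.1 q.2
      exact abs_le.1 (h2.trans h1.le)
  have heq : Bad k e W p = ⋃ j, Prod.fst '' (K j) := by
    ext x
    simp only [mem_iUnion]
    constructor
    · rintro ⟨h0, t, h1, h2⟩
      obtain ⟨j, hj⟩ := exists_nat_one_div_lt h0
      exact ⟨j, (x, t), ⟨hj.le, h1, (by rw [mem_ofPred_eq, h1]; exact hj.le), h2⟩, rfl⟩
    · rintro ⟨j, q, hq, rfl⟩
      exact ⟨lt_of_lt_of_le (hpos j) hq.1, q.2, hq.2.1, hq.2.2.2⟩
  rw [heq]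
  exact MeasurableSet.iUnion fun j => ((hcp j).image continuous_fst).measurableSet

lemma Bad_null {k : ℝ} (hk : 0 < k) (hk1 : k < 1) {ρ L : ℝ} (hρ : 0 < ρ) {e : Eu N} (he : ‖e‖ = 1)
    {W : Eu N → ℝ} {p : Eu N → Eu N} (h : WD ρ L e W p) : volume (Bad k e W p) = 0 := by
  have hopen : IsOpen {x | 0 < W x} := isOpen_lt continuous_const h.wc.cont
  have hcont : ContinuousOn (fun x => ⟪p x, e⟫) {x | 0 < W x} := h.pcont.inner continuousOn_const
  have hm : MeasurableSet {x | 0 < W x ∧ ⟪p x, e⟫ = 0} := by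
    obtain ⟨C, hC, hCe⟩ := continuousOn_iff_isClosed.1 hcont {0} isClosed_singleton
    have : {x | 0 < W x ∧ ⟪p x, e⟫ = 0} = C ∩ {x | 0 < W x} := by
      rw [← hCe]; ext x; simp [and_comm]
    rw [this]; exact hC.measurableSet.inter hopen.measurableSet
  have hnd := h.nd
  have hlm : ∀ {A : Set (Eu N)}, MeasurableSet A → ∀ x, MeasurableSet {t : ℝ | lin e x t ∈ A} :=
    fun hA x => ((continuous_lin e).comp (by fun_prop : Continuous fun t : ℝ => (x, t))).measurable hA
  have hmm : Measurable fun x => volume {t : ℝ | lin e x t ∈ {x | 0 < W x ∧ ⟪p x, e⟫ = 0}} := by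
    have := measurable_measure_prodMk_left (ν := (volume : Measure ℝ))
      ((continuous_lin e).measurable hm)
    exact this
  rw [vol_lin he hm, lintegral_eq_zero_iff hmm] at hnd
  rw [vol_lin he (Bad_meas hk hk1 hρ he h)]
  refine lintegral_eq_zero_of_ae_eq_zero ?_
  filter_upwards [hnd] with x hx
  have hvc : Continuous fun t => RR k e W (lin e x t) := (RR_cont hk hk1 he hρ h.wc).comp
    ((continuous_lin e).comp (by fun_prop : Continuous fun t : ℝ => (x, t)))
  have hwc : Continuous fun t => W (lin e x t) := h.wc.cont.comp
    ((continuous_lin e).comp (by fun_prop : Continuous fun t : ℝ => (x, t)))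
  have := line_null (w := fun t => W (lin e x t)) (v := fun t => RR k e W (lin e x t))
    (dw := fun t => ⟪p (lin e x t), e⟫) hwc hvc (h.strict_line x)
    (fun c hc => RR_vol_line hk hk1 he hρ h.wc hc x) ?_ hx
  · refine Eq.trans ?_ this
    congr 1
    ext t
    simp [Bad, lin_lin he]
  · refine ne_of_lt (lt_of_le_of_lt (measure_mono (t := Icc (-ρ) ρ) fun t ht => ?_) (by simp))
    exact abs_le.1 ((abs_le_lin he x t).trans (h.wc.supp _ ht).le)
end LS
end

noncomputable section
namespace LS

open Filter Topology

variable {N : ℕ}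

def dpsi (k : ℝ) (e : Eu N) (p : Eu N → Eu N) (x : Eu N) (τ : ℝ) : ℝ :=
  k⁻¹ * ⟪p (lin e x (τ / k)), e⟫

lemma reg_of_notBad {k : ℝ} (hk : 0 < k) {ρ L : ℝ} {e : Eu N}
    {W : Eu N → ℝ} {p : Eu N → Eu N} (h : WD ρ L e W p) {x : Eu N} (hx : x ∉ Bad k e W p)
    (hpos : 0 < RR k e W x) : RegLevel (psi k e W x) (dpsi k e p x) (RR k e W x) := by
  intro τ hτ
  have h1 : 0 < W (lin e x (τ / k)) := by change 0 < psi k e W x τ; rw [hτ]; exact hpos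
  constructor
  · have h2 := (h.strict_line x (τ / k) h1).hasDerivAt
    have h3 : HasDerivAt (fun τ : ℝ => τ / k) k⁻¹ τ := by
      simpa using (hasDerivAt_id τ).div_const k
    have h4 := HasDerivAt.scomp τ h2 h3
    exact h4
  · intro h0
    have h5 : ⟪p (lin e x (τ / k)), e⟫ = 0 := (mul_eq_zero.1 h0).resolve_left (by positivity)
    exact hx ⟨hpos, τ / k, hτ, h5⟩

lemma lin_add (e x y : Eu N) (ε s : ℝ) :
    lin e (x + ε • y) s = lin e x s + ε • (y - ⟪e, y⟫ • e) := by
  simp only [lin, inner_add_right, inner_smul_right]; module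

lemma perturb_E {k : ℝ} (hk : 0 < k) (hk1 : k < 1) {ρ L : ℝ} (hρ : 0 < ρ) {e : Eu N}
    (he : ‖e‖ = 1)
    {W : Eu N → ℝ} {p : Eu N → Eu N} (h : WD ρ L e W p) {x : Eu N}
    (hpos : 0 < RR k e W x) (hreg : RegLevel (psi k e W x) (dpsi k e p x) (RR k e W x))
    {z : ℝ} {Z : Finset ℝ} (hD : Dan k (psi k e W x) ⟪e, x⟫ (RR k e W x) z Z)
    {w : Eu N → ℝ} (hw : WC ρ w) (y : Eu N) {α : ℝ}
    (hα : 0 < k * (z - ⟪e, x⟫) * ⟪e, y⟫ + ∑ τ ∈ Z, |z - τ| *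
      ((⟪p (lin e x (τ / k)), y - ⟪e, y⟫ • e⟫ + w (lin e x (τ / k)) - α) / |dpsi k e p x τ|)) :
    ∀ᶠ ε in 𝓝[>] (0:ℝ), RR k e W x + ε * α < RR k e (fun a => W a + ε * w a) (x + ε • y) := by
  set y' := y - ⟪e, y⟫ • e with hy'
  have hWε : ∀ ε, 0 ≤ ε → WC ρ (fun a => W a + ε * w a) := by
    intro ε hε
    refine ⟨h.wc.cont.add (continuous_const.mul hw.cont),
      fun a => add_nonneg (h.wc.nonneg a) (mul_nonneg hε (hw.nonneg a)), fun a ha => ?_⟩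
    by_contra hne
    have h1 : W a = 0 := le_antisymm (not_lt.1 fun hh => hne (h.wc.supp a hh)) (h.wc.nonneg a)
    have h2 : w a = 0 := le_antisymm (not_lt.1 fun hh => hne (hw.supp a hh)) (hw.nonneg a)
    simp [h1, h2] at ha
  have hlip' : ∀ a (ε : ℝ), 0 ≤ ε → W a - L * ‖y'‖ * ε ≤ W (a + ε • y') := by
    intro a ε hε
    have := (abs_le.1 (h.lip (a + ε • y') a)).1
    rw [add_sub_cancel_left, norm_smul, Real.norm_of_nonneg hε] at this
    linarith
  have key := perturb (psi_adm hk hk1 he hρ h.wc x) hreg hD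
    (ψε := fun ε => psi k e (fun a => W a + ε * w a) (x + ε • y)) (C := L * ‖y'‖)
    (η := fun τ => ⟪p (lin e x (τ / k)), y'⟫ + w (lin e x (τ / k))) (ν := ⟪e, y⟫) (α := α)
    ?_ ?_ ?_ hα
  · have hc : ∀ᶠ ε in 𝓝[>] (0:ℝ), 0 ≤ RR k e W x + ε * α := by
      have : Tendsto (fun ε : ℝ => RR k e W x + ε * α) (𝓝[>] 0) (𝓝 (RR k e W x + 0 * α)) :=
        ((continuous_const.add (continuous_id.mul continuous_const)).tendsto 0).mono_left
          nhdsWithin_le_nhds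
      rw [zero_mul, add_zero] at this
      exact (this.eventually (lt_mem_nhds hpos)).mono fun _ => le_of_lt
    filter_upwards [key, hc, self_mem_nhdsWithin] with ε h1 h2 h3
    rw [lt_RR hk hk1 he hρ (hWε ε (le_of_lt h3)) _ h2]
    rwa [inner_add_right, inner_smul_right]
  · intro ε
    have := (continuous_lin e).comp (by fun_prop : Continuous fun τ : ℝ => (x + ε • y, τ / k))
    exact ((h.wc.cont.add (continuous_const.mul hw.cont))).comp this
  · refine Eventually.of_forall fun ε hε τ => ?_
    simp only [psi, lin_add, ← hy']
    have h1 := hlip' (lin e x (τ / k)) ε hε.le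
    have h2 := mul_nonneg hε.le (hw.nonneg (lin e x (τ / k) + ε • y'))
    linarith
  · intro τ hτ δ hδ
    have hlev := ((hD.memZ τ).1 hτ).2
    set P := lin e x (τ / k) with hP
    have hWP : 0 < W P := by change 0 < psi k e W x τ; rw [hlev]; exact hpos
    have hs := (h.strict P hWP).isLittleO.def (c := δ / 2 / (‖y'‖ + 1)) (by positivity)
    have hb : Tendsto (fun q : ℝ × ℝ => lin e x (q.2 / k)) (𝓝 (0, τ)) (𝓝 P) := by
      have hc : Continuous fun q : ℝ × ℝ => lin e x (q.2 / k) :=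
        (continuous_lin e).comp (by fun_prop : Continuous fun q : ℝ × ℝ => (x, q.2 / k))
      exact hc.tendsto (0, τ)
    have ha : Tendsto (fun q : ℝ × ℝ => lin e x (q.2 / k) + q.1 • y') (𝓝 (0, τ)) (𝓝 P) := by
      have hc : Continuous fun q : ℝ × ℝ => lin e x (q.2 / k) + q.1 • y' :=
        ((continuous_lin e).comp (by fun_prop : Continuous fun q : ℝ × ℝ => (x, q.2 / k))).add
          (by fun_prop)
      have := hc.tendsto (0, τ)
      simpa using this
    have hs' := (ha.prodMk_nhds hb).eventually hs
    have hh := (hw.cont.tendsto P).comp ha |>.eventually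
      (lt_mem_nhds (show w P - δ / 2 < w P by linarith))
    filter_upwards [hs', hh] with q h1 h2 hq
    simp only [psi, lin_add, ← hy']
    simp only [Function.comp] at h2
    simp only [add_sub_cancel_left, norm_smul, Real.norm_eq_abs, abs_of_pos hq, map_smul,
      innerSL_apply_apply, smul_eq_mul] at h1
    have h3 := (abs_le.1 h1).1
    have h4 : δ / 2 / (‖y'‖ + 1) * (q.1 * ‖y'‖) ≤ q.1 * (δ / 2) := by
      have : ‖y'‖ / (‖y'‖ + 1) ≤ 1 := by rw [div_le_one (by positivity)]; linarith
      calc δ / 2 / (‖y'‖ + 1) * (q.1 * ‖y'‖) = q.1 * (δ / 2) * (‖y'‖ / (‖y'‖ + 1)) := by ring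
        _ ≤ q.1 * (δ / 2) * 1 := by gcongr
        _ = _ := by ring
    have h5 : q.1 * (w P - δ / 2) ≤ q.1 * w (lin e x (q.2 / k) + q.1 • y') := by gcongr
    nlinarith
end LS
end

noncomputable section
namespace LS

open Filter Topology

variable {N : ℕ}

section G
variable {g : ℝ → ℝ} (hg : GCond g)
include hg

lemma g_strictMono : StrictMonoOn g (Ici 0) := by
  refine strictMonoOn_of_deriv_pos (convex_Ici 0) hg.1 fun t ht => ?_
  rw [interior_Ici] at ht
  exact hg.2.2.2 t ht

lemma g_nonneg {t : ℝ} (ht : 0 ≤ t) : 0 ≤ g t := by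
  have := (g_strictMono hg).monotoneOn (self_mem_Ici) (show t ∈ Ici (0:ℝ) from ht) ht
  rwa [hg.2.2.1] at this

lemma g_pos {t : ℝ} (ht : 0 < t) : 0 < g t := by
  have := (g_strictMono hg) (self_mem_Ici) (show t ∈ Ici (0:ℝ) from ht.le) ht
  rwa [hg.2.2.1] at this

lemma g_ii {a b : ℝ} (ha : 0 ≤ a) (hb : 0 ≤ b) : IntervalIntegrable g volume a b :=
  (hg.1.mono fun _ hx => (le_min ha hb).trans hx.1).intervalIntegrable

lemma Gfun_sub {s t : ℝ} (hs : 0 ≤ s) (ht : 0 ≤ t) : Gfun g t - Gfun g s = ∫ r in s..t, g r := by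
  unfold Gfun
  rw [intervalIntegral.integral_interval_sub_left (g_ii hg le_rfl ht) (g_ii hg le_rfl hs)]

lemma Gfun_conv {s t : ℝ} (hs : 0 ≤ s) (ht : 0 ≤ t) (hst : s ≠ t) :
    g s * (t - s) < Gfun g t - Gfun g s := by
  rw [Gfun_sub hg hs ht]
  rcases lt_or_gt_of_ne hst with h | h
  · have h1 : ∫ r in s..t, g s = g s * (t - s) := by simp [mul_comm]
    rw [← h1]
    refine intervalIntegral.integral_lt_integral_of_continuousOn_of_le_of_exists_lt h
      continuousOn_const (hg.1.mono fun x hx => hs.trans hx.1) (fun x hx => ?_) ⟨t, ⟨h.le, le_rfl⟩, ?_⟩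
    · exact (g_strictMono hg).monotoneOn hs (hs.trans hx.1.le) hx.1.le
    · exact g_strictMono hg hs ht h
  · have h1 : ∫ r in t..s, g s = g s * (s - t) := by simp [mul_comm]
    rw [intervalIntegral.integral_symm]
    have : ∫ r in t..s, g r < ∫ r in t..s, g s := by
      refine intervalIntegral.integral_lt_integral_of_continuousOn_of_le_of_exists_lt h
        (hg.1.mono fun x hx => ht.trans hx.1) continuousOn_const (fun x hx => ?_) ⟨t, ⟨le_rfl, h.le⟩, ?_⟩
      · exact (g_strictMono hg).monotoneOn (ht.trans hx.1.le) hs hx.2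
      · exact g_strictMono hg ht hs h
    rw [h1] at this; linarith

lemma Gfun_cont : ContinuousOn (Gfun g) (Ici 0) := by
  intro t ht
  have h1 : ContinuousOn (Gfun g) (uIcc 0 (t + 1)) := by
    refine intervalIntegral.continuousOn_primitive_interval' (g_ii hg le_rfl ?_) left_mem_uIcc
    have : (0:ℝ) ≤ t := ht
    linarith
  have ht' : (0:ℝ) ≤ t := ht
  rw [uIcc_of_le (by linarith)] at h1
  refine (h1 t ⟨ht, by linarith⟩).mono_of_mem_nhdsWithin ?_
  rw [← Ici_inter_Iic]
  exact inter_mem self_mem_nhdsWithin (mem_nhdsWithin_of_mem_nhds (Iic_mem_nhds (by linarith)))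

lemma gvec_norm (y : Eu N) : ‖gvec g y‖ = g ‖y‖ := by
  unfold gvec
  split_ifs with h
  · simp [h, hg.2.2.1]
  · have : 0 < ‖y‖ := norm_pos_iff.2 h
    rw [norm_smul, Real.norm_of_nonneg (div_nonneg (g_nonneg hg this.le) this.le)]
    field_simp

omit hg in
lemma gvec_inner_self (y : Eu N) : ⟪gvec g y, y⟫ = g ‖y‖ * ‖y‖ := by
  unfold gvec
  split_ifs with h
  · simp [h]
  · have : 0 < ‖y‖ := norm_pos_iff.2 h
    rw [inner_smul_left, real_inner_self_eq_norm_sq]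
    simp; field_simp

lemma gvec_cont : Continuous (gvec g : Eu N → Eu N) := by
  rw [continuous_iff_continuousAt]
  intro y
  by_cases h : y = 0
  · subst h
    have h0 : gvec g (0 : Eu N) = 0 := by simp [gvec]
    rw [ContinuousAt, h0, tendsto_zero_iff_norm_tendsto_zero]
    simp only [gvec_norm hg]
    have h1 : Tendsto (fun y : Eu N => ‖y‖) (𝓝 0) (𝓝[Ici 0] 0) := by
      refine tendsto_nhdsWithin_iff.2 ⟨?_, Eventually.of_forall fun y => norm_nonneg y⟩
      simpa using (continuous_norm (E := Eu N)).tendsto 0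
    have h2 : Tendsto g (𝓝[Ici 0] 0) (𝓝 (g 0)) := hg.1 0 self_mem_Ici
    rw [hg.2.2.1] at h2
    exact h2.comp h1
  · have hy : 0 < ‖y‖ := norm_pos_iff.2 h
    have h1 : ContinuousAt (fun y : Eu N => (g ‖y‖ / ‖y‖) • y) y := by
      refine ContinuousAt.smul (ContinuousAt.div ?_ continuous_norm.continuousAt hy.ne') continuousAt_id
      exact ContinuousAt.comp (f := fun y : Eu N => ‖y‖) (g := g) (hg.1.continuousAt (Ici_mem_nhds hy))
        continuous_norm.continuousAt
    refine h1.congr ?_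
    filter_upwards [isOpen_ne.mem_nhds h] with x hx
    simp [gvec, show x ≠ 0 from hx]

end G

def GG (g : ℝ → ℝ) (ξ : Eu N) : ℝ := Gfun g ‖ξ‖

def Breg (g : ℝ → ℝ) (ζ ξ : Eu N) : ℝ := GG g ζ - GG g ξ - ⟪gvec g ξ, ζ - ξ⟫

section G2
variable {g : ℝ → ℝ} (hg : GCond g)
include hg

lemma GG_cont : Continuous (GG g : Eu N → ℝ) :=
  (Gfun_cont hg).comp_continuous continuous_norm fun y => norm_nonneg y

omit hg in
lemma GG_zero : GG g (0 : Eu N) = 0 := by simp [GG, Gfun]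

lemma GG_nonneg (ξ : Eu N) : 0 ≤ GG g ξ := by
  unfold GG Gfun
  exact intervalIntegral.integral_nonneg (norm_nonneg _) fun t ht => g_nonneg hg ht.1

lemma Breg_cont : Continuous fun q : Eu N × Eu N => Breg g q.1 q.2 := by
  have h1 := GG_cont (N := N) hg
  have h2 := gvec_cont (N := N) hg
  unfold Breg; fun_prop

lemma Breg_pos {ζ ξ : Eu N} (hne : ζ ≠ ξ) : 0 < Breg g ζ ξ := by
  have h1 : ⟪gvec g ξ, ζ⟫ ≤ g ‖ξ‖ * ‖ζ‖ := by
    have := real_inner_le_norm (gvec g ξ) ζ; rwa [gvec_norm hg] at this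
  have h2 := gvec_inner_self (g := g) ξ
  unfold Breg
  rw [inner_sub_right, h2]
  by_cases hn : ‖ξ‖ = ‖ζ‖
  · have hG : GG g ζ = GG g ξ := by unfold GG; rw [hn]
    rw [hG]
    rw [← hn] at h1
    rcases h1.lt_or_eq with h | h
    · linarith
    · exfalso
      have hξ : ξ ≠ 0 := by
        rintro rfl
        rw [norm_zero] at hn
        exact hne (norm_eq_zero.1 hn.symm)
      have hp : 0 < ‖ξ‖ := norm_pos_iff.2 hξ
      have hgp := g_pos hg hp
      rw [gvec, if_neg hξ, inner_smul_left] at h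
      simp only [conj_trivial] at h
      have h3 : ⟪ξ, ζ⟫ = ‖ξ‖ * ‖ζ‖ := by
        rw [← hn]
        field_simp at h
        nlinarith [h]
      have h4 : ‖ζ - ξ‖ ^ 2 = 0 := by
        rw [norm_sub_sq_real, real_inner_comm, h3, ← hn]; ring
      exact hne (sub_eq_zero.1 (norm_eq_zero.1 (by simpa using h4)))
  · have := Gfun_conv hg (norm_nonneg ξ) (norm_nonneg ζ) hn
    unfold GG; nlinarith

lemma Breg_nonneg (ζ ξ : Eu N) : 0 ≤ Breg g ζ ξ := by
  by_cases h : ζ = ξ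
  · subst h; simp [Breg]
  · exact (Breg_pos hg h).le

/-- Jensen with a gap. -/
lemma jensen {ι : Type*} {e : Eu N} (he : ‖e‖ = 1) {Z : Finset ι} {θ : ι → ℝ} {p : ι → Eu N}
    (hθ : ∀ i ∈ Z, 0 ≤ θ i) (hs : ∑ i ∈ Z, θ i = 1) {q : Eu N}
    (hq : ∀ y, ⟪q, y⟫ = ⟪q, e⟫ * ⟪e, y⟫ + ∑ i ∈ Z, θ i * ⟪p i, y - ⟪e, y⟫ • e⟫)
    (ha : |⟪q, e⟫| ≤ ∑ i ∈ Z, θ i * |⟪p i, e⟫|) {s : ℝ} (hs1 : s = 1 ∨ s = -1)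
    (hsq : 0 ≤ s * ⟪q, e⟫) {j : ι} (hj : j ∈ Z) :
    GG g q + θ j * Breg g (p j + (s * |⟪p j, e⟫| - ⟪p j, e⟫) • e) q ≤ ∑ i ∈ Z, θ i * GG g (p i) := by
  set ξ : ι → Eu N := fun i => p i + (s * |⟪p i, e⟫| - ⟪p i, e⟫) • e with hξ
  have hs2 : s * s = 1 := by rcases hs1 with h | h <;> simp [h]
  have hee := inner_ee he
  have hnorm : ∀ i, ‖ξ i‖ = ‖p i‖ := by
    intro i
    rw [← sq_eq_sq₀ (norm_nonneg _) (norm_nonneg _), hξ]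
    simp only
    rw [norm_add_sq_real, inner_smul_right, norm_smul, he, mul_one, Real.norm_eq_abs, sq_abs]
    have := abs_mul_abs_self ⟪p i, e⟫
    have h2 : (s * |⟪p i, e⟫|) * (s * |⟪p i, e⟫|) = ⟪p i, e⟫ * ⟪p i, e⟫ := by
      rw [← this]; linear_combination (|⟪p i, e⟫| * |⟪p i, e⟫|) * hs2
    linear_combination h2
  have hGi : ∀ i, GG g (p i) = GG g q + ⟪gvec g q, ξ i - q⟫ + Breg g (ξ i) q := by
    intro i
    have : GG g (p i) = GG g (ξ i) := by unfold GG; rw [hnorm]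
    rw [this, Breg]; ring
  have hB : θ j * Breg g (ξ j) q ≤ ∑ i ∈ Z, θ i * Breg g (ξ i) q :=
    Finset.single_le_sum (f := fun i => θ i * Breg g (ξ i) q)
      (fun i hi => mul_nonneg (hθ i hi) (Breg_nonneg hg _ _)) hj
  have hsum : ∑ i ∈ Z, θ i * ⟪q, ξ i - q⟫ = s * ⟪q, e⟫ * (∑ i ∈ Z, θ i * |⟪p i, e⟫| - s * ⟪q, e⟫) := by
    have h1 : ∀ i, ⟪q, ξ i - q⟫ = ⟪p i, q - ⟪e, q⟫ • e⟫ + s * |⟪p i, e⟫| * ⟪q, e⟫ - ⟪q, q⟫ := by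
      intro i
      simp only [hξ, inner_sub_right, inner_add_right, inner_smul_right, real_inner_comm q (p i),
        real_inner_comm e q]
      ring
    have h2 := hq q
    simp only [h1, mul_sub, mul_add, Finset.sum_sub_distrib, Finset.sum_add_distrib, ← Finset.sum_mul,
      hs, one_mul]
    have h3 : ∑ i ∈ Z, θ i * (s * |⟪p i, e⟫| * ⟪q, e⟫) = s * ⟪q, e⟫ * ∑ i ∈ Z, θ i * |⟪p i, e⟫| := by
      rw [Finset.mul_sum]; exact Finset.sum_congr rfl fun i _ => by ring
    rw [h3, real_inner_comm q e] at *
    linear_combination -h2 + ⟪q, e⟫ * ⟪q, e⟫ * hs2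
  have hlin : 0 ≤ ∑ i ∈ Z, θ i * ⟪gvec g q, ξ i - q⟫ := by
    unfold gvec
    split_ifs with h
    · simp
    · simp only [inner_smul_left, conj_trivial]
      have : ∑ i ∈ Z, θ i * (g ‖q‖ / ‖q‖ * ⟪q, ξ i - q⟫) = g ‖q‖ / ‖q‖ * ∑ i ∈ Z, θ i * ⟪q, ξ i - q⟫ := by
        rw [Finset.mul_sum]; exact Finset.sum_congr rfl fun i _ => by ring
      rw [this, hsum]
      refine mul_nonneg (div_nonneg (g_nonneg hg (norm_nonneg _)) (norm_nonneg _)) (mul_nonneg hsq ?_)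
      have h5 : s * ⟪q, e⟫ ≤ |⟪q, e⟫| := by
        rcases hs1 with h | h <;> rw [h]
        · rw [one_mul]; exact le_abs_self _
        · rw [neg_one_mul]; exact neg_le_abs _
      linarith
  have : ∑ i ∈ Z, θ i * GG g (p i) = GG g q + ∑ i ∈ Z, θ i * ⟪gvec g q, ξ i - q⟫ +
      ∑ i ∈ Z, θ i * Breg g (ξ i) q := by
    simp only [hGi, mul_add, Finset.sum_add_distrib, ← Finset.sum_mul, hs, one_mul]
  rw [this]; linarith
end G2
end LS
end

noncomputable section
namespace LS

open Filter Topology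

variable {N : ℕ}

/-- The data of the contact configuration at a point `x`, after normalisation. -/
structure Con (k ρ : ℝ) (e : Eu N) (W : Eu N → ℝ) (p : Eu N → Eu N) (x : Eu N) (z : ℝ)
    (Z : Finset ℝ) (θ : ℝ → ℝ) (D : ℝ) : Prop where
  dan : Dan k (psi k e W x) ⟪e, x⟫ (RR k e W x) z Z
  Dpos : 0 < D
  th : ∀ τ ∈ Z, 0 < θ τ ∧ ⟪p (lin e x (τ / k)), e⟫ ≠ 0 ∧ θ τ * |⟪p (lin e x (τ / k)), e⟫| * D = |z - τ|
  sum : ∑ τ ∈ Z, θ τ = 1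
  grad : ∀ q, HasGradientAt (RR k e W) q x → ⟪q, e⟫ * D = z - ⟪e, x⟫ ∧
    (∀ y, ⟪q, y⟫ = ⟪q, e⟫ * ⟪e, y⟫ + ∑ τ ∈ Z, θ τ * ⟪p (lin e x (τ / k)), y - ⟪e, y⟫ • e⟫) ∧
    |⟪q, e⟫| ≤ ∑ τ ∈ Z, θ τ * |⟪p (lin e x (τ / k)), e⟫|
  pert : ∀ w, WC ρ w → ∀ α, α < ∑ τ ∈ Z, θ τ * w (lin e x (τ / k)) →
    ∀ᶠ ε in 𝓝[>] (0:ℝ), RR k e W x + ε * α < RR k e (fun a => W a + ε * w a) x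

lemma exists_Con {k : ℝ} (hk : 0 < k) (hk1 : k < 1) {ρ L : ℝ} (hρ : 0 < ρ) {e : Eu N}
    (he : ‖e‖ = 1) {W : Eu N → ℝ} {p : Eu N → Eu N} (h : WD ρ L e W p) {x : Eu N}
    (hx : x ∉ Bad k e W p) (hpos : 0 < RR k e W x) :
    ∃ z Z θ D, Con k ρ e W p x z Z θ D := by
  have hreg := reg_of_notBad hk h hx hpos
  obtain ⟨z, Z, hD⟩ := exists_Dan hk hk1 hρ.le (psi_adm hk hk1 he hρ h.wc x) hpos hreg rfl
  have hb : ∀ τ ∈ Z, ⟪p (lin e x (τ / k)), e⟫ ≠ 0 := by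
    intro τ hτ h0
    refine (hreg τ ((hD.memZ τ).1 hτ).2).2 ?_
    simp [dpsi, h0]
  have hzt : ∀ τ ∈ Z, 0 < |z - τ| := by
    intro τ hτ
    have h1 := ((hD.memZ τ).1 hτ).1
    refine abs_pos.2 (sub_ne_zero.2 ?_)
    rintro rfl
    simp [uIoo, min_def, max_def] at h1
    split_ifs at h1 <;> linarith [h1.1, h1.2]
  set A : ℝ → ℝ := fun τ => |z - τ| / |⟪p (lin e x (τ / k)), e⟫| with hA
  have hApos : ∀ τ ∈ Z, 0 < A τ := fun τ hτ => div_pos (hzt τ hτ) (abs_pos.2 (hb τ hτ))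
  have hne : Z.Nonempty := by
    rw [Finset.nonempty_iff_ne_empty]
    rintro rfl
    have := hD.sum_le
    simp only [Finset.sum_empty] at this
    exact hD.ne (sub_eq_zero.1 (abs_eq_zero.1 (le_antisymm this (abs_nonneg _))))
  set D := ∑ τ ∈ Z, A τ with hDdef
  have hDpos : 0 < D := Finset.sum_pos hApos hne
  have hterm : ∀ τ c, |z - τ| * (c / |dpsi k e p x τ|) = k * D * (A τ / D * c) := by
    intro τ c
    simp only [dpsi, abs_mul, abs_inv, abs_of_pos hk, hA]
    field_simp
  have hsum1 : ∑ τ ∈ Z, A τ / D = 1 := by rw [← Finset.sum_div]; exact div_self hDpos.ne'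
  have pert : ∀ w, WC ρ w → ∀ y α, D * α < (z - ⟪e, x⟫) * ⟪e, y⟫ + D * ∑ τ ∈ Z, A τ / D *
      (⟪p (lin e x (τ / k)), y - ⟪e, y⟫ • e⟫ + w (lin e x (τ / k))) →
      ∀ᶠ ε in 𝓝[>] (0:ℝ), RR k e W x + ε * α < RR k e (fun a => W a + ε * w a) (x + ε • y) := by
    intro w hw y α hα
    refine perturb_E hk hk1 hρ he h hpos hreg hD hw y ?_
    simp only [hterm]
    rw [← Finset.mul_sum]
    simp only [mul_sub _ _ α, Finset.sum_sub_distrib, ← Finset.sum_mul, hsum1, one_mul]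
    have : 0 < k * ((z - ⟪e, x⟫) * ⟪e, y⟫ + D * ∑ τ ∈ Z, A τ / D *
      (⟪p (lin e x (τ / k)), y - ⟪e, y⟫ • e⟫ + w (lin e x (τ / k))) - D * α) :=
      mul_pos hk (by linarith)
    linarith
  refine ⟨z, Z, fun τ => A τ / D, D, hD, hDpos, fun τ hτ => ⟨div_pos (hApos τ hτ) hDpos, hb τ hτ, ?_⟩,
    hsum1, ?_, ?_⟩
  · have := abs_pos.2 (hb τ hτ)
    simp only [hA]; field_simp
  · intro q hq
    have hge : ∀ y, (z - ⟪e, x⟫) * ⟪e, y⟫ + D * ∑ τ ∈ Z, A τ / D *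
        ⟪p (lin e x (τ / k)), y - ⟪e, y⟫ • e⟫ ≤ D * ⟪q, y⟫ := by
      intro y
      by_contra hlt
      push Not at hlt
      set S := (z - ⟪e, x⟫) * ⟪e, y⟫ + D * ∑ τ ∈ Z, A τ / D *
        ⟪p (lin e x (τ / k)), y - ⟪e, y⟫ • e⟫ with hS
      obtain ⟨α, h1, h2⟩ : ∃ α, ⟪q, y⟫ < α ∧ D * α < S := by
        obtain ⟨α, h1, h2⟩ := exists_between (show ⟪q, y⟫ < S / D by rwa [lt_div_iff₀' hDpos])
        exact ⟨α, h1, by rwa [lt_div_iff₀' hDpos] at h2⟩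
      have h3 := pert (fun _ => 0) ⟨continuous_const, fun _ => le_rfl, fun _ h => absurd h (lt_irrefl _)⟩ y α
        (by simpa using h2)
      have h4 : HasDerivAt (fun ε : ℝ => RR k e W (x + ε • y)) ⟪q, y⟫ 0 := by
        have h5 : HasFDerivAt (RR k e W) (InnerProductSpace.toDual ℝ (Eu N) q) (x + (0:ℝ) • y) := by
          simpa using hq.hasFDerivAt
        have h6 : HasDerivAt (fun ε : ℝ => x + ε • y) y 0 := by
          simpa using ((hasDerivAt_id (0:ℝ)).smul_const y).const_add x
        have := h5.comp_hasDerivAt (0:ℝ) h6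
        rw [InnerProductSpace.toDual_apply_apply] at this
        exact this
      have h7 := (hasDerivAt_iff_tendsto_slope_zero.1 h4).mono_left (nhdsGT_le_nhdsNE 0)
      have h8 := h7.eventually (gt_mem_nhds h1)
      obtain ⟨ε, h9, h10, h11⟩ := (h3.and (h8.and self_mem_nhdsWithin)).exists
      have h11' : (0:ℝ) < ε := h11
      simp only [zero_add, zero_smul, add_zero, smul_eq_mul, mul_zero] at h9 h10
      rw [inv_mul_lt_iff₀ h11'] at h10
      linarith
    have heq : ∀ y, D * ⟪q, y⟫ = (z - ⟪e, x⟫) * ⟪e, y⟫ + D * ∑ τ ∈ Z, A τ / D *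
        ⟪p (lin e x (τ / k)), y - ⟪e, y⟫ • e⟫ := by
      intro y
      refine le_antisymm ?_ (hge y)
      have h1 := hge (-y)
      have h2 : ∀ τ, ⟪p (lin e x (τ / k)), -y - ⟪e, -y⟫ • e⟫ = -⟪p (lin e x (τ / k)), y - ⟪e, y⟫ • e⟫ := by
        intro τ
        rw [← inner_neg_right, inner_neg_right e y]; congr 1; module
      simp only [h2] at h1
      simp only [inner_neg_right, mul_neg, Finset.sum_neg_distrib] at h1
      linarith
    have hqe : ⟪q, e⟫ * D = z - ⟪e, x⟫ := by
      have := heq e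
      simp only [inner_ee he, one_smul, sub_self, inner_zero_right, mul_zero, Finset.sum_const_zero,
        mul_one, add_zero] at this
      linarith
    refine ⟨hqe, fun y => ?_, ?_⟩
    · refine mul_left_cancel₀ hDpos.ne' ?_
      rw [heq y, ← hqe]; ring
    · have h1 : |⟪q, e⟫| * D = |z - ⟪e, x⟫| := by rw [← hqe, abs_mul, abs_of_pos hDpos]
      have h2 := hD.sum_le
      refine le_of_mul_le_mul_right ?_ hDpos
      rw [h1, Finset.sum_mul]
      refine h2.trans (le_of_eq (Finset.sum_congr rfl fun τ hτ => ?_))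
      have := abs_pos.2 (hb τ hτ)
      simp only [hA]; field_simp
  · intro w hw α hα
    have := pert w hw 0 α (by simpa using mul_lt_mul_of_pos_left hα hDpos)
    simpa using this
end LS
end

noncomputable section
namespace LS

open Filter Topology

variable {N : ℕ}

lemma inner_grad (X : Eu N) (ψ : Eu N → ℝ) (x : Eu N) : ⟪X, gradient ψ x⟫ = fderiv ℝ ψ x X := by
  rw [real_inner_comm, gradient, InnerProductSpace.toDual_symm_apply]

lemma norm_grad (ψ : Eu N → ℝ) (x : Eu N) : ‖gradient ψ x‖ = ‖fderiv ℝ ψ x‖ := by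
  rw [gradient, LinearIsometryEquiv.norm_map]

lemma meas_grad (ψ : Eu N → ℝ) : Measurable (gradient ψ) :=
  (InnerProductSpace.toDual ℝ (Eu N)).symm.continuous.measurable.comp (measurable_fderiv ℝ ψ)

open scoped Convolution in
lemma weak_lip {R : ℝ} {X : Eu N → Eu N} {F : Eu N → ℝ}
    (hX : AEStronglyMeasurable X (volume.restrict (ball 0 R))) {MX : ℝ} (hMX : ∀ x ∈ ball (0:Eu N) R, ‖X x‖ ≤ MX)
    (hF : AEStronglyMeasurable F (volume.restrict (ball 0 R))) {MF : ℝ} (hMF : ∀ x ∈ ball (0:Eu N) R, ‖F x‖ ≤ MF)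
    (hsol : ∀ φ : Eu N → ℝ, IsTestFun (ball 0 R) φ →
      ∫ x in ball (0:Eu N) R, ⟪X x, gradient φ x⟫ = ∫ x in ball (0:Eu N) R, F x * φ x)
    {φ : Eu N → ℝ} {C : NNReal} (hlip : LipschitzWith C φ) {r : ℝ} (hr : r < R)
    (hsupp : ∀ x, φ x ≠ 0 → ‖x‖ ≤ r) :
    ∫ x in ball (0:Eu N) R, ⟪X x, gradient φ x⟫ = ∫ x in ball (0:Eu N) R, F x * φ x := by
  have hδ : 0 < R - r := by linarith
  set η : ℕ → ContDiffBump (0 : Eu N) := fun n => ⟨(R - r) / ((n:ℝ) + 2) / 2, (R - r) / ((n:ℝ) + 2),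
    by positivity, half_lt_self (by positivity)⟩ with hη
  have hηr : ∀ n, (η n).rOut ≤ (R - r) / 2 := by
    intro n
    show (R - r) / ((n:ℝ) + 2) ≤ _
    gcongr; linarith [n.cast_nonneg (α := ℝ)]
  have hη0 : Tendsto (fun n => (η n).rOut) atTop (𝓝 0) := by
    have h1 : Tendsto (fun n : ℕ => (n:ℝ) + 2) atTop atTop :=
      tendsto_atTop_add_const_right _ _ tendsto_natCast_atTop_atTop
    exact h1.const_div_atTop (R - r)
  have hcpt : HasCompactSupport φ := HasCompactSupport.intro (isCompact_closedBall (0 : Eu N) r)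
    fun x hx => by
      by_contra h; exact hx (by simpa using hsupp x h)
  have hφc := hlip.continuous
  obtain ⟨B, hB⟩ := hcpt.exists_bound_of_continuous hφc
  set Φ : ℕ → Eu N → ℝ := fun n => (η n).normed volume ⋆[ContinuousLinearMap.lsmul ℝ ℝ, volume] φ with hΦ
  have hdb : ∀ x, ‖fderiv ℝ φ x‖ ≤ C := fun x => norm_fderiv_le_of_lipschitz ℝ hlip
  have hloc : LocallyIntegrable (fderiv ℝ φ) volume := by
    refine (MeasureTheory.locallyIntegrable_const (C:ℝ)).mono
      (measurable_fderiv ℝ φ).aestronglyMeasurable (Eventually.of_forall fun x => ?_)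
    simpa using hdb x
  have hder : ∀ n x, HasFDerivAt (Φ n) (((η n).normed volume ⋆[ContinuousLinearMap.lsmul ℝ ℝ, volume] fderiv ℝ φ) x) x := by
    intro n x
    have hIntg := (η n).integrable_normed (μ := (volume : Measure (Eu N)))
    have := hasFDerivAt_integral_of_dominated_loc_of_lip (μ := (volume : Measure (Eu N))) (𝕜 := ℝ)
      (F := fun x t => (η n).normed volume t * φ (x - t)) (x₀ := x) (s := univ)
      (F' := fun t => (η n).normed volume t • fderiv ℝ φ (x - t))
      (bound := fun t => (η n).normed volume t * C) univ_mem
      (Eventually.of_forall fun y => ((η n).continuous_normed.mul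
        (hφc.comp (continuous_const.sub continuous_id))).aestronglyMeasurable)
      ?_ ?_ ?_ (hIntg.mul_const _) ?_
    · exact this.2
    · refine Continuous.integrable_of_hasCompactSupport ((η n).continuous_normed.mul
        (hφc.comp (continuous_const.sub continuous_id))) ?_
      exact (η n).hasCompactSupport_normed.mul_right
    · exact ((η n).continuous_normed.measurable.smul ((measurable_fderiv ℝ φ).comp
        (measurable_const.sub measurable_id))).aestronglyMeasurable
    · refine Eventually.of_forall fun t => ?_
      refine LipschitzOnWith.of_dist_le_mul fun a _ b _ => ?_
      have h0 : 0 ≤ (η n).normed volume t := (η n).nonneg_normed t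
      have h1 : dist (φ (a - t)) (φ (b - t)) ≤ C * dist a b := by
        have := hlip.dist_le_mul (a - t) (b - t); simpa using this
      rw [Real.coe_nnabs, abs_of_nonneg (by positivity), Real.dist_eq, ← mul_sub, abs_mul,
        abs_of_nonneg h0, ← Real.dist_eq, mul_assoc]
      gcongr
    · have h1 := hlip.ae_differentiableAt (μ := (volume : Measure (Eu N)))
      have h2 : ∀ᵐ t : Eu N, DifferentiableAt ℝ φ (x - t) :=
        (Measure.measurePreserving_sub_left (volume : Measure (Eu N)) x).quasiMeasurePreserving.ae h1
      filter_upwards [h2] with t ht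
      have h3 : HasFDerivAt (fun y : Eu N => φ (y - t)) (fderiv ℝ φ (x - t)) x := by
        have h4 : HasFDerivAt (fun y : Eu N => y - t) (ContinuousLinearMap.id ℝ (Eu N)) x :=
          (hasFDerivAt_id x).sub_const t
        have := ht.hasFDerivAt.comp x h4
        rwa [ContinuousLinearMap.comp_id] at this
      exact h3.const_mul _
  have htest : ∀ n, IsTestFun (ball 0 R) (Φ n) := by
    intro n
    have hsub : Function.support (Φ n) ⊆ closedBall 0 (r + (R - r) / 2) := by
      refine (support_convolution_subset _).trans ?_
      rintro _ ⟨a, ha, b, hb, rfl⟩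
      rw [(η n).support_normed_eq] at ha
      have h1 : ‖a‖ < (η n).rOut := by simpa using ha
      have h2 := hsupp b hb
      have h3 := hηr n
      have h4 := norm_add_le a b
      rw [mem_closedBall_zero_iff]
      show ‖a + b‖ ≤ _
      linarith
    refine ⟨?_, ?_, ?_⟩
    · exact (η n).hasCompactSupport_normed.contDiff_convolution_left _ (η n).contDiff_normed
        hφc.locallyIntegrable
    · exact HasCompactSupport.of_support_subset_isCompact (isCompact_closedBall _ _) hsub
    · exact (closure_minimal hsub isClosed_closedBall).trans (closedBall_subset_ball (by linarith))
  have hconvd := ContDiffBump.ae_convolution_tendsto_right_of_locallyIntegrable (μ := volume)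
    (K := 2) hη0 (Eventually.of_forall fun n => ?_) hloc
  swap
  · show (R - r) / ((n:ℝ) + 2) ≤ 2 * ((R - r) / ((n:ℝ) + 2) / 2)
    linarith
  have hconv := fun x => ContDiffBump.convolution_tendsto_right_of_continuous (μ := volume) hη0 hφc x
  have hbd : ∀ n x, ‖((η n).normed volume ⋆[ContinuousLinearMap.lsmul ℝ ℝ, volume] fderiv ℝ φ) x‖ ≤ C := by
    intro n x
    have h1 : LipschitzWith C (Φ n) := by
      refine LipschitzWith.of_dist_le_mul fun a b => ?_
      have hi : ∀ a, Integrable (fun t => (η n).normed volume t • φ (a - t)) := fun a =>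
        Continuous.integrable_of_hasCompactSupport ((η n).continuous_normed.mul
          (hφc.comp (continuous_const.sub continuous_id))) (η n).hasCompactSupport_normed.mul_right
      rw [Real.dist_eq]
      change |(∫ t, (η n).normed volume t • φ (a - t)) - ∫ t, (η n).normed volume t • φ (b - t)| ≤ _
      rw [← integral_sub (hi a) (hi b), ← Real.norm_eq_abs]
      calc _ ≤ ∫ t, (η n).normed volume t * (C * dist a b) := by
            refine norm_integral_le_of_norm_le ((η n).integrable_normed.mul_const _)
              (Eventually.of_forall fun t => ?_)
            have h0 : 0 ≤ (η n).normed volume t := (η n).nonneg_normed t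
            rw [← smul_sub, smul_eq_mul, norm_mul, Real.norm_of_nonneg h0, Real.norm_eq_abs,
              ← Real.dist_eq]
            have := hlip.dist_le_mul (a - t) (b - t)
            simp only [dist_sub_right] at this
            gcongr
        _ = C * dist a b := by rw [integral_mul_const, (η n).integral_normed, one_mul]
    have := norm_fderiv_le_of_lipschitz ℝ h1 (x₀ := x)
    rwa [(hder n x).fderiv] at this
  have hfin : IsFiniteMeasure (volume.restrict (ball (0:Eu N) R)) :=
    ⟨by rw [Measure.restrict_apply_univ]; exact measure_ball_lt_top⟩
  have lim1 : Tendsto (fun n => ∫ x in ball (0:Eu N) R, ⟪X x, gradient (Φ n) x⟫) atTop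
      (𝓝 (∫ x in ball (0:Eu N) R, ⟪X x, gradient φ x⟫)) := by
    refine tendsto_integral_of_dominated_convergence (fun _ => MX * C) (fun n => ?_)
      (integrable_const _) (fun n => ?_) ?_
    · exact hX.inner (meas_grad _).aestronglyMeasurable
    · refine (ae_restrict_iff' measurableSet_ball).2 (Eventually.of_forall fun x hx => ?_)
      refine (norm_inner_le_norm _ _).trans ?_
      rw [norm_grad, (hder n x).fderiv]
      exact mul_le_mul (hMX x hx) (hbd n x) (norm_nonneg _) ((norm_nonneg _).trans (hMX x hx))
    · refine ae_restrict_of_ae ?_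
      filter_upwards [hconvd] with x hx
      simp only [inner_grad, (hder _ x).fderiv]
      exact ((ContinuousLinearMap.apply ℝ ℝ (X x)).continuous.tendsto _).comp hx
  have lim2 : Tendsto (fun n => ∫ x in ball (0:Eu N) R, F x * Φ n x) atTop
      (𝓝 (∫ x in ball (0:Eu N) R, F x * φ x)) := by
    refine tendsto_integral_of_dominated_convergence (fun _ => MF * B) (fun n => ?_)
      (integrable_const _) (fun n => ?_) ?_
    · exact hF.mul ((htest n).1.continuous.aestronglyMeasurable)
    · refine (ae_restrict_iff' measurableSet_ball).2 (Eventually.of_forall fun x hx => ?_)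
      rw [norm_mul]
      refine mul_le_mul (hMF x hx) ?_ (norm_nonneg _) ((norm_nonneg _).trans (hMF x hx))
      calc _ ≤ ∫ t, (η n).normed volume t * B := by
            refine norm_integral_le_of_norm_le ((η n).integrable_normed.mul_const _)
              (Eventually.of_forall fun t => ?_)
            have h0 : 0 ≤ (η n).normed volume t := (η n).nonneg_normed t
            rw [ContinuousLinearMap.lsmul_apply, smul_eq_mul, norm_mul, Real.norm_of_nonneg h0]
            exact mul_le_mul_of_nonneg_left (hB _) h0
        _ = B := by rw [integral_mul_const, (η n).integral_normed, one_mul]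
    · exact Eventually.of_forall fun x => (hconv x).const_mul _
  refine tendsto_nhds_unique lim1 ?_
  simp only [fun n => hsol (Φ n) (htest n)]
  exact lim2
end LS
end

noncomputable section
namespace LS

open Filter Topology

variable {N : ℕ}

lemma Gfun_mono {g : ℝ → ℝ} (hg : GCond g) {s t : ℝ} (hs : 0 ≤ s) (hst : s ≤ t) : Gfun g s ≤ Gfun g t := by
  have := Gfun_sub hg hs (hs.trans hst)
  have h2 : 0 ≤ ∫ r in s..t, g r :=
    intervalIntegral.integral_nonneg hst fun r hr => g_nonneg hg (hs.trans hr.1)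
  linarith

lemma WD.p_le {ρ L : ℝ} {e : Eu N} {W : Eu N → ℝ} {p : Eu N → Eu N} (h : WD ρ L e W p) (hL : 0 ≤ L)
    {x : Eu N} (hx : 0 < W x) : ‖p x‖ ≤ L := by
  have h1 := (h.strict x hx).hasFDerivAt.le_of_lip' hL (Eventually.of_forall fun y => by
    simpa [Real.norm_eq_abs] using h.lip y x)
  rwa [innerSL_apply_norm] at h1

def hj (g : ℝ → ℝ) (W : Eu N → ℝ) (p : Eu N → Eu N) (c : ℝ) (x : Eu N) : ℝ :=
  GG g (p x) * min 1 (W x / c)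

lemma hj_WC {g : ℝ → ℝ} (hg : GCond g) {ρ L : ℝ} {e : Eu N} {W : Eu N → ℝ} {p : Eu N → Eu N}
    (h : WD ρ L e W p) (hL : 0 ≤ L) {c : ℝ} (hc : 0 < c) : WC ρ (hj g W p c) := by
  have hW := h.wc.nonneg
  refine ⟨?_, fun x => mul_nonneg (GG_nonneg hg _) (le_min zero_le_one (div_nonneg (hW x) hc.le)), ?_⟩
  · rw [continuous_iff_continuousAt]
    intro x
    rcases (hW x).lt_or_eq with hx | hx
    · have h1 : ContinuousAt p x := h.pcont.continuousAt
        ((isOpen_lt continuous_const h.wc.cont).mem_nhds hx)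
      exact ((GG_cont hg).continuousAt.comp h1).mul
        ((continuous_const.min (h.wc.cont.div_const c)).continuousAt)
    · have h0 : hj g W p c x = 0 := by simp [hj, ← hx]
      rw [ContinuousAt, h0]
      have hb : ∀ y, ‖hj g W p c y‖ ≤ Gfun g L * (W y / c) := by
        intro y
        have hy0 : 0 ≤ W y / c := div_nonneg (hW y) hc.le
        have hnn : ‖hj g W p c y‖ = GG g (p y) * min 1 (W y / c) :=
          Real.norm_of_nonneg (mul_nonneg (GG_nonneg hg _) (le_min zero_le_one hy0))
        rw [hnn]
        rcases (hW y).lt_or_eq with hy | hy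
        · exact mul_le_mul (Gfun_mono hg (norm_nonneg _) (h.p_le hL hy)) (min_le_right _ _)
            (le_min zero_le_one hy0) ((GG_nonneg hg (p y)).trans (Gfun_mono hg (norm_nonneg _) (h.p_le hL hy)))
        · simp [← hy]
      refine squeeze_zero_norm hb ?_
      have : Continuous fun y => Gfun g L * (W y / c) := continuous_const.mul (h.wc.cont.div_const c)
      have h2 := this.tendsto x
      simpa [← hx] using h2
  · intro x hx
    by_contra hn
    have : W x = 0 := le_antisymm (not_lt.1 fun hh => hn (h.wc.supp x hh)) (hW x)
    simp [hj, this] at hx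

lemma energy {g : ℝ → ℝ} (hg : GCond g) {k : ℝ} (hk : 0 < k) (hk1 : k < 1) {ρ L : ℝ} (hρ : 0 < ρ)
    (hL : 0 ≤ L) {e : Eu N}
    (he : ‖e‖ = 1) {W : Eu N → ℝ} {p : Eu N → Eu N} (h : WD ρ L e W p) {c : ℝ} (hc : 0 < c) :
    ∃ H : Eu N → ENNReal, Measurable H ∧
      ∫⁻ x, H x ≤ ∫⁻ x in {x | 0 < W x}, ENNReal.ofReal (GG g (p x)) ∧
      ∀ x z Z θ D, c < RR k e W x → Con k ρ e W p x z Z θ D →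
        ENNReal.ofReal (∑ τ ∈ Z, θ τ * GG g (p (lin e x (τ / k)))) ≤ H x := by
  have hw := hj_WC hg h hL hc
  set w := hj g W p c with hwdef
  set ε : ℕ → ℝ := fun n => 1 / ((n:ℝ) + 1) with hε
  have hεpos : ∀ n, 0 < ε n := fun n => by simp only [hε]; positivity
  have hWε : ∀ n, WC ρ (fun a => W a + ε n * w a) := by
    intro n
    refine ⟨h.wc.cont.add (continuous_const.mul hw.cont),
      fun a => add_nonneg (h.wc.nonneg a) (mul_nonneg (hεpos n).le (hw.nonneg a)), fun a ha => ?_⟩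
    by_contra hne
    have h1 : W a = 0 := le_antisymm (not_lt.1 fun hh => hne (h.wc.supp a hh)) (h.wc.nonneg a)
    have h2 : w a = 0 := le_antisymm (not_lt.1 fun hh => hne (hw.supp a hh)) (hw.nonneg a)
    simp [h1, h2] at ha
  set F : ℕ → Eu N → ℝ := fun n x => (ε n)⁻¹ * (RR k e (fun a => W a + ε n * w a) x - RR k e W x) with hF
  have hcW := RR_cont hk hk1 he hρ h.wc
  have hcε := fun n => RR_cont hk hk1 he hρ (hWε n)
  have hFc : ∀ n, Continuous (F n) := fun n => continuous_const.mul ((hcε n).sub hcW)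
  have hF0 : ∀ n x, 0 ≤ F n x := by
    intro n x
    have := RR_contr hk hk1 he hρ hρ h.wc (hWε n) le_rfl
      (fun a => by have := mul_nonneg (hεpos n).le (hw.nonneg a); linarith) x
    exact mul_nonneg (inv_nonneg.2 (hεpos n).le) (by linarith)
  have hRi := (RR_WC hk hk1 he hρ h.wc (RR_supp hk hk1 he hρ h.wc)).integrable
  have hRεi := fun n => (RR_WC hk hk1 he hρ (hWε n) (RR_supp hk hk1 he hρ (hWε n))).integrable
  have hFi : ∀ n, ∫⁻ x, ENNReal.ofReal (F n x) = ENNReal.ofReal (∫ x, w x) := by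
    intro n
    have hFint : Integrable (F n) := ((hRεi n).sub hRi).const_mul _
    rw [← ofReal_integral_eq_lintegral_ofReal hFint
      (Eventually.of_forall (hF0 n))]
    congr 1
    simp only [hF]
    rw [integral_const_mul, integral_sub (hRεi n) hRi, RR_int hk hk1 he hρ h.wc,
      RR_int hk hk1 he hρ (hWε n), integral_add h.wc.integrable (hw.integrable.const_mul _),
      integral_const_mul]
    have := (hεpos n).ne'
    field_simp; ring
  refine ⟨fun x => liminf (fun n => ENNReal.ofReal (F n x)) atTop,
    Measurable.liminf fun n => (hFc n).measurable.ennreal_ofReal, ?_, ?_⟩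
  · refine (lintegral_liminf_le fun n => (hFc n).measurable.ennreal_ofReal).trans ?_
    simp only [hFi, liminf_const]
    rw [ofReal_integral_eq_lintegral_ofReal hw.integrable (Eventually.of_forall hw.nonneg),
      ← lintegral_indicator (isOpen_lt continuous_const h.wc.cont).measurableSet]
    refine lintegral_mono fun x => ?_
    by_cases hx : 0 < W x
    · rw [indicator_of_mem (show x ∈ {x | 0 < W x} from hx)]
      refine ENNReal.ofReal_le_ofReal ?_
      exact mul_le_of_le_one_right (GG_nonneg hg _) (min_le_left _ _)
    · have : W x = 0 := le_antisymm (not_lt.1 hx) (h.wc.nonneg x)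
      simp [hwdef, hj, this]
  · intro x z Z θ D hcx hCon
    have hwP : ∀ τ ∈ Z, θ τ * GG g (p (lin e x (τ / k))) = θ τ * w (lin e x (τ / k)) := by
      intro τ hτ
      have h1 : W (lin e x (τ / k)) = RR k e W x := ((hCon.dan.memZ τ).1 hτ).2
      simp only [hwdef, hj, h1]
      rw [min_eq_left, mul_one]
      rw [one_le_div hc]; exact hcx.le
    rw [Finset.sum_congr rfl hwP]
    refine le_of_forall_lt fun b hb => ?_
    have hbt : b ≠ ⊤ := hb.ne_top
    have hb' : b.toReal < ∑ τ ∈ Z, θ τ * w (lin e x (τ / k)) := by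
      rw [← ENNReal.ofReal_toReal hbt] at hb
      exact (ENNReal.ofReal_lt_ofReal_iff_of_nonneg ENNReal.toReal_nonneg).1 hb
    obtain ⟨α, hα1, hα2⟩ := exists_between hb'
    have h1 := hCon.pert w hw α hα2
    have hlim : Tendsto ε atTop (𝓝[>] 0) := tendsto_nhdsWithin_iff.2
      ⟨tendsto_one_div_add_atTop_nhds_zero_nat, Eventually.of_forall hεpos⟩
    have h2 := hlim.eventually h1
    have h3 : ENNReal.ofReal α ≤ liminf (fun n => ENNReal.ofReal (F n x)) atTop := by
      refine le_liminf_of_le (by isBoundedDefault) ?_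
      filter_upwards [h2] with n hn
      refine ENNReal.ofReal_le_ofReal ?_
      simp only [hF]
      rw [le_inv_mul_iff₀ (hεpos n)]
      linarith
    refine lt_of_lt_of_le ?_ h3
    rw [← ENNReal.ofReal_toReal hbt]
    exact (ENNReal.ofReal_lt_ofReal_iff (lt_of_le_of_lt ENNReal.toReal_nonneg hα1)).2 hα1

lemma gap {g : ℝ → ℝ} (hg : GCond g) {k : ℝ} (hk : 0 < k) (hk1 : k < 1) {ρ L : ℝ} (hρ : 0 < ρ)
    (hL : 0 ≤ L) {e : Eu N}
    (he : ‖e‖ = 1) {W : Eu N → ℝ} {p : Eu N → Eu N} (h : WD ρ L e W p) {c : ℝ} (hc : 0 < c) :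
    ∃ Gap : Eu N → ENNReal, Measurable Gap ∧
      (∫⁻ x, ENNReal.ofReal (GG g (gradient (RR k e W) x))) + ∫⁻ x, Gap x ≤
        (∫⁻ x in {x | 0 < W x}, ENNReal.ofReal (GG g (p x))) +
          ENNReal.ofReal (Gfun g (L / k)) * volume {x | 0 < W x ∧ W x ≤ c} ∧
      ∀ᵐ x, c < RR k e W x → HasGradientAt (RR k e W) (gradient (RR k e W) x) x ∧
        ∃ z Z θ D, Con k ρ e W p x z Z θ D ∧ ∀ τ ∈ Z, 0 ≤ ⟪gradient (RR k e W) x, e⟫ →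
          ENNReal.ofReal (θ τ * Breg g (p (lin e x (τ / k)) + (|⟪p (lin e x (τ / k)), e⟫| -
            ⟪p (lin e x (τ / k)), e⟫) • e) (gradient (RR k e W) x)) ≤ Gap x := by
  obtain ⟨H, hHm, hHi, hH⟩ := energy hg hk hk1 hρ hL he h hc
  set v := RR k e W with hv
  have hvc : Continuous v := RR_cont hk hk1 he hρ h.wc
  have hv0 : ∀ x, 0 ≤ v x := RR_nonneg hk hk1 he hρ h.wc
  have hLk : 0 ≤ L / k := by positivity
  have hlip : LipschitzWith (Real.toNNReal (L / k)) v := by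
    refine LipschitzWith.of_dist_le_mul fun x y => ?_
    rw [Real.coe_toNNReal _ hLk, Real.dist_eq, dist_eq_norm]
    exact RR_lip hk hk1 he hρ h.wc hL h.lip x y
  have hgrad : ∀ᵐ x, HasGradientAt v (gradient v x) x := by
    filter_upwards [hlip.ae_differentiableAt (μ := (volume : Measure (Eu N)))] with x hx
    exact hx.hasGradientAt
  have hgn : ∀ x, ‖gradient v x‖ ≤ L / k := by
    intro x
    rw [norm_grad]
    have := norm_fderiv_le_of_lipschitz ℝ hlip (x₀ := x)
    rwa [Real.coe_toNNReal _ hLk] at this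
  set A := {x | c < v x} with hA
  have hAm : MeasurableSet A := (isOpen_lt continuous_const hvc).measurableSet
  set I : Eu N → ENNReal := fun x => ENNReal.ofReal (GG g (gradient v x)) with hI
  have hIm : Measurable I := ((GG_cont hg).measurable.comp (meas_grad v)).ennreal_ofReal
  have hbad : ∀ᵐ x, x ∉ Bad k e W p := measure_eq_zero_iff_ae_notMem.1 (Bad_null hk hk1 hρ he h)
  have key : ∀ᵐ x, x ∈ A → ∃ z Z θ D, Con k ρ e W p x z Z θ D ∧ I x ≤ H x ∧
      ∀ τ ∈ Z, 0 ≤ ⟪gradient v x, e⟫ →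
          ENNReal.ofReal (θ τ * Breg g (p (lin e x (τ / k)) + (|⟪p (lin e x (τ / k)), e⟫| -
            ⟪p (lin e x (τ / k)), e⟫) • e) (gradient v x)) ≤ H x - I x := by
    filter_upwards [hgrad, hbad] with x hx1 hx2 hxA
    obtain ⟨z, Z, θ, D, hCon⟩ := exists_Con hk hk1 hρ he h hx2 (lt_trans hc hxA)
    obtain ⟨h1, h2, h3⟩ := hCon.grad _ hx1
    have h4 := hH x z Z θ D hxA hCon
    have hne : Z.Nonempty := by
      rw [Finset.nonempty_iff_ne_empty]
      rintro rfl
      have := hCon.sum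
      simp at this
    refine ⟨z, Z, θ, D, hCon, ?_, ?_⟩
    · refine le_trans (ENNReal.ofReal_le_ofReal ?_) h4
      obtain ⟨j, hj⟩ := hne
      rcases le_total 0 ⟪gradient v x, e⟫ with h0 | h0
      · have := jensen hg he (fun i hi => (hCon.th i hi).1.le) hCon.sum h2 h3 (Or.inl rfl)
          (by rwa [one_mul]) hj
        have h5 := mul_nonneg (hCon.th j hj).1.le (Breg_nonneg hg (p (lin e x (j / k)) +
          (1 * |⟪p (lin e x (j / k)), e⟫| - ⟪p (lin e x (j / k)), e⟫) • e) (gradient v x))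
        linarith
      · have := jensen hg he (fun i hi => (hCon.th i hi).1.le) hCon.sum h2 h3 (Or.inr rfl)
          (by linarith) hj
        have h5 := mul_nonneg (hCon.th j hj).1.le (Breg_nonneg hg (p (lin e x (j / k)) +
          (-1 * |⟪p (lin e x (j / k)), e⟫| - ⟪p (lin e x (j / k)), e⟫) • e) (gradient v x))
        linarith
    · intro τ hτ h0
      have := jensen hg he (fun i hi => (hCon.th i hi).1.le) hCon.sum h2 h3 (Or.inl rfl)
          (by rwa [one_mul]) hτ
      rw [one_mul] at this
      refine ENNReal.le_sub_of_add_le_left ENNReal.ofReal_ne_top (le_trans ?_ h4)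
      rw [← ENNReal.ofReal_add (GG_nonneg hg _) (mul_nonneg (hCon.th τ hτ).1.le (Breg_nonneg hg _ _))]
      exact ENNReal.ofReal_le_ofReal this
  refine ⟨A.indicator fun x => H x - I x, (hHm.sub hIm).indicator hAm, ?_, ?_⟩
  · rw [lintegral_indicator hAm, ← lintegral_add_compl I hAm]
    have h1 : (∫⁻ x in A, I x) + ∫⁻ x in A, (H x - I x) ≤ ∫⁻ x, H x := by
      rw [← lintegral_add_left hIm]
      refine le_trans (le_of_eq (setLIntegral_congr_fun_ae hAm ?_)) (setLIntegral_le_lintegral A H)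
      filter_upwards [key] with x hx hxA
      obtain ⟨z, Z, θ, D, -, h2, -⟩ := hx hxA
      exact add_tsub_cancel_of_le h2
    have hm0 : MeasurableSet {x | 0 < v x} := (isOpen_lt continuous_const hvc).measurableSet
    have hw0 : MeasurableSet {x | 0 < W x} := (isOpen_lt continuous_const h.wc.cont).measurableSet
    have hwc : MeasurableSet {x | c < W x} := (isOpen_lt continuous_const h.wc.cont).measurableSet
    have hfin : ∀ {U : Eu N → ℝ}, WC ρ U → volume {x | c < U x} ≠ ⊤ := by
      intro U hU
      refine ne_of_lt (lt_of_le_of_lt (measure_mono (t := ball (0:Eu N) ρ) fun x hx => ?_)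
        measure_ball_lt_top)
      simpa using hU.supp x (lt_trans hc hx)
    have h2 : ∫⁻ x in Aᶜ, I x ≤ ENNReal.ofReal (Gfun g (L / k)) * volume {x | 0 < W x ∧ W x ≤ c} := by
      have hvol : volume ({x | 0 < v x} \ A) = volume {x | 0 < W x ∧ W x ≤ c} := by
        have e1 : {x | 0 < W x ∧ W x ≤ c} = {x | 0 < W x} \ {x | c < W x} := by
          ext x; simp
        rw [e1, measure_sdiff (show A ⊆ {x | 0 < v x} from fun x hx => lt_trans hc hx) hAm.nullMeasurableSet
          (hfin (RR_WC hk hk1 he hρ h.wc (RR_supp hk hk1 he hρ h.wc))),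
          measure_sdiff (show {x | c < W x} ⊆ {x | 0 < W x} from fun x hx => lt_trans hc hx) hwc.nullMeasurableSet (hfin h.wc),
          RR_vol hk hk1 he hρ h.wc le_rfl, RR_vol hk hk1 he hρ h.wc hc.le]
      rw [← hvol, ← lintegral_indicator_const (hm0.diff hAm), ← lintegral_indicator hAm.compl]
      refine lintegral_mono fun x => ?_
      by_cases hxA : x ∈ A
      · simp [hxA]
      · rw [indicator_of_mem hxA]
        rcases (hv0 x).lt_or_eq with hx | hx
        · rw [indicator_of_mem (show x ∈ {x | 0 < v x} \ A from ⟨hx, hxA⟩)]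
          exact ENNReal.ofReal_le_ofReal (Gfun_mono hg (norm_nonneg _) (hgn x))
        · have h3 : fderiv ℝ v x = 0 := IsLocalMin.fderiv_eq_zero
            (Eventually.of_forall fun y => by rw [← hx]; exact hv0 y)
          have h4 : gradient v x = 0 := by
            rw [← norm_eq_zero, norm_grad, h3, norm_zero]
          simp [hI, h4, GG_zero]
    calc _ = ((∫⁻ x in A, I x) + ∫⁻ x in A, (H x - I x)) + ∫⁻ x in Aᶜ, I x := by
          rw [add_right_comm]
      _ ≤ _ := add_le_add (h1.trans hHi) h2
  · filter_upwards [hgrad, key] with x hx1 hx2 hx3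
    obtain ⟨z, Z, θ, D, h1, h2, h3⟩ := hx2 hx3
    refine ⟨hx1, z, Z, θ, D, h1, fun τ hτ h0 => ?_⟩
    rw [indicator_of_mem (show x ∈ A from hx3)]
    exact h3 τ hτ h0
end LS
end

noncomputable section
namespace LS

open Filter Topology

variable {N : ℕ}

structure Sol (R M : ℝ) (u : Eu N → ℝ) : Prop where
  hR : 0 < R
  hM : 0 ≤ M
  strict : ∀ x ∈ ball (0:Eu N) R, HasStrictFDerivAt u (innerSL ℝ (gradient u x)) x
  gcont : ContinuousOn (gradient u) (ball 0 R)
  gle : ∀ x ∈ ball (0:Eu N) R, ‖gradient u x‖ ≤ M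
  lip : ∀ x ∈ closedBall (0:Eu N) R, ∀ y ∈ closedBall (0:Eu N) R, |u x - u y| ≤ M * ‖x - y‖
  nonneg : ∀ x ∈ closedBall (0:Eu N) R, 0 ≤ u x
  bdry : ∀ x ∈ sphere (0:Eu N) R, u x = 0

lemma innerSL_grad (u : Eu N → ℝ) (x : Eu N) : innerSL ℝ (gradient u x) = fderiv ℝ u x := by
  ext y
  rw [innerSL_apply_apply, real_inner_comm, inner_grad]

lemma exists_Sol {R : ℝ} (hR : 0 < R) {u : Eu N → ℝ} (h1 : ContDiffOn ℝ 1 u (closedBall 0 R))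
    (h2 : ∀ x ∈ closedBall (0:Eu N) R, 0 ≤ u x) (h3 : ∀ x ∈ sphere (0:Eu N) R, u x = 0) :
    ∃ M, Sol R M u := by
  have hud : UniqueDiffOn ℝ (closedBall (0:Eu N) R) :=
    uniqueDiffOn_convex (convex_closedBall _ _) (by rw [interior_closedBall _ hR.ne']; exact ⟨0, by simpa⟩)
  have hc := h1.continuousOn_fderivWithin hud le_rfl
  obtain ⟨M, hM⟩ := (isCompact_closedBall (0:Eu N) R).exists_bound_of_continuousOn hc
  have hM0 : 0 ≤ M := (norm_nonneg _).trans (hM 0 (by simp [hR.le]))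
  have hnb : ∀ x ∈ ball (0:Eu N) R, closedBall (0:Eu N) R ∈ 𝓝 x := fun x hx =>
    mem_of_superset (isOpen_ball.mem_nhds hx) ball_subset_closedBall
  have hcd : ∀ x ∈ ball (0:Eu N) R, ContDiffAt ℝ 1 u x := fun x hx =>
    h1.contDiffAt (hnb x hx)
  have hcf : ContinuousOn (fderiv ℝ u) (ball (0:Eu N) R) := fun x hx =>
    ((hcd x hx).continuousAt_fderiv (by norm_num)).continuousWithinAt
  refine ⟨M, hR, hM0, fun x hx => ?_, ?_, fun x hx => ?_, fun x hx y hy => ?_, h2, h3⟩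
  · rw [innerSL_grad]
    exact (hcd x hx).hasStrictFDerivAt (by norm_num)
  · exact (InnerProductSpace.toDual ℝ (Eu N)).symm.continuous.comp_continuousOn hcf
  · rw [norm_grad, ← fderivWithin_of_mem_nhds (hnb x hx)]
    exact hM x (ball_subset_closedBall hx)
  · have := (convex_closedBall (0:Eu N) R).norm_image_sub_le_of_norm_fderivWithin_le
      (h1.differentiableOn (by norm_num)) hM hy hx
    rwa [Real.norm_eq_abs] at this

def Wt (R : ℝ) (u : Eu N → ℝ) (e : Eu N) (τ : ℝ) (x : Eu N) : ℝ :=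
  if ‖x‖ ≤ R then max (u x + τ * ⟪x, e⟫ - 2 * τ * R) 0 else 0

lemma Wt_nonneg (R : ℝ) (u : Eu N → ℝ) (e : Eu N) (τ : ℝ) (x : Eu N) : 0 ≤ Wt R u e τ x := by
  unfold Wt; split_ifs <;> simp

section
variable {R M : ℝ} {u : Eu N → ℝ}

lemma inner_le' {e : Eu N} (he : ‖e‖ = 1) {x : Eu N} (hx : ‖x‖ ≤ R) : |⟪x, e⟫| ≤ R := by
  have := abs_real_inner_le_norm x e
  rw [he, mul_one] at this; linarith

lemma exists_proj (hR : 0 < R) {e : Eu N} (he : ‖e‖ = 1) {x : Eu N} (hx : ‖x‖ ≤ R) :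
    ∃ y : Eu N, ‖y‖ = R ∧ ‖x - y‖ = R - ‖x‖ := by
  by_cases h0 : x = 0
  · exact ⟨R • e, by simp [norm_smul, he, hR.le], by simp [h0, norm_smul, he, hR.le]⟩
  · have hp : 0 < ‖x‖ := norm_pos_iff.2 h0
    refine ⟨(R / ‖x‖) • x, ?_, ?_⟩
    · rw [norm_smul, Real.norm_of_nonneg (by positivity)]; field_simp
    · have : x - (R / ‖x‖) • x = (1 - R / ‖x‖) • x := by rw [sub_smul, one_smul]
      rw [this, norm_smul, Real.norm_eq_abs, abs_of_nonpos]
      · field_simp; ring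
      · rw [sub_nonpos, one_le_div hp]; exact hx

lemma Sol.u_le (h : Sol R M u) {e : Eu N} (he : ‖e‖ = 1) {x : Eu N} (hx : ‖x‖ ≤ R) :
    u x ≤ M * (R - ‖x‖) := by
  obtain ⟨y, hy1, hy2⟩ := exists_proj h.hR he hx
  have := (abs_le.1 (h.lip x (by simpa using hx) y (by simp [hy1]))).2
  rw [h.bdry y (by simp [hy1]), hy2] at this
  linarith

lemma Wt_lip_in (h : Sol R M u) {e : Eu N} (he : ‖e‖ = 1) {τ : ℝ} (hτ : 0 ≤ τ) (hτ1 : τ ≤ 1) {x y : Eu N}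
    (hx : ‖x‖ ≤ R) (hy : ‖y‖ ≤ R) : |Wt R u e τ x - Wt R u e τ y| ≤ (M + 1) * ‖x - y‖ := by
  simp only [Wt, hx, hy, if_true]
  refine (abs_max_sub_max_le_max _ _ _ _).trans ?_
  have h1 := abs_le.1 (h.lip x (by simpa using hx) y (by simpa using hy))
  have h2 := abs_real_inner_le_norm (x - y) e
  rw [he, mul_one, inner_sub_left, abs_le] at h2
  have h0 := norm_nonneg (x - y)
  have hM := h.hM
  rw [sub_self, abs_zero]
  refine max_le (abs_le.2 ?_) (by positivity)
  constructor <;> nlinarith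

lemma Wt_le_in (h : Sol R M u) {e : Eu N} (he : ‖e‖ = 1) {τ : ℝ} (hτ : 0 ≤ τ) (hτ1 : τ ≤ 1) {x : Eu N}
    (hx : ‖x‖ ≤ R) : Wt R u e τ x ≤ (M + 1) * (R - ‖x‖) := by
  obtain ⟨y, hy1, hy2⟩ := exists_proj h.hR he hx
  have h1 := Wt_lip_in h he hτ hτ1 hx hy1.le
  have h2 : Wt R u e τ y = 0 := by
    have h3 := abs_le.1 (inner_le' he hy1.le)
    have hR := h.hR
    simp only [Wt, hy1.le, if_true, h.bdry y (by simp [hy1])]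
    refine max_eq_right ?_
    nlinarith
  rw [h2, hy2, sub_zero] at h1
  exact (le_abs_self _).trans h1

lemma Wt_lip (h : Sol R M u) {e : Eu N} (he : ‖e‖ = 1) {τ : ℝ} (hτ : 0 ≤ τ) (hτ1 : τ ≤ 1) (x y : Eu N) :
    |Wt R u e τ x - Wt R u e τ y| ≤ (M + 1) * ‖x - y‖ := by
  have hM := h.hM
  have key : ∀ x y : Eu N, ‖x‖ ≤ R → ¬ ‖y‖ ≤ R → |Wt R u e τ x - Wt R u e τ y| ≤ (M + 1) * ‖x - y‖ := by
    intro x y hx hy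
    have h1 := Wt_le_in h he hτ hτ1 hx
    have h2 : Wt R u e τ y = 0 := by simp [Wt, hy]
    rw [h2, sub_zero, abs_of_nonneg (Wt_nonneg _ _ _ _ _)]
    refine h1.trans ?_
    have := abs_norm_sub_norm_le x y
    rw [abs_le] at this
    have h5 : R - ‖x‖ ≤ ‖x - y‖ := by linarith [not_le.1 hy]
    gcongr
  by_cases hx : ‖x‖ ≤ R <;> by_cases hy : ‖y‖ ≤ R
  · exact Wt_lip_in h he hτ hτ1 hx hy
  · exact key x y hx hy
  · rw [abs_sub_comm, norm_sub_rev]; exact key y x hy hx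
  · simp only [Wt, hx, hy, if_false, sub_self, abs_zero]; positivity

lemma Wt_lipW (h : Sol R M u) {e : Eu N} (he : ‖e‖ = 1) {τ : ℝ} (hτ : 0 ≤ τ) (hτ1 : τ ≤ 1) :
    LipschitzWith (Real.toNNReal (M + 1)) (Wt R u e τ) := by
  have hM := h.hM
  refine LipschitzWith.of_dist_le_mul fun x y => ?_
  rw [Real.coe_toNNReal _ (by positivity), Real.dist_eq, dist_eq_norm]
  exact Wt_lip h he hτ hτ1 x y

lemma Wt_pos {e : Eu N} {τ : ℝ} {x : Eu N}
    (hx : 0 < Wt R u e τ x) : ‖x‖ ≤ R ∧ Wt R u e τ x = u x + τ * ⟪x, e⟫ - 2 * τ * R := by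
  unfold Wt at hx ⊢
  split_ifs at hx ⊢ with hR
  · refine ⟨hR, max_eq_left ?_⟩
    by_contra hn
    rw [max_eq_right (not_le.1 hn).le] at hx
    exact lt_irrefl _ hx
  · exact absurd hx (lt_irrefl _)

/-- radius of the support of `Wt` -/
def rho (R M τ : ℝ) : ℝ := R - τ * R / (2 * (M + 1))

lemma rho_pos (h : Sol R M u) {τ : ℝ} (hτ1 : τ ≤ 1) : 0 < rho R M τ := by
  have hM := h.hM
  have hR := h.hR
  unfold rho
  rw [sub_pos, div_lt_iff₀ (by positivity)]
  nlinarith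

lemma rho_lt (h : Sol R M u) {τ : ℝ} (hτ : 0 < τ) : rho R M τ < R := by
  have hM := h.hM
  have hR := h.hR
  have : 0 < τ * R / (2 * (M + 1)) := by positivity
  unfold rho; linarith

lemma Wt_WC (h : Sol R M u) {e : Eu N} (he : ‖e‖ = 1) {τ : ℝ} (hτ : 0 < τ) (hτ1 : τ ≤ 1) :
    WC (rho R M τ) (Wt R u e τ) := by
  refine ⟨(Wt_lipW h he hτ.le hτ1).continuous, Wt_nonneg _ _ _ _, fun x hx => ?_⟩
  obtain ⟨h1, h2⟩ := Wt_pos hx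
  rw [h2] at hx
  have h3 := h.u_le he h1
  have h4 := abs_le.1 (inner_le' he h1)
  have hM := h.hM
  have hR := h.hR
  unfold rho
  rw [lt_sub_iff_add_lt, ← lt_sub_iff_add_lt', div_lt_iff₀ (by positivity)]
  nlinarith

lemma Wt_WD (h : Sol R M u) {e : Eu N} (he : ‖e‖ = 1) {τ : ℝ} (hτ : 0 < τ) (hτ1 : τ ≤ 1)
    (hnd : volume {x ∈ ball (0:Eu N) R | ⟪gradient u x, e⟫ = -τ} = 0) :
    WD (rho R M τ) (M + 1) e (Wt R u e τ) (fun x => gradient u x + τ • e) := by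
  have hwc := Wt_WC h he hτ hτ1
  have hb : ∀ x, 0 < Wt R u e τ x → x ∈ ball (0:Eu N) R := fun x hx => by
    simpa using (hwc.supp x hx).trans (rho_lt h hτ)
  refine ⟨hwc, Wt_lip h he hτ.le hτ1, fun x hx => ?_, ?_, ?_⟩
  · have h1 := h.strict x (hb x hx)
    have h2 : HasStrictFDerivAt (fun y => u y + τ * ⟪y, e⟫ - 2 * τ * R)
        (innerSL ℝ (gradient u x + τ • e)) x := by
      have h3 : HasStrictFDerivAt (fun y : Eu N => (innerSL ℝ e) y) (innerSL ℝ e) x :=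
        (innerSL ℝ e).hasStrictFDerivAt
      have h4 := (h1.add (h3.const_mul τ)).sub_const (2 * τ * R)
      have e1 : innerSL ℝ (gradient u x + τ • e) = innerSL ℝ (gradient u x) + τ • innerSL ℝ e := by
        ext y; simp [inner_add_left, inner_smul_left]
      have e2 : (fun y => u y + τ * ⟪y, e⟫ - 2 * τ * R) =
          fun y => (u + fun y => τ * ((innerSL ℝ) e) y) y - 2 * τ * R := by
        funext y; simp [real_inner_comm]
      rw [e1, e2]
      exact h4
    refine h2.congr_of_eventuallyEq ?_
    filter_upwards [(isOpen_lt continuous_const hwc.cont).mem_nhds hx] with y hy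
    exact (Wt_pos hy).2.symm
  · exact (h.gcont.mono hb).add continuousOn_const
  · refine measure_mono_null (fun x hx => ?_) hnd
    refine ⟨hb x hx.1, ?_⟩
    have := hx.2
    rw [inner_add_left, inner_smul_left, inner_ee he] at this
    rw [conj_trivial] at this; linarith

lemma Wt_near (h : Sol R M u) {e : Eu N} (he : ‖e‖ = 1) {τ : ℝ} (hτ : 0 ≤ τ) {x : Eu N} (hx : ‖x‖ ≤ R) :
    |Wt R u e τ x - u x| ≤ 3 * τ * R := by
  have h1 := abs_le.1 (inner_le' he hx)
  have h2 := h.nonneg x (by simpa using hx)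
  have hR := h.hR
  simp only [Wt, hx, if_true]
  rw [abs_le]
  have h4 : -(τ * R) ≤ τ * ⟪x, e⟫ := by nlinarith
  have h5 : τ * ⟪x, e⟫ ≤ τ * R := by nlinarith
  have h6 := mul_nonneg hτ hR.le
  rcases max_cases (u x + τ * ⟪x, e⟫ - 2 * τ * R) 0 with ⟨h3, -⟩ | ⟨h3, h7⟩ <;> rw [h3] <;> constructor <;> linarith

lemma Wt_zero (h : Sol R M u) (e : Eu N) {x : Eu N} (hx : ‖x‖ ≤ R) : Wt R u e 0 x = u x := by
  simp [Wt, hx, h.nonneg x (by simpa using hx)]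

lemma small_level {w : Eu N → ℝ} (hw : Measurable w) {B : Set (Eu N)} (hB : MeasurableSet B)
    (hfin : volume B ≠ ⊤) {η : ℝ} (hη : 0 < η) :
    ∃ a > 0, ∀ b ≤ a, volume {x ∈ B | 0 < w x ∧ w x ≤ b} ≤ ENNReal.ofReal η := by
  have h1 : Tendsto (fun n : ℕ => volume {x ∈ B | 0 < w x ∧ w x ≤ 1 / ((n:ℝ) + 1)}) atTop
      (𝓝 (volume (⋂ n : ℕ, {x ∈ B | 0 < w x ∧ w x ≤ 1 / ((n:ℝ) + 1)}))) := by
    refine tendsto_measure_iInter_atTop (fun n => ?_) ?_ ⟨0, ?_⟩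
    · exact (hB.inter ((measurableSet_lt measurable_const hw).inter
        (measurableSet_le hw measurable_const))).nullMeasurableSet
    · intro m n hmn x hx
      refine ⟨hx.1, hx.2.1, hx.2.2.trans ?_⟩
      have : (m:ℝ) ≤ n := by exact_mod_cast hmn
      gcongr
    · exact ((measure_mono fun x hx => hx.1).trans_lt hfin.lt_top).ne
  have h2 : (⋂ n : ℕ, {x ∈ B | 0 < w x ∧ w x ≤ 1 / ((n:ℝ) + 1)}) = ∅ := by
    ext x
    simp only [mem_iInter, mem_empty_iff_false, iff_false]
    intro hx
    obtain ⟨n, hn⟩ := exists_nat_one_div_lt (hx 0).2.1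
    exact absurd (hx n).2.2 (not_le.2 hn)
  rw [h2, measure_empty] at h1
  obtain ⟨n, hn⟩ := (h1.eventually (ge_mem_nhds (ENNReal.ofReal_pos.2 hη))).exists
  refine ⟨1 / ((n:ℝ) + 1), by positivity, fun b hb => le_trans (measure_mono fun x hx => ?_) hn⟩
  exact ⟨hx.1, hx.2.1, hx.2.2.trans hb⟩

lemma exists_tau (R : ℝ) (u : Eu N → ℝ) (e : Eu N) {a : ℝ} (ha : 0 < a) :
    ∃ τ, 0 < τ ∧ τ < a ∧ volume {x ∈ ball (0:Eu N) R | ⟪gradient u x, e⟫ = -τ} = 0 := by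
  have hm : Measurable fun x => -⟪gradient u x, e⟫ := ((meas_grad u).inner measurable_const).neg
  have h1 := Measure.countable_meas_level_set_pos (μ := volume.restrict (ball (0:Eu N) R)) hm
  have h2 : ¬ (Ioo 0 a).Countable := by
    rw [← Cardinal.le_aleph0_iff_set_countable, Cardinal.mk_Ioo_real ha, not_le]
    exact Cardinal.aleph0_lt_continuum
  obtain ⟨τ, hτ, hn⟩ : ∃ τ ∈ Ioo 0 a, ¬ τ ∈ {t : ℝ | 0 < volume.restrict (ball (0:Eu N) R) {x | -⟪gradient u x, e⟫ = t}} := by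
    by_contra hcon
    push Not at hcon
    exact h2 (h1.mono hcon)
  refine ⟨τ, hτ.1, hτ.2, ?_⟩
  simp only [mem_ofPred_eq, not_lt, nonpos_iff_eq_zero] at hn
  have hms : MeasurableSet {x | -⟪gradient u x, e⟫ = τ} := hm (measurableSet_singleton τ)
  rw [Measure.restrict_apply hms] at hn
  refine measure_mono_null ?_ hn
  intro x hx
  refine ⟨?_, hx.1⟩
  show -⟪gradient u x, e⟫ = τ
  rw [hx.2, neg_neg]
end
end LS
end

noncomputable section
namespace LS

open Filter Topology

variable {N : ℕ}

lemma exists_fbar {R K : ℝ} (hR : 0 < R) (hK : 0 ≤ K) {f : ℝ → ℝ → ℝ} (hf : FCond R f) :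
    ∃ F : ℝ → ℝ → ℝ, Continuous (fun q : ℝ × ℝ => F q.1 q.2) ∧ (∀ c, Antitone fun r => F r c) ∧
      (∀ r ∈ Icc 0 R, ∀ c ∈ Icc 0 K, F r c = f r c) ∧
      (∀ ω > 0, ∃ δ > 0, ∀ r c c', |c - c'| < δ → |F r c - F r c'| ≤ ω) ∧
      ∃ MF, ∀ r c, |F r c| ≤ MF := by
  have hcp : IsCompact (Icc (0:ℝ) R ×ˢ Icc (0:ℝ) K) := isCompact_Icc.prod isCompact_Icc
  have hc : ContinuousOn (fun q : ℝ × ℝ => f q.1 q.2) (Icc 0 R ×ˢ Icc 0 K) :=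
    hf.1.mono (prod_mono le_rfl fun c hc => hc.1)
  have hu := hcp.uniformContinuousOn_of_continuous hc
  set P : ℝ → ℝ := fun r => projIcc 0 R hR.le r with hP
  set Q : ℝ → ℝ := fun c => projIcc 0 K hK c with hQ
  have hPc : Continuous P := continuous_subtype_val.comp continuous_projIcc
  have hQc : Continuous Q := continuous_subtype_val.comp continuous_projIcc
  have hmem : ∀ r c, (P r, Q c) ∈ Icc (0:ℝ) R ×ˢ Icc (0:ℝ) K := fun r c =>
    ⟨(projIcc 0 R hR.le r).2, (projIcc 0 K hK c).2⟩
  refine ⟨fun r c => f (P r) (Q c), ?_, ?_, ?_, ?_, ?_⟩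
  · exact hc.comp_continuous (f := fun q : ℝ × ℝ => (P q.1, Q q.2)) (by fun_prop) fun q => hmem _ _
  · intro c r r' hrr
    exact hf.2 _ (hmem r c).2.1 _ (hmem r c).1 _ (hmem r' c).1 (monotone_projIcc hR.le hrr)
  · intro r hr c hc
    simp only [hP, hQ, projIcc_of_mem _ hr, projIcc_of_mem _ hc]
  · intro ω hω
    obtain ⟨δ, hδ, H⟩ := Metric.uniformContinuousOn_iff.1 hu ω hω
    refine ⟨δ, hδ, fun r c c' h => ?_⟩
    have := H _ (hmem r c) _ (hmem r c') (by
      rw [Prod.dist_eq, dist_self, max_lt_iff]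
      refine ⟨hδ, lt_of_le_of_lt ?_ h⟩
      rw [Real.dist_eq]
      exact abs_projIcc_sub_projIcc hK)
    rw [Real.dist_eq] at this
    exact this.le
  · obtain ⟨MF, hMF⟩ := hcp.exists_bound_of_continuousOn hc
    exact ⟨MF, fun r c => hMF _ (hmem r c)⟩

lemma core {g : ℝ → ℝ} (hg : GCond g) {R M : ℝ} {u : Eu N → ℝ} (hS : Sol R M u) {F : ℝ → ℝ → ℝ}
    (hF : Continuous (fun q : ℝ × ℝ => F q.1 q.2)) (ha : ∀ c, Antitone fun r => F r c)
    {MF : ℝ} (hMF : ∀ r c, |F r c| ≤ MF)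
    (hsol : ∀ φ : Eu N → ℝ, IsTestFun (ball 0 R) φ →
      ∫ x in ball (0:Eu N) R, ⟪gvec g (gradient u x), gradient φ x⟫ =
        ∫ x in ball (0:Eu N) R, F ‖x‖ (u x) * φ x)
    {e : Eu N} (he : ‖e‖ = 1) {τ : ℝ} (hτ : 0 < τ) (hτ1 : τ ≤ 1)
    {k : ℝ} (hk2 : 1 / 2 ≤ k) (hk1 : k < 1) {ω : ℝ} (hω0 : 0 ≤ ω)
    (hω : ∀ r c c', |c - c'| ≤ 3 * τ * R + 10 * (M + 1) * R * (1 - k) → |F r c - F r c'| ≤ ω) :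
    (∫⁻ x in {x | 0 < Wt R u e τ x}, ENNReal.ofReal (GG g (gradient u x + τ • e))) ≠ ⊤ ∧
    (∫⁻ x in {x | 0 < Wt R u e τ x}, ENNReal.ofReal (GG g (gradient u x + τ • e))) ≤
      (∫⁻ x, ENNReal.ofReal (GG g (gradient (RR k e (Wt R u e τ)) x))) +
      ENNReal.ofReal ((ω * (10 * (M + 1) * R * (1 - k)) + 2 * τ * g (M + 1)) * volume.real (ball (0:Eu N) R) +
        g M * M * volume.real {x ∈ ball (0:Eu N) R | 0 < Wt R u e 0 x ∧ Wt R u e 0 x ≤ 3 * τ * R}) := by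
  have hk : 0 < k := by linarith
  have hM := hS.hM
  have hR := hS.hR
  set W := Wt R u e τ with hWd
  have hwc : WC (rho R M τ) W := Wt_WC hS he hτ hτ1
  have hρ := rho_pos hS hτ1 (τ := τ)
  have hρR := rho_lt hS hτ
  have hlipW : LipschitzWith (Real.toNNReal (M + 1)) W := Wt_lipW hS he hτ.le hτ1
  have hL0 : 0 ≤ M + 1 := by positivity
  set v := RR k e W with hvd
  have hvc : WC (rho R M τ) v := RR_WC hk hk1 he hρ hwc (RR_supp hk hk1 he hρ hwc)
  have hLk : 0 ≤ (M + 1) / k := by positivity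
  have hlipv : LipschitzWith (Real.toNNReal ((M + 1) / k)) v := by
    refine LipschitzWith.of_dist_le_mul fun x y => ?_
    rw [Real.coe_toNNReal _ hLk, Real.dist_eq, dist_eq_norm]
    exact RR_lip hk hk1 he hρ hwc hL0 (Wt_lip hS he hτ.le hτ1) x y
  set B := ball (0:Eu N) R with hB
  have hBm : MeasurableSet B := measurableSet_ball
  have hBfin : volume B < ⊤ := measure_ball_lt_top
  have : IsFiniteMeasure (volume.restrict B) := ⟨by simpa using hBfin⟩
  have hXc : ∀ x ∈ B, ‖gvec g (gradient u x)‖ ≤ g M := by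
    intro x hx
    rw [gvec_norm hg]
    exact (g_strictMono hg).monotoneOn (norm_nonneg _) hM (hS.gle x hx)
  have hXm : Measurable fun x => gvec g (gradient u x) := (gvec_cont hg).measurable.comp (meas_grad u)
  have huc : ContinuousOn u B := fun x hx =>
    (hS.strict x hx).hasFDerivAt.continuousAt.continuousWithinAt
  have hFu : ContinuousOn (fun x => F ‖x‖ (u x)) B :=
    hF.comp_continuousOn (f := fun x : Eu N => (‖x‖, u x)) (continuous_norm.continuousOn.prodMk huc)
  have hvW : ∀ x, |v x - W x| ≤ 10 * (M + 1) * R * (1 - k) := by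
    intro x
    refine (RR_near hk2 hk1 he hρ hwc hL0 (Wt_lip hS he hτ.le hτ1) x).trans ?_
    have : 0 ≤ 1 - k := by linarith
    gcongr
  set T := 10 * (M + 1) * R * (1 - k) with hT
  have hw := weak_lip (X := fun x => gvec g (gradient u x)) (F := fun x => F ‖x‖ (u x)) (φ := fun x => v x - W x)
    hXm.aestronglyMeasurable hXc (hFu.aestronglyMeasurable hBm) (MF := MF) (fun x _ => hMF _ _) hsol
    (hlipv.sub hlipW) hρR (fun x hx => by
      by_contra hn
      have h1 : W x = 0 := le_antisymm (not_lt.1 fun hh => hn (hwc.supp x hh).le) (hwc.nonneg x)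
      have h2 : v x = 0 := le_antisymm (not_lt.1 fun hh => hn (hvc.supp x hh).le) (hvc.nonneg x)
      exact hx (by simp [h1, h2]))
  -- lower bound of the right-hand side
  have hIc : Continuous fun x => ∫ c in (W x)..(v x), F ‖x‖ c := by
    have hun : Continuous (Function.uncurry fun (x : Eu N) c => F ‖x‖ c) :=
      hF.comp (f := fun q : Eu N × ℝ => (‖q.1‖, q.2)) (by fun_prop)
    have h1 := intervalIntegral.continuous_parametric_intervalIntegral_of_continuous (a₀ := 0)
      (μ := volume) hun hwc.cont
    have h2 := intervalIntegral.continuous_parametric_intervalIntegral_of_continuous (a₀ := 0)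
      (μ := volume) hun hvc.cont
    have h3 : (fun x => ∫ c in (W x)..(v x), F ‖x‖ c) =
        fun x => (∫ c in (0:ℝ)..(v x), F ‖x‖ c) - ∫ c in (0:ℝ)..(W x), F ‖x‖ c := by
      funext x
      have hci : ∀ a b, IntervalIntegrable (fun c => F ‖x‖ c) volume a b := fun a b =>
        (hF.comp (f := fun c : ℝ => (‖x‖, c)) (by fun_prop)).intervalIntegrable a b
      rw [intervalIntegral.integral_interval_sub_left (hci _ _) (hci _ _)]
    rw [h3]; exact h2.sub h1
  have hIi : IntegrableOn (fun x => ∫ c in (W x)..(v x), F ‖x‖ c) B :=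
    (hIc.continuousOn.integrableOn_compact (isCompact_closedBall 0 R)).mono_set ball_subset_closedBall
  have hpt : ∀ x ∈ B, (∫ c in (W x)..(v x), F ‖x‖ c) - ω * T ≤ F ‖x‖ (u x) * (v x - W x) := by
    intro x hx
    have hxR : ‖x‖ ≤ R := by simpa using (ball_subset_closedBall hx)
    have h1 := intervalIntegral.norm_integral_le_of_norm_le_const (a := W x) (b := v x)
      (f := fun c => F ‖x‖ c - F ‖x‖ (u x)) (C := ω) (fun c hc => by
        refine hω _ _ _ ?_
        have h2 := Wt_near hS he hτ.le hxR
        have h3 : |c - W x| ≤ |v x - W x| := abs_sub_left_of_mem_uIcc (uIoc_subset_uIcc hc)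
        have h4 := abs_sub_le c (W x) (u x)
        have h5 := hvW x
        simp only [hWd] at *
        linarith)
    have hci : IntervalIntegrable (fun c => F ‖x‖ c) volume (W x) (v x) :=
        (hF.comp (f := fun c : ℝ => (‖x‖, c)) (by fun_prop)).intervalIntegrable _ _
    rw [intervalIntegral.integral_sub hci intervalIntegrable_const, intervalIntegral.integral_const,
      smul_eq_mul, Real.norm_eq_abs] at h1
    have h2 := (abs_le.1 h1).2
    have h3 : ω * |v x - W x| ≤ ω * T := mul_le_mul_of_nonneg_left (hvW x) hω0
    linarith
  have hRHS : -(ω * T * volume.real B) ≤ ∫ x in B, F ‖x‖ (u x) * (v x - W x) := by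
    have h0 : 0 ≤ ∫ x in B, ∫ c in (W x)..(v x), F ‖x‖ c := by
      rw [setIntegral_eq_integral_of_forall_compl_eq_zero]
      · exact radial_double hk hk1 he hρ hwc hF ha
      · intro x hx
        have hxn : ¬ ‖x‖ < rho R M τ := fun hh => hx (by simpa [hB] using hh.trans hρR)
        have h1 : W x = 0 := le_antisymm (not_lt.1 fun hh => hxn (hwc.supp x hh)) (hwc.nonneg x)
        have h2 : v x = 0 := le_antisymm (not_lt.1 fun hh => hxn (hvc.supp x hh)) (hvc.nonneg x)
        simp [h1, h2]
    have h1 : ∫ x in B, ((∫ c in (W x)..(v x), F ‖x‖ c) - ω * T) ≤ ∫ x in B, F ‖x‖ (u x) * (v x - W x) := by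
      refine setIntegral_mono_on (hIi.sub (integrable_const _)) ?_ hBm hpt
      refine Integrable.of_bound (C := MF * T) ?_ ?_
      · exact (hFu.mul (hvc.cont.sub hwc.cont).continuousOn).aestronglyMeasurable hBm
      · refine Eventually.of_forall fun x => ?_
        rw [norm_mul]
        exact mul_le_mul (hMF _ _) (hvW x) (norm_nonneg _) ((abs_nonneg _).trans (hMF 0 0))
    rw [integral_sub hIi (integrable_const _), integral_const, smul_eq_mul, measureReal_restrict_apply_univ] at h1
    linarith [mul_comm (volume.real B) (ω * T)]
  -- upper bound of the left-hand side
  set S := {x ∈ B | 0 < Wt R u e 0 x ∧ Wt R u e 0 x ≤ 3 * τ * R} with hSd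
  have hW0m : Measurable (Wt R u e 0) := (Wt_lipW hS he le_rfl zero_le_one).continuous.measurable
  have hSm : MeasurableSet S := hBm.inter ((measurableSet_lt measurable_const hW0m).inter
    (measurableSet_le hW0m measurable_const))
  have hPm : MeasurableSet {x | 0 < W x} := (isOpen_lt continuous_const hwc.cont).measurableSet
  set J : Eu N → ℝ := {x | 0 < W x}.indicator (fun x => GG g (gradient u x + τ • e)) with hJ
  have hgL := g_nonneg hg hL0
  have hgM := g_nonneg hg hM
  have hGv : ∀ x, ‖gradient v x‖ ≤ (M + 1) / k := by
    intro x
    rw [norm_grad]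
    have := norm_fderiv_le_of_lipschitz ℝ hlipv (x₀ := x)
    rwa [Real.coe_toNNReal _ hLk] at this
  have hJi : IntegrableOn J B := by
    refine Integrable.of_bound (C := Gfun g (M + 1)) ?_ ?_
    · exact (((GG_cont hg).measurable.comp ((meas_grad u).add_const _)).indicator hPm).aestronglyMeasurable
    · filter_upwards [ae_restrict_mem hBm] with x hx
      refine (norm_indicator_le_norm_self _ _).trans ?_
      rw [Real.norm_of_nonneg (GG_nonneg hg _)]
      refine Gfun_mono hg (norm_nonneg _) ((norm_add_le _ _).trans ?_)
      rw [norm_smul, he, Real.norm_of_nonneg hτ.le]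
      have := hS.gle x hx
      linarith
  have hGi : IntegrableOn (fun x => GG g (gradient v x)) B := by
    refine Integrable.of_bound (C := Gfun g ((M + 1) / k)) ?_ ?_
    · exact ((GG_cont hg).measurable.comp (meas_grad v)).aestronglyMeasurable
    · refine Eventually.of_forall fun x => ?_
      rw [Real.norm_of_nonneg (GG_nonneg hg _)]
      exact Gfun_mono hg (norm_nonneg _) (hGv x)
  have hSi : IntegrableOn (S.indicator fun _ => g M * M) B := (integrable_const _).indicator hSm
  have hLHS : ∫ x in B, ⟪gvec g (gradient u x), gradient (fun x => v x - W x) x⟫ ≤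
      ∫ x in B, (GG g (gradient v x) - J x + 2 * τ * g (M + 1) + S.indicator (fun _ => g M * M) x) := by
    refine integral_mono_ae ?_ (((hGi.sub hJi).add (integrable_const _)).add hSi) ?_
    · have hlip := hlipv.sub hlipW
      refine Integrable.of_bound (C := g M * ((Real.toNNReal ((M + 1) / k) + Real.toNNReal (M + 1) : NNReal) : ℝ)) ?_ ?_
      · exact (hXm.inner (meas_grad _)).aestronglyMeasurable
      · filter_upwards [ae_restrict_mem hBm] with x hx
        refine (norm_inner_le_norm _ _).trans (mul_le_mul (hXc x hx) ?_ (norm_nonneg _) hgM)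
        rw [norm_grad]
        exact norm_fderiv_le_of_lipschitz ℝ hlip
    · filter_upwards [ae_restrict_mem hBm,
        ae_restrict_of_ae (s := B) (hlipv.ae_differentiableAt (μ := (volume : Measure (Eu N)))),
        ae_restrict_of_ae (s := B) (hlipW.ae_differentiableAt (μ := (volume : Measure (Eu N))))] with x hx h1 h2
      have hxR : ‖x‖ ≤ R := by simpa using (ball_subset_closedBall hx)
      have h3 : gradient (fun x => v x - W x) x = gradient v x - gradient W x := by
        refine HasGradientAt.gradient ?_
        have := (h1.hasGradientAt).hasFDerivAt.sub (h2.hasGradientAt).hasFDerivAt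
        rw [hasGradientAt_iff_hasFDerivAt, map_sub]
        exact this
      rw [h3, inner_sub_right]
      have hB1 := Breg_nonneg hg (gradient v x) (gradient u x)
      unfold Breg at hB1
      rw [inner_sub_right] at hB1
      have hSx : 0 ≤ S.indicator (fun _ => g M * M) x := indicator_nonneg (fun _ _ => by positivity) x
      have hXx := hXc x hx
      have hcs : ∀ y, |⟪gvec g (gradient u x), y⟫| ≤ g M * ‖y‖ := fun y =>
        (abs_real_inner_le_norm _ _).trans (mul_le_mul_of_nonneg_right hXx (norm_nonneg _))
      by_cases hx0 : 0 < W x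
      · have h4 : gradient W x = gradient u x + τ • e := by
          refine HasGradientAt.gradient ?_
          have h5 : HasGradientAt (fun y => u y + τ * ⟪y, e⟫ - 2 * τ * R) (gradient u x + τ • e) x := by
            have h5 := (hS.strict x hx).hasFDerivAt
            have h6 : HasFDerivAt (fun y : Eu N => (innerSL ℝ e) y) (innerSL ℝ e) x :=
              (innerSL ℝ e).hasFDerivAt
            have h7 := (h5.add (h6.const_mul τ)).sub_const (2 * τ * R)
            have e1 : InnerProductSpace.toDual ℝ _ (gradient u x + τ • e) = innerSL ℝ (gradient u x) + τ • innerSL ℝ e := by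
              ext y; simp [inner_add_left]
            have e2 : (fun y => u y + τ * ⟪y, e⟫ - 2 * τ * R) =
                fun y => (u + fun y => τ * ((innerSL ℝ) e) y) y - 2 * τ * R := by
              funext y; simp [real_inner_comm]
            rw [hasGradientAt_iff_hasFDerivAt, e1, e2]
            exact h7
          refine h5.congr_of_eventuallyEq ?_
          filter_upwards [(isOpen_lt continuous_const hwc.cont).mem_nhds hx0] with y hy
          exact (Wt_pos hy).2
        have h5 : J x = GG g (gradient u x + τ • e) := indicator_of_mem (show x ∈ {x | 0 < W x} from hx0) _
        rw [h4, h5, inner_add_right, inner_smul_right]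
        have h6 := hcs e
        rw [he, mul_one, abs_le] at h6
        have hte : ‖gradient u x + τ • e‖ ≤ ‖gradient u x‖ + τ := by
          refine (norm_add_le _ _).trans ?_
          rw [norm_smul, he, Real.norm_of_nonneg hτ.le, mul_one]
        have hgx := hS.gle x hx
        have h7 : GG g (gradient u x + τ • e) ≤ GG g (gradient u x) + τ * g (M + 1) := by
          have hB2 := Breg_nonneg hg (gradient u x) (gradient u x + τ • e)
          unfold Breg at hB2
          have e3 : gradient u x - (gradient u x + τ • e) = -(τ • e) := by abel
          rw [e3, inner_neg_right, inner_smul_right] at hB2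
          have h8 := abs_real_inner_le_norm (gvec g (gradient u x + τ • e)) e
          rw [he, mul_one, gvec_norm hg] at h8
          have h9 : g ‖gradient u x + τ • e‖ ≤ g (M + 1) :=
            (g_strictMono hg).monotoneOn (norm_nonneg _) hL0 (by linarith)
          have h10 := (abs_le.1 (h8.trans h9)).2
          nlinarith
        have h8 : g M ≤ g (M + 1) := (g_strictMono hg).monotoneOn hM hL0 (by linarith)
        have h9 : τ * (-g (M + 1)) ≤ τ * ⟪gvec g (gradient u x), e⟫ :=
          mul_le_mul_of_nonneg_left (by linarith) hτ.le
        linarith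
      · have hW0 : W x = 0 := le_antisymm (not_lt.1 hx0) (hwc.nonneg x)
        have h3 : fderiv ℝ W x = 0 := IsLocalMin.fderiv_eq_zero
            (Eventually.of_forall fun y => by rw [hW0]; exact hwc.nonneg y)
        have h4 : gradient W x = 0 := by
            rw [← norm_eq_zero, norm_grad, h3, norm_zero]
        have h5 : J x = 0 := indicator_of_notMem (show x ∉ {x | 0 < W x} from hx0) _
        rw [h4, inner_zero_right, h5]
        have h6 : ⟪gvec g (gradient u x), gradient u x⟫ - GG g (gradient u x) ≤ S.indicator (fun _ => g M * M) x := by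
          by_cases hu0 : 0 < u x
          · have hxS : x ∈ S := by
              refine ⟨hx, ?_⟩
              rw [Wt_zero hS e hxR]
              refine ⟨hu0, ?_⟩
              have h7 := (abs_le.1 (Wt_near hS he hτ.le hxR)).1
              simp only [hWd] at hW0
              rw [hW0] at h7; linarith
            rw [indicator_of_mem hxS]
            have h7 := (abs_le.1 (hcs (gradient u x))).2
            have h8 := mul_le_mul_of_nonneg_left (hS.gle x hx) hgM
            linarith [GG_nonneg hg (gradient u x)]
          · have hu1 : u x = 0 := le_antisymm (not_lt.1 hu0) (hS.nonneg x (by simpa using hxR))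
            have h7 : fderiv ℝ u x = 0 := IsLocalMin.fderiv_eq_zero (by
              filter_upwards [isOpen_ball.mem_nhds hx] with y hy
              rw [hu1]; exact hS.nonneg y (ball_subset_closedBall hy))
            have h8 : gradient u x = 0 := by
              rw [← norm_eq_zero, norm_grad, h7, norm_zero]
            rw [h8, inner_zero_right, GG_zero, sub_zero]; exact hSx
        have h7 : 0 ≤ 2 * τ * g (M + 1) := by positivity
        linarith
  have e1 : ∫ x in B, (GG g (gradient v x) - J x + 2 * τ * g (M + 1) + S.indicator (fun _ => g M * M) x) =
      (∫ x in B, GG g (gradient v x)) - (∫ x in B, J x) + 2 * τ * g (M + 1) * volume.real B +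
        g M * M * volume.real S := by
    have i1 : Integrable (fun x => GG g (gradient v x) - J x) (volume.restrict B) := hGi.sub hJi
    have i2 : Integrable (fun x => GG g (gradient v x) - J x + 2 * τ * g (M + 1)) (volume.restrict B) :=
      i1.add (integrable_const _)
    rw [integral_add i2 hSi, integral_add i1 (integrable_const _), integral_sub hGi hJi,
      integral_const, smul_eq_mul, measureReal_restrict_apply_univ, integral_indicator_const _ hSm,
      measureReal_restrict_apply hSm, smul_eq_mul, inter_eq_left.2 (fun x hx => hx.1)]
    ring
  have hfin : ∫ x in B, J x ≤ (∫ x in B, GG g (gradient v x)) +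
      ((ω * T + 2 * τ * g (M + 1)) * volume.real B + g M * M * volume.real S) := by linarith
  have hP : ∫⁻ x in {x | 0 < W x}, ENNReal.ofReal (GG g (gradient u x + τ • e)) ≤
      ENNReal.ofReal (∫ x in B, J x) := by
    rw [ofReal_integral_eq_lintegral_ofReal hJi (Eventually.of_forall fun x =>
      indicator_nonneg (fun y _ => GG_nonneg hg _) x)]
    refine le_trans (le_of_eq (setLIntegral_congr_fun hPm fun x hx => ?_))
      (lintegral_mono_set (s := {x | 0 < W x}) fun x hx => ?_)
    · show _ = ENNReal.ofReal (J x)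
      rw [hJ, indicator_of_mem hx]
    · simpa [hB] using (hwc.supp x hx).trans hρR
  have hA : ENNReal.ofReal (∫ x in B, GG g (gradient v x)) ≤
      ∫⁻ x, ENNReal.ofReal (GG g (gradient v x)) := by
    rw [ofReal_integral_eq_lintegral_ofReal hGi (Eventually.of_forall fun x => GG_nonneg hg _)]
    exact setLIntegral_le_lintegral _ _
  refine ⟨(hP.trans_lt ENNReal.ofReal_lt_top).ne, hP.trans ((ENNReal.ofReal_le_ofReal hfin).trans ?_)⟩
  exact ENNReal.ofReal_add_le.trans (add_le_add hA le_rfl)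
end LS
end

noncomputable section
namespace LS

open Filter Topology

variable {N : ℕ}

def GapOK (g : ℝ → ℝ) (R M : ℝ) (u : Eu N → ℝ) (e : Eu N) (s τ c : ℝ) (Gap : Eu N → ENNReal) (x : Eu N) : Prop :=
  c < RR (1 - s) e (Wt R u e τ) x →
    HasGradientAt (RR (1 - s) e (Wt R u e τ)) (gradient (RR (1 - s) e (Wt R u e τ)) x) x ∧
    ∃ z Z θ D, Con (1 - s) (rho R M τ) e (Wt R u e τ) (fun x => gradient u x + τ • e) x z Z θ D ∧
      ∀ t ∈ Z, 0 ≤ ⟪gradient (RR (1 - s) e (Wt R u e τ)) x, e⟫ →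
        ENNReal.ofReal (θ t * Breg g (gradient u (lin e x (t / (1 - s))) + τ • e +
          (|⟪gradient u (lin e x (t / (1 - s))) + τ • e, e⟫| - ⟪gradient u (lin e x (t / (1 - s))) + τ • e, e⟫) • e)
          (gradient (RR (1 - s) e (Wt R u e τ)) x)) ≤ Gap x

lemma gap_small {g : ℝ → ℝ} (hg : GCond g) {R M : ℝ} {u : Eu N → ℝ} (hS : Sol R M u) {f : ℝ → ℝ → ℝ}
    (hf : FCond R f) (hsol : IsDistribSolBall R g f u) {e : Eu N} (he : ‖e‖ = 1) {ε : ℝ} (hε : 0 < ε) :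
    ∃ s0 > 0, ∀ s, 0 < s → s < s0 → ∃ τ c, ∃ Gap : Eu N → ENNReal, 0 < τ ∧ τ ≤ s ∧ 0 < c ∧ c ≤ s ∧
      Measurable Gap ∧ ∫⁻ x, Gap x ≤ ENNReal.ofReal (ε * s) ∧
      WD (rho R M τ) (M + 1) e (Wt R u e τ) (fun x => gradient u x + τ • e) ∧
      ∀ᵐ x, GapOK g R M u e s τ c Gap x := by
  have hM := hS.hM
  have hR := hS.hR
  obtain ⟨F, hFc, hFa, hFe, hFu, MF, hMF⟩ := exists_fbar (K := M * R) hR (by positivity) hf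
  have hsolF : ∀ φ : Eu N → ℝ, IsTestFun (ball 0 R) φ →
      ∫ x in ball (0:Eu N) R, ⟪gvec g (gradient u x), gradient φ x⟫ =
        ∫ x in ball (0:Eu N) R, F ‖x‖ (u x) * φ x := by
    intro φ hφ
    rw [hsol φ hφ]
    refine setIntegral_congr_fun measurableSet_ball fun x hx => ?_
    have hxR : ‖x‖ < R := by simpa using hx
    have h1 : u x ≤ M * R := (hS.u_le he hxR.le).trans (by nlinarith [norm_nonneg x])
    show f ‖x‖ (u x) * φ x = F ‖x‖ (u x) * φ x
    rw [hFe _ ⟨norm_nonneg _, hxR.le⟩ _ ⟨hS.nonneg x (ball_subset_closedBall hx), h1⟩]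
  set V := volume.real (ball (0:Eu N) R) with hV
  have hV0 : 0 ≤ V := measureReal_nonneg
  set C1 := 10 * (M + 1) * R * V with hC1
  have hC10 : 0 ≤ C1 := by positivity
  set ω := ε / 2 / (C1 + 1) with hω
  have hω0 : 0 < ω := by positivity
  obtain ⟨δ, hδ, hδF⟩ := hFu ω hω0
  have hgL := g_nonneg hg (show 0 ≤ M + 1 by positivity)
  have hgM := g_nonneg hg hM
  have hG2 : 0 ≤ Gfun g (2 * (M + 1)) := by
    have := Gfun_mono hg le_rfl (show 0 ≤ 2 * (M + 1) by positivity)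
    simpa [Gfun] using this
  set C2 := 2 * g (M + 1) * V + g M * M + Gfun g (2 * (M + 1)) with hC2
  have hC20 : 0 ≤ C2 := by positivity
  set C3 := 3 * R + 10 * (M + 1) * R with hC3
  have hC30 : 0 < C3 := by positivity
  refine ⟨min (1 / 2) (min (δ / C3) (ε / 2 / (C2 + 1))), by positivity, fun s hs hs0 => ?_⟩
  rw [lt_min_iff, lt_min_iff, lt_div_iff₀ hC30, lt_div_iff₀ (by positivity)] at hs0
  obtain ⟨hs2, hsδ, hsε⟩ := hs0
  have hs1 : s ^ 2 ≤ s := by nlinarith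
  have hss : 0 < s ^ 2 := by positivity
  have hBfin : volume (ball (0:Eu N) R) ≠ ⊤ := measure_ball_lt_top.ne
  obtain ⟨a, ha, hav⟩ := small_level (Wt_lipW hS he le_rfl zero_le_one).continuous.measurable
    (measurableSet_ball (x := (0:Eu N)) (ε := R)) hBfin hss
  obtain ⟨τ, hτ, hτa, hnd⟩ := exists_tau R u e (a := min (s ^ 2) (a / (3 * R))) (by positivity)
  rw [lt_min_iff, lt_div_iff₀ (by positivity)] at hτa
  have hτs : τ ≤ s := by linarith
  have hτ1 : τ ≤ 1 := by linarith
  have hWD := Wt_WD hS he hτ hτ1 hnd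
  obtain ⟨c0, hc0, hcv⟩ := small_level hWD.wc.cont.measurable
    (measurableSet_ball (x := (0:Eu N)) (ε := R)) hBfin hss
  set c := min c0 s with hc
  have hcp : 0 < c := lt_min hc0 hs
  have hk : 0 < 1 - s := by linarith
  have hk1 : 1 - s < 1 := by linarith
  obtain ⟨Gap, hGm, hGi, hGae⟩ := gap hg hk hk1 (rho_pos hS hτ1) (by positivity) he hWD hcp
  refine ⟨τ, c, Gap, hτ, hτs, hcp, min_le_right _ _, hGm, ?_, hWD, hGae⟩
  obtain ⟨hPtop, hP⟩ := core hg hS hFc hFa hMF hsolF he hτ hτ1 (k := 1 - s) (by linarith) hk1 hω0.le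
    (fun r c c' h => hδF r c c' (lt_of_le_of_lt h (by
      have : 3 * τ * R ≤ 3 * s * R := by gcongr
      have h2 : s * C3 = 3 * s * R + 10 * (M + 1) * R * (1 - (1 - s)) := by rw [hC3]; ring
      linarith)))
  have hv1 : volume {x | 0 < Wt R u e τ x ∧ Wt R u e τ x ≤ c} ≤ ENNReal.ofReal (s ^ 2) := by
    refine le_trans (measure_mono fun x hx => ?_) (hcv c (min_le_left _ _))
    exact ⟨by simpa using (hWD.wc.supp x hx.1).trans (rho_lt hS hτ), hx⟩
  have hv2 := hav (3 * τ * R) (by linarith)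
  have hv2' : volume.real {x ∈ ball (0:Eu N) R | 0 < Wt R u e 0 x ∧ Wt R u e 0 x ≤ 3 * τ * R} ≤ s ^ 2 :=
    ENNReal.toReal_le_of_le_ofReal hss.le hv2
  set A' := ∫⁻ x, ENNReal.ofReal (GG g (gradient (RR (1 - s) e (Wt R u e τ)) x)) with hA'
  set P' := ∫⁻ x in {x | 0 < Wt R u e τ x}, ENNReal.ofReal (GG g (gradient u x + τ • e)) with hP'
  set q := ENNReal.ofReal (Gfun g ((M + 1) / (1 - s))) * volume {x | 0 < Wt R u e τ x ∧ Wt R u e τ x ≤ c} with hq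
  have hq1 : q ≤ ENNReal.ofReal (Gfun g (2 * (M + 1)) * s ^ 2) := by
    rw [ENNReal.ofReal_mul hG2]
    refine mul_le_mul' (ENNReal.ofReal_le_ofReal (Gfun_mono hg (by positivity) ?_)) hv1
    rw [div_le_iff₀ hk]; nlinarith
  have hA'top : A' ≠ ⊤ := by
    refine (lt_of_le_of_lt (le_self_add.trans hGi) ?_).ne
    exact ENNReal.add_lt_top.2 ⟨hPtop.lt_top, hq1.trans_lt ENNReal.ofReal_lt_top⟩
  set E1 := (ω * (10 * (M + 1) * R * (1 - (1 - s))) + 2 * τ * g (M + 1)) * V + g M * M *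
    volume.real {x ∈ ball (0:Eu N) R | 0 < Wt R u e 0 x ∧ Wt R u e 0 x ≤ 3 * τ * R} with hE1
  have hfin : A' + ∫⁻ x, Gap x ≤ A' + (ENNReal.ofReal E1 + ENNReal.ofReal (Gfun g (2 * (M + 1)) * s ^ 2)) := by
    refine hGi.trans ?_
    rw [← add_assoc]
    exact add_le_add hP hq1
  have h1 := (ENNReal.add_le_add_iff_left hA'top).1 hfin
  refine h1.trans ?_
  have hE10 : 0 ≤ E1 := by
    have : 0 ≤ 1 - (1 - s) := by linarith
    positivity
  rw [← ENNReal.ofReal_add hE10 (by positivity)]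
  refine ENNReal.ofReal_le_ofReal ?_
  have b1 : E1 ≤ ω * C1 * s + 2 * s ^ 2 * g (M + 1) * V + g M * M * s ^ 2 := by
    have t1 : 2 * τ * g (M + 1) * V ≤ 2 * s ^ 2 * g (M + 1) * V := by
      have := hτa.1.le
      gcongr
    have t2 := mul_le_mul_of_nonneg_left hv2' (show 0 ≤ g M * M by positivity)
    have t3 : ω * (10 * (M + 1) * R * (1 - (1 - s))) * V = ω * C1 * s := by rw [hC1]; ring
    rw [hE1, add_mul]; linarith
  have b2 : ω * C1 ≤ ε / 2 := by
    rw [hω, div_mul_eq_mul_div, div_le_iff₀ (by positivity)]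
    nlinarith
  have b3 : s * C2 ≤ ε / 2 := by
    have h3 := (lt_div_iff₀ (by positivity : (0:ℝ) < C2 + 1)).1 hsε
    nlinarith
  have b4 : 2 * s ^ 2 * g (M + 1) * V + g M * M * s ^ 2 + Gfun g (2 * (M + 1)) * s ^ 2 = (s * C2) * s := by
    rw [hC2]; ring
  have b5 := mul_le_mul_of_nonneg_right b3 hs.le
  have b6 := mul_le_mul_of_nonneg_right b2 hs.le
  linarith

lemma gap_seq {g : ℝ → ℝ} (hg : GCond g) {R M : ℝ} {u : Eu N → ℝ} (hS : Sol R M u) {f : ℝ → ℝ → ℝ}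
    (hf : FCond R f) (hsol : IsDistribSolBall R g f u) {e : Eu N} (he : ‖e‖ = 1) :
    ∃ (s τ c : ℕ → ℝ) (Gap : ℕ → Eu N → ENNReal), Tendsto s atTop (𝓝 0) ∧
      (∀ n, 0 < s n ∧ s n ≤ 1 / 2 ∧ 0 < τ n ∧ τ n ≤ s n ∧ 0 < c n ∧ c n ≤ s n ∧
        WD (rho R M (τ n)) (M + 1) e (Wt R u e (τ n)) (fun x => gradient u x + τ n • e)) ∧
      ∀ᵐ x, (∀ n, GapOK g R M u e (s n) (τ n) (c n) (Gap n) x) ∧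
        Tendsto (fun n => Gap n x / ENNReal.ofReal (s n)) atTop (𝓝 0) := by
  have hall : ∀ n : ℕ, ∃ s τ c, ∃ Gap : Eu N → ENNReal, s ≤ 1 / ((n:ℝ) + 2) ∧ 0 < s ∧ s ≤ 1 / 2 ∧
      0 < τ ∧ τ ≤ s ∧ 0 < c ∧ c ≤ s ∧
      Measurable Gap ∧ ∫⁻ x, Gap x ≤ ENNReal.ofReal ((1 / 2) ^ n * s) ∧
      WD (rho R M τ) (M + 1) e (Wt R u e τ) (fun x => gradient u x + τ • e) ∧
      ∀ᵐ x, GapOK g R M u e s τ c Gap x := by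
    intro n
    obtain ⟨s0, hs0, H⟩ := gap_small hg hS hf hsol he (ε := (1 / 2) ^ n) (by positivity)
    have hn : 1 / ((n:ℝ) + 2) ≤ 1 / 2 := by
      gcongr
      linarith [n.cast_nonneg (α := ℝ)]
    have hsp : 0 < min (s0 / 2) (1 / ((n:ℝ) + 2)) := by positivity
    obtain ⟨τ, c, Gap, h1, h2, h3, h4, h5, h6, h7, h8⟩ := H (min (s0 / 2) (1 / ((n:ℝ) + 2))) hsp
      (lt_of_le_of_lt (min_le_left _ _) (by linarith))
    exact ⟨_, τ, c, Gap, min_le_right _ _, hsp, (min_le_right _ _).trans hn, h1, h2, h3, h4, h5, h6, h7, h8⟩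
  choose s τ c Gap h1 h2 h3 h4 h5 h6 h7 h8 h9 h10 h11 using hall
  refine ⟨s, τ, c, Gap, ?_, fun n => ⟨h2 n, h3 n, h4 n, h5 n, h6 n, h7 n, h10 n⟩, ?_⟩
  · refine squeeze_zero (fun n => (h2 n).le) (fun n => (h1 n).trans ?_) tendsto_one_div_add_atTop_nhds_zero_nat
    gcongr; norm_num
  · have hsum : ∫⁻ x, ∑' n, Gap n x / ENNReal.ofReal (s n) ≠ ⊤ := by
      rw [lintegral_tsum fun n => ((h8 n).div_const _).aemeasurable]
      have hb : ∀ n, ∫⁻ x, Gap n x / ENNReal.ofReal (s n) ≤ (2⁻¹ : ENNReal) ^ n := by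
        intro n
        have hp : ENNReal.ofReal (s n) ≠ 0 := (ENNReal.ofReal_pos.2 (h2 n)).ne'
        simp only [div_eq_mul_inv]
        rw [lintegral_mul_const _ (h8 n), ← div_eq_mul_inv]
        refine ENNReal.div_le_of_le_mul ((h9 n).trans ?_)
        rw [ENNReal.ofReal_mul (by positivity), ENNReal.ofReal_pow (by norm_num)]
        gcongr
        rw [one_div, ENNReal.ofReal_inv_of_pos (by norm_num)]
        simp
      refine ((ENNReal.tsum_le_tsum hb).trans_lt ?_).ne
      rw [ENNReal.tsum_geometric]
      norm_num
    have hae := ae_lt_top (Measurable.tsum fun n => (h8 n).div_const _) hsum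
    filter_upwards [hae, ae_all_iff.2 h11] with x hx1 hx2
    exact ⟨hx2, ENNReal.tendsto_atTop_zero_of_tsum_ne_top hx1.ne⟩
end LS
end

noncomputable section
namespace LS

open Filter Topology

lemma Ain_of_subset {V : Set ℝ} {a b : ℝ} (hab : a ≤ b) (h : Ioo a b ⊆ V) :
    Ain V a b = (b - a) ^ 2 / 2 := by
  have h1 : Ain V a b = ∫ τ in a..b, (b - τ) := by
    unfold Ain
    rw [intervalIntegral.integral_of_le hab, intervalIntegral.integral_of_le hab,
      integral_Ioc_eq_integral_Ioo, integral_Ioc_eq_integral_Ioo]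
    refine setIntegral_congr_fun measurableSet_Ioo fun τ hτ => ?_
    simp [ind_mem (h hτ)]
  rw [h1, intervalIntegral.integral_sub (by simp) (by simp)]
  simp; ring

/-- Structure of the contact configuration when the level set is an interval nearby. -/
lemma Dan_two {k : ℝ} (hk : 0 < k) (hk1 : k < 1) {r : ℝ} (hr : 0 ≤ r) {ψ : ℝ → ℝ} (hA : Adm r ψ)
    {t c z : ℝ} {Z : Finset ℝ} (hc : 0 < c) (hD : Dan k ψ t c z Z) {l r' a b d : ℝ} (hd : 0 < d)
    (hkd : r * (1 - k) < k * d) (hl : l + d ≤ t) (htb : t < b) (hab : a < b) (hr' : b + 2 * d ≤ r')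
    (hs : ∀ τ ∈ Ioo l r', (c < ψ τ ↔ τ ∈ Ioo a b) ∧ (ψ τ = c ↔ τ = a ∨ τ = b)) :
    t < a ∧ Z = {a, b} ∧ t < z ∧ z - b = (1 - k) * (z - t) / 2 ∧ z - a = (1 + k) * (z - t) / 2 := by
  set V := sup ψ c with hVd
  have hVm : MeasurableSet V := (hA.isOpen c).measurableSet
  have hVb : V ⊆ Icc (-r) r := hA.subset hc.le
  have hV : ∀ τ ∈ Ioo l r', (τ ∈ V ↔ τ ∈ Ioo a b) := fun τ hτ => (hs τ hτ).1
  have hta : t < a := by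
    by_contra hcon
    push Not at hcon
    have htm : t ∈ Ioo l r' := ⟨by linarith, by linarith⟩
    have := hD.lt_t
    rcases hcon.eq_or_lt with h | h
    · have := (hs t htm).2.2 (Or.inl h.symm); linarith
    · have := (hs t htm).1.2 ⟨h, htb⟩; linarith
  have hPz : Ph k V t z = 0 := by rw [Ph, hD.ain]; ring
  have hQz : Qf k V t z = 0 := by rw [Qf, hD.mass_eq]; ring
  have htz : t < z := by
    rcases lt_trichotomy z t with h | h | h
    · have := Ph_pos_left (x := t) (z := z) hk hVm hr hVb hd hkd hk1.le (by
        refine eq_empty_iff_forall_notMem.2 fun τ hτ => ?_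
        have := (hV τ ⟨by linarith [hτ.2.1], by linarith [hτ.2.2]⟩).1 hτ.1
        linarith [this.1, hτ.2.2]) h
      linarith
    · exact absurd h hD.ne
    · exact h
  have hzy : z < b + d := by
    by_contra hcon
    push Not at hcon
    have p1 : Ph k V (b + d) t > 0 := Ph_pos_left hk hVm hr hVb hd hkd hk1.le (by
        refine eq_empty_iff_forall_notMem.2 fun τ hτ => ?_
        have := (hV τ ⟨by linarith [hτ.2.1], by linarith [hτ.2.2]⟩).1 hτ.1
        linarith [this.2, hτ.2.1]) (by linarith)
    have c0 := Ph_chain (k := k) hVm t z t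
    have c1 := Ph_chain (k := k) hVm t z (b + d)
    have c2 := Ph_chain (k := k) hVm t (b + d) t
    have c3 := Ph_chain (k := k) hVm t (b + d) z
    have c4 : Ph k V t t = 0 := by simp [Ph, Ain_self]
    have c5 := notMem_Bal.1 hD.contact (b + d)
    rw [hPz, hQz] at c0 c1
    rw [hPz] at c3
    rcases hcon.eq_or_lt with h | h
    · rw [h] at p1; linarith
    · have p2 : Ph k V (b + d) z > 0 := Ph_pos_right hk hVm hr hVb hd hkd hk1.le (by
        refine eq_empty_iff_forall_notMem.2 fun τ hτ => ?_
        have := (hV τ ⟨by linarith [hτ.2.1], by linarith [hτ.2.2]⟩).1 hτ.1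
        linarith [this.2, hτ.2.1]) h
      rw [c4] at c2
      have e1 : 0 ≤ Ph k V t (b + d) := by linarith
      rcases le_or_gt 0 (Qf k V t (b + d)) with h1 | h1
      · have := mul_nonneg h1 (by linarith : 0 ≤ z - (b + d)); linarith
      · have := mul_nonneg_of_nonpos_of_nonpos h1.le (by linarith : t - (b + d) ≤ 0); linarith
  have hzm : z ∈ Ioo l r' := ⟨by linarith, by linarith⟩
  have hsubt : ∀ w, w ≤ a → V ∩ Ioo t w = ∅ := fun w hw => by
    refine eq_empty_iff_forall_notMem.2 fun τ hτ => ?_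
    have := (hV τ ⟨by linarith [hτ.2.1], by linarith [hτ.2.2]⟩).1 hτ.1
    linarith [this.1, hτ.2.2]
  have haz : a < z := by
    by_contra hcon
    push Not at hcon
    have h1 := (Ain_zero_of_disj htz.le (hsubt z hcon)).2
    have h2 := hD.mass_eq
    have := mul_pos hk (sub_pos.2 htz)
    linarith
  have hbz : b < z := by
    by_contra hcon
    push Not at hcon
    have := hD.lt_z
    rcases hcon.eq_or_lt with h | h
    · have := (hs z hzm).2.2 (Or.inr h); linarith
    · have := (hs z hzm).1.2 ⟨haz, h⟩; linarith
  have e1 := Ain_zero_of_disj hta.le (hsubt a le_rfl)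
  have hin : Ioo a b ⊆ V := fun τ hτ => (hV τ ⟨by linarith [hτ.1], by linarith [hτ.2]⟩).2 hτ
  have e2 := mass_of_subset hab.le hin
  have e2' := Ain_of_subset hab.le hin
  have e3 := Ain_zero_of_disj (V := V) hbz.le (by
    refine eq_empty_iff_forall_notMem.2 fun τ hτ => ?_
    have := (hV τ ⟨by linarith [hτ.2.1], by linarith [hτ.2.2]⟩).1 hτ.1
    linarith [this.2, hτ.2.1])
  have m1 : mass V t z = b - a := by
    rw [← mass_add hVm t a z, ← mass_add hVm a b z, e1.2, e2, e3.2]; ring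
  have m2 : Ain V t z = ((z - a) ^ 2 - (z - b) ^ 2) / 2 := by
    rw [Ain_chain hVm t a z, Ain_chain hVm a b z, e1.1, e1.2, e2, e2', e3.1]; ring
  have q1 : b - a = k * (z - t) := by rw [← m1]; exact hD.mass_eq
  have q2 : ((z - a) ^ 2 - (z - b) ^ 2) / 2 = k * (z - t) ^ 2 / 2 := by rw [← m2]; exact hD.ain
  have q3 : (z - a) + (z - b) = z - t := by
    have : (b - a) * ((z - a) + (z - b) - (z - t)) = 0 := by
      have : (b - a) * (z - t) = k * (z - t) ^ 2 := by rw [q1]; ring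
      nlinarith
    rcases mul_eq_zero.1 this with h | h
    · linarith
    · linarith
  refine ⟨hta, ?_, htz, by linarith, by linarith⟩
  ext τ
  rw [hD.memZ, uIoo_of_lt htz]
  simp only [Finset.mem_insert, Finset.mem_singleton]
  constructor
  · rintro ⟨h1, h2⟩
    exact (hs τ ⟨by linarith [h1.1], by linarith [h1.2]⟩).2.1 h2
  · intro h
    have hm : τ ∈ Ioo t z := by
      rcases h with rfl | rfl
      · exact ⟨hta, haz⟩
      · exact ⟨htb, hbz⟩
    exact ⟨hm, (hs τ ⟨by linarith [hm.1], by linarith [hm.2]⟩).2.2 h⟩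

/-- locating the level set of a perturbed profile -/
lemma level_two {φ ψ : ℝ → ℝ} {t0 t1 δ c c0 η : ℝ} (hδ : 0 < δ) (h2 : t0 + 2 * δ < t1)
    (hmid : ∀ t ∈ Icc (t0 + δ) (t1 - δ), c0 + 2 * η ≤ φ t) (hL : φ (t0 - δ) ≤ c0 - 2 * η)
    (hRr : φ (t1 + δ) ≤ c0 - 2 * η) (hψ : Continuous ψ)
    (hnear : ∀ t ∈ Icc (t0 - δ) (t1 + δ), |ψ t - φ t| < η) (hcc : |c - c0| < η)
    (hm : StrictMonoOn ψ (Icc (t0 - δ) (t0 + δ))) (ha : StrictAntiOn ψ (Icc (t1 - δ) (t1 + δ))) :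
    ∃ a b, a ∈ Icc (t0 - δ) (t0 + δ) ∧ b ∈ Icc (t1 - δ) (t1 + δ) ∧ ψ a = c ∧ ψ b = c ∧
      ∀ τ ∈ Ioo (t0 - δ) (t1 + δ), (c < ψ τ ↔ τ ∈ Ioo a b) ∧ (ψ τ = c ↔ τ = a ∨ τ = b) := by
  have hc := abs_lt.1 hcc
  have n := fun t ht => abs_lt.1 (hnear t ht)
  have big : ∀ t ∈ Icc (t0 + δ) (t1 - δ), c < ψ t := fun t ht => by
    have := hmid t ht; have := n t ⟨by linarith [ht.1], by linarith [ht.2]⟩; linarith [this.1]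
  have lo : ψ (t0 - δ) < c := by
    have := n (t0 - δ) ⟨by linarith, by linarith⟩; linarith [this.2]
  have lo2 : ψ (t1 + δ) < c := by
    have := n (t1 + δ) ⟨by linarith, by linarith⟩; linarith [this.2]
  obtain ⟨a, haI, hac⟩ := intermediate_value_Icc (by linarith : t0 - δ ≤ t0 + δ) hψ.continuousOn
    ⟨lo.le, (big (t0 + δ) ⟨le_rfl, by linarith⟩).le⟩
  obtain ⟨b, hbI, hbc⟩ := intermediate_value_Icc' (by linarith : t1 - δ ≤ t1 + δ) hψ.continuousOn
    ⟨lo2.le, (big (t1 - δ) ⟨by linarith, le_rfl⟩).le⟩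
  refine ⟨a, b, haI, hbI, hac, hbc, fun τ hτ => ?_⟩
  rcases le_or_gt τ (t0 + δ) with h | h
  · have hτI : τ ∈ Icc (t0 - δ) (t0 + δ) := ⟨hτ.1.le, h⟩
    have hτb : τ < b := by linarith [hbI.1]
    constructor
    · rw [← hac, hm.lt_iff_lt haI hτI]
      exact ⟨fun h => ⟨h, hτb⟩, fun h => h.1⟩
    · rw [← hac, hm.injOn.eq_iff hτI haI]
      exact ⟨Or.inl, fun h => h.resolve_right hτb.ne⟩
  · have hτa : a < τ := by linarith [haI.2]
    rcases le_or_gt τ (t1 - δ) with h' | h'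
    · have hb := big τ ⟨h.le, h'⟩
      have hτb : τ < b := by
        refine lt_of_le_of_ne (h'.trans hbI.1) ?_
        rintro rfl; linarith
      constructor
      · exact ⟨fun _ => ⟨hτa, hτb⟩, fun _ => hb⟩
      · exact ⟨fun h => absurd h hb.ne', fun h => by rcases h with h | h <;> linarith⟩
    · have hτI : τ ∈ Icc (t1 - δ) (t1 + δ) := ⟨h'.le, hτ.2.le⟩
      constructor
      · rw [← hbc, ha.lt_iff_gt hbI hτI]
        exact ⟨fun h => ⟨hτa, h⟩, fun h => h.2⟩
      · rw [← hbc, ha.injOn.eq_iff hτI hbI]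
        exact ⟨Or.inr, fun h => h.resolve_left hτa.ne'⟩
end LS
end

noncomputable section
namespace LS

open Filter Topology

variable {N : ℕ}

lemma lin_hasDeriv (e x : Eu N) (t : ℝ) : HasStrictDerivAt (fun t => lin e x t) e t := by
  have h : HasStrictDerivAt (fun t : ℝ => x + (t - ⟪e, x⟫) • e) ((1:ℝ) • e) t :=
    (HasStrictDerivAt.smul_const ((hasStrictDerivAt_id t).sub_const _) e).const_add x
  rw [one_smul] at h; exact h

lemma Sol.line {R M : ℝ} {u : Eu N → ℝ} (hS : Sol R M u) {e x : Eu N} {t : ℝ}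
    (ht : lin e x t ∈ ball (0:Eu N) R) :
    HasStrictDerivAt (fun t => u (lin e x t)) ⟪gradient u (lin e x t), e⟫ t := by
  have h := (hS.strict _ ht).comp_hasStrictDerivAt t (lin_hasDeriv e x t)
  rw [innerSL_apply_apply] at h
  exact h

lemma lin_tendsto (e x : Eu N) (_ : ℝ) : Continuous (fun t => lin e x t) :=
  continuous_iff_continuousAt.2 fun t => (lin_hasDeriv e x t).hasDerivAt.continuousAt

lemma Sol.ue_cont {R M : ℝ} {u : Eu N → ℝ} (hS : Sol R M u) {e x : Eu N} {t : ℝ}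
    (ht : lin e x t ∈ ball (0:Eu N) R) :
    ContinuousAt (fun t => gradient u (lin e x t)) t :=
  ContinuousAt.comp (g := gradient u) (hS.gcont.continuousAt (isOpen_ball.mem_nhds ht))
    (lin_tendsto e x t).continuousAt

lemma Sol.slope_pos {R M : ℝ} {u : Eu N → ℝ} (hS : Sol R M u) {e x : Eu N} {l r β : ℝ}
    (h : ∀ t ∈ Icc l r, lin e x t ∈ ball (0:Eu N) R ∧ β ≤ ⟪gradient u (lin e x t), e⟫) {s t : ℝ}
    (hs : s ∈ Icc l r) (ht : t ∈ Icc l r) (hst : s ≤ t) :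
    β * (t - s) ≤ u (lin e x t) - u (lin e x s) :=
  (convex_Icc l r).mul_sub_le_image_sub_of_le_deriv (f := fun t => u (lin e x t))
    (fun t ht => (hS.line (h t ht).1).hasDerivAt.continuousAt.continuousWithinAt)
    (fun t ht => (hS.line (h t (interior_subset ht)).1).hasDerivAt.differentiableAt.differentiableWithinAt)
    (fun t ht => by
      rw [(hS.line (h t (interior_subset ht)).1).hasDerivAt.deriv]; exact (h t (interior_subset ht)).2)
    s hs t ht hst

lemma Sol.slope_neg {R M : ℝ} {u : Eu N → ℝ} (hS : Sol R M u) {e x : Eu N} {l r β : ℝ}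
    (h : ∀ t ∈ Icc l r, lin e x t ∈ ball (0:Eu N) R ∧ ⟪gradient u (lin e x t), e⟫ ≤ -β) {s t : ℝ}
    (hs : s ∈ Icc l r) (ht : t ∈ Icc l r) (hst : s ≤ t) :
    u (lin e x t) - u (lin e x s) ≤ -β * (t - s) :=
  (convex_Icc l r).image_sub_le_mul_sub_of_deriv_le (f := fun t => u (lin e x t))
    (fun t ht => (hS.line (h t ht).1).hasDerivAt.continuousAt.continuousWithinAt)
    (fun t ht => (hS.line (h t (interior_subset ht)).1).hasDerivAt.differentiableAt.differentiableWithinAt)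
    (fun t ht => by
      rw [(hS.line (h t (interior_subset ht)).1).hasDerivAt.deriv]; exact (h t (interior_subset ht)).2)
    s hs t ht hst

lemma lin_mem_ball {e x : Eu N} {R t0 t1 t : ℝ} (h0 : lin e x t0 ∈ ball (0:Eu N) R)
    (h1 : lin e x t1 ∈ ball (0:Eu N) R) (ht : t ∈ Icc t0 t1) : lin e x t ∈ ball (0:Eu N) R := by
  rcases eq_or_lt_of_le (ht.1.trans ht.2) with h | h
  · have : t = t0 := le_antisymm (h ▸ ht.2) ht.1
    rwa [this]
  have hc := convex_ball (0:Eu N) R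
  have hpos : 0 < t1 - t0 := by linarith
  have := hc h0 h1 (a := (t1 - t) / (t1 - t0)) (b := (t - t0) / (t1 - t0))
    (div_nonneg (by linarith [ht.2]) hpos.le) (div_nonneg (by linarith [ht.1]) hpos.le)
    (by field_simp; ring)
  convert this using 1
  simp only [lin, smul_add, smul_smul]
  have e1 : (t1 - t) / (t1 - t0) + (t - t0) / (t1 - t0) = 1 := by field_simp; ring
  have e2 : t - ⟪e, x⟫ = (t1 - t) / (t1 - t0) * (t0 - ⟪e, x⟫) + (t - t0) / (t1 - t0) * (t1 - ⟪e, x⟫) := by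
    field_simp; ring
  rw [e2, add_smul]
  nth_rewrite 1 [← one_smul ℝ x, ← e1]
  rw [add_smul]; abel

/-- local data near a noncritical point on the line -/
lemma Sol.loc {R M : ℝ} {u : Eu N → ℝ} (hS : Sol R M u) {e x : Eu N} {t : ℝ}
    (ht : lin e x t ∈ ball (0:Eu N) R) {β c : ℝ} (hβ : β < ⟪gradient u (lin e x t), e⟫)
    (hc : c < u (lin e x t)) :
    ∀ᶠ δ in 𝓝[>] (0:ℝ), ∀ s ∈ Icc (t - δ) (t + δ), lin e x s ∈ ball (0:Eu N) R ∧
      β ≤ ⟪gradient u (lin e x s), e⟫ ∧ c < u (lin e x s) := by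
  have h1 : ∀ᶠ s in 𝓝 t, lin e x s ∈ ball (0:Eu N) R :=
    (lin_tendsto e x t).continuousAt.eventually_mem (isOpen_ball.mem_nhds ht)
  have h2 : ∀ᶠ s in 𝓝 t, β < ⟪gradient u (lin e x s), e⟫ :=
    ((hS.ue_cont ht).inner continuousAt_const).eventually_const_lt hβ
  have h3 : ∀ᶠ s in 𝓝 t, c < u (lin e x s) :=
    (hS.line ht).hasDerivAt.continuousAt.eventually_const_lt hc
  obtain ⟨d, hd, h⟩ := Metric.eventually_nhds_iff.1 (h1.and (h2.and h3))
  filter_upwards [Ioo_mem_nhdsGT hd] with δ hδ s hs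
  have := h (y := s) (by rw [Real.dist_eq, abs_lt]; constructor <;> linarith [hs.1, hs.2, hδ.2])
  exact ⟨this.1, this.2.1.le, this.2.2⟩

lemma Sol.loc' {R M : ℝ} {u : Eu N → ℝ} (hS : Sol R M u) {e x : Eu N} {t : ℝ}
    (ht : lin e x t ∈ ball (0:Eu N) R) {β c : ℝ} (hβ : ⟪gradient u (lin e x t), e⟫ < -β)
    (hc : c < u (lin e x t)) :
    ∀ᶠ δ in 𝓝[>] (0:ℝ), ∀ s ∈ Icc (t - δ) (t + δ), lin e x s ∈ ball (0:Eu N) R ∧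
      ⟪gradient u (lin e x s), e⟫ ≤ -β ∧ c < u (lin e x s) := by
  have h1 : ∀ᶠ s in 𝓝 t, lin e x s ∈ ball (0:Eu N) R :=
    (lin_tendsto e x t).continuousAt.eventually_mem (isOpen_ball.mem_nhds ht)
  have h2 : ∀ᶠ s in 𝓝 t, ⟪gradient u (lin e x s), e⟫ < -β :=
    ((hS.ue_cont ht).inner continuousAt_const).eventually_lt_const hβ
  have h3 : ∀ᶠ s in 𝓝 t, c < u (lin e x s) :=
    (hS.line ht).hasDerivAt.continuousAt.eventually_const_lt hc
  obtain ⟨d, hd, h⟩ := Metric.eventually_nhds_iff.1 (h1.and (h2.and h3))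
  filter_upwards [Ioo_mem_nhdsGT hd] with δ hδ s hs
  have := h (y := s) (by rw [Real.dist_eq, abs_lt]; constructor <;> linarith [hs.1, hs.2, hδ.2])
  exact ⟨this.1, this.2.1.le, this.2.2⟩

/-- algebra of the weights -/
lemma weights {s θa θb pa pb D y β M : ℝ} (hs : 0 < s) (hs1 : s ≤ 1 / 2) (hD : 0 < D) (hβ : 0 < β) (hM : 0 ≤ M)
    (ha : 0 < θa) (hb : 0 < θb) (hsum : θa + θb = 1) (hpa : β ≤ pa) (hpa' : |pa| ≤ M + 1)
    (hpb : pb ≤ -(β / 2)) (hpb' : |pb| ≤ M + 1)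
    (h1 : θa * |pa| * D = (1 + (1 - s)) * y / 2) (h2 : θb * |pb| * D = (1 - (1 - s)) * y / 2)
    (hsmall : 2 * (M + 1) * s / β ≤ 1 / 2) :
    θb ≤ 2 * (M + 1) * s / β ∧ β * s / (4 * (M + 1)) ≤ θb := by
  have h3 : θb * |pb| * (2 - s) = θa * |pa| * s := by
    have : D * (θb * |pb| * (2 - s) - θa * |pa| * s) = 0 := by
      have e1 : D * (θb * |pb| * (2 - s)) = (θb * |pb| * D) * (2 - s) := by ring
      have e2 : D * (θa * |pa| * s) = (θa * |pa| * D) * s := by ring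
      rw [mul_sub, e1, e2, h1, h2]; ring
    rcases mul_eq_zero.1 this with h | h
    · exact absurd h hD.ne'
    · linarith
  have hpaa : |pa| = pa := abs_of_pos (by linarith)
  have hpbb : |pb| = -pb := abs_of_neg (by linarith)
  have hθa1 : θa ≤ 1 := by linarith
  have u1 : θb * (β / 2) ≤ θb * |pb| * (2 - s) := by
    have : θb * (β / 2) ≤ θb * |pb| := by rw [hpbb]; gcongr; linarith
    have h0 : 0 ≤ θb * |pb| := by positivity
    nlinarith
  have u2 : θa * |pa| * s ≤ (M + 1) * s := by
    have : θa * |pa| ≤ 1 * (M + 1) := by gcongr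
    nlinarith
  have A : θb ≤ 2 * (M + 1) * s / β := by
    rw [le_div_iff₀ hβ]; nlinarith
  refine ⟨A, ?_⟩
  have hθa2 : 1 / 2 ≤ θa := by linarith
  have u3 : 1 / 2 * β * s ≤ θa * |pa| * s := by rw [hpaa]; gcongr
  have u4 : θb * |pb| * (2 - s) ≤ θb * (M + 1) * 2 := by
    gcongr
    · linarith
    · linarith
  rw [div_le_iff₀ (by positivity)]
  nlinarith
end LS
end

noncomputable section
namespace LS

open Filter Topology

variable {N : ℕ}

lemma lin_sub (e x : Eu N) (s t : ℝ) : lin e x s - lin e x t = (s - t) • e := by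
  simp only [lin]
  rw [add_sub_add_left_eq_sub, ← sub_smul]; congr 1; ring

lemma Wt_diff {R M : ℝ} {u : Eu N → ℝ} (hS : Sol R M u) {e : Eu N} (he : ‖e‖ = 1) {τ : ℝ} (hτ : 0 ≤ τ)
    (y : Eu N) : |Wt R u e τ y - Wt R u e 0 y| ≤ 3 * τ * R := by
  by_cases hy : ‖y‖ ≤ R
  · rw [Wt_zero hS e hy]; exact Wt_near hS he hτ hy
  · have := hS.hR
    simp only [Wt, hy, if_false, sub_self, abs_zero]; positivity

set_option maxHeartbeats 1000000 in
lemma stage {g : ℝ → ℝ} {R M : ℝ} {u : Eu N → ℝ} (hS : Sol R M u) {e : Eu N} (he : ‖e‖ = 1)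
    {s τ c : ℝ} {Gap : Eu N → ENNReal} (hs : 0 < s) (hs2 : s ≤ 1 / 2) (hτ : 0 < τ) (hτs : τ ≤ s)
    (hcs : c ≤ s) {x : Eu N} (hG : GapOK g R M u e s τ c Gap x) (hx : x ∈ ball (0:Eu N) R)
    {t1 δ β T η C : ℝ} (hδ : 0 < δ) (hβ : 0 < β) (h4 : ⟪e, x⟫ + 4 * δ < t1)
    (heq : u (lin e x t1) = u x)
    (hI0 : ∀ t ∈ Icc (⟪e, x⟫ - 2 * δ) (⟪e, x⟫ + 2 * δ), lin e x t ∈ ball (0:Eu N) R ∧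
      β ≤ ⟪gradient u (lin e x t), e⟫ ∧ u x / 2 < u (lin e x t))
    (hI1 : ∀ t ∈ Icc (t1 - 2 * δ) (t1 + 2 * δ), lin e x t ∈ ball (0:Eu N) R ∧
      ⟪gradient u (lin e x t), e⟫ ≤ -β ∧ u x / 2 < u (lin e x t))
    (hmid : ∀ t ∈ Icc (⟪e, x⟫ + δ) (t1 - δ), u x + 2 * η ≤ u (lin e x t)) (hηδ : 2 * η ≤ β * δ)
    (hT : ∀ t ∈ Icc (⟪e, x⟫ - δ) (t1 + δ), |t| ≤ T)
    (hC : C = 9 * R + 2 * (M + 1) * T + 10 * (M + 1) * R) (k1 : C * s < η) (k2 : 2 * s * T ≤ δ)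
    (k3 : s < β / 2) (k4 : 3 * s * R < u x / 2) (k5 : s < u x - η) (k6 : R * s < δ / 8)
    (k7 : 2 * (C * s) ≤ β * (δ / 2)) (k8 : 2 * (M + 1) * s / β ≤ 1 / 2) :
    HasGradientAt (RR (1 - s) e (Wt R u e τ)) (gradient (RR (1 - s) e (Wt R u e τ)) x) x ∧
    ∃ a b θa θb, |a - ⟪e, x⟫| ≤ 2 * s * T + 2 * (C * s) / β ∧ |b - t1| ≤ 2 * s * T + 2 * (C * s) / β ∧
      θa + θb = 1 ∧ θb ≤ 2 * (M + 1) * s / β ∧ β * s / (4 * (M + 1)) ≤ θb ∧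
      ⟪gradient (RR (1 - s) e (Wt R u e τ)) x, e⟫ = 2 / (2 - s) * θa * ⟪gradient u (lin e x a) + τ • e, e⟫ ∧
      (∀ y, ⟪gradient (RR (1 - s) e (Wt R u e τ)) x, y⟫ = ⟪gradient (RR (1 - s) e (Wt R u e τ)) x, e⟫ * ⟪e, y⟫ +
        (θa * ⟪gradient u (lin e x a) + τ • e, y - ⟪e, y⟫ • e⟫ +
         θb * ⟪gradient u (lin e x b) + τ • e, y - ⟪e, y⟫ • e⟫)) ∧
      ENNReal.ofReal (θb * Breg g (gradient u (lin e x b) + τ • e +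
          (|⟪gradient u (lin e x b) + τ • e, e⟫| - ⟪gradient u (lin e x b) + τ • e, e⟫) • e)
          (gradient (RR (1 - s) e (Wt R u e τ)) x)) ≤ Gap x := by
  have hR := hS.hR
  have hM := hS.hM
  set t0 := ⟪e, x⟫ with ht0
  set k := 1 - s with hk
  have hk0 : 1 / 2 ≤ k := by linarith
  have hkpos : 0 < k := by linarith
  have hk1 : k < 1 := by linarith
  set W := Wt R u e τ with hW
  have hτ1 : τ ≤ 1 := by linarith
  have hWC : WC (rho R M τ) W := Wt_WC hS he hτ hτ1
  have hρ : 0 < rho R M τ := rho_pos hS hτ1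
  have hρR : rho R M τ < R := rho_lt hS hτ
  have hadm := psi_adm hkpos hk1 he hρ hWC x
  set ψ := psi k e W x with hψ
  set cn := RR k e W x with hcn
  have hT0 : 0 ≤ T := (abs_nonneg _).trans (hT t0 ⟨by linarith, by linarith⟩)
  have hlx : lin e x t0 = x := lin_self _ _
  have hxR : ‖x‖ ≤ R := by have := mem_ball_zero_iff.1 hx; linarith
  have hC0 : 0 ≤ C := by rw [hC]; positivity
  have hτR : τ * R ≤ s * R := by gcongr
  have hdiv : ∀ t, |t| ≤ T → |t / k - t| ≤ 2 * s * T := fun t ht => by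
    have : t / k - t = t * (s / k) := by rw [hk] at *; field_simp; ring
    rw [this, abs_mul, abs_of_pos (by positivity : 0 < s / k)]
    have : s / k ≤ 2 * s := by rw [div_le_iff₀ hkpos]; nlinarith
    calc |t| * (s / k) ≤ T * (2 * s) := by gcongr
      _ = _ := by ring
  have hnear : ∀ t, |t| ≤ T → |ψ t - Wt R u e 0 (lin e x t)| ≤ C * s := fun t ht => by
    have h1 := Wt_diff hS he hτ.le (lin e x (t / k))
    have h2 := Wt_lip hS he le_rfl zero_le_one (lin e x (t / k)) (lin e x t)
    rw [lin_sub, norm_smul, he, mul_one, Real.norm_eq_abs] at h2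
    have h3 := mul_le_mul_of_nonneg_left (hdiv t ht) (by linarith : 0 ≤ M + 1)
    have h4 : |ψ t - Wt R u e 0 (lin e x t)| ≤ |W (lin e x (t / k)) - Wt R u e 0 (lin e x (t / k))| +
      |Wt R u e 0 (lin e x (t / k)) - Wt R u e 0 (lin e x t)| := abs_sub_le _ _ _
    have h5 : 0 ≤ (M + 1) * R * s := by positivity
    have h6 : 0 ≤ R * s := by positivity
    have h7 : C * s = 9 * (R * s) + (M + 1) * (2 * s * T) + 10 * ((M + 1) * R * s) := by rw [hC]; ring
    rw [h7]; linarith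
  have hcnear : |cn - u x| ≤ C * s := by
    have h1 := RR_near hk0 hk1 he hρ hWC (by linarith : 0 ≤ M + 1) (Wt_lip hS he hτ.le hτ1) x
    have h2 := Wt_near hS he hτ.le hxR
    have h3 : |cn - u x| ≤ |cn - W x| + |W x - u x| := abs_sub_le _ _ _
    have h4 : 10 * (M + 1) * rho R M τ * (1 - k) ≤ 10 * (M + 1) * R * s := by
      rw [hk, sub_sub_cancel]; gcongr
    have h6 : 0 ≤ R * s := by positivity
    have h7 : 0 ≤ (M + 1) * T * s := by positivity
    have h8 : C * s = 9 * (R * s) + 2 * ((M + 1) * T * s) + 10 * (M + 1) * R * s := by rw [hC]; ring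
    rw [h8]; linarith
  have hcn2 := abs_le.1 hcnear
  have hcpos : 0 < cn := by linarith
  obtain ⟨hgr, z, Z, θ, D, hCon, hgap⟩ := hG (by linarith)
  refine ⟨hgr, ?_⟩
  have hφ : ∀ t, lin e x t ∈ ball (0:Eu N) R → Wt R u e 0 (lin e x t) = u (lin e x t) := fun t ht =>
    Wt_zero hS e (mem_ball_zero_iff.1 ht).le
  have hballs : ∀ t ∈ Icc (t0 - δ) (t1 + δ), lin e x t ∈ ball (0:Eu N) R := fun t ht =>
    lin_mem_ball (hI0 (t0 - δ) ⟨by linarith, by linarith⟩).1 (hI1 (t1 + δ) ⟨by linarith, by linarith⟩).1 ht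
  have hWf : ∀ y ∈ ball (0:Eu N) R, u x / 2 < u y → W y = u y + τ * ⟪y, e⟫ - 2 * τ * R := fun y hy huy => by
    have hyR := (mem_ball_zero_iff.1 hy).le
    have h1 := abs_le.1 (Wt_near hS he hτ.le hyR)
    exact (Wt_pos (by linarith [h1.1])).2
  have hin : ∀ t, ⟪lin e x t, e⟫ = t := fun t => by rw [real_inner_comm]; exact inner_lin he x t
  have hq : ∀ t ∈ Icc (t0 - δ) (t1 + δ), |t / k - t| ≤ δ := fun t ht => (hdiv t (hT t ht)).trans k2
  have hI0k : ∀ t ∈ Icc (t0 - δ) (t0 + δ), t / k ∈ Icc (t0 - 2 * δ) (t0 + 2 * δ) := fun t ht => by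
    have := abs_le.1 (hq t ⟨ht.1, by linarith [ht.2]⟩)
    constructor <;> linarith [ht.1, ht.2, this.1, this.2]
  have hI1k : ∀ t ∈ Icc (t1 - δ) (t1 + δ), t / k ∈ Icc (t1 - 2 * δ) (t1 + 2 * δ) := fun t ht => by
    have := abs_le.1 (hq t ⟨by linarith [ht.1], ht.2⟩)
    constructor <;> linarith [ht.1, ht.2, this.1, this.2]
  have hmono : StrictMonoOn ψ (Icc (t0 - δ) (t0 + δ)) := by
    intro p hp q hq' hpq
    have a1 := hI0 _ (hI0k p hp)
    have a2 := hI0 _ (hI0k q hq')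
    have hd : p / k < q / k := by gcongr
    have := hS.slope_pos (fun t ht => ⟨(hI0 t ht).1, (hI0 t ht).2.1⟩) (hI0k p hp) (hI0k q hq') hd.le
    show W (lin e x (p / k)) < W (lin e x (q / k))
    rw [hWf _ a1.1 a1.2.2, hWf _ a2.1 a2.2.2, hin, hin]
    have e1 := mul_pos hβ (sub_pos.2 hd)
    have e2 := mul_lt_mul_of_pos_left hd hτ
    linarith
  have hanti : StrictAntiOn ψ (Icc (t1 - δ) (t1 + δ)) := by
    intro p hp q hq' hpq
    have a1 := hI1 _ (hI1k p hp)
    have a2 := hI1 _ (hI1k q hq')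
    have hd : p / k < q / k := by gcongr
    have := hS.slope_neg (fun t ht => ⟨(hI1 t ht).1, (hI1 t ht).2.1⟩) (hI1k p hp) (hI1k q hq') hd.le
    show W (lin e x (q / k)) < W (lin e x (p / k))
    rw [hWf _ a1.1 a1.2.2, hWf _ a2.1 a2.2.2, hin, hin]
    have e1 := mul_pos (show 0 < β - τ by linarith) (sub_pos.2 hd)
    have e2 : (β - τ) * (q / k - p / k) = β * (q / k - p / k) - (τ * (q / k) - τ * (p / k)) := by ring
    linarith
  obtain ⟨a, b, haI, hbI, hac, hbc, hlev⟩ := level_two (φ := fun t => Wt R u e 0 (lin e x t)) (ψ := ψ)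
    (t0 := t0) (t1 := t1) (c := cn) (c0 := u x) (η := η) hδ (by linarith) (fun t ht => by
      have := hmid t ht
      simp only [hφ t (hballs t ⟨by linarith [ht.1], by linarith [ht.2]⟩)]; exact this)
    (by
      simp only [hφ (t0 - δ) (hballs _ ⟨by linarith, by linarith⟩)]
      have := hS.slope_pos (fun t ht => ⟨(hI0 t ht).1, (hI0 t ht).2.1⟩) (s := t0 - δ) (t := t0)
        ⟨by linarith, by linarith⟩ ⟨by linarith, by linarith⟩ (by linarith)
      rw [hlx] at this; linarith)
    (by
      simp only [hφ (t1 + δ) (hballs _ ⟨by linarith, by linarith⟩)]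
      have := hS.slope_neg (fun t ht => ⟨(hI1 t ht).1, (hI1 t ht).2.1⟩) (s := t1) (t := t1 + δ)
        ⟨by linarith, by linarith⟩ ⟨by linarith, by linarith⟩ (by linarith)
      rw [heq] at this; linarith)
    hadm.cont (fun t ht => (hnear t (hT t ht)).trans_lt k1) (hcnear.trans_lt k1) hmono hanti
  have haIw : a ∈ Icc (t0 - δ) (t1 + δ) := ⟨haI.1, by linarith [haI.2]⟩
  have hbIw : b ∈ Icc (t0 - δ) (t1 + δ) := ⟨by linarith [hbI.1], hbI.2⟩
  have hadist : |a - t0| ≤ 2 * (C * s) / β := by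
    rw [le_div_iff₀ hβ]
    have h1 := abs_le.1 (hnear a (hT a haIw))
    rw [hac, hφ a (hballs a haIw)] at h1
    rcases le_total a t0 with h | h
    · have := hS.slope_pos (fun t ht => ⟨(hI0 t ht).1, (hI0 t ht).2.1⟩) (s := a) (t := t0)
        ⟨by linarith [haI.1], by linarith⟩ ⟨by linarith, by linarith⟩ h
      rw [hlx] at this
      rw [abs_of_nonpos (by linarith)]; linarith [h1.1, h1.2, hcn2.1, hcn2.2]
    · have := hS.slope_pos (fun t ht => ⟨(hI0 t ht).1, (hI0 t ht).2.1⟩) (s := t0) (t := a)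
        ⟨by linarith, by linarith⟩ ⟨by linarith, by linarith [haI.2]⟩ h
      rw [hlx] at this
      rw [abs_of_nonneg (by linarith)]; linarith [h1.1, h1.2, hcn2.1, hcn2.2]
  have hbdist : |b - t1| ≤ 2 * (C * s) / β := by
    rw [le_div_iff₀ hβ]
    have h1 := abs_le.1 (hnear b (hT b hbIw))
    rw [hbc, hφ b (hballs b hbIw)] at h1
    rcases le_total b t1 with h | h
    · have := hS.slope_neg (fun t ht => ⟨(hI1 t ht).1, (hI1 t ht).2.1⟩) (s := b) (t := t1)
        ⟨by linarith [hbI.1], by linarith⟩ ⟨by linarith, by linarith⟩ h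
      rw [heq] at this
      rw [abs_of_nonpos (by linarith)]; linarith [h1.1, h1.2, hcn2.1, hcn2.2]
    · have := hS.slope_neg (fun t ht => ⟨(hI1 t ht).1, (hI1 t ht).2.1⟩) (s := t1) (t := b)
        ⟨by linarith, by linarith⟩ ⟨by linarith, by linarith [hbI.2]⟩ h
      rw [heq] at this
      rw [abs_of_nonneg (by linarith)]; linarith [h1.1, h1.2, hcn2.1, hcn2.2]
  have hbt : b ≤ t1 + δ / 2 := by
    have h1 : 2 * (C * s) / β ≤ δ / 2 := by rw [div_le_iff₀ hβ]; linarith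
    linarith [(abs_le.1 hbdist).2]
  obtain ⟨hta, hZ, htz, hzb, hza⟩ := Dan_two (r := R) hkpos hk1 hR.le (ψ := ψ)
    ⟨hadm.cont, hadm.nonneg, fun t ht => hadm.supp t fun h => ht ⟨by linarith [h.1], by linarith [h.2]⟩⟩ hcpos hCon.dan (d := δ / 4) (l := t0 - δ)
    (r' := t1 + δ) (a := a) (b := b) (by linarith) (by rw [hk]; nlinarith) (by linarith) (by linarith [hbI.1])
    (by linarith [haI.2, hbI.1]) (by linarith) hlev
  have hab : a < b := by linarith [haI.2, hbI.1]
  have haZ : a ∈ Z := by rw [hZ]; simp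
  have hbZ : b ∈ Z := by rw [hZ]; simp
  have hZs : ∀ F : ℝ → ℝ, ∑ τ ∈ Z, F τ = F a + F b := fun F => by
    rw [hZ, Finset.sum_pair hab.ne]
  obtain ⟨tha, -, tha2⟩ := hCon.th a haZ
  obtain ⟨thb, -, thb2⟩ := hCon.th b hbZ
  have hsum := hCon.sum
  rw [hZs] at hsum
  have hypos : 0 < z - t0 := by linarith
  have tha2 : θ a * |⟪gradient u (lin e x (a / k)) + τ • e, e⟫| * D = (1 + (1 - s)) * (z - t0) / 2 := by
    refine tha2.trans ?_
    rw [hza]; exact abs_of_pos (by positivity)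
  have thb2 : θ b * |⟪gradient u (lin e x (b / k)) + τ • e, e⟫| * D = (1 - (1 - s)) * (z - t0) / 2 := by
    refine thb2.trans ?_
    have : 0 < 1 - k := by linarith
    rw [hzb]; exact abs_of_pos (by positivity)
  have hee : ⟪e, e⟫ = 1 := inner_ee he
  have pe : ∀ y, ⟪gradient u y + τ • e, e⟫ = ⟪gradient u y, e⟫ + τ := fun y => by
    rw [inner_add_left, inner_smul_left, conj_trivial, hee, mul_one]
  have hue : ∀ y ∈ ball (0:Eu N) R, |⟪gradient u y, e⟫| ≤ M := fun y hy => by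
    have := abs_real_inner_le_norm (gradient u y) e
    rw [he, mul_one] at this; exact this.trans (hS.gle y hy)
  have A0 := hI0 _ (hI0k a haI)
  have A1 := hI1 _ (hI1k b hbI)
  have ba := abs_le.1 (hue _ A0.1)
  have bb := abs_le.1 (hue _ A1.1)
  obtain ⟨w1, w2⟩ := weights (pa := ⟪gradient u (lin e x (a / k)) + τ • e, e⟫)
    (pb := ⟪gradient u (lin e x (b / k)) + τ • e, e⟫) hs hs2 hCon.Dpos hβ hM tha thb hsum
    (by rw [pe]; linarith [A0.2.1]) (by rw [pe, abs_le]; constructor <;> linarith [ba.1, ba.2])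
    (by rw [pe]; linarith [A1.2.1]) (by rw [pe, abs_le]; constructor <;> linarith [bb.1, bb.2]) tha2 thb2 k8
  obtain ⟨g1, g2, -⟩ := hCon.grad _ hgr
  have hqe : ⟪gradient (RR k e W) x, e⟫ = 2 / (2 - s) * θ a * ⟪gradient u (lin e x (a / k)) + τ • e, e⟫ := by
    rw [abs_of_pos (show 0 < ⟪gradient u (lin e x (a / k)) + τ • e, e⟫ by rw [pe]; linarith [A0.2.1])] at tha2
    have hs3 : 2 - s ≠ 0 := by linarith
    have : D * (⟪gradient (RR k e W) x, e⟫ * (2 - s) - 2 * θ a * ⟪gradient u (lin e x (a / k)) + τ • e, e⟫) = 0 := by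
      have e1 : D * (⟪gradient (RR k e W) x, e⟫ * (2 - s)) = (⟪gradient (RR k e W) x, e⟫ * D) * (2 - s) := by ring
      have e2 : D * (2 * θ a * ⟪gradient u (lin e x (a / k)) + τ • e, e⟫) =
        2 * (θ a * ⟪gradient u (lin e x (a / k)) + τ • e, e⟫ * D) := by ring
      rw [mul_sub, e1, e2, g1, tha2]; ring
    rcases mul_eq_zero.1 this with h | h
    · exact absurd h hCon.Dpos.ne'
    · field_simp; linarith
  refine ⟨a / k, b / k, θ a, θ b, ?_, ?_, hsum, w1, w2, hqe, ?_, ?_⟩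
  · have := abs_sub_le (a / k) a t0; linarith [hdiv a (hT a haIw)]
  · have := abs_sub_le (b / k) b t1; linarith [hdiv b (hT b hbIw)]
  · intro y; rw [g2 y, hZs]
  · refine hgap b hbZ ?_
    rw [hqe]
    have : 0 < 2 - s := by linarith
    have : 0 ≤ ⟪gradient u (lin e x (a / k)) + τ • e, e⟫ := by rw [pe]; linarith [A0.2.1]
    positivity
end LS
end

noncomputable section
namespace LS

open Filter Topology

variable {N : ℕ}

set_option maxHeartbeats 1000000 in
lemma pt_sym {g : ℝ → ℝ} (hg : GCond g) {R M : ℝ} {u : Eu N → ℝ} (hS : Sol R M u) {e : Eu N} (he : ‖e‖ = 1)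
    {s τ c : ℕ → ℝ} {Gap : ℕ → Eu N → ENNReal} (hs : Tendsto s atTop (𝓝 0))
    (hn : ∀ n, 0 < s n ∧ s n ≤ 1 / 2 ∧ 0 < τ n ∧ τ n ≤ s n ∧ c n ≤ s n) {x : Eu N}
    (hx1 : ∀ n, GapOK g R M u e (s n) (τ n) (c n) (Gap n) x)
    (hx2 : Tendsto (fun n => Gap n x / ENNReal.ofReal (s n)) atTop (𝓝 0))
    (hx : x ∈ ball (0:Eu N) R) (hux : 0 < u x) (h0 : 0 < ⟪gradient u x, e⟫) {t1 : ℝ} (ht : ⟪e, x⟫ < t1)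
    (hb : lin e x t1 ∈ ball (0:Eu N) R) (hgt : ∀ t ∈ Ioo ⟪e, x⟫ t1, u x < u (lin e x t))
    (heq : u (lin e x t1) = u x) (hneg : ⟪gradient u (lin e x t1), e⟫ < 0) :
    gradient u (lin e x t1) = gradient u x - (2 * ⟪gradient u x, e⟫) • e := by
  have hR := hS.hR
  have hM := hS.hM
  have hee : ⟪e, e⟫ = 1 := inner_ee he
  have hlx : lin e x ⟪e, x⟫ = x := lin_self _ _
  set t0 := ⟪e, x⟫ with ht0
  obtain ⟨β, hβ, hβ1⟩ := exists_between (lt_min h0 (neg_pos.2 hneg))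
  have hβa := (lt_min_iff.1 hβ1).1
  have hβb := (lt_min_iff.1 hβ1).2
  have L0 := hS.loc (e := e) (x := x) (t := t0) (β := β) (c := u x / 2) (by rwa [hlx]) (by rwa [hlx]) (by rw [hlx]; linarith)
  have L1 := hS.loc' (e := e) (x := x) (t := t1) (β := β) (c := u x / 2) hb (by linarith) (by rw [heq]; linarith)
  obtain ⟨δ', hδL, hδL1, hδ'⟩ := (L0.and (L1.and (Ioo_mem_nhdsGT (by linarith : 0 < (t1 - t0) / 2)))).exists
  obtain ⟨δ, hδ, rfl⟩ : ∃ δ, 0 < δ ∧ 2 * δ = δ' := ⟨δ' / 2, by linarith [hδ'.1], by ring⟩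
  have hδ4 : t0 + 4 * δ < t1 := by linarith [hδ'.2]
  -- the minimum in the middle
  obtain ⟨η, hη, hη1, hη2, hmid⟩ : ∃ η > 0, 2 * η ≤ β * δ ∧ η < u x ∧
      ∀ t ∈ Icc (t0 + δ) (t1 - δ), u x + 2 * η ≤ u (lin e x t) := by
    have hcont : ContinuousOn (fun t => u (lin e x t)) (Icc (t0 + δ) (t1 - δ)) := fun t htt =>
      (hS.line (lin_mem_ball (t0 := t0) (t1 := t1) (by rwa [hlx]) hb
        ⟨by linarith [htt.1], by linarith [htt.2]⟩)).hasDerivAt.continuousAt.continuousWithinAt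
    obtain ⟨m, hm, hmin⟩ := isCompact_Icc.exists_isMinOn (nonempty_Icc.2 (by linarith : t0 + δ ≤ t1 - δ)) hcont
    have hmm := hgt m ⟨by linarith [hm.1], by linarith [hm.2]⟩
    have hbd : 0 < β * δ := by positivity
    refine ⟨min ((u (lin e x m) - u x) / 2) (min (β * δ / 2) (u x / 2)), ?_, ?_, ?_, fun t htt => ?_⟩
    · exact lt_min (by linarith) (lt_min (by linarith) (by linarith))
    · have := (min_le_right ((u (lin e x m) - u x) / 2) (min (β * δ / 2) (u x / 2))).trans (min_le_left _ _)
      linarith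
    · have := (min_le_right ((u (lin e x m) - u x) / 2) (min (β * δ / 2) (u x / 2))).trans (min_le_right _ _)
      linarith
    · have := min_le_left ((u (lin e x m) - u x) / 2) (min (β * δ / 2) (u x / 2))
      have h3 : u (lin e x m) ≤ u (lin e x t) := hmin htt
      linarith
  set T := |t0| + |t1| + δ with hT
  have hTb : ∀ t ∈ Icc (t0 - δ) (t1 + δ), |t| ≤ T := fun t htt => by
    rw [abs_le, hT]
    have := neg_abs_le t0
    have := le_abs_self t1
    have := abs_nonneg t0
    have := abs_nonneg t1
    constructor <;> linarith [htt.1, htt.2]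
  set C := 9 * R + 2 * (M + 1) * T + 10 * (M + 1) * R with hC
  have small : ∀ A B : ℝ, 0 < B → ∀ᶠ n in atTop, A * s n < B := fun A B hB => by
    have : Tendsto (fun n => A * s n) atTop (𝓝 (A * 0)) := hs.const_mul A
    rw [mul_zero] at this
    exact this.eventually_lt_const hB
  have hst : ∀ᶠ n in atTop, ∃ q : ℝ × ℝ × ℝ × ℝ,
      |q.1 - t0| ≤ 2 * s n * T + 2 * (C * s n) / β ∧ |q.2.1 - t1| ≤ 2 * s n * T + 2 * (C * s n) / β ∧
      q.2.2.1 + q.2.2.2 = 1 ∧ q.2.2.2 ≤ 2 * (M + 1) * s n / β ∧ β * s n / (4 * (M + 1)) ≤ q.2.2.2 ∧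
      ⟪gradient (RR (1 - s n) e (Wt R u e (τ n))) x, e⟫ = 2 / (2 - s n) * q.2.2.1 * ⟪gradient u (lin e x q.1) + τ n • e, e⟫ ∧
      (∀ y, ⟪gradient (RR (1 - s n) e (Wt R u e (τ n))) x, y⟫ = ⟪gradient (RR (1 - s n) e (Wt R u e (τ n))) x, e⟫ * ⟪e, y⟫ +
        (q.2.2.1 * ⟪gradient u (lin e x q.1) + τ n • e, y - ⟪e, y⟫ • e⟫ +
         q.2.2.2 * ⟪gradient u (lin e x q.2.1) + τ n • e, y - ⟪e, y⟫ • e⟫)) ∧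
      ENNReal.ofReal (q.2.2.2 * Breg g (gradient u (lin e x q.2.1) + τ n • e +
          (|⟪gradient u (lin e x q.2.1) + τ n • e, e⟫| - ⟪gradient u (lin e x q.2.1) + τ n • e, e⟫) • e)
          (gradient (RR (1 - s n) e (Wt R u e (τ n))) x)) ≤ Gap n x := by
    filter_upwards [small C η hη, small (2 * T) δ hδ, small 1 (β / 2) (by linarith),
      small (3 * R) (u x / 2) (by linarith), small 1 (u x - η) (by linarith), small R (δ / 8) (by linarith),
      small (2 * C) (β * (δ / 2)) (by positivity), small (2 * (M + 1) / β) (1 / 2) (by norm_num)]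
      with n k1 k2 k3 k4 k5 k6 k7 k8
    obtain ⟨n1, n2, n3, n4, n5⟩ := hn n
    obtain ⟨-, a, b, θa, θb, h⟩ := stage hS he n1 n2 n3 n4 n5 (hx1 n) hx hδ hβ hδ4 heq hδL hδL1 hmid hη1 hTb hC
      k1 (by linarith) (by linarith) (by linarith) (by linarith) k6 (by linarith)
      (by rw [mul_div_right_comm]; exact k8.le)
    exact ⟨(a, b, θa, θb), h⟩
  obtain ⟨q, hq⟩ := hst.choice
  have hbd0 : Tendsto (fun n => 2 * s n * T + 2 * (C * s n) / β) atTop (𝓝 0) := by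
    have : Tendsto (fun n => 2 * s n * T + 2 * (C * s n) / β) atTop (𝓝 (2 * 0 * T + 2 * (C * 0) / β)) :=
      ((hs.const_mul 2).mul_const T).add (((hs.const_mul C).const_mul 2).div_const β)
    simpa using this
  have ha : Tendsto (fun n => (q n).1) atTop (𝓝 t0) := by
    rw [tendsto_iff_norm_sub_tendsto_zero]
    exact squeeze_zero' (Eventually.of_forall fun _ => norm_nonneg _) (hq.mono fun n h => h.1) hbd0
  have hbt : Tendsto (fun n => (q n).2.1) atTop (𝓝 t1) := by
    rw [tendsto_iff_norm_sub_tendsto_zero]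
    exact squeeze_zero' (Eventually.of_forall fun _ => norm_nonneg _) (hq.mono fun n h => h.2.1) hbd0
  have hτ0 : Tendsto τ atTop (𝓝 0) := squeeze_zero (fun n => (hn n).2.2.1.le) (fun n => (hn n).2.2.2.1) hs
  have hθb : Tendsto (fun n => (q n).2.2.2) atTop (𝓝 0) := by
    have : Tendsto (fun n => 2 * (M + 1) * s n / β) atTop (𝓝 (2 * (M + 1) * 0 / β)) :=
      (hs.const_mul _).div_const β
    rw [mul_zero, zero_div] at this
    refine squeeze_zero' (hq.mono fun n h => ?_) (hq.mono fun n h => h.2.2.2.1) this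
    refine le_trans ?_ h.2.2.2.2.1
    have := (hn n).1
    positivity
  have hθa : Tendsto (fun n => (q n).2.2.1) atTop (𝓝 1) := by
    have : Tendsto (fun n => 1 - (q n).2.2.2) atTop (𝓝 (1 - 0)) := hθb.const_sub 1
    rw [sub_zero] at this
    refine this.congr' (hq.mono fun n h => ?_)
    linarith [h.2.2.1]
  have hte : Tendsto (fun n => τ n • e) atTop (𝓝 (0:Eu N)) := by
    have := hτ0.smul_const e; rwa [zero_smul] at this
  have hpa : Tendsto (fun n => gradient u (lin e x (q n).1) + τ n • e) atTop (𝓝 (gradient u x)) := by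
    have h1 := (hS.ue_cont (e := e) (x := x) (t := t0) (by rwa [hlx])).tendsto.comp ha
    rw [hlx] at h1
    have := h1.add hte
    rwa [add_zero] at this
  have hpb : Tendsto (fun n => gradient u (lin e x (q n).2.1) + τ n • e) atTop (𝓝 (gradient u (lin e x t1))) := by
    have := ((hS.ue_cont hb).tendsto.comp hbt).add hte
    rwa [add_zero] at this
  have hqe : Tendsto (fun n => ⟪gradient (RR (1 - s n) e (Wt R u e (τ n))) x, e⟫) atTop (𝓝 ⟪gradient u x, e⟫) := by
    have h1 : Tendsto (fun n => 2 / (2 - s n)) atTop (𝓝 1) := by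
      have : Tendsto (fun n => 2 / (2 - s n)) atTop (𝓝 (2 / (2 - 0))) :=
        tendsto_const_nhds.div (hs.const_sub 2) (by norm_num)
      simpa using this
    have h2 := (h1.mul hθa).mul (hpa.inner (𝕜 := ℝ) (tendsto_const_nhds (x := e)))
    rw [one_mul, one_mul] at h2
    exact h2.congr' (hq.mono fun n h => h.2.2.2.2.2.1.symm)
  have hqn : Tendsto (fun n => gradient (RR (1 - s n) e (Wt R u e (τ n))) x) atTop (𝓝 (gradient u x)) := by
    have h1 : ∀ᶠ n in atTop, ⟪gradient (RR (1 - s n) e (Wt R u e (τ n))) x, e⟫ • e +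
        ((q n).2.2.1 • ((gradient u (lin e x (q n).1) + τ n • e) - ⟪gradient u (lin e x (q n).1) + τ n • e, e⟫ • e) +
         (q n).2.2.2 • ((gradient u (lin e x (q n).2.1) + τ n • e) - ⟪gradient u (lin e x (q n).2.1) + τ n • e, e⟫ • e))
        = gradient (RR (1 - s n) e (Wt R u e (τ n))) x := by
      filter_upwards [hq] with n h
      refine ext_inner_right ℝ fun y => ?_
      rw [h.2.2.2.2.2.2.1 y, inner_add_left, inner_add_left, inner_smul_left, inner_smul_left, inner_smul_left,
        inner_sub_left, inner_sub_left, inner_smul_left, inner_smul_left, inner_sub_right, inner_sub_right,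
        inner_smul_right, inner_smul_right]
      simp only [conj_trivial]
      ring
    refine Tendsto.congr' h1 ?_
    have h2 := (hqe.smul_const e).add ((hθa.smul (hpa.sub ((hpa.inner (𝕜 := ℝ) (tendsto_const_nhds (x := e))).smul_const e))).add
      (hθb.smul (hpb.sub ((hpb.inner (𝕜 := ℝ) (tendsto_const_nhds (x := e))).smul_const e))))
    rw [one_smul, zero_smul, add_zero, add_sub_cancel] at h2
    exact h2
  set p1 := gradient u (lin e x t1) with hp1
  have hζ : Tendsto (fun n => gradient u (lin e x (q n).2.1) + τ n • e +
          (|⟪gradient u (lin e x (q n).2.1) + τ n • e, e⟫| - ⟪gradient u (lin e x (q n).2.1) + τ n • e, e⟫) • e)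
      atTop (𝓝 (p1 + (|⟪p1, e⟫| - ⟪p1, e⟫) • e)) := by
    have h1 := hpb.inner (𝕜 := ℝ) (tendsto_const_nhds (x := e))
    exact hpb.add ((h1.abs.sub h1).smul_const e)
  have hB := ((Breg_cont hg).tendsto (p1 + (|⟪p1, e⟫| - ⟪p1, e⟫) • e, gradient u x)).comp (hζ.prodMk_nhds hqn)
  have hB0 : Breg g (p1 + (|⟪p1, e⟫| - ⟪p1, e⟫) • e) (gradient u x) ≤ 0 := by
    have h1 : Tendsto (fun n => ENNReal.toReal (Gap n x / ENNReal.ofReal (s n))) atTop (𝓝 0) :=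
      (ENNReal.tendsto_toReal ENNReal.zero_ne_top).comp hx2
    have h2 := h1.const_mul (4 * (M + 1) / β)
    rw [mul_zero] at h2
    refine le_of_tendsto_of_tendsto hB h2 ?_
    have hfin : ∀ᶠ n in atTop, Gap n x / ENNReal.ofReal (s n) < ⊤ :=
      hx2.eventually_lt_const ENNReal.zero_lt_top
    filter_upwards [hq, hfin] with n h hf
    obtain ⟨n1, -⟩ := hn n
    have hG := h.2.2.2.2.2.2.2
    simp only [Function.comp]
    set Bn := Breg g (gradient u (lin e x (q n).2.1) + τ n • e +
          (|⟪gradient u (lin e x (q n).2.1) + τ n • e, e⟫| - ⟪gradient u (lin e x (q n).2.1) + τ n • e, e⟫) • e)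
          (gradient (RR (1 - s n) e (Wt R u e (τ n))) x) with hBn
    have hBn0 : 0 ≤ Bn := Breg_nonneg hg _ _
    have hG2 : ENNReal.ofReal (β / (4 * (M + 1)) * Bn) ≤ Gap n x / ENNReal.ofReal (s n) := by
      rw [ENNReal.le_div_iff_mul_le (Or.inl (by simpa using n1)) (Or.inl ENNReal.ofReal_ne_top),
        ← ENNReal.ofReal_mul (by positivity)]
      refine (ENNReal.ofReal_le_ofReal ?_).trans hG
      have := mul_le_mul_of_nonneg_right h.2.2.2.2.1 hBn0
      refine le_trans (le_of_eq ?_) this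
      ring
    have h5 := (ENNReal.ofReal_le_iff_le_toReal hf.ne).1 hG2
    have h6 := mul_le_mul_of_nonneg_left h5 (by positivity : 0 ≤ 4 * (M + 1) / β)
    refine le_trans (le_of_eq ?_) h6
    field_simp
  have hz : p1 + (|⟪p1, e⟫| - ⟪p1, e⟫) • e = gradient u x := by
    by_contra hne
    have := Breg_pos hg hne
    linarith
  rw [abs_of_neg hneg] at hz
  have h7 : ⟪gradient u x, e⟫ = -⟪p1, e⟫ := by
    rw [← hz, inner_add_left, inner_smul_left, conj_trivial, hee]; ring
  rw [h7, ← hz, add_sub_assoc, ← sub_smul]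
  have : (-⟪p1, e⟫ - ⟪p1, e⟫) - 2 * -⟪p1, e⟫ = 0 := by ring
  rw [this, zero_smul, add_zero]
end LS
end

noncomputable section
namespace LS

open Filter Topology
variable {N : ℕ}

/-- `t1` is the parameter of the first return to the level `u x` along the line through `x`. -/
def Ret (R : ℝ) (u : Eu N → ℝ) (e x : Eu N) (t1 : ℝ) : Prop :=
  ⟪e, x⟫ < t1 ∧ lin e x t1 ∈ ball (0:Eu N) R ∧ (∀ t ∈ Ioo ⟪e, x⟫ t1, u x < u (lin e x t)) ∧
    u (lin e x t1) = u x

lemma Sol.pos {R M : ℝ} {u : Eu N → ℝ} (hS : Sol R M u) {e x : Eu N} (hx : x ∈ ball (0:Eu N) R)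
    (h0 : 0 < ⟪gradient u x, e⟫) : 0 < u x := by
  rcases (hS.nonneg x (ball_subset_closedBall hx)).lt_or_eq with h | h
  · exact h
  exfalso
  have hm : IsLocalMin u x := by
    filter_upwards [isOpen_ball.mem_nhds hx] with y hy
    rw [← h]; exact hS.nonneg y (ball_subset_closedBall hy)
  have h1 := hm.hasFDerivAt_eq_zero (hS.strict x hx).hasFDerivAt
  have h2 := congrArg (fun L => L e) h1
  simp only [innerSL_apply_apply, zero_apply] at h2
  exact h0.ne' h2

lemma Sol.cont {R M : ℝ} {u : Eu N → ℝ} (hS : Sol R M u) : ContinuousOn u (closedBall 0 R) := by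
  have : LipschitzOnWith (Real.toNNReal M) u (closedBall 0 R) := by
    refine LipschitzOnWith.of_dist_le_mul fun x hx y hy => ?_
    rw [Real.coe_toNNReal _ hS.hM, Real.dist_eq, dist_eq_norm]
    exact hS.lip x hx y hy
  exact this.continuousOn

lemma ret_exists {R M : ℝ} {u : Eu N → ℝ} (hS : Sol R M u) {e x : Eu N} (he : ‖e‖ = 1)
    (hx : x ∈ ball (0:Eu N) R) (h0 : 0 < ⟪gradient u x, e⟫) : ∃ t1, Ret R u e x t1 := by
  have hpos := hS.pos hx h0
  have hlx : lin e x ⟪e, x⟫ = x := lin_self _ _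
  unfold Ret
  set t0 := ⟪e, x⟫ with ht0
  obtain ⟨β, hβ, hβ1⟩ := exists_between h0
  have hl := hS.loc (e := e) (x := x) (t := t0) (by rwa [hlx]) (β := β) (c := 0) (by rwa [hlx]) (by rwa [hlx])
  obtain ⟨δ, hδl, hδ⟩ := (hl.and self_mem_nhdsWithin).exists
  replace hδ : 0 < δ := hδ
  have hinc : ∀ t ∈ Ioc t0 (t0 + δ), u x < u (lin e x t) := by
    intro t ht
    have h := hS.slope_pos (l := t0 - δ) (r := t0 + δ) (β := β) (fun t ht => ⟨(hδl t ht).1, (hδl t ht).2.1⟩)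
      (s := t0) (t := t) ⟨by linarith, by linarith⟩ ⟨by linarith [ht.1], ht.2⟩ ht.1.le
    have h2 : 0 < β * (t - t0) := mul_pos hβ (by linarith [ht.1])
    rw [hlx] at h
    linarith
  have hb1 : lin e x (t0 + δ) ∈ ball (0:Eu N) R := (hδl (t0 + δ) ⟨by linarith, by linarith⟩).1
  have hnb : ‖lin e x (t0 + δ)‖ < R := by simpa using hb1
  have hle : t0 + δ ≤ R := (le_abs_self _).trans ((abs_le_lin he x _).trans hnb.le)
  have hR := hS.hR
  have hlc : Continuous (fun t => lin e x t) := lin_tendsto e x 0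
  obtain ⟨T, hT, hTR⟩ : R ∈ (fun t => ‖lin e x t‖) '' Icc (t0 + δ) R := by
    refine intermediate_value_Icc hle (hlc.norm.continuousOn) ⟨hnb.le, ?_⟩
    exact (le_abs_self R).trans (abs_le_lin he x R)
  simp only at hTR
  have hcl : ∀ t ∈ Icc t0 T, lin e x t ∈ closedBall (0:Eu N) R := by
    intro t ht
    rw [mem_closedBall_zero_iff]
    refine le_of_forall_pos_lt_add fun ε hε => ?_
    have hx' : ‖x‖ < R := by simpa using hx
    have := lin_mem_ball (e := e) (x := x) (R := R + ε) (t0 := t0) (t1 := T) (t := t)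
      (by rw [hlx]; simp; linarith) (by simp [hTR, hε]) ht
    simpa using this
  have hwc : ContinuousOn (fun t => u (lin e x t)) (Icc t0 T) :=
    hS.cont.comp hlc.continuousOn hcl
  have hsub : Icc (t0 + δ) T ⊆ Icc t0 T := Icc_subset_Icc_left (by linarith)
  have hK : IsCompact {t ∈ Icc (t0 + δ) T | u (lin e x t) ≤ u x} := by
    have h := (hwc.mono hsub).preimage_isClosed_of_isClosed isClosed_Icc (isClosed_Iic (a := u x))
    exact isCompact_Icc.of_isClosed_subset h inter_subset_left
  have hTu : u (lin e x T) = 0 := hS.bdry _ (by simpa using hTR)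
  obtain ⟨t1, ht1, hmin⟩ := hK.exists_isLeast ⟨T, ⟨hT.1, le_rfl⟩, by rw [hTu]; exact hpos.le⟩
  have hgt : ∀ t ∈ Ioo t0 t1, u x < u (lin e x t) := by
    intro t ht
    by_contra hcon
    push Not at hcon
    rcases le_or_gt t (t0 + δ) with h | h
    · exact absurd (hinc t ⟨ht.1, h⟩) (not_lt.2 hcon)
    · have := hmin ⟨⟨h.le, ht.2.le.trans ht1.1.2⟩, hcon⟩
      linarith [ht.2]
  have ht01 : t0 < t1 := by linarith [ht1.1.1]
  have heq : u (lin e x t1) = u x := by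
    refine le_antisymm ht1.2 ?_
    have hc := (hwc t1 ⟨ht01.le, ht1.1.2⟩).mono_left
      (nhdsWithin_mono t1 (s := Ioo t0 t1) fun t ht => ⟨ht.1.le, ht.2.le.trans ht1.1.2⟩)
    have : NeBot (𝓝[Ioo t0 t1] t1) := by
      rw [← mem_closure_iff_nhdsWithin_neBot, closure_Ioo ht01.ne]; exact right_mem_Icc.2 ht01.le
    exact ge_of_tendsto hc (by filter_upwards [self_mem_nhdsWithin] with t ht; exact (hgt t ht).le)
  refine ⟨t1, ht01, ?_, hgt, heq⟩
  have h1 := hcl t1 ⟨ht01.le, ht1.1.2⟩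
  rw [mem_closedBall_zero_iff] at h1
  rw [mem_ball_zero_iff]
  refine lt_of_le_of_ne h1 fun h => ?_
  have := hS.bdry (lin e x t1) (by simpa using h)
  linarith

lemma ret_nonpos {R M : ℝ} {u : Eu N → ℝ} (hS : Sol R M u) {e x : Eu N} {t1 : ℝ} (hpos : 0 < u x)
    (h : Ret R u e x t1) : ⟪gradient u (lin e x t1), e⟫ ≤ 0 := by
  obtain ⟨h1, h2, h3, h4⟩ := h
  by_contra hcon
  push Not at hcon
  obtain ⟨β, hβ, hβ1⟩ := exists_between hcon
  have hl := hS.loc h2 (β := β) (c := 0) hβ1 (by rwa [h4])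
  have hlt : ∀ᶠ δ in 𝓝[>] (0:ℝ), δ < t1 - ⟪e, x⟫ :=
    nhdsWithin_le_nhds (eventually_lt_nhds (by linarith))
  obtain ⟨δ, ⟨hδl, hδ2⟩, hδ⟩ := ((hl.and hlt).and self_mem_nhdsWithin).exists
  replace hδ : 0 < δ := hδ
  have h := hS.slope_pos (l := t1 - δ) (r := t1 + δ) (β := β) (fun t ht => ⟨(hδl t ht).1, (hδl t ht).2.1⟩)
      (s := t1 - δ) (t := t1) ⟨by linarith, by linarith⟩ ⟨by linarith, by linarith⟩ (by linarith)
  have h5 := h3 (t1 - δ) ⟨by linarith, by linarith⟩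
  have : 0 < β * (t1 - (t1 - δ)) := mul_pos hβ (by linarith)
  linarith

lemma good_dense {g : ℝ → ℝ} (hg : GCond g) {R M : ℝ} {u : Eu N → ℝ} (hS : Sol R M u) {f : ℝ → ℝ → ℝ}
    (hf : FCond R f) (hsol : IsDistribSolBall R g f u) {e : Eu N} (he : ‖e‖ = 1) {O : Set (Eu N)}
    (hO : IsOpen O) (hne : O.Nonempty) (hOb : ∀ y ∈ O, y ∈ ball (0:Eu N) R ∧ 0 < ⟪gradient u y, e⟫) :
    ∃ y ∈ O, ∃ t1, Ret R u e y t1 ∧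
      gradient u (lin e y t1) = gradient u y - (2 * ⟪gradient u y, e⟫) • e := by
  obtain ⟨s, τ, c, Gap, hs, hn, hae⟩ := gap_seq hg hS hf hsol he
  set Gd := {x | (∀ n, GapOK g R M u e (s n) (τ n) (c n) (Gap n) x) ∧
        Tendsto (fun n => Gap n x / ENNReal.ofReal (s n)) atTop (𝓝 0)} with hGd
  have hae' : volume Gdᶜ = 0 := hae
  set Gc := toMeasurable volume Gdᶜ
  have hGc0 : volume Gc = 0 := by rw [measure_toMeasurable]; exact hae'
  have hOG : volume (O \ Gc) ≠ 0 := by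
    rw [measure_sdiff_null hGc0]; exact (hO.measure_pos volume hne).ne'
  rw [vol_lin he (hO.measurableSet.diff (measurableSet_toMeasurable _ _))] at hOG
  obtain ⟨x, hx⟩ : ∃ x : Eu N, volume {t : ℝ | lin e x t ∈ O \ Gc} ≠ 0 := by
    by_contra hcon
    push Not at hcon
    apply hOG
    exact (lintegral_congr fun x => hcon x).trans lintegral_zero
  set T := {t : ℝ | lin e x t ∈ ball (0:Eu N) R ∧ ⟪gradient u (lin e x t), e⟫ = 0} with hT
  have hA : volume ((fun t => u (lin e x t)) '' T) = 0 := by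
    refine addHaar_image_eq_zero_of_det_fderivWithin_eq_zero volume
      (f' := fun t => ContinuousLinearMap.toSpanSingleton ℝ ⟪gradient u (lin e x t), e⟫)
      (fun t ht => (hS.line ht.1).hasDerivAt.hasFDerivAt.hasFDerivWithinAt) fun t ht => ?_
    rw [ht.2]; simp
  have hnull := null_preimage (T := {t : ℝ | lin e x t ∈ O \ Gc}) (w := fun t => u (lin e x t))
    (dw := fun t => ⟪gradient u (lin e x t), e⟫) (fun t ht => hS.line (hOb _ ht.1).1)
    (fun t ht => (hOb _ ht.1).2.ne') hA
  obtain ⟨t, ht, htA⟩ : ∃ t, lin e x t ∈ O \ Gc ∧ u (lin e x t) ∉ (fun t => u (lin e x t)) '' T := by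
    by_contra hcon
    push Not at hcon
    apply hx
    refine measure_mono_null ?_ hnull
    intro t ht
    exact ⟨ht, hcon t ht⟩
  have hgood : lin e x t ∈ Gd := by
    by_contra h
    exact ht.2 (subset_toMeasurable _ _ h)
  have hb := hOb _ ht.1
  have hpos := hS.pos hb.1 hb.2
  obtain ⟨t1, hr⟩ := ret_exists hS he hb.1 hb.2
  have hnp := ret_nonpos hS hpos hr
  have hr' := hr
  obtain ⟨h1, h2, h3, h4⟩ := hr
  refine ⟨lin e x t, ht.1, t1, hr', ?_⟩
  refine pt_sym hg hS he hs (fun n => ⟨(hn n).1, (hn n).2.1, (hn n).2.2.1, (hn n).2.2.2.1, (hn n).2.2.2.2.2.1⟩)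
    hgood.1 hgood.2 hb.1 hpos hb.2 h1 h2 h3 h4 (lt_of_le_of_ne hnp fun h => htA ?_)
  rw [lin_lin he] at h h2 h4
  exact ⟨t1, ⟨h2, h⟩, h4⟩
end LS
end

noncomputable section
namespace LS

open Filter Topology
variable {N : ℕ}

lemma cont_lin2 (e : Eu N) : Continuous (fun q : Eu N × ℝ => lin e q.1 q.2) := continuous_lin e

lemma Sol.u_lin_cont {R M : ℝ} {u : Eu N → ℝ} (hS : Sol R M u) {e x : Eu N} {t : ℝ}
    (ht : lin e x t ∈ ball (0:Eu N) R) : ContinuousAt (fun q : Eu N × ℝ => u (lin e q.1 q.2)) (x, t) :=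
  ContinuousAt.comp (g := u) (f := fun q : Eu N × ℝ => lin e q.1 q.2) (x := (x, t))
    (hS.strict _ ht).hasFDerivAt.continuousAt (cont_lin2 e).continuousAt

lemma Sol.g_lin_cont {R M : ℝ} {u : Eu N → ℝ} (hS : Sol R M u) {e x : Eu N} {t : ℝ}
    (ht : lin e x t ∈ ball (0:Eu N) R) :
    ContinuousAt (fun q : Eu N × ℝ => gradient u (lin e q.1 q.2)) (x, t) :=
  ContinuousAt.comp (g := gradient u) (f := fun q : Eu N × ℝ => lin e q.1 q.2) (x := (x, t))
    (hS.gcont.continuousAt (isOpen_ball.mem_nhds ht)) (cont_lin2 e).continuousAt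

lemma Sol.g_cont {R M : ℝ} {u : Eu N → ℝ} (hS : Sol R M u) {x : Eu N}
    (hx : x ∈ ball (0:Eu N) R) : ContinuousAt (gradient u) x :=
  hS.gcont.continuousAt (isOpen_ball.mem_nhds hx)

lemma Sol.u_cont {R M : ℝ} {u : Eu N → ℝ} (hS : Sol R M u) {x : Eu N}
    (hx : x ∈ ball (0:Eu N) R) : ContinuousAt u x :=
  (hS.strict _ hx).hasFDerivAt.continuousAt

/-- Near a point `x` with first return `t1`, the points `y` close to `x` have no return before `t1 - δ`. -/
lemma ret_lower {R M : ℝ} {u : Eu N → ℝ} (hS : Sol R M u) {e x : Eu N}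
    (hx : x ∈ ball (0:Eu N) R) (h0 : 0 < ⟪gradient u x, e⟫) {t1 : ℝ} (hr : Ret R u e x t1) {η : ℝ} (hη : 0 < η) :
    ∀ᶠ y in 𝓝 x, ∀ t, ⟪e, y⟫ < t → t ≤ t1 - η → u y < u (lin e y t) := by
  obtain ⟨h1, h2, h3, h4⟩ := hr
  have hpos := hS.pos hx h0
  have hlx : lin e x ⟪e, x⟫ = x := lin_self _ _
  have hec : Continuous fun y : Eu N => ⟪e, y⟫ := by fun_prop
  set t0 := ⟪e, x⟫ with ht0
  obtain ⟨β, hβ, hβ1⟩ := exists_between h0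
  obtain ⟨β', hβ', hβ2⟩ := exists_between hβ
  have hl := hS.loc (e := e) (x := x) (t := t0) (by rwa [hlx]) (β := β) (c := 0) (by rwa [hlx]) (by rwa [hlx])
  obtain ⟨δ, hδl, hδ⟩ := (hl.and self_mem_nhdsWithin).exists
  replace hδ : 0 < δ := hδ
  have hA : ∀ᶠ y in 𝓝 x, ∀ t ∈ Icc (t0 - δ) (t0 + δ), lin e y t ∈ ball (0:Eu N) R ∧
      β' ≤ ⟪gradient u (lin e y t), e⟫ := by
    refine isCompact_Icc.eventually_forall_of_forall_eventually fun t ht => ?_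
    obtain ⟨a1, a2, a3⟩ := hδl t ht
    have b1 : ∀ᶠ q : Eu N × ℝ in 𝓝 (x, t), lin e q.1 q.2 ∈ ball (0:Eu N) R :=
      (cont_lin2 e).continuousAt.eventually (isOpen_ball.mem_nhds a1)
    have b2 : ∀ᶠ q : Eu N × ℝ in 𝓝 (x, t), β' < ⟪gradient u (lin e q.1 q.2), e⟫ :=
      ((hS.g_lin_cont a1).inner (𝕜 := ℝ) continuousAt_const).eventually (lt_mem_nhds (by linarith))
    filter_upwards [b1, b2] with q c1 c2
    exact ⟨c1, c2.le⟩
  have hB : ∀ᶠ y in 𝓝 x, ∀ t ∈ Icc (t0 + δ) (t1 - η), u y < u (lin e y t) := by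
    refine isCompact_Icc.eventually_forall_of_forall_eventually fun t ht => ?_
    have hin : t ∈ Icc t0 t1 := ⟨by linarith [ht.1], by linarith [ht.2]⟩
    have a1 := lin_mem_ball (by rwa [hlx]) h2 hin
    have a2 := h3 t ⟨by linarith [ht.1], by linarith [ht.2]⟩
    have c1 : ContinuousAt (fun q : Eu N × ℝ => u q.1) (x, t) :=
      ContinuousAt.comp (g := u) (hS.u_cont hx) continuousAt_fst
    exact c1.eventually_lt (hS.u_lin_cont a1) a2
  have hC : ∀ᶠ y in 𝓝 x, ⟪e, y⟫ ∈ Ioo (t0 - δ) (t0 + δ) :=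
    hec.continuousAt.eventually (Ioo_mem_nhds (by linarith) (by linarith))
  filter_upwards [hA, hB, hC] with y hA hB hC t ht ht2
  rcases le_or_gt t (t0 + δ) with h | h
  · have h5 := hS.slope_pos hA (s := ⟪e, y⟫) (t := t) ⟨hC.1.le, hC.2.le⟩ ⟨by linarith [hC.1], h⟩ ht.le
    rw [lin_self] at h5
    have : 0 < β' * (t - ⟪e, y⟫) := mul_pos hβ' (by linarith)
    linarith
  · exact hB t ⟨h.le, ht2⟩

theorem sym_all {g : ℝ → ℝ} (hg : GCond g) {R M : ℝ} {u : Eu N → ℝ} (hS : Sol R M u) {f : ℝ → ℝ → ℝ}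
    (hf : FCond R f) (hsol : IsDistribSolBall R g f u) {e x : Eu N} (he : ‖e‖ = 1)
    (hx : x ∈ ball (0:Eu N) R) (h0 : 0 < ⟪gradient u x, e⟫) {t1 : ℝ} (hr : Ret R u e x t1) :
    gradient u (lin e x t1) = gradient u x - (2 * ⟪gradient u x, e⟫) • e := by
  have hr' := hr
  obtain ⟨h1, h2, h3, h4⟩ := hr
  have hpos := hS.pos hx h0
  have hlx : lin e x ⟪e, x⟫ = x := lin_self _ _
  have hfr : ∃ᶠ q in 𝓝 (x, t1), gradient u (lin e q.1 q.2) - (gradient u q.1 - (2 * ⟪gradient u q.1, e⟫) • e) ∈ ({0} : Set (Eu N)) := by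
    rw [(nhds_basis_ball (x := (x, t1))).frequently_iff]
    intro η hη
    set P : Eu N → Prop := fun y => (dist y x < η ∧ ⟪e, y⟫ < t1 ∧ ∀ t, ⟪e, y⟫ < t → t ≤ t1 - η / 2 → u y < u (lin e y t)) ∧
      y ∈ ball (0:Eu N) R ∧ 0 < ⟪gradient u y, e⟫ with hP
    have hPx : ∀ᶠ y in 𝓝 x, P y := by
      have hec : Continuous fun y : Eu N => ⟪e, y⟫ := by fun_prop
      filter_upwards [ball_mem_nhds x hη, ret_lower hS hx h0 hr' (half_pos hη), isOpen_ball.mem_nhds hx,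
        ((hS.g_cont hx).inner (𝕜 := ℝ) continuousAt_const).eventually (lt_mem_nhds h0),
        hec.continuousAt.eventually (gt_mem_nhds h1)] with y a1 a2 a3 a4 a5
      exact ⟨⟨a1, a5, a2⟩, a3, a4⟩
    set O : Set (Eu N) := {y | ∀ᶠ z in 𝓝 y, P z ∧ u (lin e z t1) < u z}
    have hOo : IsOpen O := isOpen_setOfPred_eventually_nhds
    have hOP : ∀ y ∈ O, P y ∧ u (lin e y t1) < u y := fun y hy => hy.self_of_nhds
    have hne : O.Nonempty := by
      have hct : Tendsto (fun δ : ℝ => lin e x (⟪e, x⟫ + δ)) (𝓝[>] 0) (𝓝 x) := by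
        have : Continuous (fun δ : ℝ => lin e x (⟪e, x⟫ + δ)) := (lin_tendsto e x 0).comp (by fun_prop)
        have h := this.tendsto 0
        simp only [add_zero, hlx] at h
        exact h.mono_left nhdsWithin_le_nhds
      have e1 := hct.eventually (eventually_eventually_nhds.2 hPx)
      have e2 : ∀ᶠ δ in 𝓝[>] (0:ℝ), δ < t1 - ⟪e, x⟫ :=
        nhdsWithin_le_nhds (eventually_lt_nhds (by linarith))
      obtain ⟨δ, ⟨hδ1, hδ2⟩, hδ⟩ := ((e1.and e2).and self_mem_nhdsWithin).exists
      replace hδ : 0 < δ := hδ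
      refine ⟨lin e x (⟪e, x⟫ + δ), hδ1.and ?_⟩
      have hb := hδ1.self_of_nhds.2.1
      have c1 : ContinuousAt (fun z => u (lin e z t1)) (lin e x (⟪e, x⟫ + δ)) :=
        ContinuousAt.comp (g := fun q : Eu N × ℝ => u (lin e q.1 q.2)) (f := fun z => (z, t1))
          (hS.u_lin_cont (by rwa [lin_lin he])) (by fun_prop)
      refine c1.eventually_lt (hS.u_cont hb) ?_
      rw [lin_lin he, h4]
      exact h3 _ ⟨by linarith, by linarith⟩
    obtain ⟨y, hy, t, hrt, hgr⟩ := good_dense hg hS hf hsol he hOo hne fun y hy => (hOP y hy).1.2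
    obtain ⟨⟨⟨hd, hlt, hlow⟩, hyb, hye⟩, hy1⟩ := hOP y hy
    obtain ⟨k1, k2, k3, k4⟩ := hrt
    refine ⟨(y, t), ?_, ?_⟩
    · rw [mem_ball, Prod.dist_eq]
      refine max_lt hd ?_
      rw [Real.dist_eq, abs_lt]
      constructor
      · by_contra hcon
        have := hlow t k1 (by linarith)
        linarith
      · by_contra hcon
        have := k3 t1 ⟨hlt, by linarith⟩
        linarith
    · rw [mem_singleton_iff, sub_eq_zero]; exact hgr
  have hcont : ContinuousAt (fun q : Eu N × ℝ => gradient u (lin e q.1 q.2) - (gradient u q.1 - (2 * ⟪gradient u q.1, e⟫) • e)) (x, t1) := by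
    have c1 : ContinuousAt (fun q : Eu N × ℝ => gradient u q.1) (x, t1) :=
      ContinuousAt.comp (g := gradient u) (hS.g_cont hx) continuousAt_fst
    have c2 : ContinuousAt (fun q : Eu N × ℝ => ⟪gradient u q.1, e⟫) (x, t1) := c1.inner (𝕜 := ℝ) continuousAt_const
    exact (hS.g_lin_cont h2).sub (c1.sub ((continuousAt_const.mul c2).smul continuousAt_const))
  have := isClosed_singleton.mem_of_frequently_of_tendsto hfr hcont
  exact sub_eq_zero.1 this
end LS
end

noncomputable section
namespace LS

open Filter Topology
variable {N : ℕ}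

/-- First return along the ray from `x` in direction `v`. -/
def RetV (R : ℝ) (u : Eu N → ℝ) (x v : Eu N) (s : ℝ) : Prop :=
  0 < s ∧ x + s • v ∈ ball (0:Eu N) R ∧ (∀ t ∈ Ioo 0 s, u x < u (x + t • v)) ∧ u (x + s • v) = u x

lemma ne_of_inner_pos {p v : Eu N} (h : 0 < ⟪p, v⟫) : v ≠ 0 := by
  rintro rfl; simp at h

lemma lin_unit {x v : Eu N} (hv : v ≠ 0) (s : ℝ) :
    lin (‖v‖⁻¹ • v) x (⟪‖v‖⁻¹ • v, x⟫ + s * ‖v‖) = x + s • v := by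
  have : ‖v‖ ≠ 0 := norm_ne_zero_iff.2 hv
  unfold lin
  rw [add_sub_cancel_left, smul_smul, mul_assoc, mul_inv_cancel₀ this, mul_one]

lemma retV_iff {R : ℝ} {u : Eu N → ℝ} {x v : Eu N} (hv : v ≠ 0) (s : ℝ) :
    Ret R u (‖v‖⁻¹ • v) x (⟪‖v‖⁻¹ • v, x⟫ + s * ‖v‖) ↔ RetV R u x v s := by
  have hn : 0 < ‖v‖ := norm_pos_iff.2 hv
  unfold Ret RetV
  rw [lin_unit hv]
  refine and_congr ?_ (and_congr Iff.rfl (and_congr ⟨fun h t ht => ?_, fun h t ht => ?_⟩ Iff.rfl))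
  · rw [lt_add_iff_pos_right, mul_pos_iff_of_pos_right hn]
  · have := h (⟪‖v‖⁻¹ • v, x⟫ + t * ‖v‖) ⟨by have := mul_pos ht.1 hn; linarith,
      by have := mul_lt_mul_of_pos_right ht.2 hn; linarith⟩
    rwa [lin_unit hv] at this
  · have := h ((t - ⟪‖v‖⁻¹ • v, x⟫) / ‖v‖) ⟨div_pos (by linarith [ht.1]) hn,
      by rw [div_lt_iff₀ hn]; linarith [ht.2]⟩
    rw [← lin_unit hv, div_mul_cancel₀ _ hn.ne', add_sub_cancel] at this
    exact this

lemma unit_norm {v : Eu N} (hv : v ≠ 0) : ‖‖v‖⁻¹ • v‖ = 1 := by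
  rw [norm_smul, norm_inv, norm_norm, inv_mul_cancel₀ (norm_ne_zero_iff.2 hv)]

lemma retV_exists {R M : ℝ} {u : Eu N → ℝ} (hS : Sol R M u) {x v : Eu N}
    (hx : x ∈ ball (0:Eu N) R) (h0 : 0 < ⟪gradient u x, v⟫) : ∃ s, RetV R u x v s := by
  have hv := ne_of_inner_pos h0
  have hn : 0 < ‖v‖ := norm_pos_iff.2 hv
  obtain ⟨t1, h⟩ := ret_exists hS (unit_norm hv) hx (by rw [real_inner_smul_right]; positivity)
  refine ⟨(t1 - ⟪‖v‖⁻¹ • v, x⟫) / ‖v‖, (retV_iff hv _).1 ?_⟩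
  rw [div_mul_cancel₀ _ hn.ne', add_sub_cancel]
  exact h

lemma retV_unique {R : ℝ} {u : Eu N → ℝ} {x v : Eu N} {s t : ℝ} (h : RetV R u x v s) (h' : RetV R u x v t) :
    s = t := by
  rcases lt_trichotomy s t with hl | hl | hl
  · exact absurd (h'.2.2.1 s ⟨h.1, hl⟩) (by rw [h.2.2.2]; exact lt_irrefl _)
  · exact hl
  · exact absurd (h.2.2.1 t ⟨h'.1, hl⟩) (by rw [h'.2.2.2]; exact lt_irrefl _)

/-- The reflection property. -/
def SymV (R : ℝ) (u : Eu N → ℝ) : Prop :=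
  ∀ x v s, x ∈ ball (0:Eu N) R → 0 < ⟪gradient u x, v⟫ → RetV R u x v s →
    gradient u (x + s • v) = gradient u x - (2 * ⟪gradient u x, v⟫ / ‖v‖ ^ 2) • v

theorem symV {g : ℝ → ℝ} (hg : GCond g) {R M : ℝ} {u : Eu N → ℝ} (hS : Sol R M u) {f : ℝ → ℝ → ℝ}
    (hf : FCond R f) (hsol : IsDistribSolBall R g f u) : SymV R u := by
  intro x v s hx h0 hr
  have hv := ne_of_inner_pos h0
  have hn : 0 < ‖v‖ := norm_pos_iff.2 hv
  have := sym_all hg hS hf hsol (unit_norm hv) hx (by rw [real_inner_smul_right]; positivity)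
    ((retV_iff hv s).2 hr)
  rw [lin_unit hv] at this
  rw [this, real_inner_smul_right, smul_smul]
  congr 2
  field_simp

lemma Sol.ray {R M : ℝ} {u : Eu N → ℝ} (hS : Sol R M u) {x v : Eu N} {t : ℝ}
    (ht : x + t • v ∈ ball (0:Eu N) R) :
    HasDerivAt (fun t : ℝ => u (x + t • v)) ⟪gradient u (x + t • v), v⟫ t := by
  have h1 : HasDerivAt (fun t : ℝ => x + t • v) v t := by
    have := (HasDerivAt.smul_const (hasDerivAt_id t) v).const_add x
    rw [one_smul] at this; exact this
  have h := (hS.strict _ ht).hasFDerivAt.comp_hasDerivAt t h1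
  rw [innerSL_apply_apply] at h
  exact h

lemma Sol.uray_cont {R M : ℝ} {u : Eu N → ℝ} (hS : Sol R M u) {x v : Eu N} {t : ℝ}
    (ht : x + t • v ∈ ball (0:Eu N) R) :
    ContinuousAt (fun q : (Eu N × Eu N) × ℝ => u (q.1.1 + q.2 • q.1.2)) ((x, v), t) :=
  ContinuousAt.comp (g := u) (f := fun q : (Eu N × Eu N) × ℝ => q.1.1 + q.2 • q.1.2) (x := ((x, v), t))
    (hS.u_cont ht) (by fun_prop)

lemma Sol.gray_cont {R M : ℝ} {u : Eu N → ℝ} (hS : Sol R M u) {x v : Eu N} {t : ℝ}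
    (ht : x + t • v ∈ ball (0:Eu N) R) :
    ContinuousAt (fun q : (Eu N × Eu N) × ℝ => gradient u (q.1.1 + q.2 • q.1.2)) ((x, v), t) :=
  ContinuousAt.comp (g := gradient u) (f := fun q : (Eu N × Eu N) × ℝ => q.1.1 + q.2 • q.1.2) (x := ((x, v), t))
    (hS.g_cont ht) (by fun_prop)

lemma ray_mem {R : ℝ} {x v : Eu N} {s t : ℝ} (hx : x ∈ ball (0:Eu N) R) (h : x + s • v ∈ ball (0:Eu N) R)
    (hs : 0 < s) (ht : t ∈ Icc 0 s) : x + t • v ∈ ball (0:Eu N) R := by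
  have := (convex_ball (0:Eu N) R).add_smul_mem (x := x) (y := s • v) hx h (t := t / s)
    ⟨div_nonneg ht.1 hs.le, (div_le_one hs).2 ht.2⟩
  rwa [smul_smul, div_mul_cancel₀ _ hs.ne'] at this

lemma ray_slope {R M : ℝ} {u : Eu N → ℝ} (hS : Sol R M u) {x v : Eu N} {δ β : ℝ}
    (h : ∀ t ∈ Icc 0 δ, x + t • v ∈ ball (0:Eu N) R ∧ β ≤ ⟪gradient u (x + t • v), v⟫) (hβ : 0 < β) {t : ℝ}
    (ht : t ∈ Ioc 0 δ) : u x < u (x + t • v) := by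
  have h1 : StrictMonoOn (fun t : ℝ => u (x + t • v)) (Icc 0 δ) := by
    refine strictMonoOn_of_deriv_pos (convex_Icc _ _)
      (fun t ht => (hS.ray (h t ht).1).continuousAt.continuousWithinAt) fun t ht => ?_
    have ht' := interior_subset ht
    rw [(hS.ray (h t ht').1).deriv]
    linarith [(h t ht').2]
  have := h1 (a := 0) (b := t) ⟨le_rfl, ht.1.le.trans ht.2⟩ ⟨ht.1.le, ht.2⟩ ht.1
  simpa using this

/-- continuity of the return time -/
lemma retV_cont {R M : ℝ} {u : Eu N → ℝ} (hS : Sol R M u) {x v : Eu N}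
    (hx : x ∈ ball (0:Eu N) R) (h0 : 0 < ⟪gradient u x, v⟫) {s : ℝ} (hr : RetV R u x v s)
    (hneg : ⟪gradient u (x + s • v), v⟫ < 0) {η : ℝ} (hη : 0 < η) :
    ∀ᶠ q : Eu N × Eu N in 𝓝 (x, v), ∀ t, RetV R u q.1 q.2 t → |t - s| < η := by
  obtain ⟨h1, h2, h3, h4⟩ := hr
  obtain ⟨β, hβ, hβ1⟩ := exists_between h0
  have hx0 : x + (0:ℝ) • v = x := by simp
  obtain ⟨δ, hδ, hδl⟩ : ∃ δ : ℝ, 0 < δ ∧ ∀ᶠ q : Eu N × Eu N in 𝓝 (x, v), ∀ t ∈ Icc 0 δ,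
      q.1 + t • q.2 ∈ ball (0:Eu N) R ∧ β ≤ ⟪gradient u (q.1 + t • q.2), q.2⟫ := by
    have b1 : ∀ᶠ q : (Eu N × Eu N) × ℝ in 𝓝 ((x, v), 0), q.1.1 + q.2 • q.1.2 ∈ ball (0:Eu N) R := by
      have : ContinuousAt (fun q : (Eu N × Eu N) × ℝ => q.1.1 + q.2 • q.1.2) ((x, v), 0) := by fun_prop
      exact this.eventually (isOpen_ball.mem_nhds (by simpa using hx))
    have b2 : ∀ᶠ q : (Eu N × Eu N) × ℝ in 𝓝 ((x, v), 0), β < ⟪gradient u (q.1.1 + q.2 • q.1.2), q.1.2⟫ := by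
      have c := (hS.gray_cont (x := x) (v := v) (t := 0) (by rwa [hx0])).inner (𝕜 := ℝ)
        (continuousAt_snd.comp continuousAt_fst)
      refine c.eventually (lt_mem_nhds ?_)
      simp only [zero_smul, add_zero]
      exact hβ1
    have b3 := b1.and b2
    rw [nhds_prod_eq] at b3
    obtain ⟨P, hP, Q, hQ, hPQ⟩ := eventually_prod_iff.1 b3
    obtain ⟨δ, hδ, hsub⟩ := Metric.nhds_basis_closedBall.mem_iff.1 hQ
    refine ⟨δ, hδ, hP.mono fun q hq t ht => ?_⟩
    have := hPQ hq (y := t) (hsub (by rw [mem_closedBall, Real.dist_eq, sub_zero, abs_of_nonneg ht.1]; exact ht.2))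
    exact ⟨this.1, this.2.le⟩
  have hB : ∀ᶠ q : Eu N × Eu N in 𝓝 (x, v), ∀ t ∈ Icc δ (s - η), u q.1 < u (q.1 + t • q.2) := by
    refine isCompact_Icc.eventually_forall_of_forall_eventually fun t ht => ?_
    have a1 := ray_mem hx h2 h1 (t := t) ⟨by linarith [ht.1], by linarith [ht.2]⟩
    have c1 : ContinuousAt (fun q : (Eu N × Eu N) × ℝ => u q.1.1) ((x, v), t) :=
      ContinuousAt.comp (g := u) (f := fun q : (Eu N × Eu N) × ℝ => q.1.1) (x := ((x, v), t))
        (hS.u_cont hx) (by fun_prop)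
    exact c1.eventually_lt (hS.uray_cont a1) (h3 t ⟨by linarith [ht.1], by linarith [ht.2]⟩)
  obtain ⟨η', hη', hη1, hb, hlt⟩ : ∃ η' > 0, η' < η ∧ x + (s + η') • v ∈ ball (0:Eu N) R ∧
      u (x + (s + η') • v) < u x := by
    have hd := (hS.ray h2).hasDerivWithinAt (s := Ioi s)
    have e1 : ∀ᶠ t in 𝓝[>] s, u (x + t • v) < u (x + s • v) := by
      have hsl := (hasDerivWithinAt_iff_tendsto_slope.1 hd)
      simp only [self_notMem_Ioi, not_false_eq_true, sdiff_singleton_eq_self] at hsl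
      filter_upwards [hsl.eventually (gt_mem_nhds hneg), self_mem_nhdsWithin] with t ht ht'
      rw [slope_def_field, div_lt_iff₀ (sub_pos.2 ht')] at ht
      linarith
    have e2 : ∀ᶠ t in 𝓝[>] s, x + t • v ∈ ball (0:Eu N) R := by
      have : ContinuousAt (fun t : ℝ => x + t • v) s := by fun_prop
      exact nhdsWithin_le_nhds (this.eventually (isOpen_ball.mem_nhds h2))
    have e3 : ∀ᶠ t in 𝓝[>] s, t < s + η := nhdsWithin_le_nhds (gt_mem_nhds (by linarith))
    obtain ⟨t, ⟨⟨k1, k2⟩, k3⟩, k4⟩ := (((e1.and e2).and e3).and self_mem_nhdsWithin).exists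
    replace k4 : s < t := k4
    refine ⟨t - s, by linarith, by linarith, ?_, ?_⟩
    · rwa [add_sub_cancel]
    · rw [add_sub_cancel]; linarith
  have hC : ∀ᶠ q : Eu N × Eu N in 𝓝 (x, v), u (q.1 + (s + η') • q.2) < u q.1 := by
    have c1 : ContinuousAt (fun q : Eu N × Eu N => u q.1) (x, v) :=
      ContinuousAt.comp (g := u) (hS.u_cont hx) continuousAt_fst
    have c2 : ContinuousAt (fun q : Eu N × Eu N => u (q.1 + (s + η') • q.2)) (x, v) :=
      ContinuousAt.comp (g := u) (f := fun q : Eu N × Eu N => q.1 + (s + η') • q.2) (x := (x, v))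
        (hS.u_cont hb) (by fun_prop)
    exact c2.eventually_lt c1 hlt
  filter_upwards [hδl, hB, hC] with q hA hB hC t ht
  obtain ⟨k1, k2, k3, k4⟩ := ht
  rw [abs_lt]
  constructor
  · by_contra hcon
    push Not at hcon
    rcases le_or_gt t δ with h | h
    · have := ray_slope hS hA hβ ⟨k1, h⟩
      linarith
    · have := hB t ⟨h.le, by linarith⟩
      linarith
  · by_contra hcon
    push Not at hcon
    have := k3 (s + η') ⟨by linarith, by linarith⟩
    linarith
end LS
end

noncomputable section
namespace LS

open Filter Topology
variable {N : ℕ}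

lemma impl_diff {F : ℝ × ℝ → ℝ} {F' : ℝ × ℝ →L[ℝ] ℝ} {θ0 d : ℝ} {s : ℝ → ℝ}
    (hF : HasStrictFDerivAt F F' (θ0, s θ0)) (hd : HasDerivAt (fun σ => F (θ0, σ)) d (s θ0)) (hne : d ≠ 0)
    (hs : ContinuousAt s θ0) (h0 : ∀ᶠ θ in 𝓝 θ0, F (θ, s θ) = F (θ0, s θ0)) :
    ∃ s', HasDerivAt s s' θ0 := by
  have h1 : HasDerivAt (fun σ : ℝ => ((θ0, σ) : ℝ × ℝ)) (0, 1) (s θ0) :=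
    (hasDerivAt_const _ _).prodMk (hasDerivAt_id _)
  have h2 : F' (0, 1) = d := (hF.hasFDerivAt.comp_hasDerivAt (s θ0) h1).unique hd
  have hinv : (F' ∘L .inr ℝ ℝ ℝ).IsInvertible := by
    refine ⟨ContinuousLinearEquiv.unitsEquivAut ℝ (Units.mk0 d hne), ?_⟩
    ext
    simp [h2]
  have h3 := hF.eventually_apply_eq_iff_implicitFunctionOfProdDomain hinv
  have h4 := (hF.hasStrictFDerivAt_implicitFunctionOfProdDomain hinv).hasFDerivAt.hasDerivAt
  have hp : Tendsto (fun θ => (θ, s θ)) (𝓝 θ0) (𝓝 (θ0, s θ0)) := by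
    rw [nhds_prod_eq]; exact tendsto_id.prodMk hs
  refine ⟨_, h4.congr_of_eventuallyEq ?_⟩
  filter_upwards [hp.eventually h3, h0] with θ a b
  exact (a.1 b).symm

lemma refl_inner {p v : Eu N} (y : Eu N) :
    ⟪p - (2 * ⟪p, v⟫ / ‖v‖ ^ 2) • v, y⟫ = ⟪p, y⟫ - 2 * ⟪p, v⟫ / ‖v‖ ^ 2 * ⟪v, y⟫ := by
  rw [inner_sub_left, real_inner_smul_left]

lemma refl_inner_self {p v : Eu N} (hv : v ≠ 0) :
    ⟪p - (2 * ⟪p, v⟫ / ‖v‖ ^ 2) • v, v⟫ = - ⟪p, v⟫ := by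
  have hn : ‖v‖ ≠ 0 := norm_ne_zero_iff.2 hv
  rw [refl_inner, real_inner_self_eq_norm_sq]
  field_simp
  ring

/-- return time -/
def ST (R : ℝ) (u : Eu N → ℝ) (x v : Eu N) : ℝ := if h : ∃ s, RetV R u x v s then h.choose else 0

lemma ST_spec {R M : ℝ} {u : Eu N → ℝ} (hS : Sol R M u) {x v : Eu N} (hx : x ∈ ball (0:Eu N) R)
    (h0 : 0 < ⟪gradient u x, v⟫) : RetV R u x v (ST R u x v) := by
  have h := retV_exists hS hx h0
  rw [ST, dif_pos h]
  exact h.choose_spec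

lemma ST_eq {R : ℝ} {u : Eu N → ℝ} {x v : Eu N} {s : ℝ} (h : RetV R u x v s) : ST R u x v = s := by
  have h' : ∃ s, RetV R u x v s := ⟨s, h⟩
  rw [ST, dif_pos h']
  exact retV_unique h'.choose_spec h

set_option maxHeartbeats 1000000 in
lemma ST_deriv {R M : ℝ} {u : Eu N → ℝ} (hS : Sol R M u) (hsym : SymV R u) (x h v w : Eu N) (θ0 : ℝ)
    (hx : x + θ0 • h ∈ ball (0:Eu N) R) (h0 : 0 < ⟪gradient u (x + θ0 • h), v + θ0 • w⟫) :
    ∃ s', HasDerivAt (fun θ : ℝ => ST R u (x + θ • h) (v + θ • w)) s' θ0 ∧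
      s' * ⟪gradient u (x + θ0 • h), v + θ0 • w⟫ * ‖v + θ0 • w‖ ^ 2 =
        ST R u (x + θ0 • h) (v + θ0 • w) * ⟪gradient u (x + θ0 • h), w⟫ * ‖v + θ0 • w‖ ^ 2
        - 2 * ⟪gradient u (x + θ0 • h), v + θ0 • w⟫ * ⟪v + θ0 • w, h⟫
        - 2 * ST R u (x + θ0 • h) (v + θ0 • w) * ⟪gradient u (x + θ0 • h), v + θ0 • w⟫ * ⟪v + θ0 • w, w⟫ := by
  have hr := ST_spec hS hx h0
  have hgr := hsym _ _ _ hx h0 hr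
  have hv := ne_of_inner_pos h0
  have hn : ‖v + θ0 • w‖ ≠ 0 := norm_ne_zero_iff.2 hv
  set s : ℝ → ℝ := fun θ : ℝ => ST R u (x + θ • h) (v + θ • w) with hs
  have hs0 : ST R u (x + θ0 • h) (v + θ0 • w) = s θ0 := rfl
  rw [hs0] at hr hgr ⊢
  have hneg : ⟪gradient u (x + θ0 • h + s θ0 • (v + θ0 • w)), v + θ0 • w⟫ = -⟪gradient u (x + θ0 • h), v + θ0 • w⟫ := by
    rw [hgr, refl_inner_self hv]
  have hpc : Tendsto (fun θ : ℝ => (x + θ • h, v + θ • w)) (𝓝 θ0) (𝓝 (x + θ0 • h, v + θ0 • w)) := by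
    have : Continuous (fun θ : ℝ => (x + θ • h, v + θ • w)) := by fun_prop
    exact this.tendsto θ0
  have hxc : Continuous (fun θ : ℝ => x + θ • h) := by fun_prop
  have hvc : Continuous (fun θ : ℝ => v + θ • w) := by fun_prop
  have hev : ∀ᶠ θ in 𝓝 θ0, RetV R u (x + θ • h) (v + θ • w) (s θ) := by
    have e1 : ∀ᶠ θ in 𝓝 θ0, x + θ • h ∈ ball (0:Eu N) R := hxc.continuousAt.eventually (isOpen_ball.mem_nhds hx)
    have c : ContinuousAt (fun θ : ℝ => gradient u (x + θ • h)) θ0 :=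
      ContinuousAt.comp (g := gradient u) (f := fun θ : ℝ => x + θ • h) (hS.g_cont hx) hxc.continuousAt
    have e2 : ∀ᶠ θ in 𝓝 θ0, 0 < ⟪gradient u (x + θ • h), v + θ • w⟫ :=
      (c.inner (𝕜 := ℝ) hvc.continuousAt).eventually (lt_mem_nhds h0)
    filter_upwards [e1, e2] with θ a b
    exact ST_spec hS a b
  clear_value s
  have hsc : ContinuousAt s θ0 := by
    rw [Metric.continuousAt_iff']
    intro η hη
    have := hpc.eventually (retV_cont hS hx h0 hr (by rw [hneg]; linarith) hη)
    filter_upwards [this, hev] with θ a b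
    exact a _ b
  have hdiff : ∃ s', HasDerivAt s s' θ0 := by
    have hG : ContDiff ℝ 1 (fun q : ℝ × ℝ => x + q.1 • h + q.2 • (v + q.1 • w)) := by fun_prop
    have hG' := hG.contDiffAt.hasStrictFDerivAt (x := (θ0, s θ0)) one_ne_zero
    have hH : ContDiff ℝ 1 (fun q : ℝ × ℝ => x + q.1 • h) := by fun_prop
    have hH' := hH.contDiffAt.hasStrictFDerivAt (x := (θ0, s θ0)) one_ne_zero
    have l1 : HasStrictFDerivAt u _ ((fun q : ℝ × ℝ => x + q.1 • h + q.2 • (v + q.1 • w)) (θ0, s θ0)) :=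
      hS.strict _ hr.2.1
    have l2 : HasStrictFDerivAt u _ ((fun q : ℝ × ℝ => x + q.1 • h) (θ0, s θ0)) := hS.strict _ hx
    have k1 := l1.comp (θ0, s θ0) hG'
    have k2 := l2.comp (θ0, s θ0) hH'
    clear l1 l2 hG' hH'
    refine impl_diff (k1.sub k2) (d := -⟪gradient u (x + θ0 • h), v + θ0 • w⟫) ?_ (by linarith) hsc ?_
    · have := (hS.ray hr.2.1).sub_const (u (x + θ0 • h))
      rw [hneg] at this
      exact this
    · filter_upwards [hev] with θ a
      have a1 := a.2.2.2
      have a2 := hr.2.2.2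
      simp only [Pi.sub_apply, Function.comp]
      rw [a1, a2, sub_self, sub_self]
  obtain ⟨s', hs'⟩ := hdiff
  refine ⟨s', hs ▸ hs', ?_⟩
  have d1 : HasDerivAt (fun θ : ℝ => x + θ • h) h θ0 := by
    have := (HasDerivAt.smul_const (hasDerivAt_id θ0) h).const_add x
    rw [one_smul] at this; exact this
  have d2 : HasDerivAt (fun θ : ℝ => v + θ • w) w θ0 := by
    have := (HasDerivAt.smul_const (hasDerivAt_id θ0) w).const_add v
    rw [one_smul] at this; exact this
  have d3 := d1.add (hs'.smul d2)
  have k1 := (hS.strict _ hr.2.1).hasFDerivAt.comp_hasDerivAt θ0 d3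
  have k2 := (hS.strict _ hx).hasFDerivAt.comp_hasDerivAt θ0 d1
  have k3 : HasDerivAt (fun θ : ℝ => u (x + θ • h)) _ θ0 := k1.congr_of_eventuallyEq (by
    filter_upwards [hev] with θ a
    exact a.2.2.2.symm)
  have k4 := k3.unique k2
  rw [innerSL_apply_apply, innerSL_apply_apply, hgr] at k4
  generalize gradient u (x + θ0 • h) = p at k4 ⊢
  generalize s θ0 = σ at k4 ⊢
  generalize v + θ0 • w = V at hv hn k4 ⊢
  rw [inner_add_right, inner_add_right, real_inner_smul_right, real_inner_smul_right,
    refl_inner, refl_inner, refl_inner_self hv] at k4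
  field_simp at k4
  linarith
end LS
end

noncomputable section
namespace LS

open Filter Topology
variable {N : ℕ}

lemma ST_dir {R M : ℝ} {u : Eu N → ℝ} (hS : Sol R M u) (hsym : SymV R u) {x v : Eu N}
    (hx : x ∈ ball (0:Eu N) R) (h0 : 0 < ⟪gradient u x, v⟫) :
    ST R u x v * ‖v‖ ^ 2 = ST R u x (gradient u x) * ⟪gradient u x, v⟫ := by
  set p := gradient u x with hp
  have hp0 : p ≠ 0 := by intro h; rw [h] at h0; simp at h0
  have hpn : 0 < ‖p‖ ^ 2 := by have := norm_pos_iff.2 hp0; positivity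
  have hpos : ∀ θ ∈ Icc (0:ℝ) 1, 0 < ⟪p, p + θ • (v - p)⟫ := by
    intro θ hθ
    rw [inner_add_right, real_inner_smul_right, inner_sub_right, real_inner_self_eq_norm_sq]
    have : ‖p‖ ^ 2 + θ * (⟪p, v⟫ - ‖p‖ ^ 2) = (1 - θ) * ‖p‖ ^ 2 + θ * ⟪p, v⟫ := by ring
    rw [this]
    rcases hθ.2.lt_or_eq with h | h
    · have a1 : 0 < (1 - θ) * ‖p‖ ^ 2 := mul_pos (by linarith) hpn
      have a2 : 0 ≤ θ * ⟪p, v⟫ := mul_nonneg hθ.1 h0.le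
      linarith
    · rw [h]; linarith
  have hd : ∀ θ ∈ Icc (0:ℝ) 1, HasDerivAt (fun θ : ℝ => ST R u x (p + θ • (v - p)) * ‖p + θ • (v - p)‖ ^ 2 /
      ⟪p, p + θ • (v - p)⟫) 0 θ := by
    intro θ hθ
    have hps := hpos θ hθ
    obtain ⟨s', hs', heq⟩ := ST_deriv hS hsym x 0 p (v - p) θ (by simpa using hx)
      (by rw [smul_zero, add_zero, ← hp]; exact hps)
    simp only [smul_zero, add_zero, ← hp, inner_zero_right, mul_zero, sub_zero] at hs' heq
    have d2 : HasDerivAt (fun θ : ℝ => p + θ • (v - p)) (v - p) θ := by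
      have := (HasDerivAt.smul_const (hasDerivAt_id θ) (v - p)).const_add p
      rw [one_smul] at this; exact this
    have d3 := d2.norm_sq
    have d4 : HasDerivAt (fun θ : ℝ => ⟪p, p + θ • (v - p)⟫) ⟪p, v - p⟫ θ := by
      have := (hasDerivAt_const θ p).inner (𝕜 := ℝ) d2
      simpa using! this
    have d5 := (hs'.mul d3).div d4 hps.ne'
    refine d5.congr_deriv ?_
    rw [div_eq_zero_iff]
    left
    simp only [Pi.mul_apply]
    linear_combination heq
  have hc := constant_of_has_deriv_right_zero (a := 0) (b := 1)
    (fun θ hθ => (hd θ hθ).continuousAt.continuousWithinAt)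
    (fun θ hθ => (hd θ ⟨hθ.1, hθ.2.le⟩).hasDerivWithinAt) 1 ⟨zero_le_one, le_rfl⟩
  simp only [one_smul, zero_smul, add_zero, add_sub_cancel, real_inner_self_eq_norm_sq] at hc
  rw [mul_div_assoc, mul_div_assoc, div_self hpn.ne', mul_one] at hc
  rw [← hc]
  field_simp

lemma ST_loc {R M : ℝ} {u : Eu N → ℝ} (hS : Sol R M u) (hsym : SymV R u) {x y v : Eu N}
    (h : ∀ θ ∈ Icc (0:ℝ) 1, x + θ • (y - x) ∈ ball (0:Eu N) R ∧ 0 < ⟪gradient u (x + θ • (y - x)), v⟫) :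
    ST R u y v * ‖v‖ ^ 2 + 2 * ⟪v, y⟫ = ST R u x v * ‖v‖ ^ 2 + 2 * ⟪v, x⟫ := by
  have hd : ∀ θ ∈ Icc (0:ℝ) 1, HasDerivAt (fun θ : ℝ => ST R u (x + θ • (y - x)) v * ‖v‖ ^ 2 +
      2 * ⟪v, x + θ • (y - x)⟫) 0 θ := by
    intro θ hθ
    obtain ⟨h1, h2⟩ := h θ hθ
    obtain ⟨s', hs', heq⟩ := ST_deriv hS hsym x (y - x) v 0 θ h1
      (by rw [smul_zero, add_zero]; exact h2)
    simp only [smul_zero, add_zero, inner_zero_right, mul_zero, sub_zero, zero_mul, zero_sub] at hs' heq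
    have d2 : HasDerivAt (fun θ : ℝ => x + θ • (y - x)) (y - x) θ := by
      have := (HasDerivAt.smul_const (hasDerivAt_id θ) (y - x)).const_add x
      rw [one_smul] at this; exact this
    have d4 : HasDerivAt (fun θ : ℝ => ⟪v, x + θ • (y - x)⟫) ⟪v, y - x⟫ θ := by
      have := (hasDerivAt_const θ v).inner (𝕜 := ℝ) d2
      simpa using! this
    refine ((hs'.mul_const (‖v‖ ^ 2)).add (d4.const_mul 2)).congr_deriv ?_
    refine mul_left_cancel₀ h2.ne' ?_
    linear_combination heq
  have hc := constant_of_has_deriv_right_zero (a := 0) (b := 1)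
    (fun θ hθ => (hd θ hθ).continuousAt.continuousWithinAt)
    (fun θ hθ => (hd θ ⟨hθ.1, hθ.2.le⟩).hasDerivWithinAt) 1 ⟨zero_le_one, le_rfl⟩
  simp only [one_smul, zero_smul, add_zero, add_sub_cancel] at hc
  exact hc

def kap (R : ℝ) (u : Eu N → ℝ) (x : Eu N) : ℝ := ST R u x (gradient u x) / 2
/-- the centre attached to a noncritical point -/
def zf (R : ℝ) (u : Eu N → ℝ) (x : Eu N) : Eu N := x + kap R u x • gradient u x

lemma inner_grad_pos {u : Eu N → ℝ} {x : Eu N} (hp : gradient u x ≠ 0) : 0 < ⟪gradient u x, gradient u x⟫ :=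
  real_inner_self_pos.2 hp

lemma kap_pos {R M : ℝ} {u : Eu N → ℝ} (hS : Sol R M u) {x : Eu N} (hx : x ∈ ball (0:Eu N) R)
    (hp : gradient u x ≠ 0) : 0 < kap R u x :=
  half_pos (ST_spec hS hx (inner_grad_pos hp)).1

lemma ST_zf {R M : ℝ} {u : Eu N → ℝ} (hS : Sol R M u) (hsym : SymV R u) {x v : Eu N}
    (hx : x ∈ ball (0:Eu N) R) (h0 : 0 < ⟪gradient u x, v⟫) :
    ST R u x v * ‖v‖ ^ 2 + 2 * ⟪v, x⟫ = 2 * ⟪v, zf R u x⟫ := by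
  rw [ST_dir hS hsym hx h0, zf, inner_add_right, real_inner_smul_right, kap, real_inner_comm v]
  ring

lemma zf_loc {R M : ℝ} {u : Eu N → ℝ} (hS : Sol R M u) (hsym : SymV R u) {x : Eu N}
    (hx : x ∈ ball (0:Eu N) R) (hp : gradient u x ≠ 0) : ∀ᶠ y in 𝓝 x, zf R u y = zf R u x := by
  have hev : ∀ᶠ q : Eu N × Eu N in 𝓝 (gradient u x, gradient u x), 0 < ⟪q.1, q.2⟫ := by
    have : ContinuousAt (fun q : Eu N × Eu N => ⟪q.1, q.2⟫) (gradient u x, gradient u x) := by fun_prop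
    exact this.eventually (lt_mem_nhds (inner_grad_pos hp))
  obtain ⟨ε, hε, hsub⟩ := Metric.nhds_basis_ball.mem_iff.1 hev
  have hε' : ∀ a ∈ ball (gradient u x) ε, ∀ v ∈ ball (gradient u x) ε, 0 < ⟪a, v⟫ := by
    intro a ha v hv
    have hm : ((a, v) : Eu N × Eu N) ∈ ball (gradient u x, gradient u x) ε := by
      rw [mem_ball, Prod.dist_eq]; exact max_lt ha hv
    exact hsub hm
  have hev2 : ∀ᶠ y in 𝓝 x, y ∈ ball (0:Eu N) R ∧ gradient u y ∈ ball (gradient u x) ε := by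
    have e1 : ∀ᶠ y in 𝓝 x, y ∈ ball (0:Eu N) R := isOpen_ball.mem_nhds hx
    have e2 : ∀ᶠ y in 𝓝 x, gradient u y ∈ ball (gradient u x) ε :=
      (hS.g_cont hx).eventually_mem (ball_mem_nhds _ hε)
    exact e1.and e2
  obtain ⟨δ, hδ, hδs⟩ := Metric.nhds_basis_ball.mem_iff.1 hev2
  filter_upwards [ball_mem_nhds x hδ] with y hy
  have hv : ∀ v ∈ ball (gradient u x) ε, ⟪v, zf R u y - zf R u x⟫ = 0 := by
    intro v hv
    have hxb : x ∈ ball x δ := mem_ball_self hδ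
    have h1 := ST_zf hS hsym (hδs hxb).1 (hε' _ (hδs hxb).2 v hv)
    have h2 := ST_zf hS hsym (hδs hy).1 (hε' _ (hδs hy).2 v hv)
    have h3 := ST_loc hS hsym (x := x) (y := y) (v := v) fun θ hθ => by
      have hb : x + θ • (y - x) ∈ ball x δ := (convex_ball x δ).add_smul_sub_mem hxb hy hθ
      exact ⟨(hδs hb).1, hε' _ (hδs hb).2 v hv⟩
    rw [inner_sub_right]
    linarith
  set d := zf R u y - zf R u x with hd
  have h1 := hv (gradient u x) (mem_ball_self hε)
  set τ := ε / (2 * (‖d‖ + 1)) with hτ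
  have hdn : 0 ≤ ‖d‖ := norm_nonneg d
  have hτ0 : 0 < τ := by positivity
  have h2 := hv (gradient u x + τ • d) (by
    rw [mem_ball, dist_eq_norm, add_sub_cancel_left, norm_smul, Real.norm_eq_abs, abs_of_pos hτ0, hτ,
      div_mul_eq_mul_div, div_lt_iff₀ (by positivity)]
    refine mul_lt_mul_of_pos_left ?_ hε
    linarith)
  rw [inner_add_left, h1, real_inner_smul_left, zero_add] at h2
  have h3 : ⟪d, d⟫ = 0 := (mul_eq_zero.1 h2).resolve_left hτ0.ne'
  have h4 : d = 0 := inner_self_eq_zero.1 h3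
  exact sub_eq_zero.1 h4

lemma zf_inner {R M : ℝ} {u : Eu N → ℝ} (hS : Sol R M u) {x v : Eu N}
    (hx : x ∈ ball (0:Eu N) R) (hp : gradient u x ≠ 0) (h : 0 < ⟪v, zf R u x - x⟫) : 0 < ⟪gradient u x, v⟫ := by
  rw [zf, add_sub_cancel_left, real_inner_smul_right] at h
  rw [real_inner_comm]
  exact pos_of_mul_pos_right h (kap_pos hS hx hp).le

lemma zf_norm {x z q : Eu N} : ‖q - z‖ ^ 2 = ‖q - x‖ ^ 2 - 2 * ⟪q - x, z - x⟫ + ‖x - z‖ ^ 2 := by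
  have : q - z = (q - x) - (z - x) := by abel
  rw [this, norm_sub_sq_real, norm_sub_rev z x]

lemma zf_inside {R M : ℝ} {u : Eu N → ℝ} (hS : Sol R M u) (hsym : SymV R u) {x q : Eu N}
    (hx : x ∈ ball (0:Eu N) R) (hp : gradient u x ≠ 0) (hq : ‖q - zf R u x‖ < ‖x - zf R u x‖) :
    q ∈ ball (0:Eu N) R ∧ u x < u q := by
  have h1 : ‖q - zf R u x‖ ^ 2 < ‖x - zf R u x‖ ^ 2 := by
    have := norm_nonneg (q - zf R u x); gcongr
  rw [zf_norm (x := x)] at h1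
  have hne : q - x ≠ 0 := by
    intro h; rw [sub_eq_zero.1 h] at hq; exact lt_irrefl _ hq
  have hn : 0 < ‖q - x‖ ^ 2 := by have := norm_pos_iff.2 hne; positivity
  have h2 : 0 < ⟪gradient u x, q - x⟫ := zf_inner hS hx hp (by linarith)
  have h3 := ST_zf hS hsym hx h2
  have h4 : 1 < ST R u x (q - x) := by
    rw [inner_sub_right] at h1
    by_contra hcon
    push Not at hcon
    have := mul_le_mul_of_nonneg_right hcon hn.le
    linarith
  have hr := ST_spec hS hx h2
  have hq1 : x + (1:ℝ) • (q - x) = q := by rw [one_smul, add_sub_cancel]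
  have a1 := ray_mem hx hr.2.1 hr.1 (t := 1) ⟨zero_le_one, h4.le⟩
  have a2 := hr.2.2.1 1 ⟨zero_lt_one, h4⟩
  rw [hq1] at a1 a2
  exact ⟨a1, a2⟩

lemma zf_sphere {R M : ℝ} {u : Eu N → ℝ} (hS : Sol R M u) (hsym : SymV R u) {x y : Eu N}
    (hx : x ∈ ball (0:Eu N) R) (hp : gradient u x ≠ 0) (hy : ‖y - zf R u x‖ = ‖x - zf R u x‖) :
    y ∈ ball (0:Eu N) R ∧ u y = u x ∧ gradient u y = (kap R u x)⁻¹ • (zf R u x - y) ∧ zf R u y = zf R u x := by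
  have hk := kap_pos hS hx hp
  rcases eq_or_ne y x with h | hne
  · subst h
    refine ⟨hx, rfl, ?_, rfl⟩
    rw [zf, add_sub_cancel_left, smul_smul, inv_mul_cancel₀ hk.ne', one_smul]
  have hv : y - x ≠ 0 := sub_ne_zero.2 hne
  have hn : 0 < ‖y - x‖ ^ 2 := by have := norm_pos_iff.2 hv; positivity
  have h1 := zf_norm (x := x) (z := zf R u x) (q := y)
  rw [hy] at h1
  have h2 : 0 < ⟪gradient u x, y - x⟫ := zf_inner hS hx hp (by linarith)
  have h3 := ST_zf hS hsym hx h2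
  have h5 : 2 * (kap R u x * ⟪gradient u x, y - x⟫) = ‖y - x‖ ^ 2 := by
    have : zf R u x - x = kap R u x • gradient u x := by rw [zf, add_sub_cancel_left]
    rw [this, real_inner_smul_right, real_inner_comm] at h1
    linarith
  have h4 : ST R u x (y - x) = 1 := by
    rw [inner_sub_right] at h1
    have : (ST R u x (y - x) - 1) * ‖y - x‖ ^ 2 = 0 := by linarith
    have := (mul_eq_zero.1 this).resolve_right hn.ne'
    linarith
  have hr := ST_spec hS hx h2
  rw [h4] at hr
  have hg := hsym _ _ _ hx h2 hr
  obtain ⟨-, r2, r3, r4⟩ := hr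
  have hy1 : x + (1:ℝ) • (y - x) = y := by rw [one_smul, add_sub_cancel]
  rw [hy1] at r2 r4 hg
  have hgi : ⟪gradient u y, x - y⟫ = ⟪gradient u x, y - x⟫ := by
    rw [← neg_sub y x, inner_neg_right, hg, refl_inner_self hv, neg_neg]
  have hgy : gradient u y = (kap R u x)⁻¹ • (zf R u x - y) := by
    have hc : 2 * ⟪gradient u x, y - x⟫ / ‖y - x‖ ^ 2 = (kap R u x)⁻¹ := by
      rw [← h5]; field_simp
    rw [hg, hc]
    have : zf R u x - y = kap R u x • gradient u x - (y - x) := by rw [zf]; abel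
    rw [this, smul_sub (kap R u x)⁻¹ (kap R u x • gradient u x), smul_smul, inv_mul_cancel₀ hk.ne', one_smul]
  refine ⟨r2, r4, hgy, ?_⟩
  have hr' : RetV R u y (x - y) 1 := by
    refine ⟨zero_lt_one, ?_, fun t ht => ?_, ?_⟩
    · rw [one_smul, add_sub_cancel]; exact hx
    · have := r3 (1 - t) ⟨by linarith [ht.2], by linarith [ht.1]⟩
      have e : x + (1 - t) • (y - x) = y + t • (x - y) := by module
      rw [e] at this
      rw [r4]; exact this
    · rw [one_smul, add_sub_cancel]; exact r4.symm
  have h6 := ST_dir hS hsym r2 (by rw [hgi]; exact h2 : 0 < ⟪gradient u y, x - y⟫)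
  rw [ST_eq hr', one_mul, hgi, norm_sub_rev, ← h5] at h6
  have h7 : kap R u y = kap R u x := by
    have : 2 * (kap R u y - kap R u x) * ⟪gradient u x, y - x⟫ = 0 := by
      have hk2 : kap R u y = ST R u y (gradient u y) / 2 := rfl
      rw [hk2]
      linear_combination -h6
    have := (mul_eq_zero.1 this).resolve_right h2.ne'
    linarith
  rw [zf, h7, hgy, smul_smul, mul_inv_cancel₀ hk.ne', one_smul, add_sub_cancel]
end LS
end

noncomputable section
namespace LS

open Filter Topology
variable {N : ℕ}

def Gd (R : ℝ) (u : Eu N → ℝ) (z : Eu N) : Set ℝ :=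
  {r | ∃ x ∈ ball (0:Eu N) R, gradient u x ≠ 0 ∧ zf R u x = z ∧ ‖x - z‖ = r}

lemma zf_dist_pos {R M : ℝ} {u : Eu N → ℝ} (hS : Sol R M u) {x : Eu N} (hx : x ∈ ball (0:Eu N) R)
    (hp : gradient u x ≠ 0) : 0 < ‖x - zf R u x‖ := by
  have hk := kap_pos hS hx hp
  rw [norm_sub_rev, zf, add_sub_cancel_left, norm_smul]
  exact mul_pos (norm_pos_iff.2 hk.ne') (norm_pos_iff.2 hp)

lemma gd_pos {R M : ℝ} {u : Eu N → ℝ} (hS : Sol R M u) {z : Eu N} {r : ℝ} (hr : r ∈ Gd R u z) : 0 < r := by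
  obtain ⟨x, hx, hp, rfl, rfl⟩ := hr
  exact zf_dist_pos hS hx hp

lemma gd_center {R M : ℝ} {u : Eu N → ℝ} (hS : Sol R M u) (hsym : SymV R u) {z : Eu N} {r : ℝ}
    (hr : r ∈ Gd R u z) : z ∈ ball (0:Eu N) R := by
  obtain ⟨x, hx, hp, rfl, rfl⟩ := hr
  exact (zf_inside hS hsym hx hp (by rw [sub_self, norm_zero]; exact zf_dist_pos hS hx hp)).1

lemma gd_lt {R M : ℝ} {u : Eu N → ℝ} (hS : Sol R M u) (hsym : SymV R u) {z : Eu N} {r : ℝ}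
    (hr : r ∈ Gd R u z) : r < 2 * R := by
  have hz := gd_center hS hsym hr
  obtain ⟨x, hx, hp, h1, rfl⟩ := hr
  rw [mem_ball_zero_iff] at hx hz
  linarith [norm_sub_le x z]

lemma gd_all {R M : ℝ} {u : Eu N → ℝ} (hS : Sol R M u) (hsym : SymV R u) {z y : Eu N}
    (hr : ‖y - z‖ ∈ Gd R u z) : y ∈ ball (0:Eu N) R ∧ gradient u y ≠ 0 ∧ zf R u y = z ∧
      ∃ c : ℝ, 0 < c ∧ gradient u y = c • (z - y) := by
  have h0 := gd_pos hS hr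
  obtain ⟨x, hx, hp, rfl, h1⟩ := hr
  obtain ⟨a, b, c, d⟩ := zf_sphere hS hsym hx hp h1.symm
  have hk := kap_pos hS hx hp
  have hi : 0 < (kap R u x)⁻¹ := inv_pos.2 hk
  refine ⟨a, ?_, d, _, hi, c⟩
  rw [c]
  refine smul_ne_zero hi.ne' ?_
  rw [← norm_pos_iff, norm_sub_rev]; exact h0

lemma gd_const {R M : ℝ} {u : Eu N → ℝ} (hS : Sol R M u) (hsym : SymV R u) {z y y' : Eu N}
    (hr : ‖y - z‖ ∈ Gd R u z) (h : ‖y' - z‖ = ‖y - z‖) : u y' = u y := by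
  obtain ⟨a, b, c, -⟩ := gd_all hS hsym hr
  subst c
  exact (zf_sphere hS hsym a b h).2.1

lemma gd_in {R M : ℝ} {u : Eu N → ℝ} (hS : Sol R M u) (hsym : SymV R u) {z y q : Eu N}
    (hr : ‖y - z‖ ∈ Gd R u z) (h : ‖q - z‖ < ‖y - z‖) : u y < u q := by
  obtain ⟨a, b, c, -⟩ := gd_all hS hsym hr
  subst c
  exact (zf_inside hS hsym a b h).2

lemma gd_open {R M : ℝ} {u : Eu N → ℝ} (hS : Sol R M u) (hsym : SymV R u) (z : Eu N) :
    IsOpen (Gd R u z) := by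
  rw [isOpen_iff_mem_nhds]
  intro r hr
  have h0 := gd_pos hS hr
  obtain ⟨x, hx, hp, hz, h1⟩ := hr
  have e1 : ∀ᶠ y in 𝓝 x, y ∈ ball (0:Eu N) R := isOpen_ball.mem_nhds hx
  have e2 : ∀ᶠ y in 𝓝 x, gradient u y ≠ 0 := (hS.g_cont hx).eventually_ne hp
  have e3 := zf_loc hS hsym hx hp
  have hc : ContinuousAt (fun s : ℝ => z + (s / r) • (x - z)) r := by fun_prop
  have hv : z + (r / r) • (x - z) = x := by rw [div_self h0.ne', one_smul, add_sub_cancel]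
  have hev : ∀ᶠ s in 𝓝 r, (fun s : ℝ => z + (s / r) • (x - z)) s ∈
      {y | y ∈ ball (0:Eu N) R ∧ gradient u y ≠ 0 ∧ zf R u y = zf R u x} := by
    apply hc.eventually_mem
    simp only [hv]
    exact e1.and (e2.and e3)
  filter_upwards [hev, lt_mem_nhds h0] with s hs hs0
  obtain ⟨a, b, c⟩ := hs
  refine ⟨_, a, b, c.trans hz, ?_⟩
  rw [add_sub_cancel_left, norm_smul, h1, Real.norm_eq_abs, abs_of_pos (by positivity)]
  field_simp

lemma open_conn_Ioo {C : Set ℝ} (ho : IsOpen C) (hc : IsPreconnected C) (hn : C.Nonempty)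
    (hb : BddBelow C) (ha : BddAbove C) : C = Ioo (sInf C) (sSup C) := by
  apply Subset.antisymm
  · intro r hr
    obtain ⟨ε, hε, h⟩ := Metric.isOpen_iff.1 ho r hr
    have h1 : r - ε / 2 ∈ C := h (by rw [mem_ball, Real.dist_eq, abs_lt]; constructor <;> linarith)
    have h2 : r + ε / 2 ∈ C := h (by rw [mem_ball, Real.dist_eq, abs_lt]; constructor <;> linarith)
    exact ⟨by linarith [csInf_le hb h1], by linarith [le_csSup ha h2]⟩
  · exact (IsConnected.Ioo_csInf_csSup_subset ⟨hn, hc⟩ hb ha)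

def Cc (R : ℝ) (u : Eu N → ℝ) (x : Eu N) : Set ℝ :=
  connectedComponentIn (Gd R u (zf R u x)) ‖x - zf R u x‖

lemma mem_gd {R : ℝ} {u : Eu N → ℝ} {x : Eu N} (hx : x ∈ ball (0:Eu N) R)
    (hp : gradient u x ≠ 0) : ‖x - zf R u x‖ ∈ Gd R u (zf R u x) := ⟨x, hx, hp, rfl, rfl⟩

lemma mem_Cc {R : ℝ} {u : Eu N → ℝ} {x : Eu N} (hx : x ∈ ball (0:Eu N) R)
    (hp : gradient u x ≠ 0) : ‖x - zf R u x‖ ∈ Cc R u x :=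
  mem_connectedComponentIn (mem_gd hx hp)

lemma Cc_sub {R : ℝ} {u : Eu N → ℝ} {x : Eu N} : Cc R u x ⊆ Gd R u (zf R u x) :=
  connectedComponentIn_subset _ _

lemma Cc_Ioo {R M : ℝ} {u : Eu N → ℝ} (hS : Sol R M u) (hsym : SymV R u) {x : Eu N}
    (hx : x ∈ ball (0:Eu N) R) (hp : gradient u x ≠ 0) :
    Cc R u x = Ioo (sInf (Cc R u x)) (sSup (Cc R u x)) ∧ 0 ≤ sInf (Cc R u x) ∧
      sInf (Cc R u x) < sSup (Cc R u x) := by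
  have hn : (Cc R u x).Nonempty := ⟨_, mem_Cc hx hp⟩
  have h := open_conn_Ioo (C := Cc R u x) (gd_open hS hsym _).connectedComponentIn
    isPreconnected_connectedComponentIn hn
    ⟨0, fun r hr => (gd_pos hS (Cc_sub hr)).le⟩ ⟨2 * R, fun r hr => (gd_lt hS hsym (Cc_sub hr)).le⟩
  refine ⟨h, le_csInf hn fun r hr => (gd_pos hS (Cc_sub hr)).le, ?_⟩
  rw [h] at hn
  obtain ⟨r, hr⟩ := hn
  exact hr.1.trans hr.2

def An (R : ℝ) (u : Eu N → ℝ) (x : Eu N) : Set (Eu N) := {y | ‖y - zf R u x‖ ∈ Cc R u x}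

lemma An_eq {R M : ℝ} {u : Eu N → ℝ} (hS : Sol R M u) (hsym : SymV R u) {x : Eu N}
    (hx : x ∈ ball (0:Eu N) R) (hp : gradient u x ≠ 0) :
    ball (zf R u x) (sSup (Cc R u x)) \ closedBall (zf R u x) (sInf (Cc R u x)) = An R u x := by
  ext y
  rw [An, mem_ofPred_eq, (Cc_Ioo hS hsym hx hp).1, Set.mem_sdiff, mem_ball, mem_closedBall, dist_eq_norm,
    not_le, mem_Ioo, and_comm, ← (Cc_Ioo hS hsym hx hp).1]

lemma An_trans {R M : ℝ} {u : Eu N → ℝ} (hS : Sol R M u) (hsym : SymV R u) {x y : Eu N}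
    (hy : y ∈ An R u x) : y ∈ ball (0:Eu N) R ∧ gradient u y ≠ 0 ∧ An R u y = An R u x := by
  have hy' : ‖y - zf R u x‖ ∈ Cc R u x := hy
  obtain ⟨a, b, c, -⟩ := gd_all hS hsym (Cc_sub hy')
  refine ⟨a, b, ?_⟩
  have : Cc R u y = Cc R u x := by
    unfold Cc
    rw [c]
    exact (connectedComponentIn_eq hy').symm
  rw [An, An, this, c]

lemma An_open {R M : ℝ} {u : Eu N → ℝ} (hS : Sol R M u) (hsym : SymV R u) {x : Eu N} :
    IsOpen (An R u x) := by
  have : IsOpen (Cc R u x) := (gd_open hS hsym _).connectedComponentIn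
  exact this.preimage (f := fun y : Eu N => ‖y - zf R u x‖) (by fun_prop)

theorem Sol.locSym {R M : ℝ} {u : Eu N → ℝ} (hN : 1 ≤ N) (hS : Sol R M u) (hsym : SymV R u)
    (h1 : ContDiffOn ℝ 1 u (closedBall 0 R)) : LocallySymmetric R u := by
  obtain ⟨ω, hω⟩ : ∃ ω : Eu N, ‖ω‖ = 1 :=
    ⟨EuclideanSpace.single (⟨0, hN⟩ : Fin N) (1:ℝ), by simp⟩
  have hR := hS.hR
  have hud : UniqueDiffOn ℝ (closedBall (0:Eu N) R) :=
    uniqueDiffOn_convex (convex_closedBall _ _) (by rw [interior_closedBall _ hR.ne']; exact ⟨0, by simpa⟩)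
  have hcf := h1.continuousOn_fderivWithin hud le_rfl
  set d : ℕ → Eu N := TopologicalSpace.denseSeq (Eu N) with hd
  have hdd : DenseRange d := TopologicalSpace.denseRange_denseSeq _
  clear_value d
  set K : Set ℕ := {k | (d k ∈ ball (0:Eu N) R ∧ gradient u (d k) ≠ 0) ∧ ∀ j < k, d j ∉ An R u (d k)} with hK
  have hKD : ∀ k ∈ K, d k ∈ ball (0:Eu N) R ∧ gradient u (d k) ≠ 0 := fun k hk => hk.1
  refine ⟨K, fun k => zf R u (d k), fun k => sInf (Cc R u (d k)), fun k => sSup (Cc R u (d k)),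
    fun k r => u (zf R u (d k) + r • ω),
    fun k r => fderivWithin ℝ u (closedBall 0 R) (zf R u (d k) + r • ω) ω, ?_, ?_, ?_, ?_⟩
  · intro k hk
    obtain ⟨a, b⟩ := hKD k hk
    have := Cc_Ioo hS hsym a b
    exact ⟨gd_center hS hsym (mem_gd a b), this.2.1, this.2.2⟩
  · intro k hk l hl hkl
    obtain ⟨a, b⟩ := hKD k hk
    obtain ⟨a', b'⟩ := hKD l hl
    simp only [Function.onFun]
    rw [An_eq hS hsym a b, An_eq hS hsym a' b', disjoint_left]
    intro y hy hy'
    have e : An R u (d k) = An R u (d l) :=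
      (An_trans hS hsym hy).2.2.symm.trans (An_trans hS hsym hy').2.2
    rcases lt_or_gt_of_ne hkl with h | h
    · apply hl.2 k h
      rw [← e]; exact mem_Cc a b
    · apply hk.2 l h
      rw [e]; exact mem_Cc a' b'
  · ext x
    simp only [mem_union, mem_iUnion, mem_ofPred_eq]
    constructor
    · intro hx
      by_cases hp : gradient u x = 0
      · exact Or.inr ⟨hx, hp⟩
      left
      have hne : (An R u x).Nonempty := ⟨x, mem_Cc hx hp⟩
      have hex : ∃ k, d k ∈ An R u x := by
        obtain ⟨y, hy, k, rfl⟩ := hdd.inter_open_nonempty _ (An_open hS hsym) hne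
        exact ⟨k, hy⟩
      obtain ⟨a, b, c⟩ := An_trans hS hsym (Nat.find_spec hex)
      refine ⟨Nat.find hex, ⟨⟨a, b⟩, fun j hj => ?_⟩, ?_⟩
      · rw [c]; exact Nat.find_min hex hj
      · rw [An_eq hS hsym a b, c]; exact mem_Cc hx hp
    · rintro (⟨k, hk, hx⟩ | hx)
      · obtain ⟨a, b⟩ := hKD k hk
        rw [An_eq hS hsym a b] at hx
        exact (An_trans hS hsym hx).1
      · exact hx.1
  · intro k hk
    obtain ⟨a, b⟩ := hKD k hk
    obtain ⟨hI, hi0, hio⟩ := Cc_Ioo hS hsym a b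
    have hsub : ∀ r ∈ Ioo (sInf (Cc R u (d k))) (sSup (Cc R u (d k))), r ∈ Gd R u (zf R u (d k)) := by
      intro r hr
      rw [← hI] at hr
      exact Cc_sub hr
    beta_reduce
    rw [An_eq hS hsym a b]
    have hA : An R u (d k) = {y | ‖y - zf R u (d k)‖ ∈ Ioo (sInf (Cc R u (d k))) (sSup (Cc R u (d k)))} := by
      rw [← hI]; rfl
    rw [hA]
    clear hA hI
    generalize sInf (Cc R u (d k)) = α at *
    generalize sSup (Cc R u (d k)) = β at *
    generalize zf R u (d k) = z at *
    have hnr : ∀ r : ℝ, 0 ≤ r → ‖z + r • ω - z‖ = r := by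
      intro r hr
      rw [add_sub_cancel_left, norm_smul, hω, mul_one, Real.norm_eq_abs, abs_of_nonneg hr]
    have hpt : ∀ r ∈ Ioo α β, z + r • ω ∈ ball (0:Eu N) R := by
      intro r hr
      exact (gd_all hS hsym (by rw [hnr r (hi0.trans hr.1.le)]; exact hsub r hr)).1
    have hcl : MapsTo (fun r : ℝ => z + r • ω) (Icc α β) (closedBall (0:Eu N) R) := by
      rw [← closure_Ioo hio.ne, ← closure_ball (0:Eu N) hR.ne']
      exact MapsTo.closure hpt (by fun_prop)
    have hcc : Continuous (fun r : ℝ => z + r • ω) := by fun_prop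
    refine ⟨⟨?_, ?_⟩, ?_, ?_, ?_⟩
    · exact (hcf.comp hcc.continuousOn hcl).clm_apply continuousOn_const
    · intro r hr
      have hl : HasDerivWithinAt (fun r : ℝ => z + r • ω) ω (Icc α β) r := by
        have := ((hasDerivAt_id r).smul_const ω).const_add z
        rw [one_smul] at this
        exact this.hasDerivWithinAt
      have hf := ((h1.differentiableOn (by norm_num)) _ (hcl hr)).hasFDerivWithinAt
      exact hf.comp_hasDerivWithinAt r hl hcl
    · intro x hx
      have h0 : 0 ≤ ‖x - z‖ := norm_nonneg _
      refine (gd_const hS hsym (z := z) (y := x) (hsub _ hx) (hnr _ h0)).symm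
    · intro r hr
      have h0 : 0 < r := hi0.trans_lt hr.1
      have hb := hpt r hr
      obtain ⟨-, -, -, c, hc, hg⟩ := gd_all hS hsym (z := z) (y := z + r • ω)
        (by rw [hnr r h0.le]; exact hsub r hr)
      rw [fderivWithin_of_mem_nhds (mem_of_superset (isOpen_ball.mem_nhds hb) ball_subset_closedBall),
        ← innerSL_grad, innerSL_apply_apply, hg]
      have : z - (z + r • ω) = (-r) • ω := by module
      rw [this, smul_smul, real_inner_smul_left, real_inner_self_eq_norm_sq, hω]
      nlinarith [mul_pos hc h0]
    · intro x hx
      rw [mem_ball, dist_eq_norm] at hx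
      have hct : ContinuousOn (fun r : ℝ => u (z + r • ω)) (Icc α β) :=
        h1.continuousOn.comp hcc.continuousOn hcl
      have ht : Tendsto (fun r : ℝ => u (z + r • ω)) (𝓝[Ioo α β] α) (𝓝 (u (z + α • ω))) :=
        ((hct α (left_mem_Icc.2 hio.le)).mono Ioo_subset_Icc_self)
      rw [nhdsWithin_Ioo_eq_nhdsGT hio] at ht
      refine le_of_tendsto ht ?_
      filter_upwards [Ioo_mem_nhdsGT hio] with r hr
      have h0 : 0 ≤ r := hi0.trans hr.1.le
      exact (gd_in hS hsym (z := z) (y := z + r • ω) (by rw [hnr r h0]; exact hsub r hr)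
        (by rw [hnr r h0]; exact hx.trans hr.1)).le
end LS
end

/-- Lemma 2.3 (Brock): every weak solution of problem (P) is locally symmetric. -/
theorem weak_solution_locally_symmetric
    {N : ℕ} (hN : 1 ≤ N) (R : ℝ) (hR : 0 < R) (g : ℝ → ℝ) (f : ℝ → ℝ → ℝ)
    (hg : GCond g) (hf : FCond R f)
    (u : EuclideanSpace ℝ (Fin N) → ℝ) (hu : IsWeakSolP R g f u) :
    LocallySymmetric R u := by
  obtain ⟨h1, h2, -, h3, h4⟩ := hu
  obtain ⟨M, hS⟩ := LS.exists_Sol hR h1 h2 h3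
  exact hS.locSym hN (LS.symV hg hS hf h4) h1
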